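/- Let c satisfy (B0)–(B3) and (B2s). If u is a c-convex solution of: λ ≤ |∂ᶜu| ≤ 1/λ on an open set U^λ ⊂ U and |∂ᶜu| ≤ Λ on cl U, then u is continuously differentiable inside U^λ; equivalently, the c-subdifferential ∂ᶜu(x̄) is a singleton for every x̄ ∈ U^λ. -/

import Mathlib

open Set MeasureTheory Metric Bornology
open scoped ENNReal NNReal Pointwise

noncomputable section

abbrev Euc (n : ℕ) := EuclideanSpace ℝ (Fin n)

/-- Partial gradient of the cost in the first variable: `D_x c(x,y)`. -/
noncomputable def gradX (n : ℕ) (c : Euc n → Euc n → ℝ) (x y : Euc n) : Euc n :=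
  gradient (fun x' => c x' y) x

/-- Partial gradient of the cost in the second variable: `D_y c(x,y)`. -/
noncomputable def gradY (n : ℕ) (c : Euc n → Euc n → ℝ) (x y : Euc n) : Euc n :=
  gradient (fun y' => c x y') y

/-- Mixed second derivative `D²_{xy} c` as a continuous linear map. -/
noncomputable def DxyC (n : ℕ) (c : Euc n → Euc n → ℝ) (x y : Euc n) : Euc n →L[ℝ] Euc n :=
  fderiv ℝ (fun x' => gradY n c x' y) x

/-- Second derivative `D²_{xx} c`. -/
noncomputable def DxxC (n : ℕ) (c : Euc n → Euc n → ℝ) (x y : Euc n) : Euc n →L[ℝ] Euc n :=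
  fderiv ℝ (fun x' => gradX n c x' y) x

/-- Third derivative `D²_{xx} D_y c`. -/
noncomputable def DxxyC (n : ℕ) (c : Euc n → Euc n → ℝ) (x y : Euc n) :
    Euc n →L[ℝ] Euc n →L[ℝ] Euc n :=
  fderiv ℝ (fun x' => DxyC n c x' y) x

/-- `β⁺_c = ‖D²_{xy} c‖_{L∞(U×V)}`. -/
noncomputable def betaPlus (n : ℕ) (c : Euc n → Euc n → ℝ) (U V : Set (Euc n)) : ℝ :=
  sSup ((fun p : Euc n × Euc n => ‖DxyC n c p.1 p.2‖) '' (U ×ˢ V))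

/-- `β⁻_c = ‖(D²_{xy} c)⁻¹‖_{L∞(U×V)}`. -/
noncomputable def betaMinus (n : ℕ) (c : Euc n → Euc n → ℝ) (U V : Set (Euc n)) : ℝ :=
  sSup ((fun p : Euc n × Euc n => ‖(DxyC n c p.1 p.2).inverse‖) '' (U ×ˢ V))

/-- `γ⁺_c = ‖det D²_{xy} c‖_{L∞(U×V)}`. -/
noncomputable def gammaPlus (n : ℕ) (c : Euc n → Euc n → ℝ) (U V : Set (Euc n)) : ℝ :=
  sSup ((fun p : Euc n × Euc n =>
    |LinearMap.det ((DxyC n c p.1 p.2 : Euc n →L[ℝ] Euc n) : Euc n →ₗ[ℝ] Euc n)|) '' (U ×ˢ V))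

/-- `γ⁻_c = ‖(det D²_{xy} c)⁻¹‖_{L∞(U×V)}`. -/
noncomputable def gammaMinus (n : ℕ) (c : Euc n → Euc n → ℝ) (U V : Set (Euc n)) : ℝ :=
  sSup ((fun p : Euc n × Euc n =>
    |LinearMap.det ((DxyC n c p.1 p.2 : Euc n →L[ℝ] Euc n) : Euc n →ₗ[ℝ] Euc n)|⁻¹) '' (U ×ˢ V))

noncomputable def supDxx (n : ℕ) (c : Euc n → Euc n → ℝ) (U V : Set (Euc n)) : ℝ :=
  sSup ((fun p : Euc n × Euc n => ‖DxxC n c p.1 p.2‖) '' (U ×ˢ V))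

noncomputable def supDx (n : ℕ) (c : Euc n → Euc n → ℝ) (U V : Set (Euc n)) : ℝ :=
  sSup ((fun p : Euc n × Euc n => ‖gradX n c p.1 p.2‖) '' (U ×ˢ V))

noncomputable def supDxxy (n : ℕ) (c : Euc n → Euc n → ℝ) (U V : Set (Euc n)) : ℝ :=
  sSup ((fun p : Euc n × Euc n => ‖DxxyC n c p.1 p.2‖) '' (U ×ˢ V))

/-- The constant `M_c` from Theorem 4.3. -/
noncomputable def Mconst (n : ℕ) (c : Euc n → Euc n → ℝ) (U V : Set (Euc n)) : ℝ :=
  (betaMinus n c U V) ^ 2 * supDxx n c U V +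
    (betaMinus n c U V) ^ 3 * supDx n c U V * supDxxy n c U V

/-- The constant `ε_c` of Lemma 6.1: `1/ε_c = 2 (β⁺)⁴ (β⁻)⁶ ‖D³_{xxy} c‖_∞`. -/
noncomputable def epsC (n : ℕ) (c : Euc n → Euc n → ℝ) (U V : Set (Euc n)) : ℝ :=
  (2 * (betaPlus n c U V) ^ 4 * (betaMinus n c U V) ^ 6 * supDxxy n c U V)⁻¹

/-- Condition (B0). -/
def B0cond (n : ℕ) (c : Euc n → Euc n → ℝ) (U V : Set (Euc n)) : Prop :=
  IsOpen U ∧ IsBounded U ∧ IsOpen V ∧ IsBounded V ∧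
    ContDiffOn ℝ 4 (Function.uncurry c) (closure U ×ˢ closure V)

/-- `f` is a (C¹-) diffeomorphism from `S` onto its range. -/
def DiffeoOnto (n : ℕ) (f : Euc n → Euc n) (S : Set (Euc n)) : Prop :=
  Set.InjOn f S ∧ ContDiffOn ℝ 1 f S ∧ ContDiffOn ℝ 1 (Function.invFunOn f S) (f '' S)

/-- Condition (B1) (bi-twist). -/
def B1cond (n : ℕ) (c : Euc n → Euc n → ℝ) (U V : Set (Euc n)) : Prop :=
  (∀ y ∈ closure V, DiffeoOnto n (fun x => -gradY n c x y) (closure U)) ∧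
  (∀ x ∈ closure U, DiffeoOnto n (fun y => -gradX n c x y) (closure V))

/-- `U_ȳ := -D_y c(U, ȳ)`. -/
def Uyset (n : ℕ) (c : Euc n → Euc n → ℝ) (U : Set (Euc n)) (ybar : Euc n) : Set (Euc n) :=
  (fun x => -gradY n c x ybar) '' U

/-- `V_x̄ := -D_x c(x̄, V)`. -/
def Vxset (n : ℕ) (c : Euc n → Euc n → ℝ) (V : Set (Euc n)) (xbar : Euc n) : Set (Euc n) :=
  (fun y => -gradX n c xbar y) '' V

/-- Condition (B2) (bi-convexity). -/
def B2cond (n : ℕ) (c : Euc n → Euc n → ℝ) (U V : Set (Euc n)) : Prop :=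
  (∀ y ∈ closure V, Convex ℝ (Uyset n c U y)) ∧ (∀ x ∈ closure U, Convex ℝ (Vxset n c V x))

/-- A strongly convex set: each boundary point is touched from outside by a sphere of
radius `R` enclosing the set. -/
def StronglyConvexSet (n : ℕ) (Q : Set (Euc n)) : Prop :=
  Convex ℝ Q ∧ ∃ R : ℝ, 0 < R ∧ ∀ x ∈ frontier Q, ∃ z : Euc n, dist x z = R ∧ Q ⊆ closedBall z R

/-- Condition (B2s). -/
def B2scond (n : ℕ) (c : Euc n → Euc n → ℝ) (U V : Set (Euc n)) : Prop :=
  (∀ y ∈ closure V, StronglyConvexSet n (Uyset n c U y)) ∧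
  (∀ x ∈ closure U, StronglyConvexSet n (Vxset n c V x))

/-- An affinely parameterized line segment on `[-1,1]`. -/
def IsAffineSeg (n : ℕ) (F : ℝ → Euc n × Euc n) : Prop :=
  ∃ a b : Euc n × Euc n, ∀ t ∈ Icc (-1 : ℝ) 1, F t = a + t • b

/-- `∂²/∂s∂t c(x(s), y(t))` at `(0,0)`. -/
noncomputable def crossDiff2 (n : ℕ) (c : Euc n → Euc n → ℝ) (x y : ℝ → Euc n) : ℝ :=
  deriv (fun s => deriv (fun t => c (x s) (y t)) 0) 0

/-- `∂⁴/∂s²∂t² c(x(s), y(t))` at `(0,0)`. -/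
noncomputable def crossDiff4 (n : ℕ) (c : Euc n → Euc n → ℝ) (x y : ℝ → Euc n) : ℝ :=
  deriv (deriv (fun s => deriv (deriv (fun t => c (x s) (y t))) 0)) 0

/-- Condition (B3) (= A3w). -/
def B3cond (n : ℕ) (c : Euc n → Euc n → ℝ) (U V : Set (Euc n)) : Prop :=
  ∀ x y : ℝ → Euc n, (∀ t ∈ Icc (-1 : ℝ) 1, x t ∈ closure U) →
    (∀ t ∈ Icc (-1 : ℝ) 1, y t ∈ closure V) →
    IsAffineSeg n (fun t => (gradY n c (x t) (y 0), gradX n c (x 0) (y t))) →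
    crossDiff2 n c x y = 0 → crossDiff4 n c x y ≤ 0

/-- Condition (B4) (non-negative cross-curvature). -/
def B4cond (n : ℕ) (c : Euc n → Euc n → ℝ) (U V : Set (Euc n)) : Prop :=
  ∀ x y : ℝ → Euc n, (∀ t ∈ Icc (-1 : ℝ) 1, x t ∈ closure U) →
    (∀ t ∈ Icc (-1 : ℝ) 1, y t ∈ closure V) →
    IsAffineSeg n (fun t => (gradY n c (x t) (y 0), gradX n c (x 0) (y t))) →
    crossDiff4 n c x y ≤ 0

/-- The `c*`-transform `u^{c*}(y) = sup_{x ∈ A} (-c(x,y) - u(x))`. -/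
noncomputable def cStarT (n : ℕ) (c : Euc n → Euc n → ℝ) (A : Set (Euc n)) (u : Euc n → ℝ)
    (y : Euc n) : ℝ :=
  sSup ((fun x => -c x y - u x) '' A)

/-- `u` is `c`-convex on `A` (relative to the target set `B`): `u = (u^{c*})^c`. -/
def CConvexOn (n : ℕ) (c : Euc n → Euc n → ℝ) (A B : Set (Euc n)) (u : Euc n → ℝ) : Prop :=
  ∀ x ∈ A, u x = sSup ((fun y => -c x y - cStarT n c A u y) '' B)

/-- The `c`-subdifferential `∂ᶜu ⊂ A × B`. -/
def cSubdiff (n : ℕ) (c : Euc n → Euc n → ℝ) (A B : Set (Euc n)) (u : Euc n → ℝ) :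
    Set (Euc n × Euc n) :=
  {p | p.1 ∈ A ∧ p.2 ∈ B ∧ u p.1 + cStarT n c A u p.2 + c p.1 p.2 = 0}

def cSubdiffAt (n : ℕ) (c : Euc n → Euc n → ℝ) (A B : Set (Euc n)) (u : Euc n → ℝ)
    (x : Euc n) : Set (Euc n) :=
  {y | (x, y) ∈ cSubdiff n c A B u}

def cSubdiffImg (n : ℕ) (c : Euc n → Euc n → ℝ) (A B : Set (Euc n)) (u : Euc n → ℝ)
    (X : Set (Euc n)) : Set (Euc n) :=
  ⋃ x ∈ X, cSubdiffAt n c A B u x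

/-- `∂^{c*}u^{c*}(Y) = {x : ∃ y ∈ Y, (x,y) ∈ ∂ᶜu}`. -/
def cSubdiffPre (n : ℕ) (c : Euc n → Euc n → ℝ) (A B : Set (Euc n)) (u : Euc n → ℝ)
    (Y : Set (Euc n)) : Set (Euc n) :=
  {x | ∃ y ∈ Y, (x, y) ∈ cSubdiff n c A B u}

/-- `|∂ᶜu| ≥ lam` on `S`. -/
def MAge (n : ℕ) (c : Euc n → Euc n → ℝ) (A B : Set (Euc n)) (u : Euc n → ℝ) (lam : ℝ)
    (S : Set (Euc n)) : Prop :=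
  ∀ X : Set (Euc n), X ⊆ S → MeasurableSet X →
    ENNReal.ofReal lam * volume X ≤ volume (cSubdiffImg n c A B u X)

/-- `|∂ᶜu| ≤ lam` on `S`. -/
def MAle (n : ℕ) (c : Euc n → Euc n → ℝ) (A B : Set (Euc n)) (u : Euc n → ℝ) (lam : ℝ)
    (S : Set (Euc n)) : Prop :=
  ∀ X : Set (Euc n), X ⊆ S → MeasurableSet X →
    volume (cSubdiffImg n c A B u X) ≤ ENNReal.ofReal lam * volume X

/-- The inverse of the cost-exponential coordinate change `q(x) = -D_y c(x, ȳ)`. -/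
noncomputable def xOf (n : ℕ) (c : Euc n → Euc n → ℝ) (U : Set (Euc n)) (ybar : Euc n) :
    Euc n → Euc n :=
  Function.invFunOn (fun x => -gradY n c x ybar) (closure U)

/-- `cl U_ȳ := -D_y c(cl U, ȳ)`. -/
def clUy (n : ℕ) (c : Euc n → Euc n → ℝ) (U : Set (Euc n)) (ybar : Euc n) : Set (Euc n) :=
  (fun x => -gradY n c x ybar) '' closure U

/-- The modified cost `c̃(q,y) = c(x(q), y) - c(x(q), ȳ)`. -/
noncomputable def modCost (n : ℕ) (c : Euc n → Euc n → ℝ) (U : Set (Euc n)) (ybar : Euc n)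
    (q y : Euc n) : ℝ :=
  c (xOf n c U ybar q) y - c (xOf n c U ybar q) ybar

/-- The modified potential `ũ(q) = u(x(q)) + c(x(q), ȳ)`. -/
noncomputable def modPot (n : ℕ) (c : Euc n → Euc n → ℝ) (U : Set (Euc n)) (ybar : Euc n)
    (u : Euc n → ℝ) (q : Euc n) : ℝ :=
  u (xOf n c U ybar q) + c (xOf n c U ybar q) ybar

/-- The `c̃`-cone generated by `qt` and `Q` with height `-h0 > 0`. -/
noncomputable def cConeFun (n : ℕ) (ct : Euc n → Euc n → ℝ) (B Q : Set (Euc n)) (qt : Euc n)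
    (h0 : ℝ) (q : Euc n) : ℝ :=
  sSup {r : ℝ | ∃ y ∈ B, r = -ct q y + ct qt y + h0 ∧
    ∀ p ∈ frontier Q, -ct p y + ct qt y + h0 ≤ 0}

/-- The ordinary subdifferential `∂u(x)` relative to a domain `A`. -/
def subdiffAt (n : ℕ) (A : Set (Euc n)) (u : Euc n → ℝ) (x : Euc n) : Set (Euc n) :=
  {p | ∀ ε > 0, ∃ δ > 0, ∀ x' ∈ A, ‖x' - x‖ < δ →
    u x + @inner ℝ _ _ p (x' - x) - ε * ‖x' - x‖ ≤ u x'}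

/-- The dual norm `‖v‖*_K = sup_{w ∈ K} ⟨w, v⟩`. -/
noncomputable def dualNorm (n : ℕ) (K : Set (Euc n)) (v : Euc n) : ℝ :=
  sSup ((fun w => (@inner ℝ _ _ w v : ℝ)) '' K)

/-- The section `S(x̄, ȳ, τ)`. -/
def sectS (n : ℕ) (c : Euc n → Euc n → ℝ) (U : Set (Euc n)) (u : Euc n → ℝ)
    (xbar ybar : Euc n) (τ : ℝ) : Set (Euc n) :=
  {x ∈ U | u x ≤ u xbar - c x ybar + c xbar ybar + τ}

/-- The measure with density `f` restricted to `A`. -/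
noncomputable def densMeasure (n : ℕ) (A : Set (Euc n)) (f : Euc n → ℝ) : Measure (Euc n) :=
  (volume.restrict A).withDensity fun x => ENNReal.ofReal (f x)

end

section
open Set MeasureTheory Metric Bornology Filter Topology
open scoped ENNReal NNReal Pointwise

namespace FKM

/-- C^k inverse function theorem for injective maps on open sets. -/
theorem inverse_lemma {E : Type*} [NormedAddCommGroup E] [NormedSpace ℝ E] [FiniteDimensional ℝ E]
    (f : E → E) (O : Set E) (k : WithTop ℕ∞) (hk : k ≠ 0)
    (hO : IsOpen O) (hf : ContDiffOn ℝ k f O) (hinj : InjOn f O)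
    (hd : ∀ x ∈ O, ∀ v, fderiv ℝ f x v = 0 → v = 0) :
    IsOpen (f '' O) ∧ ContDiffOn ℝ k (Function.invFunOn f O) (f '' O) := by
  have : CompleteSpace E := FiniteDimensional.complete ℝ E
  have key : ∀ x ∈ O, f '' O ∈ 𝓝 (f x) ∧ ContDiffAt ℝ k (Function.invFunOn f O) (f x) := by
    intro x hx
    have hfx : ContDiffAt ℝ k f x := hf.contDiffAt (hO.mem_nhds hx)
    have hinjd : Function.Injective (fderiv ℝ f x : E →ₗ[ℝ] E) := by
      rw [injective_iff_map_eq_zero]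
      exact hd x hx
    let e : E ≃L[ℝ] E :=
      (LinearEquiv.ofInjectiveEndo (fderiv ℝ f x : E →ₗ[ℝ] E) hinjd).toContinuousLinearEquiv
    have he : (e : E →L[ℝ] E) = fderiv ℝ f x := by
      ext v; rfl
    have hdf : HasFDerivAt f (e : E →L[ℝ] E) x := by
      rw [he]; exact (hfx.differentiableAt hk).hasFDerivAt
    have hs : HasStrictFDerivAt f (e : E →L[ℝ] E) x := hfx.hasStrictFDerivAt' hdf hk
    have hmap := hs.map_nhds_eq_of_equiv
    refine ⟨?_, ?_⟩
    · rw [← hmap]; exact image_mem_map (hO.mem_nhds hx)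
    · have h1 := hfx.to_localInverse hdf hk
      refine h1.congr_of_eventuallyEq ?_
      have h2 : ∀ᶠ y in 𝓝 x, y ∈ O ∧ hs.localInverse f e x (f y) = y :=
        (hO.eventually_mem hx).and hs.eventually_left_inverse
      have h3 : ∀ᶠ z in 𝓝 (f x), ∃ y, (y ∈ O ∧ hs.localInverse f e x (f y) = y) ∧ f y = z := by
        rw [← hmap]
        exact (eventually_map.2 (h2.mono fun y hy => ⟨y, hy, rfl⟩))
      filter_upwards [h3] with z hz
      obtain ⟨y, ⟨hyO, hy⟩, rfl⟩ := hz
      have : Function.invFunOn f O (f y) = y := hinj.leftInvOn_invFunOn hyO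
      rw [this]; exact hy.symm
  constructor
  · rw [isOpen_iff_mem_nhds]
    rintro _ ⟨x, hx, rfl⟩
    exact (key x hx).1
  · rintro _ ⟨x, hx, rfl⟩
    exact (key x hx).2.contDiffWithinAt

section Dir
variable {G F : Type*} [NormedAddCommGroup G] [NormedSpace ℝ G]
  [NormedAddCommGroup F] [NormedSpace ℝ F]

/-- directional derivative -/
noncomputable def dd (e : G) (f : G → F) (z : G) : F := fderiv ℝ f z e

theorem dd_add (e e' : G) (f : G → F) (z : G) : dd (e + e') f z = dd e f z + dd e' f z := by
  simp [dd]
theorem dd_smul (r : ℝ) (e : G) (f : G → F) (z : G) : dd (r • e) f z = r • dd e f z := by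
  simp [dd]
theorem dd_zero (f : G → F) (z : G) : dd (0 : G) f z = 0 := by simp [dd]

theorem dd_contDiffOn {O : Set G} (hO : IsOpen O) {f : G → F} {k m : WithTop ℕ∞} (h : m + 1 ≤ k)
    (hf : ContDiffOn ℝ k f O) (e : G) : ContDiffOn ℝ m (dd e f) O :=
  (hf.fderiv_of_isOpen hO h).clm_apply contDiffOn_const

theorem dd_congr {O : Set G} (hO : IsOpen O) {f g : G → F} (h : EqOn f g O) (e : G) :
    EqOn (dd e f) (dd e g) O := by
  intro z hz
  unfold dd
  rw [(h.eventuallyEq_of_mem (hO.mem_nhds hz)).fderiv_eq]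

theorem dd_comm {O : Set G} (hO : IsOpen O) {f : G → F} {k : WithTop ℕ∞} (h : 2 ≤ k)
    (hf : ContDiffOn ℝ k f O) (e e' : G) {z : G} (hz : z ∈ O) :
    dd e (dd e' f) z = dd e' (dd e f) z := by
  have hfz : ContDiffAt ℝ k f z := hf.contDiffAt (hO.mem_nhds hz)
  have hs : IsSymmSndFDerivAt ℝ f z := hfz.isSymmSndFDerivAt (by simpa using h)
  have hd : DifferentiableAt ℝ (fderiv ℝ f) z := by
    have := (hfz.fderiv_right (m := 1) (by simpa [one_add_one_eq_two] using h))
    exact this.differentiableAt (by norm_num)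
  have key : ∀ a b : G, dd a (dd b f) z = fderiv ℝ (fderiv ℝ f) z a b := by
    intro a b
    unfold dd
    rw [fderiv_clm_apply hd (by fun_prop)]
    simp
  rw [key, key]
  exact hs e e'

theorem dd_add_fun {f g : G → F} {z : G} (hf : DifferentiableAt ℝ f z)
    (hg : DifferentiableAt ℝ g z) (e : G) :
    dd e (fun w => f w + g w) z = dd e f z + dd e g z := by
  unfold dd
  rw [fderiv_fun_add hf hg]; rfl

/-- chain rule along a curve -/
theorem dd_hasDerivAt {f : G → F} {γ : ℝ → G} {s : ℝ} {γ' : G} (hγ : HasDerivAt γ γ' s)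
    (hf : DifferentiableAt ℝ f (γ s)) : HasDerivAt (fun r => f (γ r)) (dd γ' f (γ s)) s :=
  hf.hasFDerivAt.comp_hasDerivAt s hγ

end Dir

/-- one-dimensional differential inequality -/
theorem ode_ineq {g' g'' : ℝ → ℝ} {C A : ℝ} (hC : 0 ≤ C)
    (h2 : ∀ t ∈ Icc (0:ℝ) 1, HasDerivWithinAt g' (g'' t) (Icc 0 1) t)
    (hK : ∀ t ∈ Icc (0:ℝ) 1, -C * |g' t| ≤ g'' t) (hA : g' 0 = A) :
    ∀ t ∈ Icc (0:ℝ) 1, min (Real.exp (-(C+1)) * A) (Real.exp (C+1) * A) ≤ g' t := by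
  have hcont : ContinuousOn (fun t => -g' t) (Icc 0 1) :=
    (HasDerivWithinAt.continuousOn h2).neg
  have hder : ∀ t ∈ Ico (0:ℝ) 1, HasDerivWithinAt (fun t => -g' t) (-g'' t) (Ici t) t := by
    intro t ht
    have h := (h2 t ⟨ht.1, ht.2.le⟩).neg
    refine (h.mono_of_mem_nhdsWithin ?_)
    exact mem_nhdsWithin.2 ⟨Iio 1, isOpen_Iio, ht.2, fun x hx => ⟨ht.1.trans hx.2, le_of_lt hx.1⟩⟩
  rcases le_or_gt A 0 with hA0 | hA0
  · have main : ∀ ε > 0, ∀ t ∈ Icc (0:ℝ) 1, -g' t ≤ (-A + ε) * Real.exp ((C+1) * t) := by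
      intro ε hε t ht
      have hB : ∀ x, HasDerivAt (fun t => (-A + ε) * Real.exp ((C+1) * t))
          ((-A + ε) * (Real.exp ((C+1) * x) * (C+1))) x := by
        intro x
        have := (((hasDerivAt_id x).const_mul (C+1)).exp).const_mul (-A + ε)
        simpa using this
      refine image_le_of_deriv_right_lt_deriv_boundary hcont hder ?_ hB ?_ ht
      · simp [hA]; linarith
      · intro x hx heq
        have h1 := hK x ⟨hx.1, hx.2.le⟩
        have hp : 0 < (-A + ε) * Real.exp ((C+1) * x) :=
          mul_pos (by linarith) (Real.exp_pos _)
        have : |g' x| = (-A + ε) * Real.exp ((C+1) * x) := by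
          rw [← heq, abs_of_neg (by linarith)]
        rw [this] at h1
        nlinarith
    intro t ht
    refine (min_le_right _ _).trans ?_
    have h3 : -g' t ≤ -A * Real.exp ((C+1)*t) := by
      refine le_of_forall_pos_le_add fun δ hδ => ?_
      have := main (δ / Real.exp ((C+1)*t)) (by positivity) t ht
      have h4 : (-A + δ / Real.exp ((C+1)*t)) * Real.exp ((C+1)*t) = -A * Real.exp ((C+1)*t) + δ := by
        field_simp
      linarith
    have h5 : Real.exp ((C+1)*t) ≤ Real.exp (C+1) := by
      apply Real.exp_le_exp.2
      nlinarith [ht.2]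
    nlinarith
  · intro t ht
    refine (min_le_left _ _).trans ?_
    have hB : ∀ x, HasDerivAt (fun t => (-A) * Real.exp (-(C+1) * t))
        ((-A) * (Real.exp (-(C+1) * x) * (-(C+1)))) x := by
      intro x
      have := (((hasDerivAt_id x).const_mul (-(C+1))).exp).const_mul (-A)
      simpa using this
    have hle : -g' t ≤ (-A) * Real.exp (-(C+1) * t) := by
      refine image_le_of_deriv_right_lt_deriv_boundary hcont hder ?_ hB ?_ ht
      · simp [hA]
      · intro x hx heq
        have h1 := hK x ⟨hx.1, hx.2.le⟩
        have hp : 0 < A * Real.exp (-(C+1) * x) := mul_pos hA0 (Real.exp_pos _)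
        have : |g' x| = A * Real.exp (-(C+1) * x) := by
          rw [abs_of_pos (by linarith)]; linarith
        rw [this] at h1
        nlinarith
    have h5 : Real.exp (-(C+1)) ≤ Real.exp (-(C+1)*t) := by
      apply Real.exp_le_exp.2
      nlinarith [ht.2]
    nlinarith

/-- Integrated version. -/
theorem ode_ineq_int {g g' g'' : ℝ → ℝ} {C : ℝ} (hC : 0 ≤ C)
    (h1 : ∀ t ∈ Icc (0:ℝ) 1, HasDerivWithinAt g (g' t) (Icc 0 1) t)
    (h2 : ∀ t ∈ Icc (0:ℝ) 1, HasDerivWithinAt g' (g'' t) (Icc 0 1) t)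
    (hK : ∀ t ∈ Icc (0:ℝ) 1, -C * |g' t| ≤ g'' t) :
    min (Real.exp (-(C+1)) * g' 0) (Real.exp (C+1) * g' 0) ≤ g 1 - g 0 := by
  have h := ode_ineq hC h2 hK rfl
  obtain ⟨t, ht, htt⟩ := exists_hasDerivAt_eq_slope g g' (zero_lt_one) 
    (HasDerivWithinAt.continuousOn h1)
    (fun t ht => (h1 t ⟨ht.1.le, ht.2.le⟩).hasDerivAt (Icc_mem_nhds ht.1 ht.2))
  have := h t ⟨ht.1.le, ht.2.le⟩
  rw [htt] at this
  simpa using this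

end FKM

end


section
open Set MeasureTheory Metric Bornology Filter Topology
open scoped ENNReal NNReal Pointwise

namespace FKM
variable {n : ℕ}

/-- `q_y(x)` -/
noncomputable def qm (c : Euc n → Euc n → ℝ) (x y : Euc n) : Euc n := -gradY n c x y
/-- `p_x(y)` -/
noncomputable def pm (c : Euc n → Euc n → ℝ) (x y : Euc n) : Euc n := -gradX n c x y

/-- the interior version of (B0) -/
structure Sm (c : Euc n → Euc n → ℝ) (U V : Set (Euc n)) : Prop where
  oU : IsOpen U
  oV : IsOpen V
  smooth : ContDiffOn ℝ 4 (Function.uncurry c) (U ×ˢ V)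

/-- the interior version of (B0)-(B2) -/
structure PreGood (c : Euc n → Euc n → ℝ) (U V : Set (Euc n)) : Prop extends Sm c U V where
  injq : ∀ y ∈ V, InjOn (fun x => qm c x y) U
  injp : ∀ x ∈ U, InjOn (fun y => pm c x y) V
  ndq : ∀ x ∈ U, ∀ y ∈ V, ∀ η : Euc n,
    (∀ ζ : Euc n, dd (η, 0) (dd (0, ζ) (Function.uncurry c)) (x, y) = 0) → η = 0
  ndp : ∀ x ∈ U, ∀ y ∈ V, ∀ ζ : Euc n,
    (∀ η : Euc n, dd (0, ζ) (dd (η, 0) (Function.uncurry c)) (x, y) = 0) → ζ = 0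
  cvq : ∀ y ∈ V, Convex ℝ ((fun x => qm c x y) '' U)
  cvp : ∀ x ∈ U, Convex ℝ ((fun y => pm c x y) '' V)

/-- the working structure: interior version of (B0)-(B3) -/
structure Good (c : Euc n → Euc n → ℝ) (U V : Set (Euc n)) : Prop extends PreGood c U V where
  mtw : ∀ x ∈ U, ∀ y ∈ V, ∀ η η' ζ ζ' : Euc n,
    (∀ ζ0 : Euc n, dd (η, 0) (dd (η, 0) (dd (0, ζ0) (Function.uncurry c))) (x, y)
      + dd (η', 0) (dd (0, ζ0) (Function.uncurry c)) (x, y) = 0) →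
    (∀ η0 : Euc n, dd (0, ζ) (dd (0, ζ) (dd (η0, 0) (Function.uncurry c))) (x, y)
      + dd (0, ζ') (dd (η0, 0) (Function.uncurry c)) (x, y) = 0) →
    dd (η, 0) (dd (0, ζ) (Function.uncurry c)) (x, y) = 0 →
    dd (η, 0) (dd (η, 0) (dd (0, ζ) (dd (0, ζ) (Function.uncurry c)))) (x, y)
      ≤ dd (η', 0) (dd (0, ζ') (Function.uncurry c)) (x, y)

theorem dd_swap {F : Type*} [NormedAddCommGroup F] [NormedSpace ℝ F]
    (f : Euc n × Euc n → F) (a b : Euc n) :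
    dd (a, b) (fun z => f z.swap) = fun z => dd (b, a) f z.swap := by
  ext1 z
  have := (ContinuousLinearEquiv.prodComm ℝ (Euc n) (Euc n)).comp_right_fderiv (f := f) (x := z)
  unfold dd
  have h2 : (fun z : Euc n × Euc n => f z.swap) =
    f ∘ (ContinuousLinearEquiv.prodComm ℝ (Euc n) (Euc n)) := by
    ext z; rfl
  rw [h2, this]
  rfl

theorem uncurry_swap (c : Euc n → Euc n → ℝ) :
    Function.uncurry (fun y x => c x y) = fun z : Euc n × Euc n => Function.uncurry c z.swap := by
  ext z; rfl

namespace Sm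
variable {c : Euc n → Euc n → ℝ} {U V : Set (Euc n)}

theorem oUV (G : Sm c U V) : IsOpen (U ×ˢ V) := G.oU.prod G.oV

theorem dd_smooth3 (G : Sm c U V) (e : Euc n × Euc n) :
    ContDiffOn ℝ 3 (dd e (Function.uncurry c)) (U ×ˢ V) :=
  dd_contDiffOn G.oUV (by norm_num) G.smooth e
theorem dd_smooth2 (G : Sm c U V) (e e' : Euc n × Euc n) :
    ContDiffOn ℝ 2 (dd e (dd e' (Function.uncurry c))) (U ×ˢ V) :=
  dd_contDiffOn G.oUV (by norm_num) (G.dd_smooth3 e') e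

theorem comm4 (G : Sm c U V) (e e' : Euc n × Euc n) {z : Euc n × Euc n} (hz : z ∈ U ×ˢ V) :
    dd e (dd e (dd e' (dd e' (Function.uncurry c)))) z
     = dd e' (dd e' (dd e (dd e (Function.uncurry c)))) z := by
  have O := G.oUV
  set C := Function.uncurry c
  have h0 : EqOn (dd e (dd e' C)) (dd e' (dd e C)) (U ×ˢ V) := fun w hw =>
    dd_comm O (by norm_num) G.smooth e e' hw
  have h1 : EqOn (dd e (dd e' (dd e' C))) (dd e' (dd e (dd e' C))) (U ×ˢ V) := fun w hw =>
    dd_comm O (by norm_num) (G.dd_smooth3 e') e e' hw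
  have h2 : EqOn (dd e' (dd e (dd e' C))) (dd e' (dd e' (dd e C))) (U ×ˢ V) :=
    dd_congr O h0 e'
  have h3 : EqOn (dd e (dd e (dd e' (dd e' C)))) (dd e (dd e' (dd e' (dd e C)))) (U ×ˢ V) :=
    dd_congr O (h1.trans h2) e
  rw [h3 hz]
  rw [dd_comm O (le_refl _) (G.dd_smooth2 e' e) e e' hz]
  apply dd_congr O _ e' hz
  intro w hw
  exact dd_comm O (by norm_num) (G.dd_smooth3 e) e e' hw

theorem comm3 (G : Sm c U V) (e e' : Euc n × Euc n) {z : Euc n × Euc n} (hz : z ∈ U ×ˢ V) :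
    dd e (dd e (dd e' (Function.uncurry c))) z = dd e' (dd e (dd e (Function.uncurry c))) z := by
  have O := G.oUV
  set C := Function.uncurry c
  have h0 : EqOn (dd e (dd e' C)) (dd e' (dd e C)) (U ×ˢ V) := fun w hw =>
    dd_comm O (by norm_num) G.smooth e e' hw
  rw [dd_congr O h0 e hz]
  exact dd_comm O (by norm_num) (G.dd_smooth3 e) e e' hz

theorem comm2 (G : Sm c U V) (e e' : Euc n × Euc n) {z : Euc n × Euc n} (hz : z ∈ U ×ˢ V) :
    dd e (dd e' (Function.uncurry c)) z = dd e' (dd e (Function.uncurry c)) z :=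
  dd_comm G.oUV (by norm_num) G.smooth e e' hz

theorem swap (G : Sm c U V) : Sm (fun y x => c x y) V U where
  oU := G.oV
  oV := G.oU
  smooth := by
    rw [uncurry_swap]
    exact G.smooth.comp (ContinuousLinearEquiv.prodComm ℝ (Euc n) (Euc n)).contDiff.contDiffOn
      (fun z hz => ⟨hz.2, hz.1⟩)

theorem inner_qm (G : Sm c U V) {x y : Euc n} (hx : x ∈ U) (hy : y ∈ V) (ζ : Euc n) :
    inner ℝ (qm c x y) ζ = - dd (0, ζ) (Function.uncurry c) (x, y) := by
  have hd : DifferentiableAt ℝ (Function.uncurry c) (x, y) :=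
    (G.smooth.contDiffAt (G.oUV.mem_nhds ⟨hx, hy⟩)).differentiableAt (by norm_num)
  have h1 : HasFDerivAt (fun y' => c x y')
      ((fderiv ℝ (Function.uncurry c) (x, y)).comp (ContinuousLinearMap.inr ℝ (Euc n) (Euc n))) y :=
    HasFDerivAt.comp (g := Function.uncurry c) y hd.hasFDerivAt (hasFDerivAt_prodMk_right x y)
  unfold qm gradY gradient
  rw [inner_neg_left, InnerProductSpace.toDual_symm_apply, h1.fderiv]
  simp [dd]

theorem qm_smooth (G : Sm c U V) :
    ContDiffOn ℝ 3 (fun z : Euc n × Euc n => qm c z.1 z.2) (U ×ˢ V) := by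
  have h1 : ContDiffOn ℝ 3 (fderiv ℝ (Function.uncurry c)) (U ×ˢ V) :=
    G.smooth.fderiv_of_isOpen G.oUV (by norm_num)
  have h2 : ContDiffOn ℝ 3 (fun z : Euc n × Euc n =>
      -(InnerProductSpace.toDual ℝ (Euc n)).symm ((fderiv ℝ (Function.uncurry c) z).comp
      (ContinuousLinearMap.inr ℝ (Euc n) (Euc n)))) (U ×ˢ V) := by
    apply ContDiffOn.neg
    apply (InnerProductSpace.toDual ℝ (Euc n)).symm.contDiff.comp_contDiffOn
    exact h1.clm_comp contDiffOn_const
  refine h2.congr ?_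
  rintro ⟨x, y⟩ ⟨hx, hy⟩
  refine ext_inner_right ℝ fun ζ => ?_
  rw [G.inner_qm hx hy, inner_neg_left, InnerProductSpace.toDual_symm_apply]
  simp [dd]

theorem inner_dd_qm (G : Sm c U V) {z : Euc n × Euc n} (hz : z ∈ U ×ˢ V)
    (e : Euc n × Euc n) (ζ : Euc n) :
    inner ℝ (dd e (fun z : Euc n × Euc n => qm c z.1 z.2) z) ζ
      = - dd e (dd (0, ζ) (Function.uncurry c)) z := by
  have h : EqOn (fun z : Euc n × Euc n => inner ℝ ζ (qm c z.1 z.2))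
      (fun z => - dd (0, ζ) (Function.uncurry c) z) (U ×ˢ V) := by
    rintro ⟨x, y⟩ ⟨hx, hy⟩
    simp only
    rw [real_inner_comm, G.inner_qm hx hy]
  have h2 := dd_congr G.oUV h e hz
  have hd : DifferentiableAt ℝ (fun z : Euc n × Euc n => qm c z.1 z.2) z :=
    (G.qm_smooth.contDiffAt (G.oUV.mem_nhds hz)).differentiableAt (by norm_num)
  unfold dd at h2 ⊢
  rw [((innerSL ℝ ζ).hasFDerivAt.comp z hd.hasFDerivAt).fderiv (f := fun z : Euc n × Euc n => inner ℝ ζ (qm c z.1 z.2))] at h2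
  rw [fderiv_fun_neg] at h2
  rw [real_inner_comm]
  simpa using h2

end Sm

theorem PreGood.swap {c : Euc n → Euc n → ℝ} {U V : Set (Euc n)} (G : PreGood c U V) :
    PreGood (fun y x => c x y) V U where
  toSm := G.toSm.swap
  injq := G.injp
  injp := G.injq
  ndq := by
    intro x hx y hy η h
    simp only [uncurry_swap, dd_swap] at h
    exact G.ndp y hy x hx η h
  ndp := by
    intro x hx y hy η h
    simp only [uncurry_swap, dd_swap] at h
    exact G.ndq y hy x hx η h
  cvq := G.cvp
  cvp := G.cvq


theorem Good.swap {c : Euc n → Euc n → ℝ} {U V : Set (Euc n)} (G : Good c U V) :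
    Good (fun y x => c x y) V U where
  toPreGood := G.toPreGood.swap
  mtw := by
    intro x hx y hy η η' ζ ζ' h1 h2 h3
    simp only [uncurry_swap, dd_swap, Prod.swap_prod_mk] at h1 h2 h3 ⊢
    have hz : (y, x) ∈ U ×ˢ V := ⟨hy, hx⟩
    rw [G.comm4 _ _ hz, G.comm2 _ _ hz]
    refine G.mtw y hy x hx ζ ζ' η η' h2 h1 ?_
    rw [G.comm2 _ _ hz]; exact h3

end FKM

end


section
open Set MeasureTheory Metric Bornology Filter Topology
open scoped ENNReal NNReal Pointwise

namespace FKM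
variable {n : ℕ}

/-- the joint map `(x,y) ↦ (q_y(x), y)` -/
noncomputable def jm (c : Euc n → Euc n → ℝ) (z : Euc n × Euc n) : Euc n × Euc n :=
  (qm c z.1 z.2, z.2)

/-- joint inverse of `(x,y) ↦ (q_y(x), y)` -/
noncomputable def Xinv (c : Euc n → Euc n → ℝ) (U V : Set (Euc n)) (w : Euc n × Euc n) : Euc n :=
  (Function.invFunOn (jm c) (U ×ˢ V) w).1

/-- second order chain rule along a curve -/
theorem dd_hasDerivAt2 {G F : Type*} [NormedAddCommGroup G] [NormedSpace ℝ G]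
    [NormedAddCommGroup F] [NormedSpace ℝ F] {f : G → F} {γ γ' : ℝ → G} {s : ℝ} {γ'' : G}
    (h1 : HasDerivAt γ (γ' s) s) (h2 : HasDerivAt γ' γ'' s) (hf : ContDiffAt ℝ 2 f (γ s)) :
    HasDerivAt (fun r => dd (γ' r) f (γ r))
      (dd (γ' s) (dd (γ' s) f) (γ s) + dd γ'' f (γ s)) s := by
  have hd : DifferentiableAt ℝ (fderiv ℝ f) (γ s) :=
    (hf.fderiv_right (m := 1) (by norm_num)).differentiableAt (by norm_num)
  have h3 : HasDerivAt (fun r => fderiv ℝ f (γ r)) (fderiv ℝ (fderiv ℝ f) (γ s) (γ' s)) s :=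
    hd.hasFDerivAt.comp_hasDerivAt s h1
  have h4 := h3.clm_apply h2
  have key : dd (γ' s) (dd (γ' s) f) (γ s) = fderiv ℝ (fderiv ℝ f) (γ s) (γ' s) (γ' s) := by
    unfold dd
    rw [fderiv_clm_apply hd (by fun_prop)]
    simp
  rw [key]
  exact h4

namespace PreGood
variable {c : Euc n → Euc n → ℝ} {U V : Set (Euc n)}

theorem jm_inj (G : PreGood c U V) : InjOn (jm c) (U ×ˢ V) := by
  rintro ⟨x, y⟩ ⟨hx, hy⟩ ⟨x', y'⟩ ⟨hx', hy'⟩ h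
  simp only [jm, Prod.mk.injEq] at h
  obtain ⟨h1, rfl⟩ := h
  exact Prod.ext (G.injq y hy hx hx' h1) rfl

theorem jm_smooth (G : PreGood c U V) : ContDiffOn ℝ 3 (jm c) (U ×ˢ V) :=
  G.qm_smooth.prodMk contDiff_snd.contDiffOn

theorem jm_inv (G : PreGood c U V) : IsOpen (jm c '' (U ×ˢ V)) ∧
    ContDiffOn ℝ 3 (Function.invFunOn (jm c) (U ×ˢ V)) (jm c '' (U ×ˢ V)) := by
  refine inverse_lemma (jm c) (U ×ˢ V) 3 (by norm_num) G.oUV G.jm_smooth G.jm_inj ?_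
  rintro z hz ⟨η, ζ⟩ hv
  have hd : DifferentiableAt ℝ (fun z : Euc n × Euc n => qm c z.1 z.2) z :=
    (G.qm_smooth.contDiffAt (G.oUV.mem_nhds hz)).differentiableAt (by norm_num)
  have h1 : HasFDerivAt (jm c) ((fderiv ℝ (fun z : Euc n × Euc n => qm c z.1 z.2) z).prod
      (ContinuousLinearMap.snd ℝ _ _)) z := hd.hasFDerivAt.prodMk hasFDerivAt_snd
  rw [h1.fderiv] at hv
  simp only [ContinuousLinearMap.prod_apply, ContinuousLinearMap.coe_snd', Prod.mk_eq_zero] at hv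
  obtain ⟨h2, rfl⟩ := hv
  have : η = 0 := by
    refine G.ndq z.1 hz.1 z.2 hz.2 η fun ζ => ?_
    have h3 := G.inner_dd_qm hz (η, 0) ζ
    unfold dd at h3 ⊢
    rw [h2] at h3
    simp at h3
    simpa using h3
  simp [this]

theorem oDX (G : PreGood c U V) : IsOpen (jm c '' (U ×ˢ V)) := G.jm_inv.1

theorem Xinv_smooth (G : PreGood c U V) : ContDiffOn ℝ 3 (Xinv c U V) (jm c '' (U ×ˢ V)) :=
  contDiff_fst.comp_contDiffOn G.jm_inv.2

theorem Xinv_qm (G : PreGood c U V) {x y : Euc n} (hx : x ∈ U) (hy : y ∈ V) :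
    Xinv c U V (qm c x y, y) = x := by
  have : Function.invFunOn (jm c) (U ×ˢ V) (jm c (x, y)) = (x, y) :=
    G.jm_inj.leftInvOn_invFunOn (show (x, y) ∈ U ×ˢ V from ⟨hx, hy⟩)
  unfold Xinv
  unfold jm at this ⊢
  simp only at this
  rw [this]

theorem mem_DX {q y : Euc n} :
    (q, y) ∈ jm c '' (U ×ˢ V) ↔ y ∈ V ∧ q ∈ (fun x => qm c x y) '' U := by
  constructor
  · rintro ⟨⟨x, y'⟩, ⟨hx, hy⟩, h⟩
    simp only [jm, Prod.mk.injEq] at h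
    obtain ⟨rfl, rfl⟩ := h
    exact ⟨hy, x, hx, rfl⟩
  · rintro ⟨hy, x, hx, rfl⟩
    exact ⟨(x, y), ⟨hx, hy⟩, rfl⟩

theorem jm_mem {x y : Euc n} (hx : x ∈ U) (hy : y ∈ V) :
    (qm c x y, y) ∈ jm c '' (U ×ˢ V) := mem_DX.2 ⟨hy, x, hx, rfl⟩

theorem Xinv_mem (G : PreGood c U V) {q y : Euc n} (h : (q, y) ∈ jm c '' (U ×ˢ V)) :
    Xinv c U V (q, y) ∈ U := by
  obtain ⟨hy, x, hx, rfl⟩ := mem_DX.1 h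
  simpa only [G.Xinv_qm hx hy] using hx

theorem qm_Xinv (G : PreGood c U V) {q y : Euc n} (h : (q, y) ∈ jm c '' (U ×ˢ V)) :
    qm c (Xinv c U V (q, y)) y = q := by
  obtain ⟨hy, x, hx, rfl⟩ := mem_DX.1 h
  simp only [G.Xinv_qm hx hy]

theorem DX_seg (G : PreGood c U V) {q q' y : Euc n} (h : (q, y) ∈ jm c '' (U ×ˢ V))
    (h' : (q', y) ∈ jm c '' (U ×ˢ V)) {s : ℝ} (hs : s ∈ Icc (0:ℝ) 1) :
    (q + s • (q' - q), y) ∈ jm c '' (U ×ˢ V) := by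
  rw [mem_DX] at *
  exact ⟨h.1, (G.cvq y h.1).add_smul_sub_mem h.2 h'.2 hs⟩

/-- Existence of curves that are affine in the `q_y` coordinates, with second derivatives. -/
theorem qcurve (G : PreGood c U V) {q w y : Euc n} {s : ℝ}
    (h : (q + s • w, y) ∈ jm c '' (U ×ˢ V)) :
    ∃ γ' : ℝ → Euc n, ∃ γ'' : Euc n,
      HasDerivAt (fun r => Xinv c U V (q + r • w, y)) (γ' s) s ∧
      HasDerivAt γ' γ'' s ∧ (∀ r, γ' r = dd (w, 0) (Xinv c U V) (q + r • w, y)) ∧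
      (∀ r, (q + r • w, y) ∈ jm c '' (U ×ˢ V) →
        HasDerivAt (fun r => Xinv c U V (q + r • w, y)) (γ' r) r) ∧
      (∀ r, (q + r • w, y) ∈ jm c '' (U ×ˢ V) → ∀ ζ : Euc n,
        dd (γ' r, 0) (dd (0, ζ) (Function.uncurry c)) (Xinv c U V (q + r • w, y), y) = -inner ℝ w ζ) ∧
      (∀ ζ : Euc n, dd (γ' s, 0) (dd (γ' s, 0) (dd (0, ζ) (Function.uncurry c)))
          (Xinv c U V (q + s • w, y), y)
        + dd (γ'', 0) (dd (0, ζ) (Function.uncurry c)) (Xinv c U V (q + s • w, y), y) = 0) := by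
  have hl : ∀ r : ℝ, HasDerivAt (fun r : ℝ => (q + r • w, y)) (w, 0) r := by
    intro r
    have h1 : HasDerivAt (fun r : ℝ => q + r • w) w r := by
      simpa using ((hasDerivAt_id r).smul_const w).const_add q
    exact h1.prodMk (hasDerivAt_const r y)
  have hder : ∀ r : ℝ, (q + r • w, y) ∈ jm c '' (U ×ˢ V) →
      HasDerivAt (fun r => Xinv c U V (q + r • w, y)) (dd (w, 0) (Xinv c U V) (q + r • w, y)) r := by
    intro r hr
    exact dd_hasDerivAt (f := Xinv c U V) (hl r)
      ((G.Xinv_smooth.contDiffAt (G.oDX.mem_nhds hr)).differentiableAt (by norm_num))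
  have hder2 : HasDerivAt (fun r => dd (w, 0) (Xinv c U V) (q + r • w, y))
      (dd (w, 0) (dd (w, 0) (Xinv c U V)) (q + s • w, y)) s := by
    refine dd_hasDerivAt (f := dd (w, 0) (Xinv c U V)) (hl s) ?_
    have h2 : ContDiffOn ℝ 2 (dd (w, 0) (Xinv c U V)) (jm c '' (U ×ˢ V)) :=
      dd_contDiffOn G.oDX (by norm_num) G.Xinv_smooth _
    exact (h2.contDiffAt (G.oDX.mem_nhds h)).differentiableAt (by norm_num)
  have hq : ∀ r : ℝ, (q + r • w, y) ∈ jm c '' (U ×ˢ V) → ∀ ζ : Euc n,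
        dd (dd (w, 0) (Xinv c U V) (q + r • w, y), 0) (dd (0, ζ) (Function.uncurry c)) (Xinv c U V (q + r • w, y), y) = -inner ℝ w ζ := by
    intro r hr ζ
    have hy : y ∈ V := (mem_DX.1 hr).1
    have hx := G.Xinv_mem hr
    have hz : (Xinv c U V (q + r • w, y), y) ∈ U ×ˢ V := ⟨hx, hy⟩
    have h1 := (hder r hr).prodMk (hasDerivAt_const r y)
    have h2 : HasDerivAt (fun t => dd (0, ζ) (Function.uncurry c) (Xinv c U V (q + t • w, y), y)) _ r :=
     dd_hasDerivAt (f := dd (0, ζ) (Function.uncurry c)) h1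
      (((G.dd_smooth3 _).contDiffAt (G.oUV.mem_nhds hz)).differentiableAt (by norm_num))
    have h3 : HasDerivAt (fun t : ℝ => - inner ℝ (q + t • w) ζ) (-inner ℝ w ζ) r := by
      have h4 : HasDerivAt (fun r : ℝ => q + r • w) w r := by
        simpa using ((hasDerivAt_id r).smul_const w).const_add q
      have h5 := ((h4.inner ℝ (hasDerivAt_const r ζ))).fun_neg
      simpa using h5
    refine h2.unique (h3.congr_of_eventuallyEq ?_)
    have hev : ∀ᶠ t in 𝓝 r, (q + t • w, y) ∈ jm c '' (U ×ˢ V) :=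
      (hl r).continuousAt.eventually_mem (G.oDX.mem_nhds hr)
    filter_upwards [hev] with t ht
    have := G.inner_qm (G.Xinv_mem ht) hy ζ
    rw [G.qm_Xinv ht] at this
    linarith
  refine ⟨fun r => dd (w, 0) (Xinv c U V) (q + r • w, y), _, hder s h, hder2, fun _ => rfl, hder, hq, ?_⟩
  intro ζ
  have hy : y ∈ V := (mem_DX.1 h).1
  have hx := G.Xinv_mem h
  have hz : (Xinv c U V (q + s • w, y), y) ∈ U ×ˢ V := ⟨hx, hy⟩
  have h1 := (hder s h).prodMk (hasDerivAt_const s y)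
  have h2 := hder2.prodMk (hasDerivAt_const s (0 : Euc n))
  have h3 := dd_hasDerivAt2 (f := dd (0, ζ) (Function.uncurry c))
    (γ := fun r => (Xinv c U V (q + r • w, y), y))
    (γ' := fun r => (dd (w, 0) (Xinv c U V) (q + r • w, y), 0)) h1 h2
    (((G.dd_smooth3 _).contDiffAt (G.oUV.mem_nhds hz)).of_le (by norm_num))
  refine h3.unique ((hasDerivAt_const s (-inner ℝ w ζ)).congr_of_eventuallyEq ?_)
  have hev : ∀ᶠ t in 𝓝 s, (q + t • w, y) ∈ jm c '' (U ×ˢ V) :=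
      (hl s).continuousAt.eventually_mem (G.oDX.mem_nhds h)
  filter_upwards [hev] with t ht
  exact hq t ht ζ

/-- solvability for second jets -/
theorem exists_jet (G : PreGood c U V) {x y : Euc n} (hx : x ∈ U) (hy : y ∈ V) (ζ : Euc n) :
    ∃ ζ' : Euc n, ∀ η0 : Euc n, dd (0, ζ) (dd (0, ζ) (dd (η0, 0) (Function.uncurry c))) (x, y)
      + dd (0, ζ') (dd (η0, 0) (Function.uncurry c)) (x, y) = 0 := by
  have hz : (x, y) ∈ U ×ˢ V := ⟨hx, hy⟩
  let T : Euc n →ₗ[ℝ] Euc n :=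
    { toFun := fun ζ' => (InnerProductSpace.toDual ℝ (Euc n)).symm
        ((fderiv ℝ (fun z => (fderiv ℝ (Function.uncurry c) z).comp
          (ContinuousLinearMap.inl ℝ (Euc n) (Euc n))) (x, y)) (0, ζ'))
      map_add' := by
        intro a b
        rw [← map_add, ← map_add]; congr 2; simp
      map_smul' := by
        intro r a
        have h1 : ((0 : Euc n), r • a) = r • ((0 : Euc n), a) := by simp
        rw [RingHom.id_apply, h1, map_smul]
        refine ext_inner_right ℝ fun v => ?_
        rw [InnerProductSpace.toDual_symm_apply, real_inner_smul_left]
        simp [InnerProductSpace.toDual_symm_apply] }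
  have hT : ∀ ζ' η0, inner ℝ (T ζ') η0 = dd (0, ζ') (dd (η0, 0) (Function.uncurry c)) (x, y) := by
    intro ζ' η0
    have hd : DifferentiableAt ℝ (fderiv ℝ (Function.uncurry c)) (x, y) :=
      ((G.smooth.contDiffAt (G.oUV.mem_nhds hz)).fderiv_right (m := 3) (by norm_num)).differentiableAt
        (by norm_num)
    simp only [T, LinearMap.coe_mk, AddHom.coe_mk, InnerProductSpace.toDual_symm_apply]
    unfold dd
    rw [fderiv_clm_apply hd (by fun_prop), fderiv_clm_comp hd (by fun_prop)]
    simp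
  have hinj : Function.Injective T := by
    rw [injective_iff_map_eq_zero]
    intro ζ' h
    refine G.ndp x hx y hy ζ' fun η => ?_
    rw [← hT, h, inner_zero_left]
  have hsurj : Function.Surjective T := LinearMap.injective_iff_surjective.1 hinj
  obtain ⟨ζ', h⟩ := hsurj (-(InnerProductSpace.toDual ℝ (Euc n)).symm
    ((fderiv ℝ (dd (0, ζ) (dd (0, ζ) (Function.uncurry c))) (x, y)).comp
      (ContinuousLinearMap.inl ℝ (Euc n) (Euc n))))
  refine ⟨ζ', fun η0 => ?_⟩
  rw [← hT, h, inner_neg_left, InnerProductSpace.toDual_symm_apply, G.comm3 _ _ hz]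
  simp [dd]
end PreGood

namespace Good
variable {c : Euc n → Euc n → ℝ} {U V : Set (Euc n)}


/-- The key one-sided inequality (P1). -/
theorem P1 (G : Good c U V) {a x y ζ ζ' : Euc n} (ha : a ∈ U) (hx : x ∈ U) (hy : y ∈ V)
    (h0 : inner ℝ (qm c x y - qm c a y) ζ = 0)
    (hζ : ∀ η0 : Euc n, dd (0, ζ) (dd (0, ζ) (dd (η0, 0) (Function.uncurry c))) (a, y)
      + dd (0, ζ') (dd (η0, 0) (Function.uncurry c)) (a, y) = 0) :
    dd (0, ζ) (dd (0, ζ) (Function.uncurry c)) (x, y) + dd (0, ζ') (Function.uncurry c) (x, y) ≤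
    dd (0, ζ) (dd (0, ζ) (Function.uncurry c)) (a, y) + dd (0, ζ') (Function.uncurry c) (a, y) := by
  set C := Function.uncurry c with hCdef
  set q := qm c a y with hq
  set w := qm c x y - qm c a y with hw
  have hdom : ∀ s ∈ Icc (0:ℝ) 1, (q + s • w, y) ∈ jm c '' (U ×ˢ V) := fun s hs =>
    G.DX_seg (PreGood.jm_mem ha hy) (PreGood.jm_mem hx hy) hs
  set γ : ℝ → Euc n := fun s => Xinv c U V (q + s • w, y) with hγ
  have hγ0 : γ 0 = a := by simp [hγ, hq, G.Xinv_qm ha hy]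
  have hγ1 : γ 1 = x := by simp [hγ, hw, hq, G.Xinv_qm hx hy]
  set h : ℝ → ℝ := fun s => dd (0, ζ) (dd (0, ζ) C) (γ s, y) + dd (0, ζ') C (γ s, y) with hh
  set γ' : ℝ → Euc n := fun r => dd (w, 0) (Xinv c U V) (q + r • w, y) with hγ'
  set h' : ℝ → ℝ := fun s => dd (γ' s, 0) (dd (0, ζ) (dd (0, ζ) C)) (γ s, y)
      + dd (γ' s, 0) (dd (0, ζ') C) (γ s, y) with hh'
  have key : ∀ s ∈ Icc (0:ℝ) 1, HasDerivAt h (h' s) s ∧ ∃ h'' ≤ 0, HasDerivAt h' h'' s := by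
    intro s hs
    obtain ⟨g', γ'', e1, e2, e3, e4, e5, e6⟩ := G.qcurve (hdom s hs)
    have hg : g' = γ' := funext e3
    subst hg
    have hxs : γ s ∈ U := G.Xinv_mem (hdom s hs)
    have hz : (γ s, y) ∈ U ×ˢ V := ⟨hxs, hy⟩
    have c1 := e1.prodMk (hasDerivAt_const s y)
    have c2 := e2.prodMk (hasDerivAt_const s (0 : Euc n))
    have f1 : ContDiffAt ℝ 2 (dd (0, ζ) (dd (0, ζ) C)) (γ s, y) :=
      (G.dd_smooth2 _ _).contDiffAt (G.oUV.mem_nhds hz)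
    have f2 : ContDiffAt ℝ 2 (dd (0, ζ') C) (γ s, y) :=
      ((G.dd_smooth3 _).contDiffAt (G.oUV.mem_nhds hz)).of_le (by norm_num)
    refine ⟨?_, ?_⟩
    · exact (dd_hasDerivAt (f := dd (0, ζ) (dd (0, ζ) C)) c1 (f1.differentiableAt (by norm_num))).add
        (dd_hasDerivAt (f := dd (0, ζ') C) c1 (f2.differentiableAt (by norm_num)))
    · have d1 := dd_hasDerivAt2 (f := dd (0, ζ) (dd (0, ζ) C)) (γ := fun r => (γ r, y))
        (γ' := fun r => (γ' r, 0)) c1 c2 f1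
      have d2 := dd_hasDerivAt2 (f := dd (0, ζ') C) (γ := fun r => (γ r, y))
        (γ' := fun r => (γ' r, 0)) c1 c2 f2
      refine ⟨_, ?_, d1.add d2⟩
      have e6' := e6 ζ'
      obtain ⟨ζ'', hz''⟩ := G.exists_jet hxs hy ζ
      have hcross : dd (γ' s, 0) (dd (0, ζ) C) (γ s, y) = 0 := by
        have := e5 s (hdom s hs) ζ
        rw [h0, neg_zero] at this
        exact this
      have m := G.mtw _ hxs y hy (γ' s) γ'' ζ ζ'' e6 hz'' hcross
      have hz3 := hz'' γ''
      rw [G.comm3 _ _ hz, G.comm2 _ _ hz] at hz3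
      change dd (γ' s, 0) (dd (γ' s, 0) (dd (0, ζ) (dd (0, ζ) C))) (γ s, y)
        + dd (γ'', 0) (dd (0, ζ) (dd (0, ζ) C)) (γ s, y)
        + (dd (γ' s, 0) (dd (γ' s, 0) (dd (0, ζ') C)) (γ s, y)
        + dd (γ'', 0) (dd (0, ζ') C) (γ s, y)) ≤ 0
      change dd (γ' s, 0) (dd (γ' s, 0) (dd (0, ζ') C)) (γ s, y)
        + dd (γ'', 0) (dd (0, ζ') C) (γ s, y) = 0 at e6'
      linarith
  have hh'0 : h' 0 = 0 := by
    have hz : (a, y) ∈ U ×ˢ V := ⟨ha, hy⟩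
    have := hζ (γ' 0)
    rw [G.comm3 _ _ hz, G.comm2 _ _ hz] at this
    simp only [hh', hγ0]
    exact this
  have hanti : ∀ s ∈ Icc (0:ℝ) 1, h' s ≤ 0 := by
    have : AntitoneOn h' (Icc 0 1) := by
      apply antitoneOn_of_deriv_nonpos (convex_Icc 0 1)
      · intro s hs
        obtain ⟨_, _, _, h3⟩ := key s hs
        exact h3.continuousAt.continuousWithinAt
      · intro s hs
        rw [interior_Icc] at hs
        obtain ⟨_, _, _, h3⟩ := key s ⟨hs.1.le, hs.2.le⟩
        exact h3.differentiableAt.differentiableWithinAt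
      · intro s hs
        rw [interior_Icc] at hs
        obtain ⟨_, _, h2, h3⟩ := key s ⟨hs.1.le, hs.2.le⟩
        rw [h3.deriv]; exact h2
    intro s hs
    rw [← hh'0]
    exact this ⟨le_rfl, zero_le_one⟩ hs hs.1
  have hanti2 : AntitoneOn h (Icc 0 1) := by
    apply antitoneOn_of_deriv_nonpos (convex_Icc 0 1)
    · intro s hs
      exact (key s hs).1.continuousAt.continuousWithinAt
    · intro s hs
      rw [interior_Icc] at hs
      exact (key s ⟨hs.1.le, hs.2.le⟩).1.differentiableAt.differentiableWithinAt
    · intro s hs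
      rw [interior_Icc] at hs
      rw [(key s ⟨hs.1.le, hs.2.le⟩).1.deriv]
      exact hanti s ⟨hs.1.le, hs.2.le⟩
  have := hanti2 ⟨le_rfl, zero_le_one⟩ ⟨zero_le_one, le_rfl⟩ zero_le_one
  simp only [hh, hγ0, hγ1] at this
  exact this

end Good
end FKM

end


section
open Set MeasureTheory Metric Bornology Filter Topology
open scoped ENNReal NNReal Pointwise

namespace FKM
variable {n : ℕ}

/-- inverse of `y ↦ p_a(y)` -/
noncomputable def Yv (c : Euc n → Euc n → ℝ) (U V : Set (Euc n)) (w : Euc n × Euc n) : Euc n :=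
  Xinv (fun y x => c x y) V U (w.2, w.1)

/-- domain of `Yv` -/
def DP (c : Euc n → Euc n → ℝ) (U V : Set (Euc n)) : Set (Euc n × Euc n) :=
  {w | (w.2, w.1) ∈ jm (fun y x => c x y) '' (V ×ˢ U)}

/-- the function `φ_{a,x}(p)` -/
noncomputable def Phi (c : Euc n → Euc n → ℝ) (U V : Set (Euc n))
    (z : Euc n × Euc n × Euc n) : ℝ :=
  - c z.2.1 (Yv c U V (z.1, z.2.2)) + c z.1 (Yv c U V (z.1, z.2.2))

/-- domain of `Phi` -/
def DF (c : Euc n → Euc n → ℝ) (U V : Set (Euc n)) : Set (Euc n × Euc n × Euc n) :=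
  {z | z.2.1 ∈ U ∧ (z.1, z.2.2) ∈ DP c U V}

namespace Good
variable {c : Euc n → Euc n → ℝ} {U V : Set (Euc n)}

theorem mem_DP {a p : Euc n} : (a, p) ∈ DP c U V ↔ a ∈ U ∧ p ∈ (fun y => pm c a y) '' V :=
  PreGood.mem_DX (c := fun y x => c x y) (U := V) (V := U)

theorem pm_mem_DP {a y : Euc n} (ha : a ∈ U) (hy : y ∈ V) : (a, pm c a y) ∈ DP c U V :=
  mem_DP.2 ⟨ha, y, hy, rfl⟩

theorem oDP (G : Good c U V) : IsOpen (DP c U V) :=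
  G.swap.oDX.preimage continuous_swap

theorem Yv_smooth (G : Good c U V) : ContDiffOn ℝ 3 (Yv c U V) (DP c U V) :=
  G.swap.Xinv_smooth.comp (ContinuousLinearEquiv.prodComm ℝ (Euc n) (Euc n)).contDiff.contDiffOn
    (fun _ h => h)

theorem Yv_pm (G : Good c U V) {a y : Euc n} (ha : a ∈ U) (hy : y ∈ V) :
    Yv c U V (a, pm c a y) = y := G.swap.Xinv_qm hy ha

theorem Yv_mem (G : Good c U V) {a p : Euc n} (h : (a, p) ∈ DP c U V) : Yv c U V (a, p) ∈ V :=
  G.swap.Xinv_mem h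

theorem pm_Yv (G : Good c U V) {a p : Euc n} (h : (a, p) ∈ DP c U V) :
    pm c a (Yv c U V (a, p)) = p := G.swap.qm_Xinv h

theorem DP_seg (G : Good c U V) {a p p' : Euc n} (h : (a, p) ∈ DP c U V)
    (h' : (a, p') ∈ DP c U V) {s : ℝ} (hs : s ∈ Icc (0:ℝ) 1) :
    (a, p + s • (p' - p)) ∈ DP c U V := G.swap.DX_seg h h' hs

theorem inner_pm (G : Good c U V) {x y : Euc n} (hx : x ∈ U) (hy : y ∈ V) (η : Euc n) :
    inner ℝ (pm c x y) η = - dd (η, 0) (Function.uncurry c) (x, y) := by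
  have := G.swap.inner_qm hy hx η
  rw [uncurry_swap, dd_swap] at this
  exact this

theorem pm_smooth (G : Good c U V) :
    ContDiffOn ℝ 3 (fun z : Euc n × Euc n => pm c z.1 z.2) (U ×ˢ V) :=
  G.swap.qm_smooth.comp (ContinuousLinearEquiv.prodComm ℝ (Euc n) (Euc n)).contDiff.contDiffOn
    (fun _ h => ⟨h.2, h.1⟩)

theorem inner_dd_pm (G : Good c U V) {z : Euc n × Euc n} (hz : z ∈ U ×ˢ V)
    (e : Euc n × Euc n) (η : Euc n) :
    inner ℝ (dd e (fun z : Euc n × Euc n => pm c z.1 z.2) z) η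
      = - dd e (dd (η, 0) (Function.uncurry c)) z := by
  have h1 := G.swap.inner_dd_qm (z := z.swap) ⟨hz.2, hz.1⟩ e.swap η
  rw [uncurry_swap, dd_swap] at h1
  have h2 : (fun z : Euc n × Euc n => qm (fun y x => c x y) z.1 z.2) =
    fun z => (fun z : Euc n × Euc n => pm c z.1 z.2) z.swap := rfl
  rw [h2] at h1
  obtain ⟨e1, e2⟩ := e
  simp only [Prod.swap_prod_mk] at h1
  rw [dd_swap] at h1
  have h3 := congrFun (dd_swap (fun z : Euc n × Euc n => pm c z.1 z.2) e2 e1) z.swap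
  rw [h3] at h1
  simpa using h1

/-- curves affine in the `p_a` coordinates -/
theorem pcurve (G : Good c U V) {a p w : Euc n} {s : ℝ} (h : (a, p + s • w) ∈ DP c U V) :
    ∃ γ' : ℝ → Euc n, ∃ γ'' : Euc n,
      HasDerivAt (fun r => Yv c U V (a, p + r • w)) (γ' s) s ∧
      HasDerivAt γ' γ'' s ∧ (∀ r, γ' r = dd (0, w) (Yv c U V) (a, p + r • w)) ∧
      (∀ r, (a, p + r • w) ∈ DP c U V →
        HasDerivAt (fun r => Yv c U V (a, p + r • w)) (γ' r) r) ∧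
      (∀ r, (a, p + r • w) ∈ DP c U V → ∀ η : Euc n,
        dd (0, γ' r) (dd (η, 0) (Function.uncurry c)) (a, Yv c U V (a, p + r • w)) = -inner ℝ w η) ∧
      (∀ η : Euc n, dd (0, γ' s) (dd (0, γ' s) (dd (η, 0) (Function.uncurry c)))
          (a, Yv c U V (a, p + s • w))
        + dd (0, γ'') (dd (η, 0) (Function.uncurry c)) (a, Yv c U V (a, p + s • w)) = 0) := by
  obtain ⟨γ', γ'', h1, h2, h3, h4, h5, h6⟩ := G.swap.qcurve h
  simp only [uncurry_swap, dd_swap] at h5 h6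
  refine ⟨γ', γ'', h1, h2, ?_, h4, h5, h6⟩
  intro r
  rw [h3]
  have : Yv c U V = fun z => Xinv (fun y x => c x y) V U z.swap := rfl
  rw [this, dd_swap]; rfl

theorem oDF (G : Good c U V) : IsOpen (DF c U V) := by
  apply IsOpen.inter
  · exact G.oU.preimage (by fun_prop)
  · exact G.oDP.preimage (by fun_prop)

theorem Phi_smooth (G : Good c U V) : ContDiffOn ℝ 3 (Phi c U V) (DF c U V) := by
  have hY : ContDiffOn ℝ 3 (fun z : Euc n × Euc n × Euc n => Yv c U V (z.1, z.2.2)) (DF c U V) :=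
    G.Yv_smooth.comp (by fun_prop) (fun z hz => hz.2)
  have hc : ContDiffOn ℝ 3 (Function.uncurry c) (U ×ˢ V) := G.smooth.of_le (by norm_num)
  have h1 : ContDiffOn ℝ 3 (fun z : Euc n × Euc n × Euc n =>
      Function.uncurry c (z.2.1, Yv c U V (z.1, z.2.2))) (DF c U V) :=
    hc.comp (ContDiffOn.prodMk (by fun_prop) hY) (fun z hz => ⟨hz.1, G.Yv_mem hz.2⟩)
  have h2 : ContDiffOn ℝ 3 (fun z : Euc n × Euc n × Euc n =>
      Function.uncurry c (z.1, Yv c U V (z.1, z.2.2))) (DF c U V) :=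
    hc.comp (ContDiffOn.prodMk (by fun_prop) hY) (fun z hz => ⟨(mem_DP.1 hz.2).1, G.Yv_mem hz.2⟩)
  exact h1.neg.add h2

theorem line_deriv (a x p w : Euc n) (s : ℝ) :
    HasDerivAt (fun r : ℝ => (a, x, p + r • w)) ((0 : Euc n), (0 : Euc n), w) s := by
  have h4 : HasDerivAt (fun r : ℝ => p + r • w) w s := by
    simpa using ((hasDerivAt_id s).smul_const w).const_add p
  exact (hasDerivAt_const s a).prodMk ((hasDerivAt_const s x).prodMk h4)

theorem Phi_d1 (G : Good c U V) {a x p : Euc n} (h : (a, x, p) ∈ DF c U V) (w : Euc n) :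
    dd (0, 0, w) (Phi c U V) (a, x, p) =
      inner ℝ (qm c x (Yv c U V (a, p)) - qm c a (Yv c U V (a, p))) (dd (0, w) (Yv c U V) (a, p)) := by
  have h0 : (a, p + (0:ℝ) • w) ∈ DP c U V := by simpa using h.2
  have hx : x ∈ U := h.1
  have ha : a ∈ U := (mem_DP.1 h.2).1
  have hy : Yv c U V (a, p) ∈ V := G.Yv_mem h.2
  obtain ⟨γ', γ'', h1, h2, h3, h4, h5, h6⟩ := G.pcurve h0
  have hγ : γ' 0 = dd (0, w) (Yv c U V) (a, p) := by simpa using h3 0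
  have dx : ∀ x ∈ U, HasDerivAt (fun r : ℝ => c x (Yv c U V (a, p + r • w)))
      (- inner ℝ (qm c x (Yv c U V (a, p))) (γ' 0)) 0 := by
    intro x hx
    have e1 := (hasDerivAt_const (0:ℝ) x).prodMk h1
    have hz : (x, Yv c U V (a, p + (0:ℝ) • w)) ∈ U ×ˢ V := ⟨hx, by simpa using hy⟩
    have e2 := dd_hasDerivAt (f := Function.uncurry c) e1
      ((G.smooth.contDiffAt (G.oUV.mem_nhds hz)).differentiableAt (by norm_num))
    rw [G.inner_qm hx hy, neg_neg]
    simpa using e2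
  have e3 := ((dx x hx).fun_neg.fun_add (dx a ha))
  have e4 := dd_hasDerivAt (f := Phi c U V) (line_deriv a x p w 0)
    ((G.Phi_smooth.contDiffAt (G.oDF.mem_nhds (by simpa using h))).differentiableAt (by norm_num))
  have e5 := e4.unique e3
  rw [inner_sub_left, ← hγ]
  simp only [zero_smul, add_zero] at e5
  rw [e5]; ring

/-- (P1) in terms of `Phi`. -/
theorem Phi_P1 (G : Good c U V) {a x p : Euc n} (h : (a, x, p) ∈ DF c U V) (w : Euc n)
    (hw : dd (0, 0, w) (Phi c U V) (a, x, p) = 0) :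
    0 ≤ dd (0, 0, w) (dd (0, 0, w) (Phi c U V)) (a, x, p) := by
  have h0 : (a, p + (0:ℝ) • w) ∈ DP c U V := by simpa using h.2
  have hx : x ∈ U := h.1
  have ha : a ∈ U := (mem_DP.1 h.2).1
  have hy : Yv c U V (a, p) ∈ V := G.Yv_mem h.2
  obtain ⟨γ', γ'', h1, h2, h3, h4, h5, h6⟩ := G.pcurve h0
  have hγ : γ' 0 = dd (0, w) (Yv c U V) (a, p) := by simpa using h3 0
  rw [G.Phi_d1 h, ← hγ] at hw
  have hy0 : Yv c U V (a, p + (0:ℝ) • w) = Yv c U V (a, p) := by simp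
  rw [hy0] at h6
  have key := G.P1 ha hx hy hw h6
  have dx : ∀ x ∈ U, HasDerivAt (fun r : ℝ => dd (0, γ' r) (Function.uncurry c) (x, Yv c U V (a, p + r • w)))
      (dd (0, γ' 0) (dd (0, γ' 0) (Function.uncurry c)) (x, Yv c U V (a, p))
        + dd (0, γ'') (Function.uncurry c) (x, Yv c U V (a, p))) 0 := by
    intro x hx
    have e1 := (hasDerivAt_const (0:ℝ) x).prodMk h1
    have e2 := (hasDerivAt_const (0:ℝ) (0 : Euc n)).prodMk h2
    have hz : (x, Yv c U V (a, p + (0:ℝ) • w)) ∈ U ×ˢ V := ⟨hx, by simpa using hy⟩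
    have := dd_hasDerivAt2 (f := Function.uncurry c) (γ := fun r : ℝ => (x, Yv c U V (a, p + r • w)))
      (γ' := fun r => (0, γ' r)) e1 e2
      ((G.smooth.contDiffAt (G.oUV.mem_nhds hz)).of_le (by norm_num))
    rw [hy0] at this
    exact this
  have e3 := ((dx x hx).fun_neg.fun_add (dx a ha))
  have e4 := dd_hasDerivAt (f := dd (0, 0, w) (Phi c U V)) (line_deriv a x p w 0)
    (((dd_contDiffOn (m := 2) G.oDF (by norm_num) G.Phi_smooth (0,0,w)).contDiffAt
      (G.oDF.mem_nhds (by simpa using h))).differentiableAt (by norm_num))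
  have hev : ∀ᶠ r : ℝ in 𝓝 0, (a, x, p + r • w) ∈ DF c U V :=
    (line_deriv a x p w 0).continuousAt.eventually_mem (G.oDF.mem_nhds (by simpa using h))
  have e5 := e4.unique (e3.congr_of_eventuallyEq (by
    filter_upwards [hev] with r hr
    rw [G.Phi_d1 hr, ← h3, inner_sub_left, G.inner_qm hx (G.Yv_mem hr.2),
      G.inner_qm ha (G.Yv_mem hr.2)]
    ring))
  simp only [zero_smul, add_zero] at e5
  rw [e5]; linarith

theorem Yv_d_surj (G : Good c U V) {a p : Euc n} (h : (a, p) ∈ DP c U V) (ζ : Euc n) :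
    dd (0, dd (0, ζ) (fun z : Euc n × Euc n => pm c z.1 z.2) (a, Yv c U V (a, p))) (Yv c U V) (a, p)
      = ζ := by
  set w := dd (0, ζ) (fun z : Euc n × Euc n => pm c z.1 z.2) (a, Yv c U V (a, p)) with hw
  have h0 : (a, p + (0:ℝ) • w) ∈ DP c U V := by simpa using h
  have ha : a ∈ U := (mem_DP.1 h).1
  have hy : Yv c U V (a, p) ∈ V := G.Yv_mem h
  obtain ⟨γ', γ'', h1, h2, h3, h4, h5, h6⟩ := G.pcurve h0
  have hγ : γ' 0 = dd (0, w) (Yv c U V) (a, p) := by simpa using h3 0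
  rw [← hγ]
  have : γ' 0 - ζ = 0 := by
    refine G.ndp a ha _ hy _ fun η => ?_
    have e1 := h5 0 h0 η
    have e2 := G.inner_dd_pm (z := (a, Yv c U V (a, p))) ⟨ha, hy⟩ (0, ζ) η
    rw [← hw] at e2
    have e3 : ((0 : Euc n), γ' 0 - ζ) = (0, γ' 0) + (-1 : ℝ) • (0, ζ) := by
      simp [sub_eq_add_neg]
    rw [e3, dd_add, dd_smul]
    simp only [zero_smul, add_zero] at e1
    rw [e1, e2]; simp
  exact sub_eq_zero.1 this

end Good
end FKM

end


section
open Set MeasureTheory Metric Bornology Filter Topology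
open scoped ENNReal NNReal Pointwise

namespace FKM
variable {n : ℕ}

theorem third_bound {G : Type*} [NormedAddCommGroup G] [NormedSpace ℝ G] {f : G → ℝ} {O K : Set G}
    (hO : IsOpen O) (hf : ContDiffOn ℝ 3 f O) (hK : IsCompact K) (hs : K ⊆ O) :
    ∃ M : ℝ, ∀ z ∈ K, ∀ e e' e'' : G, |dd e (dd e' (dd e'' f)) z| ≤ M * ‖e‖ * ‖e'‖ * ‖e''‖ := by
  have d1 := hf.fderiv_of_isOpen (m := 2) hO (by norm_num)
  have d2 := d1.fderiv_of_isOpen (m := 1) hO (by norm_num)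
  have d3 := d2.fderiv_of_isOpen (m := 0) hO (by norm_num)
  obtain ⟨M, hM⟩ := hK.exists_bound_of_continuousOn (d3.continuousOn.mono hs)
  refine ⟨M, fun z hz e e' e'' => ?_⟩
  have a1 : EqOn (dd e' (dd e'' f)) (fun z => fderiv ℝ (fderiv ℝ f) z e' e'') O := by
    intro z hz
    have hd : DifferentiableAt ℝ (fderiv ℝ f) z :=
      (d1.contDiffAt (hO.mem_nhds hz)).differentiableAt (by norm_num)
    unfold dd
    rw [fderiv_clm_apply hd (by fun_prop)]
    simp
  have a2 : dd e (dd e' (dd e'' f)) z = fderiv ℝ (fderiv ℝ (fderiv ℝ f)) z e e' e'' := by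
    rw [dd_congr hO a1 e (hs hz)]
    have hd : DifferentiableAt ℝ (fderiv ℝ (fderiv ℝ f)) z :=
      (d2.contDiffAt (hO.mem_nhds (hs hz))).differentiableAt (by norm_num)
    have h1 := ((hd.hasFDerivAt.clm_apply (hasFDerivAt_const e' z)).clm_apply
      (hasFDerivAt_const e'' z)).fderiv
    unfold dd
    rw [h1]
    simp
  rw [a2, ← Real.norm_eq_abs]
  refine (ContinuousLinearMap.le_opNorm _ _).trans ?_
  gcongr
  refine (ContinuousLinearMap.le_opNorm _ _).trans ?_
  gcongr
  refine (ContinuousLinearMap.le_opNorm _ _).trans ?_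
  gcongr
  exact hM z hz

attribute [local irreducible] qm pm Yv Xinv Phi
namespace Good
variable {c : Euc n → Euc n → ℝ} {U V : Set (Euc n)}

/-- segment point in `q`-coordinates -/
noncomputable def qs (c : Euc n → Euc n → ℝ) (U V : Set (Euc n)) (t : ℝ × Euc n × Euc n × Euc n) :
    Euc n × Euc n :=
  (qm c t.2.1 (Yv c U V (t.2.1, t.2.2.2)) + t.1 • (qm c t.2.2.1 (Yv c U V (t.2.1, t.2.2.2)) -
    qm c t.2.1 (Yv c U V (t.2.1, t.2.2.2))), Yv c U V (t.2.1, t.2.2.2))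

theorem qs_mem (G : Good c U V) : MapsTo (qs c U V) (Icc (0:ℝ) 1 ×ˢ DF c U V) (jm c '' (U ×ˢ V)) := by
  rintro ⟨s, a, x, p⟩ ⟨hs, hx, hp⟩
  exact G.DX_seg (PreGood.jm_mem (mem_DP.1 hp).1 (G.Yv_mem hp)) (PreGood.jm_mem hx (G.Yv_mem hp)) hs

theorem Yv_cont (G : Good c U V) :
    ContinuousOn (fun t : ℝ × Euc n × Euc n × Euc n => Yv c U V (t.2.1, t.2.2.2))
      (Icc (0:ℝ) 1 ×ˢ DF c U V) :=
  G.Yv_smooth.continuousOn.comp (by fun_prop) (fun t ht => ht.2.2)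

theorem qs_cont (G : Good c U V) : ContinuousOn (qs c U V) (Icc (0:ℝ) 1 ×ˢ DF c U V) := by
  have hY := G.Yv_cont
  have h1 : ContinuousOn (fun t : ℝ × Euc n × Euc n × Euc n => qm c t.2.1 (Yv c U V (t.2.1, t.2.2.2)))
      (Icc (0:ℝ) 1 ×ˢ DF c U V) :=
    G.qm_smooth.continuousOn.comp (ContinuousOn.prodMk (by fun_prop) hY)
      (fun t ht => ⟨(mem_DP.1 ht.2.2).1, G.Yv_mem ht.2.2⟩)
  have h2 : ContinuousOn (fun t : ℝ × Euc n × Euc n × Euc n => qm c t.2.2.1 (Yv c U V (t.2.1, t.2.2.2)))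
      (Icc (0:ℝ) 1 ×ˢ DF c U V) :=
    G.qm_smooth.continuousOn.comp (ContinuousOn.prodMk (by fun_prop) hY)
      (fun t ht => ⟨ht.2.1, G.Yv_mem ht.2.2⟩)
  have h3 := h1.add ((continuousOn_fst (s := Icc (0:ℝ) 1 ×ˢ DF c U V)).smul (h2.sub h1))
  exact h3.prodMk hY

theorem zs_mem (G : Good c U V) : MapsTo (fun t : ℝ × Euc n × Euc n × Euc n =>
    (t.2.1, Xinv c U V (qs c U V t), t.2.2.2)) (Icc (0:ℝ) 1 ×ˢ DF c U V) (DF c U V) := by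
  intro t ht
  exact ⟨G.Xinv_mem (G.qs_mem ht), ht.2.2⟩

theorem bounds (G : Good c U V) {K : Set (Euc n × Euc n × Euc n)} (hK : IsCompact K)
    (hs : K ⊆ DF c U V) : ∃ M : ℝ, 0 < M ∧
    (∀ s ∈ Icc (0:ℝ) 1, ∀ z ∈ K, ‖fderiv ℝ (Xinv c U V) (qs c U V (s, z))‖ ≤ M) ∧
    (∀ s ∈ Icc (0:ℝ) 1, ∀ z ∈ K, ∀ e e' e'', |dd e (dd e' (dd e'' (Phi c U V)))
      (z.1, Xinv c U V (qs c U V (s, z)), z.2.2)| ≤ M * ‖e‖ * ‖e'‖ * ‖e''‖) ∧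
    (∀ z ∈ K, ‖fderiv ℝ (fun z : Euc n × Euc n => pm c z.1 z.2) (z.1, Yv c U V (z.1, z.2.2))‖ ≤ M) := by
  have hKc : IsCompact (Icc (0:ℝ) 1 ×ˢ K) := isCompact_Icc.prod hK
  have hsub : Icc (0:ℝ) 1 ×ˢ K ⊆ Icc (0:ℝ) 1 ×ˢ DF c U V := prod_mono le_rfl hs
  have c1 : ContinuousOn (fun t => fderiv ℝ (Xinv c U V) (qs c U V t)) (Icc (0:ℝ) 1 ×ˢ K) :=
    ((G.Xinv_smooth.fderiv_of_isOpen (m := 2) G.oDX (by norm_num)).continuousOn.comp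
      G.qs_cont G.qs_mem).mono hsub
  have c0 : ContinuousOn (fun t : ℝ × Euc n × Euc n × Euc n =>
      (t.2.1, Xinv c U V (qs c U V t), t.2.2.2)) (Icc (0:ℝ) 1 ×ˢ DF c U V) :=
    ContinuousOn.prodMk (by fun_prop) (ContinuousOn.prodMk
      (G.Xinv_smooth.continuousOn.comp G.qs_cont G.qs_mem) (by fun_prop))
  have c3 : ContinuousOn (fun z : Euc n × Euc n × Euc n =>
      fderiv ℝ (fun z : Euc n × Euc n => pm c z.1 z.2) (z.1, Yv c U V (z.1, z.2.2))) K := by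
    refine (G.pm_smooth.fderiv_of_isOpen (m := 2) G.oUV (by norm_num)).continuousOn.comp ?_ ?_
    · refine ContinuousOn.prodMk (by fun_prop) ?_
      exact G.Yv_smooth.continuousOn.comp (by fun_prop) (fun t ht => (hs ht).2)
    · intro z hz
      exact ⟨(mem_DP.1 (hs hz).2).1, G.Yv_mem (hs hz).2⟩
  obtain ⟨M1, h1⟩ := hKc.exists_bound_of_continuousOn c1
  obtain ⟨M2, h2⟩ := third_bound G.oDF G.Phi_smooth (hKc.image_of_continuousOn (c0.mono hsub))
    (by rintro _ ⟨t, ht, rfl⟩; exact G.zs_mem (hsub ht))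
  obtain ⟨M3, h3⟩ := hK.exists_bound_of_continuousOn c3
  refine ⟨max 1 (max M1 (max M2 M3)), by positivity, ?_, ?_, ?_⟩
  · intro s hs z hz
    exact (h1 (s, z) ⟨hs, hz⟩).trans ((le_max_left _ _).trans (le_max_right _ _))
  · intro s hs z hz e e' e''
    refine (h2 _ ⟨(s, z), ⟨hs, hz⟩, rfl⟩ e e' e'').trans ?_
    gcongr
    exact (le_max_left _ _).trans ((le_max_right _ _).trans (le_max_right _ _))
  · intro z hz
    exact (h3 z hz).trans ((le_max_right _ _).trans ((le_max_right _ _).trans (le_max_right _ _)))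

/-- gradient of `Phi` in `p` -/
noncomputable def xi (c : Euc n → Euc n → ℝ) (U V : Set (Euc n)) (z : Euc n × Euc n × Euc n) : Euc n :=
  (InnerProductSpace.toDual ℝ (Euc n)).symm ((fderiv ℝ (Phi c U V) z).comp
    ((ContinuousLinearMap.inr ℝ (Euc n) (Euc n × Euc n)).comp
      (ContinuousLinearMap.inr ℝ (Euc n) (Euc n))))

theorem inner_xi (z : Euc n × Euc n × Euc n) (w : Euc n) :
    inner ℝ (xi c U V z) w = dd (0, 0, w) (Phi c U V) z := by
  unfold xi
  rw [InnerProductSpace.toDual_symm_apply]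
  simp [dd]

theorem xi_cont (G : Good c U V) : ContinuousOn (xi c U V) (DF c U V) := by
  unfold xi
  refine (InnerProductSpace.toDual ℝ (Euc n)).symm.continuous.comp_continuousOn ?_
  exact ((G.Phi_smooth.fderiv_of_isOpen (m := 2) G.oDF (by norm_num)).clm_comp
    contDiffOn_const).continuousOn

theorem dd_dd_eq (G : Good c U V) {z : Euc n × Euc n × Euc n} (hz : z ∈ DF c U V)
    (e e' : Euc n × Euc n × Euc n) :
    dd e (dd e' (Phi c U V)) z = fderiv ℝ (fderiv ℝ (Phi c U V)) z e e' := by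
  have d1 := G.Phi_smooth.fderiv_of_isOpen (m := 2) G.oDF (by norm_num)
  have hd : DifferentiableAt ℝ (fderiv ℝ (Phi c U V)) z :=
    (d1.contDiffAt (G.oDF.mem_nhds hz)).differentiableAt (by norm_num)
  unfold dd
  rw [fderiv_clm_apply hd (by fun_prop)]
  simp

theorem dd_dd_diag (G : Good c U V) {a p : Euc n} (hz : (a, a, p) ∈ DF c U V) (w w' : Euc n) :
    dd (0, 0, w) (dd (0, 0, w') (Phi c U V)) (a, a, p) = 0 := by
  have e4 := dd_hasDerivAt (f := dd (0, 0, w') (Phi c U V)) (line_deriv a a p w 0)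
    (((dd_contDiffOn (m := 2) G.oDF (by norm_num) G.Phi_smooth (0,0,w')).contDiffAt
      (G.oDF.mem_nhds (by simpa using hz))).differentiableAt (by norm_num))
  have hev : ∀ᶠ r : ℝ in 𝓝 0, (a, a, p + r • w) ∈ DF c U V :=
    (line_deriv a a p w 0).continuousAt.eventually_mem (G.oDF.mem_nhds (by simpa using hz))
  have e5 := e4.unique ((hasDerivAt_const (0:ℝ) (0:ℝ)).congr_of_eventuallyEq (by
    filter_upwards [hev] with r hr
    rw [G.Phi_d1 hr, sub_self, inner_zero_left]))
  simpa using e5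

/-- second derivative bound -/
theorem hess_bound (G : Good c U V) {K : Set (Euc n × Euc n × Euc n)} 
    (hs : K ⊆ DF c U V) {M : ℝ} (hM : 0 < M)
    (hM1 : ∀ s ∈ Icc (0:ℝ) 1, ∀ z ∈ K, ‖fderiv ℝ (Xinv c U V) (qs c U V (s, z))‖ ≤ M)
    (hM2 : ∀ s ∈ Icc (0:ℝ) 1, ∀ z ∈ K, ∀ e e' e'', |dd e (dd e' (dd e'' (Phi c U V)))
      (z.1, Xinv c U V (qs c U V (s, z)), z.2.2)| ≤ M * ‖e‖ * ‖e'‖ * ‖e''‖) {a x p : Euc n} (hz : (a, x, p) ∈ K)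
    (w w' : Euc n) :
    |dd (0, 0, w) (dd (0, 0, w') (Phi c U V)) (a, x, p)| ≤
      M * M * ‖qm c x (Yv c U V (a, p)) - qm c a (Yv c U V (a, p))‖ * ‖w‖ * ‖w'‖ := by
  have hzD := hs hz
  have hx : x ∈ U := hzD.1
  have ha : a ∈ U := (mem_DP.1 hzD.2).1
  set y := Yv c U V (a, p) with hy0
  have hy : y ∈ V := G.Yv_mem hzD.2
  set e := qm c x y - qm c a y with he
  have hqs : ∀ s : ℝ, qs c U V (s, a, x, p) = (qm c a y + s • e, y) := fun s => rfl
  set γ : ℝ → Euc n := fun s => Xinv c U V (qm c a y + s • e, y) with hγ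
  have hγ0 : γ 0 = a := by simp [hγ, G.Xinv_qm ha hy]
  have hγ1 : γ 1 = x := by simp [hγ, he, G.Xinv_qm hx hy]
  have hdom : ∀ s ∈ Icc (0:ℝ) 1, (qm c a y + s • e, y) ∈ jm c '' (U ×ˢ V) := fun s hs' =>
    G.qs_mem (x := (s, a, x, p)) ⟨hs', hzD⟩
  have hzs : ∀ s ∈ Icc (0:ℝ) 1, (a, γ s, p) ∈ DF c U V := fun s hs' =>
    ⟨G.Xinv_mem (hdom s hs'), hzD.2⟩
  set b : ℝ → ℝ := fun s => dd (0, 0, w) (dd (0, 0, w') (Phi c U V)) (a, γ s, p) with hb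
  set b' : ℝ → ℝ := fun s => dd (0, fderiv ℝ (Xinv c U V) (qm c a y + s • e, y) (e, 0), 0)
    (dd (0, 0, w) (dd (0, 0, w') (Phi c U V))) (a, γ s, p) with hb'
  have d2 := dd_contDiffOn (m := 1) G.oDF (by norm_num)
    (dd_contDiffOn (m := 2) G.oDF (by norm_num) G.Phi_smooth (0,0,w')) (0,0,w)
  have hder : ∀ s ∈ Icc (0:ℝ) 1, HasDerivWithinAt b (b' s) (Icc 0 1) s := by
    intro s hs'
    obtain ⟨g', γ'', e1, e2, e3, e4, e5, e6⟩ := G.qcurve (hdom s hs')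
    have e7 : HasDerivAt (fun s => (a, γ s, p)) ((0 : Euc n), g' s, (0 : Euc n)) s :=
      (hasDerivAt_const s a).prodMk (e1.prodMk (hasDerivAt_const s p))
    have e9 := dd_hasDerivAt e7 ((d2.contDiffAt (G.oDF.mem_nhds (hzs s hs'))).differentiableAt
      (by norm_num))
    rw [e3] at e9
    exact e9.hasDerivWithinAt
  have hnw : ∀ v : Euc n, ‖((0 : Euc n), (0 : Euc n), v)‖ = ‖v‖ := by
    intro v; simp [Prod.norm_def]
  have hbd : ∀ s ∈ Ico (0:ℝ) 1, ‖b' s‖ ≤ M * M * ‖e‖ * ‖w‖ * ‖w'‖ := by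
    intro s hs'
    have hs'' : s ∈ Icc (0:ℝ) 1 := ⟨hs'.1, hs'.2.le⟩
    have n1 := hM1 s hs'' _ hz
    rw [hqs] at n1
    have n3 : ‖fderiv ℝ (Xinv c U V) (qm c a y + s • e, y) (e, 0)‖ ≤ M * ‖e‖ := by
      refine (ContinuousLinearMap.le_opNorm _ _).trans ?_
      have : ‖(e, (0 : Euc n))‖ = ‖e‖ := by simp [Prod.norm_def]
      rw [this]; gcongr
    have n4 : ‖((0 : Euc n), fderiv ℝ (Xinv c U V) (qm c a y + s • e, y) (e, 0), (0 : Euc n))‖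
        ≤ M * ‖e‖ := by
      simpa [Prod.norm_def] using n3
    have n2 := hM2 s hs'' _ hz (0, fderiv ℝ (Xinv c U V) (qm c a y + s • e, y) (e, 0), 0)
      (0, 0, w) (0, 0, w')
    rw [hnw, hnw] at n2
    calc ‖b' s‖ ≤ _ := n2
      _ ≤ M * (M * ‖e‖) * ‖w‖ * ‖w'‖ := by gcongr
      _ = _ := by ring
  have := norm_image_sub_le_of_norm_deriv_le_segment_01' hder hbd
  have hb1 : b 1 = dd (0, 0, w) (dd (0, 0, w') (Phi c U V)) (a, x, p) := by
    simp only [hb, hγ1]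
  have hb0 : b 0 = 0 := by
    have h0 := hzs 0 ⟨le_rfl, zero_le_one⟩
    simp only [hb, hγ0] at h0 ⊢
    rw [G.dd_dd_diag h0]
  rw [hb0, sub_zero, hb1] at this
  exact this

theorem e_le_xi (G : Good c U V) {M : ℝ} (hM : 0 < M) {a x p : Euc n} (hz : (a, x, p) ∈ DF c U V)
    (hM3 : ‖fderiv ℝ (fun z : Euc n × Euc n => pm c z.1 z.2) (a, Yv c U V (a, p))‖ ≤ M) :
    ‖qm c x (Yv c U V (a, p)) - qm c a (Yv c U V (a, p))‖ ≤ M * ‖xi c U V (a, x, p)‖ := by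
  set e := qm c x (Yv c U V (a, p)) - qm c a (Yv c U V (a, p)) with he
  set w := dd (0, e) (fun z : Euc n × Euc n => pm c z.1 z.2) (a, Yv c U V (a, p)) with hw
  have h1 := G.Phi_d1 hz w
  rw [hw, G.Yv_d_surj hz.2, ← hw, ← he, ← inner_xi, real_inner_self_eq_norm_sq] at h1
  have h2 : ‖w‖ ≤ M * ‖e‖ := by
    refine (ContinuousLinearMap.le_opNorm _ _).trans ?_
    have : ‖((0 : Euc n), e)‖ = ‖e‖ := by simp [Prod.norm_def]
    rw [this]; gcongr
  have h3 : ‖e‖ ^ 2 ≤ ‖xi c U V (a, x, p)‖ * (M * ‖e‖) := by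
    rw [← h1]
    exact (real_inner_le_norm _ _).trans (by gcongr)
  rcases eq_or_lt_of_le (norm_nonneg e) with h | h
  · rw [← h]; positivity
  · nlinarith

/-- algebraic core of `Kest` -/
theorem quad_est (B : Euc n → Euc n → ℝ) (ξ : Euc n) {N : ℝ} (hN : 0 ≤ N)
    (hB : ∀ w w', |B w w'| ≤ N * ‖ξ‖ * ‖w‖ * ‖w'‖)
    (h1 : ∀ a b d, B (a + b) d = B a d + B b d) (h2 : ∀ a b d, B d (a + b) = B d a + B d b)
    (hpos : ∀ w, inner ℝ ξ w = 0 → 0 ≤ B w w) (w : Euc n) :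
    -(2 * N * ‖w‖ * |inner ℝ ξ w|) ≤ B w w := by
  rcases eq_or_lt_of_le (norm_nonneg ξ) with h0 | h0
  · have := hB w w
    rw [← h0] at this
    simp only [mul_zero, zero_mul] at this
    have h3 := (abs_nonpos_iff.1 this)
    rw [h3]
    have : 0 ≤ 2 * N * ‖w‖ * |inner ℝ ξ w| := by positivity
    linarith
  obtain ⟨r, w0, hw, hw0ξ, hrn, hw0n⟩ : ∃ r w0 : Euc n, w = w0 + r ∧ inner ℝ ξ w0 = 0 ∧
      ‖r‖ = |inner ℝ ξ w| / ‖ξ‖ ∧ ‖w0‖ ≤ ‖w‖ := by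
    have q0 : inner ℝ ξ (w - (inner ℝ ξ w / ‖ξ‖ ^ 2) • ξ) = 0 := by
      rw [inner_sub_right, inner_smul_right, real_inner_self_eq_norm_sq]
      field_simp; simp
    refine ⟨(inner ℝ ξ w / ‖ξ‖ ^ 2) • ξ, w - (inner ℝ ξ w / ‖ξ‖ ^ 2) • ξ, by simp, q0, ?_, ?_⟩
    · rw [norm_smul, Real.norm_eq_abs, abs_div, abs_of_nonneg (sq_nonneg ‖ξ‖)]
      field_simp
    · have h2 : inner ℝ (w - (inner ℝ ξ w / ‖ξ‖ ^ 2) • ξ) ((inner ℝ ξ w / ‖ξ‖ ^ 2) • ξ) = 0 := by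
        rw [inner_smul_right, real_inner_comm (x := ξ), q0, mul_zero]
      have h3 := norm_add_sq_real (w - (inner ℝ ξ w / ‖ξ‖ ^ 2) • ξ) ((inner ℝ ξ w / ‖ξ‖ ^ 2) • ξ)
      rw [h2, sub_add_cancel] at h3
      refine (sq_le_sq₀ (norm_nonneg _) (norm_nonneg _)).1 ?_
      rw [h3]
      have := sq_nonneg ‖(inner ℝ ξ w / ‖ξ‖ ^ 2) • ξ‖
      linarith
  have hP := hpos w0 hw0ξ
  have hsplit : B w w = B w0 w0 + B w0 r + B r w := by
    conv_lhs => rw [hw, h1, h2]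
    rw [← hw]
  have b1 := neg_le_of_abs_le (hB w0 r)
  have b2 := neg_le_of_abs_le (hB r w)
  rw [hsplit]
  have b3 : N * ‖ξ‖ * ‖w0‖ * ‖r‖ ≤ N * ‖w‖ * |inner ℝ ξ w| := by
    rw [hrn]
    calc N * ‖ξ‖ * ‖w0‖ * (|inner ℝ ξ w| / ‖ξ‖)
        ≤ N * ‖ξ‖ * ‖w‖ * (|inner ℝ ξ w| / ‖ξ‖) := by gcongr
      _ = _ := by field_simp
  have b4 : N * ‖ξ‖ * ‖r‖ * ‖w‖ = N * ‖w‖ * |inner ℝ ξ w| := by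
    rw [hrn]
    field_simp
  linarith

/-- K -/
theorem Kest (G : Good c U V) {K : Set (Euc n × Euc n × Euc n)} (hK : IsCompact K)
    (hs : K ⊆ DF c U V) : ∃ C : ℝ, 0 ≤ C ∧ ∀ z ∈ K, ∀ w : Euc n,
    -(C * ‖w‖ * |dd (0, 0, w) (Phi c U V) z|) ≤ dd (0, 0, w) (dd (0, 0, w) (Phi c U V)) z := by
  obtain ⟨M, hM, hM1, hM2, hM3⟩ := G.bounds hK hs
  refine ⟨2 * (M * M * M), by positivity, ?_⟩
  rintro ⟨a, x, p⟩ hz w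
  have hzD := hs hz
  have hh := G.hess_bound hs hM hM1 hM2 hz
  have hm3 := hM3 _ hz
  dsimp only at hm3
  have he := G.e_le_xi hM hzD hm3
  have hb := G.dd_dd_eq hzD
  have hs1 : ∀ a b : Euc n, ((0 : Euc n), (0 : Euc n), a + b) = (0, 0, a) + (0, 0, b) := by
    intro a b; simp
  have := quad_est (fun w w' => dd (0, 0, w) (dd (0, 0, w') (Phi c U V)) (a, x, p))
    (xi c U V (a, x, p)) (N := M * M * M) (by positivity) ?_ ?_ ?_ ?_ w
  · rw [inner_xi] at this
    exact this
  · intro w w'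
    refine (hh w w').trans ?_
    have : M * M * ‖qm c x (Yv c U V (a, p)) - qm c a (Yv c U V (a, p))‖ ≤
      M * M * (M * ‖xi c U V (a, x, p)‖) := by gcongr
    have e : M * M * M * ‖xi c U V (a, x, p)‖ = M * M * (M * ‖xi c U V (a, x, p)‖) := by ring
    rw [e]
    gcongr
  · intro r s d
    simp only [hb, hs1, map_add, ContinuousLinearMap.add_apply]
  · intro r s d
    simp only [hb, hs1, map_add]
  · intro w0 hw0
    exact G.Phi_P1 hzD w0 (by rw [← inner_xi]; exact hw0)

/-- K1: quantitative quasi-convexity along `p`-segments. -/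
theorem K1 (G : Good c U V) {K : Set (Euc n × Euc n × Euc n)} (hK : IsCompact K)
    (hs : K ⊆ DF c U V) : ∃ κ : ℝ, 0 < κ ∧ κ ≤ 1 ∧ ∀ a x p p' : Euc n,
    (∀ t ∈ Icc (0:ℝ) 1, (a, x, p + t • (p' - p)) ∈ K) →
    min (κ * inner ℝ (xi c U V (a, x, p)) (p' - p)) (κ⁻¹ * inner ℝ (xi c U V (a, x, p)) (p' - p))
      ≤ Phi c U V (a, x, p') - Phi c U V (a, x, p) := by
  obtain ⟨C, hC, hKe⟩ := G.Kest hK hs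
  obtain ⟨R, hR⟩ := hK.isBounded.exists_norm_le
  have hR0 : 0 ≤ max R 0 := le_max_right _ _
  set D := C * (2 * max R 0) with hD
  have hD0 : 0 ≤ D := by positivity
  refine ⟨Real.exp (-(D+1)), Real.exp_pos _, Real.exp_le_one_iff.2 (by linarith), ?_⟩
  intro a x p p' hseg
  rw [← Real.exp_neg, neg_neg]
  set w := p' - p with hw
  have hp : ∀ t ∈ Icc (0:ℝ) 1, ‖p + t • w‖ ≤ max R 0 := by
    intro t ht
    have h1 := hR _ (hseg t ht)
    have h2 : ‖p + t • w‖ ≤ ‖(a, x, p + t • w)‖ :=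
      (le_max_right _ _).trans (le_max_right ‖a‖ ‖(x, p + t • w)‖)
    exact h2.trans (h1.trans (le_max_left _ _))
  have hwn : ‖w‖ ≤ 2 * max R 0 := by
    have h1 := hp 0 ⟨le_rfl, zero_le_one⟩
    have h2 := hp 1 ⟨zero_le_one, le_rfl⟩
    simp only [zero_smul, add_zero, one_smul] at h1 h2
    have h3 : w = (p + w) - p := by simp
    rw [h3]
    exact (norm_sub_le _ _).trans (by linarith)
  have h1 : ∀ t ∈ Icc (0:ℝ) 1, HasDerivWithinAt (fun t => Phi c U V (a, x, p + t • w))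
      (dd (0, 0, w) (Phi c U V) (a, x, p + t • w)) (Icc 0 1) t := by
    intro t ht
    exact (dd_hasDerivAt (f := Phi c U V) (line_deriv a x p w t)
      ((G.Phi_smooth.contDiffAt (G.oDF.mem_nhds (hs (hseg t ht)))).differentiableAt
        (by norm_num))).hasDerivWithinAt
  have h2 : ∀ t ∈ Icc (0:ℝ) 1, HasDerivWithinAt (fun t => dd (0, 0, w) (Phi c U V) (a, x, p + t • w))
      (dd (0, 0, w) (dd (0, 0, w) (Phi c U V)) (a, x, p + t • w)) (Icc 0 1) t := by
    intro t ht
    exact (dd_hasDerivAt (f := dd (0, 0, w) (Phi c U V)) (line_deriv a x p w t)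
      (((dd_contDiffOn (m := 2) G.oDF (by norm_num) G.Phi_smooth (0,0,w)).contDiffAt
        (G.oDF.mem_nhds (hs (hseg t ht)))).differentiableAt
        (by norm_num))).hasDerivWithinAt
  have := ode_ineq_int hD0 h1 h2 (by
    intro t ht
    refine le_trans ?_ (hKe _ (hseg t ht) w)
    rw [neg_mul, neg_le_neg_iff]
    gcongr
    rw [hD]
    gcongr)
  simp only [zero_smul, add_zero, one_smul] at this
  rw [inner_xi]
  have e1 : p + w = p' := by simp [hw]
  rw [e1] at this
  exact this

theorem seg_K (G : Good c U V) {a x p p' : Euc n} (hx : x ∈ U) (hp : (a, p) ∈ DP c U V)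
    (hp' : (a, p') ∈ DP c U V) :
    ∃ K ⊆ DF c U V, IsCompact K ∧ ∀ t ∈ Icc (0:ℝ) 1, (a, x, p + t • (p' - p)) ∈ K := by
  refine ⟨(fun t : ℝ => (a, x, p + t • (p' - p))) '' Icc 0 1, ?_, ?_, ?_⟩
  · rintro _ ⟨t, ht, rfl⟩
    exact ⟨hx, G.DP_seg hp hp' ht⟩
  · exact isCompact_Icc.image (by fun_prop)
  · exact fun t ht => ⟨t, ht, rfl⟩

/-- monotonicity: nonnegative initial slope implies the end value is larger -/
theorem slope_nonneg (G : Good c U V) {a x p p' : Euc n} (hx : x ∈ U) (hp : (a, p) ∈ DP c U V)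
    (hp' : (a, p') ∈ DP c U V) (h : 0 ≤ inner ℝ (xi c U V (a, x, p)) (p' - p)) :
    Phi c U V (a, x, p) ≤ Phi c U V (a, x, p') := by
  obtain ⟨K, h1, h2, h3⟩ := G.seg_K hx hp hp'
  obtain ⟨κ, k0, k1, hk⟩ := G.K1 h2 h1
  have := hk a x p p' h3
  have h4 : 0 ≤ min (κ * inner ℝ (xi c U V (a, x, p)) (p' - p)) (κ⁻¹ * inner ℝ (xi c U V (a, x, p)) (p' - p)) :=
    le_min (by positivity) (by positivity)
  linarith

/-- quasi-convexity (Loeper's maximum principle) -/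
theorem quasi (G : Good c U V) {a x p p' : Euc n} (hx : x ∈ U) (hp : (a, p) ∈ DP c U V)
    (hp' : (a, p') ∈ DP c U V) {t : ℝ} (ht : t ∈ Icc (0:ℝ) 1) :
    Phi c U V (a, x, p + t • (p' - p)) ≤ max (Phi c U V (a, x, p)) (Phi c U V (a, x, p')) := by
  have hm := G.DP_seg hp hp' ht
  rcases le_total 0 (inner ℝ (xi c U V (a, x, p + t • (p' - p))) (p' - p)) with h | h
  · refine le_max_of_le_right (G.slope_nonneg hx hm hp' ?_)
    have : p' - (p + t • (p' - p)) = (1 - t) • (p' - p) := by module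
    rw [this, inner_smul_right]
    exact mul_nonneg (by linarith [ht.2]) h
  · refine le_max_of_le_left (G.slope_nonneg hx hm hp ?_)
    have : p - (p + t • (p' - p)) = (- t) • (p' - p) := by module
    rw [this, inner_smul_right]
    nlinarith [ht.1]

end Good
end FKM

end


section
open Set MeasureTheory Metric Bornology Filter Topology
open scoped ENNReal NNReal Pointwise

namespace FKM
variable {n : ℕ}
attribute [local irreducible] qm pm Yv Xinv Phi

/-- derivative of `p_a` in `y` -/
noncomputable def Dp (c : Euc n → Euc n → ℝ) (w : Euc n × Euc n) : Euc n →L[ℝ] Euc n :=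
  (fderiv ℝ (fun z : Euc n × Euc n => pm c z.1 z.2) w).comp
    (ContinuousLinearMap.inr ℝ (Euc n) (Euc n))

/-- derivative of `Yv` in `p` -/
noncomputable def Dy (c : Euc n → Euc n → ℝ) (U V : Set (Euc n)) (w : Euc n × Euc n) :
    Euc n →L[ℝ] Euc n :=
  (fderiv ℝ (Yv c U V) w).comp (ContinuousLinearMap.inr ℝ (Euc n) (Euc n))

/-- point on a `q_y`-segment -/
noncomputable def Xs (c : Euc n → Euc n → ℝ) (U V : Set (Euc n)) (y x0 x1 : Euc n) (s : ℝ) : Euc n :=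
  Xinv c U V (qm c x0 y + s • (qm c x1 y - qm c x0 y), y)

namespace Good
variable {c : Euc n → Euc n → ℝ} {U V : Set (Euc n)}

theorem Dp_apply (w : Euc n × Euc n) (ζ : Euc n) :
    Dp c w ζ = dd (0, ζ) (fun z : Euc n × Euc n => pm c z.1 z.2) w := by
  simp [Dp, dd]

theorem Dy_apply (w : Euc n × Euc n) (ζ : Euc n) :
    Dy c U V w ζ = dd (0, ζ) (Yv c U V) w := by
  simp [Dy, dd]

theorem Dp_cont (G : Good c U V) : ContinuousOn (Dp c) (U ×ˢ V) := by
  unfold Dp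
  exact ((G.pm_smooth.fderiv_of_isOpen (m := 2) G.oUV (by norm_num)).clm_comp
    contDiffOn_const).continuousOn

theorem Dy_cont (G : Good c U V) : ContinuousOn (Dy c U V) (DP c U V) := by
  unfold Dy
  exact ((G.Yv_smooth.fderiv_of_isOpen (m := 2) G.oDP (by norm_num)).clm_comp
    contDiffOn_const).continuousOn

theorem Dy_Dp (G : Good c U V) {a p : Euc n} (h : (a, p) ∈ DP c U V) (ζ : Euc n) :
    Dy c U V (a, p) (Dp c (a, Yv c U V (a, p)) ζ) = ζ := by
  rw [Dy_apply, Dp_apply, G.Yv_d_surj h]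

theorem xi_inner (G : Good c U V) {a x p : Euc n} (h : (a, x, p) ∈ DF c U V) (w : Euc n) :
    inner ℝ (xi c U V (a, x, p)) w =
      inner ℝ (qm c x (Yv c U V (a, p)) - qm c a (Yv c U V (a, p))) (Dy c U V (a, p) w) := by
  rw [inner_xi, G.Phi_d1 h, Dy_apply]

theorem xi_adj (G : Good c U V) {a x p : Euc n} (h : (a, x, p) ∈ DF c U V) :
    xi c U V (a, x, p) = ContinuousLinearMap.adjoint (Dy c U V (a, p))
      (qm c x (Yv c U V (a, p)) - qm c a (Yv c U V (a, p))) := by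
  refine ext_inner_right ℝ fun w => ?_
  rw [G.xi_inner h, ContinuousLinearMap.adjoint_inner_left]

theorem adj_xi (G : Good c U V) {a x p : Euc n} (h : (a, x, p) ∈ DF c U V) :
    ContinuousLinearMap.adjoint (Dp c (a, Yv c U V (a, p))) (xi c U V (a, x, p)) =
      qm c x (Yv c U V (a, p)) - qm c a (Yv c U V (a, p)) := by
  refine ext_inner_right ℝ fun w => ?_
  rw [ContinuousLinearMap.adjoint_inner_left, G.xi_inner h, G.Dy_Dp h.2]

theorem Xs_mem (G : Good c U V) {y x0 x1 : Euc n} (hy : y ∈ V) (h0 : x0 ∈ U) (h1 : x1 ∈ U) {s : ℝ}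
    (hs : s ∈ Icc (0:ℝ) 1) : Xs c U V y x0 x1 s ∈ U :=
  G.Xinv_mem (G.DX_seg (PreGood.jm_mem h0 hy) (PreGood.jm_mem h1 hy) hs)

theorem qm_Xs (G : Good c U V) {y x0 x1 : Euc n} (hy : y ∈ V) (h0 : x0 ∈ U) (h1 : x1 ∈ U) {s : ℝ}
    (hs : s ∈ Icc (0:ℝ) 1) :
    qm c (Xs c U V y x0 x1 s) y = qm c x0 y + s • (qm c x1 y - qm c x0 y) :=
  G.qm_Xinv (G.DX_seg (PreGood.jm_mem h0 hy) (PreGood.jm_mem h1 hy) hs)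

theorem xi_Xs (G : Good c U V) {a p x0 x1 : Euc n} (h : (a, p) ∈ DP c U V)
    (h0 : x0 ∈ U) (h1 : x1 ∈ U) {s : ℝ} (hs : s ∈ Icc (0:ℝ) 1) :
    xi c U V (a, Xs c U V (Yv c U V (a, p)) x0 x1 s, p) =
      xi c U V (a, x0, p) + s • (xi c U V (a, x1, p) - xi c U V (a, x0, p)) := by
  have hy := G.Yv_mem h
  rw [G.xi_adj (a := a) (p := p) (x := Xs c U V (Yv c U V (a, p)) x0 x1 s)
      ⟨G.Xs_mem hy h0 h1 hs, h⟩, G.xi_adj (a := a) (p := p) (x := x0) ⟨h0, h⟩,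
    G.xi_adj (a := a) (p := p) (x := x1) ⟨h1, h⟩, G.qm_Xs hy h0 h1 hs,
    ← map_sub, ← map_smul, ← map_add]
  congr 1
  module

theorem xi_inj (G : Good c U V) {a p x0 x1 : Euc n} (h : (a, p) ∈ DP c U V)
    (h0 : x0 ∈ U) (h1 : x1 ∈ U) (he : xi c U V (a, x0, p) = xi c U V (a, x1, p)) : x0 = x1 := by
  have e0 := G.adj_xi (a := a) (p := p) (x := x0) ⟨h0, h⟩
  have e1 := G.adj_xi (a := a) (p := p) (x := x1) ⟨h1, h⟩
  rw [he, e1] at e0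
  exact G.injq _ (G.Yv_mem h) h0 h1 (sub_left_injective e0).symm

theorem xi_self (G : Good c U V) {a p : Euc n} (h : (a, p) ∈ DP c U V) :
    xi c U V (a, a, p) = 0 := by
  rw [G.xi_adj ⟨(mem_DP.1 h).1, h⟩, sub_self, map_zero]

theorem Phi_apply (a x p : Euc n) : Phi c U V (a, x, p) =
    - c x (Yv c U V (a, p)) + c a (Yv c U V (a, p)) := by
  unfold Phi; rfl

theorem dual_quasi (G : Good c U V) {y0 y x0 x1 : Euc n} (hy0 : y0 ∈ V) (hy : y ∈ V)
    (h0 : x0 ∈ U) (h1 : x1 ∈ U) {s : ℝ} (hs : s ∈ Icc (0:ℝ) 1) :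
    - c (Xs c U V y0 x0 x1 s) y + c (Xs c U V y0 x0 x1 s) y0 ≤
      max (- c x0 y + c x0 y0) (- c x1 y + c x1 y0) := by
  have e : ∀ x, pm (fun y x => c x y) y0 x = qm c x y0 := by intro x; unfold pm qm; rfl
  have eY : ∀ q, Yv (fun y x => c x y) V U (y0, q) = Xinv c U V (q, y0) := by
    intro q; unfold Yv; rfl
  have := G.swap.quasi (a := y0) (x := y) (p := qm c x0 y0) (p' := qm c x1 y0) hy
    (by rw [← e]; exact pm_mem_DP hy0 h0) (by rw [← e]; exact pm_mem_DP hy0 h1) hs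
  rw [Phi_apply, Phi_apply, Phi_apply, eY, eY, eY, G.Xinv_qm h0 hy0, G.Xinv_qm h1 hy0] at this
  exact this

/-- convexity of `ξ_p`-images -/
theorem xi_convex (G : Good c U V) {a p : Euc n} (h : (a, p) ∈ DP c U V) {P : Set (Euc n)}
    (hP : P ⊆ U) (hs : ∀ x0 ∈ P, ∀ x1 ∈ P, ∀ s ∈ Icc (0:ℝ) 1, Xs c U V (Yv c U V (a, p)) x0 x1 s ∈ P) :
    Convex ℝ ((fun x => xi c U V (a, x, p)) '' P) := by
  rw [convex_iff_add_mem]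
  rintro _ ⟨x0, h0, rfl⟩ _ ⟨x1, h1, rfl⟩ α β hα hβ hab
  have hβ1 : β ∈ Icc (0:ℝ) 1 := ⟨hβ, by linarith⟩
  refine ⟨_, hs x0 h0 x1 h1 β hβ1, ?_⟩
  dsimp only
  rw [G.xi_Xs h (hP h0) (hP h1) hβ1]
  have : α = 1 - β := by linarith
  subst this
  module

end Good

/-- potentials together with everything we know about contact sets -/
structure Setup (c : Euc n → Euc n → ℝ) (U V : Set (Euc n)) (u v : Euc n → ℝ) (O : Set (Euc n))
    (lam Lam : ℝ) : Prop where
  G : Good c U V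
  bU : IsBounded U
  bV : IsBounded V
  cont : ContinuousOn (Function.uncurry c) (closure U ×ˢ closure V)
  cu : ContinuousOn u (closure U)
  cv : ContinuousOn v (closure V)
  ge : ∀ x ∈ closure U, ∀ y ∈ closure V, 0 ≤ u x + v y + c x y
  exy : ∀ x ∈ closure U, ∃ y ∈ closure V, u x + v y + c x y = 0
  eyx : ∀ y ∈ closure V, ∃ x ∈ closure U, u x + v y + c x y = 0
  oO : IsOpen O
  sO : O ⊆ U
  inV : ∀ x ∈ O, ∀ y ∈ closure V, u x + v y + c x y = 0 → y ∈ V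
  inU : ∀ y ∈ V, ∀ x ∈ closure U, u x + v y + c x y = 0 → x ∈ U
  hlam : 0 < lam
  hLam : 0 < Lam
  vge : ∀ X ⊆ O, MeasurableSet X → ENNReal.ofReal lam * volume X ≤
    volume {y | y ∈ closure V ∧ ∃ x ∈ X, u x + v y + c x y = 0}
  vle : ∀ Y ⊆ V, IsCompact Y → volume Y ≤
    ENNReal.ofReal Lam * volume {x | x ∈ closure U ∧ ∃ y ∈ Y, u x + v y + c x y = 0}

namespace Setup
variable {c : Euc n → Euc n → ℝ} {U V O : Set (Euc n)} {u v : Euc n → ℝ} {lam Lam : ℝ}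

theorem cU (S : Setup c U V u v O lam Lam) : IsCompact (closure U) := S.bU.isCompact_closure
theorem cV (S : Setup c U V u v O lam Lam) : IsCompact (closure V) := S.bV.isCompact_closure

/-- sublevel sets of `v + c(a,·)` are `p_a`-convex -/
theorem sub_conv (S : Setup c U V u v O lam Lam) {a p p' : Euc n} (hp : (a, p) ∈ DP c U V)
    (hp' : (a, p') ∈ DP c U V) {t : ℝ} (ht : t ∈ Icc (0:ℝ) 1) :
    v (Yv c U V (a, p + t • (p' - p))) + c a (Yv c U V (a, p + t • (p' - p))) ≤
      max (v (Yv c U V (a, p)) + c a (Yv c U V (a, p)))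
        (v (Yv c U V (a, p')) + c a (Yv c U V (a, p'))) := by
  have hm := S.G.DP_seg hp hp' ht
  obtain ⟨x, hx, hc⟩ := S.eyx _ (subset_closure (S.G.Yv_mem hm))
  have hxU := S.inU _ (S.G.Yv_mem hm) x hx hc
  have hq := S.G.quasi hxU hp hp' ht
  rw [Good.Phi_apply, Good.Phi_apply, Good.Phi_apply] at hq
  have g0 := S.ge x hx _ (subset_closure (S.G.Yv_mem hp))
  have g1 := S.ge x hx _ (subset_closure (S.G.Yv_mem hp'))
  rcases le_max_iff.1 hq with h | h
  · exact le_max_of_le_left (by linarith)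
  · exact le_max_of_le_right (by linarith)

theorem dual_quasi' (S : Setup c U V u v O lam Lam) {y0 y x0 x1 : Euc n} (hy0 : y0 ∈ V)
    (hy : y ∈ closure V) (h0 : x0 ∈ U) (h1 : x1 ∈ U) {s : ℝ} (hs : s ∈ Icc (0:ℝ) 1) :
    - c (Xs c U V y0 x0 x1 s) y + c (Xs c U V y0 x0 x1 s) y0 ≤
      max (- c x0 y + c x0 y0) (- c x1 y + c x1 y0) := by
  have hcy : ∀ x ∈ U, ContinuousOn (fun y => c x y) (closure V) := fun x hx =>
    S.cont.comp (f := fun y => (x, y)) (by fun_prop) (fun y hy => ⟨subset_closure hx, hy⟩)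
  refine ContinuousWithinAt.closure_le hy (f := fun y => - c (Xs c U V y0 x0 x1 s) y +
    c (Xs c U V y0 x0 x1 s) y0) (g := fun y => max (- c x0 y + c x0 y0) (- c x1 y + c x1 y0)) ?_ ?_ ?_
  · exact ((((hcy _ (S.G.Xs_mem hy0 h0 h1 hs)).neg).add continuousOn_const) y hy).mono subset_closure
  · exact (((hcy _ h0).neg.add continuousOn_const).sup ((hcy _ h1).neg.add continuousOn_const)
      y hy).mono subset_closure
  · intro z hz
    exact S.G.dual_quasi hy0 hz h0 h1 hs

/-- contact sets of `y` are `q_y`-convex -/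
theorem contact_Xs (S : Setup c U V u v O lam Lam) {y0 x0 x1 : Euc n} (hy0 : y0 ∈ V)
    (h0 : x0 ∈ U) (h1 : x1 ∈ U) (k0 : u x0 + v y0 + c x0 y0 = 0) (k1 : u x1 + v y0 + c x1 y0 = 0)
    {s : ℝ} (hs : s ∈ Icc (0:ℝ) 1) :
    u (Xs c U V y0 x0 x1 s) + v y0 + c (Xs c U V y0 x0 x1 s) y0 = 0 := by
  have hm := S.G.Xs_mem hy0 h0 h1 hs
  refine le_antisymm ?_ (S.ge _ (subset_closure hm) _ (subset_closure hy0))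
  obtain ⟨y, hy, hc⟩ := S.exy _ (subset_closure hm)
  have hq := S.dual_quasi' hy0 hy h0 h1 hs
  have g0 := S.ge x0 (subset_closure h0) y hy
  have g1 := S.ge x1 (subset_closure h1) y hy
  rcases le_max_iff.1 hq with h | h <;> linarith

/-- the contact set of a compact set of `y`s is compact -/
theorem contact_compact (S : Setup c U V u v O lam Lam) {Y : Set (Euc n)} (hY : IsCompact Y)
    (hYV : Y ⊆ closure V) :
    IsCompact {z : Euc n × Euc n | z.1 ∈ closure U ∧ z.2 ∈ Y ∧ u z.1 + v z.2 + c z.1 z.2 = 0} := by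
  have hK := S.cU.prod hY
  have hc : ContinuousOn (fun z : Euc n × Euc n => u z.1 + v z.2 + c z.1 z.2) (closure U ×ˢ Y) := by
    refine ((S.cu.comp continuousOn_fst (fun z hz => hz.1)).add
      (S.cv.comp continuousOn_snd (fun z hz => hYV hz.2))).add ?_
    exact S.cont.mono (prod_mono le_rfl hYV)
  have h := hc.preimage_isClosed_of_isClosed hK.isClosed (isClosed_singleton (x := (0:ℝ)))
  have e : {z : Euc n × Euc n | z.1 ∈ closure U ∧ z.2 ∈ Y ∧ u z.1 + v z.2 + c z.1 z.2 = 0} =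
      (closure U ×ˢ Y) ∩ (fun z : Euc n × Euc n => u z.1 + v z.2 + c z.1 z.2) ⁻¹' {0} := by
    ext z
    constructor
    · rintro ⟨h1, h2, h3⟩; exact ⟨⟨h1, h2⟩, h3⟩
    · rintro ⟨⟨h1, h2⟩, h3⟩; exact ⟨h1, h2, h3⟩
  rw [e]
  exact hK.of_isClosed_subset h inter_subset_left
end Setup
end FKM

end


section
open Set MeasureTheory Metric Bornology Filter Topology
open scoped ENNReal NNReal Pointwise

namespace FKM
variable {n : ℕ}

theorem vol_image_le (n : ℕ) (R : ℝ) : ∃ C : ℝ, 0 < C ∧ ∀ (f : Euc n → Euc n)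
    (f' : Euc n → Euc n →L[ℝ] Euc n) (s : Set (Euc n)), MeasurableSet s →
    (∀ x ∈ s, HasFDerivWithinAt f (f' x) s x) → (∀ x ∈ s, ‖f' x‖ ≤ R) →
    volume (f '' s) ≤ ENNReal.ofReal C * volume s := by
  have hc : ContinuousOn (fun T : Euc n →L[ℝ] Euc n => |T.det|) (closedBall 0 R) :=
    (continuous_abs.comp ContinuousLinearMap.continuous_det).continuousOn
  obtain ⟨C, hC⟩ := (isCompact_closedBall (0 : Euc n →L[ℝ] Euc n) R).bddAbove_image hc
  refine ⟨max C 1, by positivity, fun f f' s hs hf hb => ?_⟩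
  refine (addHaar_image_le_lintegral_abs_det_fderiv volume hs hf).trans ?_
  calc ∫⁻ x in s, ENNReal.ofReal |(f' x).det| ≤ ∫⁻ x in s, ENNReal.ofReal (max C 1) := by
        refine setLIntegral_mono measurable_const fun x hx => ENNReal.ofReal_le_ofReal ?_
        refine le_max_of_le_left (hC ⟨f' x, ?_, rfl⟩)
        simpa using hb x hx
    _ = _ := by simp

/-- the linear map sending the orthonormal basis `b` to `w` -/
noncomputable def wmap (b : OrthonormalBasis (Fin n) ℝ (Euc n)) (w : Fin n → Euc n) :
    Euc n →ₗ[ℝ] Euc n := b.toBasis.constr ℝ w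

theorem wmap_apply (b : OrthonormalBasis (Fin n) ℝ (Euc n)) (w : Fin n → Euc n) (x : Euc n) :
    wmap b w x = ∑ i, (inner ℝ (b i) x) • w i := by
  simp [wmap, Module.Basis.constr_apply_fintype, b.repr_apply_apply]

theorem wmap_b (b : OrthonormalBasis (Fin n) ℝ (Euc n)) (w : Fin n → Euc n) (i : Fin n) :
    wmap b w (b i) = w i := by
  have := b.toBasis.constr_basis ℝ w i
  simpa [wmap] using this

theorem det_wmap (b : OrthonormalBasis (Fin n) ℝ (Euc n)) (w : Fin n → Euc n)
    (h : ∀ i j, i < j → inner ℝ (b j) (w i) = 0) :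
    LinearMap.det (wmap b w) = ∏ i, inner ℝ (b i) (w i) := by
  rw [← LinearMap.det_toMatrix b.toBasis, Matrix.det_of_isUpperTriangular]
  · refine Finset.prod_congr rfl fun i _ => ?_
    rw [LinearMap.toMatrix_apply]
    simp [wmap_b, b.repr_apply_apply]
  · intro i j hij
    rw [LinearMap.toMatrix_apply]
    simp only [OrthonormalBasis.coe_toBasis, wmap_b, OrthonormalBasis.coe_toBasis_repr_apply,
      b.repr_apply_apply]
    exact h j i hij

theorem vol_box (b : OrthonormalBasis (Fin n) ℝ (Euc n)) (l r : Fin n → ℝ) :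
    volume {x : Euc n | ∀ i, inner ℝ (b i) x ∈ Icc (l i) (r i)} = ∏ i, ENNReal.ofReal (r i - l i) := by
  have h1 := (PiLp.volume_preserving_ofLp (Fin n)).comp b.measurePreserving_repr
  have hm : MeasurableSet (Icc l r) := measurableSet_Icc
  have := h1.measure_preimage hm.nullMeasurableSet
  rw [Real.volume_Icc_pi] at this
  rw [← this]
  congr 1
  ext x
  simp only [mem_setOf_eq, mem_preimage, Function.comp, mem_Icc, Pi.le_def, b.repr_apply_apply]
  exact ⟨fun h => ⟨fun i => (h i).1, fun i => (h i).2⟩, fun h i => ⟨h.1 i, h.2 i⟩⟩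

theorem vol_cube (b : OrthonormalBasis (Fin n) ℝ (Euc n)) (l r : ℝ) (h : l ≤ r):
    volume {x : Euc n | ∀ i, inner ℝ (b i) x ∈ Icc l r} = ENNReal.ofReal ((r - l) ^ n) := by
  rw [vol_box b (fun _ => l) (fun _ => r)]
  simp [ENNReal.ofReal_pow (sub_nonneg.2 h)]

theorem cube_compact (b : OrthonormalBasis (Fin n) ℝ (Euc n)) (l r : ℝ) :
    IsCompact {x : Euc n | ∀ i, inner ℝ (b i) x ∈ Icc l r} := by
  have h2 : IsCompact (Icc (fun _ : Fin n => l) (fun _ => r)) := isCompact_Icc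
  have h3 := h2.image (f := fun y : Fin n → ℝ => b.repr.symm (WithLp.toLp 2 y)) (by fun_prop)
  convert h3 using 1
  ext x
  simp only [mem_setOf_eq, mem_image, mem_Icc, Pi.le_def]
  constructor
  · intro h
    refine ⟨WithLp.ofLp (b.repr x), ⟨fun i => ?_, fun i => ?_⟩, by simp⟩
    · rw [b.repr_apply_apply]; exact (h i).1
    · rw [b.repr_apply_apply]; exact (h i).2
  · rintro ⟨y, ⟨h1, h2⟩, rfl⟩ i
    have : inner ℝ (b i) (b.repr.symm (WithLp.toLp 2 y)) = y i := by
      rw [← b.repr_apply_apply]; simp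
    rw [this]; exact ⟨h1 i, h2 i⟩

theorem vol_wmap (b : OrthonormalBasis (Fin n) ℝ (Euc n)) (w : Fin n → Euc n) (l r : ℝ) (h : l ≤ r) :
    volume (wmap b w '' {x : Euc n | ∀ i, inner ℝ (b i) x ∈ Icc l r}) =
      ENNReal.ofReal (|LinearMap.det (wmap b w)| * (r - l) ^ n) := by
  rw [Measure.addHaar_image_linearMap, vol_cube b l r h, ENNReal.ofReal_mul (abs_nonneg _)]

theorem vol_dual (b : OrthonormalBasis (Fin n) ℝ (Euc n)) (w : Fin n → Euc n) (t : ℝ) (ht : 0 ≤ t)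
    (hd : LinearMap.det (wmap b w) ≠ 0) :
    volume {x : Euc n | ∀ i, |inner ℝ (w i) x| ≤ t} =
      ENNReal.ofReal (|LinearMap.det (wmap b w)|⁻¹ * (2 * t) ^ n) := by
  have hdet : LinearMap.det (LinearMap.adjoint (wmap b w)) = LinearMap.det (wmap b w) := by
    rw [← LinearMap.det_toMatrix b.toBasis, LinearMap.toMatrix_adjoint b b, Matrix.det_conjTranspose,
      LinearMap.det_toMatrix]
    simp
  have := Measure.addHaar_preimage_linearMap (volume : Measure (Euc n)) (hdet.symm ▸ hd)
    {x : Euc n | ∀ i, inner ℝ (b i) x ∈ Icc (-t) t}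
  rw [vol_cube b _ _ (by linarith), hdet, ← ENNReal.ofReal_mul (abs_nonneg _), abs_inv] at this
  convert this using 2
  · ext x
    simp only [mem_setOf_eq, mem_preimage, LinearMap.adjoint_inner_right, wmap_b, abs_le, mem_Icc]
  · ring_nf

theorem det_near (n : ℕ) : ∃ ε : ℝ, 0 < ε ∧ ∀ (b : OrthonormalBasis (Fin n) ℝ (Euc n))
    (z : Fin n → Euc n) (t : Fin n → ℝ), (∀ i, 0 < t i) → (∀ i, ‖z i - t i • b i‖ ≤ ε * t i) →
    (1/2) * ∏ i, t i ≤ |LinearMap.det (wmap b z)| := by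
  have hc : ContinuousAt (fun T : Euc n →L[ℝ] Euc n => |T.det|) 1 :=
    (continuous_abs.comp ContinuousLinearMap.continuous_det).continuousAt
  have h1 : (1/2 : ℝ) < |(1 : Euc n →L[ℝ] Euc n).det| := by
    have : (1 : Euc n →L[ℝ] Euc n).det = 1 := by simp [ContinuousLinearMap.det]
    rw [this]; norm_num
  obtain ⟨δ, hδ, hδ'⟩ := Metric.eventually_nhds_iff.1 (hc.eventually (lt_mem_nhds h1))
  refine ⟨δ / (2 * (n + 1)), by positivity, fun b z t ht hz => ?_⟩
  -- normalised map
  set A : Euc n →ₗ[ℝ] Euc n := wmap b (fun i => (t i)⁻¹ • z i) with hA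
  have hcomp : wmap b z = A ∘ₗ wmap b (fun i => t i • b i) := by
    refine b.toBasis.ext fun i => ?_
    simp only [OrthonormalBasis.coe_toBasis, LinearMap.comp_apply, wmap_b, map_smul, hA]
    rw [smul_smul, mul_inv_cancel₀ (ht i).ne', one_smul]
  have hdt : LinearMap.det (wmap b (fun i => t i • b i)) = ∏ i, t i := by
    rw [det_wmap]
    · refine Finset.prod_congr rfl fun i _ => ?_
      simp [inner_smul_right]
    · intro i j hij
      simp [inner_smul_right, b.inner_eq_ite, hij.ne']
  have hAn : ‖LinearMap.toContinuousLinearMap A - 1‖ ≤ δ / 2 := by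
    refine ContinuousLinearMap.opNorm_le_bound _ (by positivity) fun x => ?_
    have e : (LinearMap.toContinuousLinearMap A - 1) x =
        ∑ i, (inner ℝ (b i) x) • ((t i)⁻¹ • (z i - t i • b i)) := by
      simp only [ContinuousLinearMap.sub_apply, LinearMap.coe_toContinuousLinearMap',
        ContinuousLinearMap.one_apply, hA, wmap_apply]
      have hx : x = ∑ i, (inner ℝ (b i) x : ℝ) • b i := (b.sum_repr' x).symm
      conv_lhs => rhs; rw [hx]
      rw [← Finset.sum_sub_distrib]
      refine Finset.sum_congr rfl fun i _ => ?_
      rw [← smul_sub, smul_sub ((t i)⁻¹), smul_smul (t i)⁻¹ (t i), inv_mul_cancel₀ (ht i).ne',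
        one_smul]
    rw [e]
    refine (norm_sum_le _ _).trans ?_
    calc ∑ i, ‖(inner ℝ (b i) x) • ((t i)⁻¹ • (z i - t i • b i))‖
        ≤ ∑ i : Fin n, ‖x‖ * (δ / (2 * (n + 1))) := by
          refine Finset.sum_le_sum fun i _ => ?_
          rw [norm_smul, norm_smul]
          have e1 : ‖(inner ℝ (b i) x : ℝ)‖ ≤ ‖x‖ := by
            have := norm_inner_le_norm (𝕜 := ℝ) (b i) x
            rwa [b.norm_eq_one, one_mul] at this
          have e2 : ‖(t i)⁻¹‖ * ‖z i - t i • b i‖ ≤ δ / (2 * (n + 1)) := by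
            rw [norm_inv, Real.norm_of_nonneg (ht i).le, inv_mul_le_iff₀ (ht i), mul_comm]
            exact hz i
          exact mul_le_mul e1 e2 (by positivity) (norm_nonneg _)
      _ = (n / (n + 1)) * (δ / 2 * ‖x‖) := by
          simp only [Finset.sum_const, Finset.card_univ, Fintype.card_fin, nsmul_eq_mul]
          field_simp
      _ ≤ 1 * (δ / 2 * ‖x‖) := by
          refine mul_le_mul_of_nonneg_right ?_ (by positivity)
          rw [div_le_one (by positivity)]; linarith
      _ = _ := one_mul _
  have hd := hδ' (y := LinearMap.toContinuousLinearMap A) (by rw [dist_eq_norm]; linarith)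
  have hd2 : (1/2:ℝ) < |LinearMap.det A| := by simpa using hd
  rw [hcomp, LinearMap.det_comp, hdt, abs_mul, abs_of_pos (Finset.prod_pos fun i _ => ht i)]
  exact mul_le_mul_of_nonneg_right hd2.le (Finset.prod_pos fun i _ => ht i).le

theorem greedy_step (k : ℕ) (hk : k < n) (f : ℕ → Euc n) (K : Set (Euc n)) (hK : IsCompact K)
    {r : ℝ} (hr : 0 < r) (hrK : closedBall 0 r ⊆ K) :
    ∃ g w : Euc n, ‖g‖ = 1 ∧ (∀ i < k, inner ℝ (f i) g = 0) ∧ w ∈ K ∧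
      (∀ p ∈ K, |inner ℝ g p| ≤ inner ℝ g w) ∧
      ∀ h, (∀ i < k, inner ℝ (f i) h = 0) → inner ℝ g h = 0 → inner ℝ w h = 0 := by
  let S : Submodule ℝ (Euc n) := Submodule.span ℝ (f '' Iio k)
  have hS : ∀ h, h ∈ Sᗮ ↔ ∀ i < k, inner ℝ (f i) h = 0 := by
    intro h
    constructor
    · intro hh i hi
      exact (Submodule.mem_orthogonal _ _).1 hh _ (Submodule.subset_span ⟨i, hi, rfl⟩)
    · intro hh
      have : S ≤ (Submodule.span ℝ {h})ᗮ := by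
        refine Submodule.span_le.2 ?_
        rintro _ ⟨i, hi, rfl⟩
        rw [SetLike.mem_coe, Submodule.mem_orthogonal_singleton_iff_inner_left]
        exact hh i hi
      rw [Submodule.mem_orthogonal]
      intro s hs
      exact Submodule.mem_orthogonal_singleton_iff_inner_left.1 (this hs)
  let P : Euc n →L[ℝ] Euc n := Sᗮ.starProjection
  have hPin : ∀ p, P p ∈ Sᗮ := fun p => Submodule.starProjection_apply_mem _ _
  have hPid : ∀ p ∈ Sᗮ, P p = p := fun p hp => Submodule.starProjection_eq_self_iff.2 hp
  have hPs : ∀ p, ∀ h ∈ Sᗮ, inner ℝ (P p) h = inner ℝ p h := by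
    intro p h hh
    have := Submodule.inner_starProjection_left_eq_right Sᗮ p h
    rw [hPid h hh |> (show Sᗮ.starProjection h = h from ·)] at this
    exact this
  obtain ⟨w, hw, hmax⟩ := hK.exists_isMaxOn ⟨0, hrK (by simp [hr.le])⟩
    (f := fun p => ‖P p‖) (by fun_prop)
  -- the max is positive
  have hpos : 0 < ‖P w‖ := by
    have hne : Sᗮ ≠ ⊥ := by
      intro hbot
      have htop : S = ⊤ := (Submodule.orthogonal_eq_bot_iff).1 hbot
      have h1 : Module.finrank ℝ S ≤ k := by
        have := finrank_span_finset_le_card (R := ℝ) ((Finset.range k).image f)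
        have e : (((Finset.range k).image f : Finset (Euc n)) : Set (Euc n)) = f '' Iio k := by
          simp
        rw [Set.finrank, e] at this
        exact this.trans (Finset.card_image_le.trans (by simp))
      rw [htop, finrank_top, finrank_euclideanSpace_fin] at h1
      omega
    obtain ⟨e, he, he0⟩ := Submodule.exists_mem_ne_zero_of_ne_bot hne
    have hen : 0 < ‖e‖ := norm_pos_iff.2 he0
    have h2 : (r / ‖e‖) • e ∈ K := hrK (by
      rw [mem_closedBall_zero_iff, norm_smul, norm_div, norm_norm, div_mul_cancel₀ _ hen.ne',
        Real.norm_of_nonneg hr.le])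
    have h3 := hmax h2
    simp only [mem_setOf_eq, map_smul, hPid e he] at h3
    rw [norm_smul, norm_div, norm_norm, div_mul_cancel₀ _ hen.ne', Real.norm_of_nonneg hr.le] at h3
    linarith
  have hgS : ‖P w‖⁻¹ • P w ∈ Sᗮ := Sᗮ.smul_mem _ (hPin w)
  refine ⟨‖P w‖⁻¹ • P w, w, ?_, (hS _).1 hgS, hw, ?_, ?_⟩
  · rw [norm_smul, norm_inv, norm_norm, inv_mul_cancel₀ hpos.ne']
  · intro p hp
    have e1 : inner ℝ (‖P w‖⁻¹ • P w) w = ‖P w‖ := by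
      rw [real_inner_comm, ← hPs _ _ hgS, inner_smul_right, real_inner_self_eq_norm_sq]
      field_simp
    have e2 : inner ℝ (‖P w‖⁻¹ • P w) p = inner ℝ (‖P w‖⁻¹ • P w) (P p) := by
      rw [real_inner_comm, ← hPs _ _ hgS, real_inner_comm]
    rw [e1, e2]
    refine (abs_real_inner_le_norm _ _).trans ?_
    rw [norm_smul, norm_inv, norm_norm, inv_mul_cancel₀ hpos.ne', one_mul]
    exact hmax hp
  · intro h hh hg
    have hhS := (hS h).2 hh
    rw [← hPs _ _ hhS]
    rw [inner_smul_left] at hg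
    simpa [hpos.ne'] using hg

theorem greedy (m : ℕ) (f0 : Euc (m+1)) (hf0 : ‖f0‖ = 1) (K : Set (Euc (m+1))) (hK : IsCompact K)
    {r : ℝ} (hr : 0 < r) (hrK : closedBall 0 r ⊆ K) :
    ∃ (b : OrthonormalBasis (Fin (m+1)) ℝ (Euc (m+1))) (w : Fin (m+1) → Euc (m+1)), b 0 = f0 ∧
      ∀ i, i ≠ 0 → w i ∈ K ∧ (∀ p ∈ K, |inner ℝ (b i) p| ≤ inner ℝ (b i) (w i)) ∧
        ∀ j, i < j → inner ℝ (b j) (w i) = 0 := by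
  have key : ∀ k, k ≤ m → ∃ f w : ℕ → Euc (m+1), f 0 = f0 ∧
      (∀ i ≤ k, ‖f i‖ = 1) ∧ (∀ i ≤ k, ∀ j < i, inner ℝ (f j) (f i) = 0) ∧
      ∀ i, 1 ≤ i → i ≤ k → w i ∈ K ∧ (∀ p ∈ K, |inner ℝ (f i) p| ≤ inner ℝ (f i) (w i)) ∧
        ∀ h, (∀ j ≤ i, inner ℝ (f j) h = 0) → inner ℝ (w i) h = 0 := by
    intro k
    induction k with
    | zero =>
      intro _
      refine ⟨fun _ => f0, fun _ => 0, rfl, fun i _ => hf0, ?_, ?_⟩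
      · intro i hi j hj; omega
      · intro i h1 h2; omega
    | succ k ih =>
      intro hk
      obtain ⟨f, w, h0, h1, h2, h3⟩ := ih (by omega)
      obtain ⟨g, z, hg1, hg2, hz, hz2, hz3⟩ := greedy_step (k+1) (by omega) f K hK hr hrK
      refine ⟨Function.update f (k+1) g, Function.update w (k+1) z, ?_, ?_, ?_, ?_⟩
      · rw [Function.update_of_ne (by omega)]; exact h0
      · intro i hi
        rcases Nat.lt_or_ge k i with h | h
        · obtain rfl : i = k+1 := by omega
          simpa using hg1
        · rw [Function.update_of_ne (by omega)]; exact h1 i h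
      · intro i hi j hj
        rw [Function.update_of_ne (by omega) _ f]
        rcases Nat.lt_or_ge k i with h | h
        · obtain rfl : i = k+1 := by omega
          simpa using hg2 j hj
        · rw [Function.update_of_ne (by omega)]; exact h2 i h j hj
      · intro i hi1 hi2
        rcases Nat.lt_or_ge k i with h | h
        · obtain rfl : i = k+1 := by omega
          simp only [Function.update_self]
          refine ⟨hz, hz2, fun h hh => hz3 h (fun j hj => ?_) ?_⟩
          · have := hh j (by omega)
            rwa [Function.update_of_ne (by omega)] at this
          · simpa using hh (k+1) le_rfl
        · rw [Function.update_of_ne (by omega), Function.update_of_ne (by omega)]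
          refine ⟨(h3 i hi1 h).1, (h3 i hi1 h).2.1, fun g' hg' => (h3 i hi1 h).2.2 g' fun j hj => ?_⟩
          have := hg' j hj
          rwa [Function.update_of_ne (by omega)] at this
  obtain ⟨f, w, h0, h1, h2, h3⟩ := key m le_rfl
  have hon : Orthonormal ℝ (fun i : Fin (m+1) => f i) := by
    refine ⟨fun i => h1 i (by omega), fun i j hij => ?_⟩
    rcases lt_or_gt_of_ne hij with h | h
    · exact h2 j (by omega) i h
    · rw [real_inner_comm]; exact h2 i (by omega) j h
  have hon' : Orthonormal ℝ ((univ : Set (Fin (m+1))).domRestrict (fun i : Fin (m+1) => f i)) :=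
    hon.comp _ Subtype.val_injective
  obtain ⟨b, hb⟩ := hon'.exists_orthonormalBasis_extension_of_card_eq (by simp)
  refine ⟨b, fun i => w i, by rw [hb 0 trivial]; exact h0, fun i hi => ?_⟩
  have hi' : 1 ≤ (i : ℕ) := by
    have : (i:ℕ) ≠ 0 := fun h => hi (Fin.ext h)
    omega
  obtain ⟨e1, e2, e3⟩ := h3 i hi' (by omega)
  refine ⟨e1, by rw [hb i trivial]; exact e2, fun j hij => ?_⟩
  rw [real_inner_comm]
  refine e3 _ fun l hl => ?_
  rw [hb j trivial]
  exact h2 j (by omega) l (by have : (i:ℕ) < j := hij; omega)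

end FKM

end


section
open Set MeasureTheory Metric Bornology Filter Topology
open scoped ENNReal NNReal Pointwise

namespace FKM
variable {n : ℕ}
attribute [local irreducible] qm pm Yv Xinv Phi

namespace Good
variable {c : Euc n → Euc n → ℝ} {U V : Set (Euc n)}

theorem Yv_hasFDeriv (G : Good c U V) {a p : Euc n} (h : (a, p) ∈ DP c U V) :
    HasFDerivAt (fun p => Yv c U V (a, p)) (Dy c U V (a, p)) p := by
  have h1 : HasFDerivAt (Yv c U V) (fderiv ℝ (Yv c U V) (a, p)) (a, p) :=
    ((G.Yv_smooth.contDiffAt (G.oDP.mem_nhds h)).differentiableAt (by norm_num)).hasFDerivAt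
  exact h1.comp p (hasFDerivAt_prodMk_right a p)

theorem pm_hasFDeriv (G : Good c U V) {a y : Euc n} (ha : a ∈ U) (hy : y ∈ V) :
    HasFDerivAt (fun y => pm c a y) (Dp c (a, y)) y := by
  have h1 : HasFDerivAt (fun z : Euc n × Euc n => pm c z.1 z.2)
      (fderiv ℝ (fun z : Euc n × Euc n => pm c z.1 z.2) (a, y)) (a, y) :=
    ((G.pm_smooth.contDiffAt (G.oUV.mem_nhds ⟨ha, hy⟩)).differentiableAt (by norm_num)).hasFDerivAt
  exact h1.comp y (hasFDerivAt_prodMk_right a y)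

theorem qm_hasFDeriv (G : Good c U V) {x y : Euc n} (hx : x ∈ U) (hy : y ∈ V) :
    HasFDerivAt (fun x => qm c x y)
      ((fderiv ℝ (fun z : Euc n × Euc n => qm c z.1 z.2) (x, y)).comp
        (ContinuousLinearMap.inl ℝ (Euc n) (Euc n))) x := by
  have h1 : HasFDerivAt (fun z : Euc n × Euc n => qm c z.1 z.2)
      (fderiv ℝ (fun z : Euc n × Euc n => qm c z.1 z.2) (x, y)) (x, y) :=
    ((G.qm_smooth.contDiffAt (G.oUV.mem_nhds ⟨hx, hy⟩)).differentiableAt (by norm_num)).hasFDerivAt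
  exact h1.comp (f := fun x => (x, y)) x (hasFDerivAt_prodMk_left x y)

theorem Xinv_hasFDeriv (G : Good c U V) {x y : Euc n} (hx : x ∈ U) (hy : y ∈ V) :
    HasFDerivAt (fun q => Xinv c U V (q, y))
      ((fderiv ℝ (Xinv c U V) (qm c x y, y)).comp
        (ContinuousLinearMap.inl ℝ (Euc n) (Euc n))) (qm c x y) := by
  have h1 : HasFDerivAt (Xinv c U V) (fderiv ℝ (Xinv c U V) (qm c x y, y)) (qm c x y, y) :=
    ((G.Xinv_smooth.contDiffAt (G.oDX.mem_nhds (PreGood.jm_mem hx hy))).differentiableAt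
      (by norm_num)).hasFDerivAt
  exact h1.comp (f := fun q => (q, y)) (qm c x y) (hasFDerivAt_prodMk_left _ y)

theorem Yv_contOn (G : Good c U V) : ContinuousOn (fun z : Euc n × Euc n × Euc n => Yv c U V (z.1, z.2.2))
    (DF c U V) :=
  G.Yv_smooth.continuousOn.comp (f := fun z : Euc n × Euc n × Euc n => (z.1, z.2.2))
    (by fun_prop) (fun z hz => hz.2)

/-- uniform first order bounds on a compact set -/
theorem bounds1 (G : Good c U V) {K : Set (Euc n × Euc n × Euc n)} (hK : IsCompact K)
    (hs : K ⊆ DF c U V) : ∃ R : ℝ, 0 < R ∧ ∀ a x p, (a, x, p) ∈ K →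
      ‖Dy c U V (a, p)‖ ≤ R ∧ ‖Dp c (a, Yv c U V (a, p))‖ ≤ R ∧
      ‖((fderiv ℝ (Xinv c U V) (qm c x (Yv c U V (a, p)), Yv c U V (a, p))).comp
        (ContinuousLinearMap.inl ℝ (Euc n) (Euc n))).comp
          (ContinuousLinearMap.adjoint (Dp c (a, Yv c U V (a, p))))‖ ≤ R ∧
      ‖(ContinuousLinearMap.adjoint (Dy c U V (a, p))).comp
        ((fderiv ℝ (fun z : Euc n × Euc n => qm c z.1 z.2) (x, Yv c U V (a, p))).comp
        (ContinuousLinearMap.inl ℝ (Euc n) (Euc n)))‖ ≤ R ∧ ‖xi c U V (a, x, p)‖ ≤ R := by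
  have hY := G.Yv_contOn.mono hs
  have h1 : ContinuousOn (fun z : Euc n × Euc n × Euc n => Dy c U V (z.1, z.2.2)) K :=
    G.Dy_cont.comp (f := fun z : Euc n × Euc n × Euc n => (z.1, z.2.2))
    (by fun_prop) (fun z hz => (hs hz).2)
  have h2 : ContinuousOn (fun z : Euc n × Euc n × Euc n => Dp c (z.1, Yv c U V (z.1, z.2.2))) K :=
    G.Dp_cont.comp (f := fun z : Euc n × Euc n × Euc n => (z.1, Yv c U V (z.1, z.2.2)))
    (continuousOn_fst.prodMk hY) (fun z hz => ⟨(mem_DP.1 (hs hz).2).1, G.Yv_mem (hs hz).2⟩)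
  have hxy : ContinuousOn (fun z : Euc n × Euc n × Euc n => (z.2.1, Yv c U V (z.1, z.2.2))) K :=
    ContinuousOn.prodMk (by fun_prop) hY
  have hxm : MapsTo (fun z : Euc n × Euc n × Euc n => (z.2.1, Yv c U V (z.1, z.2.2))) K (U ×ˢ V) :=
    fun z hz => ⟨(hs hz).1, G.Yv_mem (hs hz).2⟩
  have hq : ContinuousOn (fun z : Euc n × Euc n × Euc n => qm c z.2.1 (Yv c U V (z.1, z.2.2))) K :=
    G.qm_smooth.continuousOn.comp hxy hxm
  have h3 : ContinuousOn (fun z : Euc n × Euc n × Euc n => fderiv ℝ (Xinv c U V)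
      (qm c z.2.1 (Yv c U V (z.1, z.2.2)), Yv c U V (z.1, z.2.2))) K :=
    (G.Xinv_smooth.continuousOn_fderiv_of_isOpen G.oDX (by norm_num)).comp (hq.prodMk hY)
      (fun z hz => PreGood.jm_mem (hs hz).1 (G.Yv_mem (hs hz).2))
  have h4 : ContinuousOn (fun z : Euc n × Euc n × Euc n =>
      fderiv ℝ (fun z : Euc n × Euc n => qm c z.1 z.2) (z.2.1, Yv c U V (z.1, z.2.2))) K :=
    (G.qm_smooth.continuousOn_fderiv_of_isOpen G.oUV (by norm_num)).comp hxy hxm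
  have hadj : Continuous (fun T : Euc n →L[ℝ] Euc n => ContinuousLinearMap.adjoint T) :=
    (ContinuousLinearMap.adjoint (𝕜 := ℝ) (E := Euc n) (F := Euc n)).continuous
  obtain ⟨R1, hR1⟩ := hK.exists_bound_of_continuousOn h1
  obtain ⟨R2, hR2⟩ := hK.exists_bound_of_continuousOn h2
  obtain ⟨R3, hR3⟩ := hK.exists_bound_of_continuousOn
    (((h3.clm_comp continuousOn_const).clm_comp (hadj.comp_continuousOn h2)) :
      ContinuousOn (fun z : Euc n × Euc n × Euc n => ((fderiv ℝ (Xinv c U V)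
      (qm c z.2.1 (Yv c U V (z.1, z.2.2)), Yv c U V (z.1, z.2.2))).comp
        (ContinuousLinearMap.inl ℝ (Euc n) (Euc n))).comp
          (ContinuousLinearMap.adjoint (Dp c (z.1, Yv c U V (z.1, z.2.2))))) K)
  obtain ⟨R4, hR4⟩ := hK.exists_bound_of_continuousOn
    (((hadj.comp_continuousOn h1).clm_comp (h4.clm_comp continuousOn_const)) :
      ContinuousOn (fun z : Euc n × Euc n × Euc n =>
        (ContinuousLinearMap.adjoint (Dy c U V (z.1, z.2.2))).comp
        ((fderiv ℝ (fun z : Euc n × Euc n => qm c z.1 z.2) (z.2.1, Yv c U V (z.1, z.2.2))).comp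
        (ContinuousLinearMap.inl ℝ (Euc n) (Euc n)))) K)
  obtain ⟨R5, hR5⟩ := hK.exists_bound_of_continuousOn (G.xi_cont.mono hs)
  refine ⟨max 1 (max R1 (max R2 (max R3 (max R4 R5)))), by positivity, fun a x p hz => ⟨?_, ?_, ?_, ?_, ?_⟩⟩
  · exact (hR1 _ hz).trans (by simp)
  · exact (hR2 _ hz).trans (by simp)
  · exact (hR3 _ hz).trans (by simp)
  · exact (hR4 _ hz).trans (by simp)
  · exact (hR5 _ hz).trans (by simp)

/-- Lipschitz dependence of `ξ` on the base point -/
theorem xi_lip (G : Good c U V) {K : Set (Euc n × Euc n × Euc n)} (hK : IsCompact K)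
    (hs : K ⊆ DF c U V) : ∃ R : ℝ, 0 < R ∧ ∀ a x p p', (∀ t ∈ Icc (0:ℝ) 1, (a, x, p + t • (p' - p)) ∈ K) →
      R * ‖p' - p‖ ≤ 1 / 2 → ‖xi c U V (a, x, p') - xi c U V (a, x, p)‖ ≤
        R * ‖p' - p‖ * ‖xi c U V (a, x, p)‖ := by
  obtain ⟨M, hM, hM1, hM2, hM3⟩ := G.bounds hK hs
  refine ⟨2 * (M * M * M), by positivity, fun a x p p' hseg hsm => ?_⟩
  have hcont : ContinuousOn (fun t : ℝ => ‖xi c U V (a, x, p + t • (p' - p))‖) (Icc 0 1) :=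
    (G.xi_cont.comp (f := fun t : ℝ => (a, x, p + t • (p' - p))) (by fun_prop)
      (fun t ht => hs (hseg t ht))).norm
  obtain ⟨t0, ht0, hmax⟩ := isCompact_Icc.exists_isMaxOn (nonempty_Icc.2 zero_le_one) hcont
  set m := ‖xi c U V (a, x, p + t0 • (p' - p))‖ with hm
  -- difference estimate
  have key : ∀ t ∈ Icc (0:ℝ) 1, ‖xi c U V (a, x, p + t • (p' - p)) - xi c U V (a, x, p)‖ ≤
      M * M * M * ‖p' - p‖ * m := by
    intro t ht
    set d := xi c U V (a, x, p + t • (p' - p)) - xi c U V (a, x, p) with hd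
    have hder : ∀ r ∈ Icc (0:ℝ) 1, HasDerivWithinAt
        (fun r : ℝ => dd (0, 0, d) (Phi c U V) (a, x, p + r • (p' - p)))
        (dd (0, 0, p' - p) (dd (0, 0, d) (Phi c U V)) (a, x, p + r • (p' - p))) (Icc 0 1) r := by
      intro r hr
      have d2 := dd_contDiffOn (m := 2) G.oDF (by norm_num) G.Phi_smooth (0, 0, d)
      have h1 : DifferentiableAt ℝ (dd (0, 0, d) (Phi c U V)) (a, x, p + r • (p' - p)) :=
        (d2.contDiffAt (G.oDF.mem_nhds (hs (hseg r hr)))).differentiableAt (by norm_num)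
      exact (h1.hasFDerivAt.comp_hasDerivAt r (line_deriv a x p (p' - p) r)).hasDerivWithinAt
    have hb : ∀ r ∈ Icc (0:ℝ) 1, ‖dd (0, 0, p' - p) (dd (0, 0, d) (Phi c U V))
        (a, x, p + r • (p' - p))‖ ≤ M * M * M * ‖p' - p‖ * m * ‖d‖ := by
      intro r hr
      have e1 := G.hess_bound hs hM hM1 hM2 (hseg r hr) (p' - p) d
      have e2' := hM3 _ (hseg r hr)
      dsimp only at e2'
      have e2 := G.e_le_xi hM (hs (hseg r hr)) e2'
      have e3 : ‖xi c U V (a, x, p + r • (p' - p))‖ ≤ m := hmax hr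
      rw [Real.norm_eq_abs]
      refine e1.trans ?_
      calc _ ≤ M * M * (M * m) * ‖p' - p‖ * ‖d‖ := by gcongr; exact e2.trans (by gcongr)
        _ = _ := by ring
    have hmv := (convex_Icc (0:ℝ) 1).norm_image_sub_le_of_norm_hasDerivWithin_le hder hb
      (left_mem_Icc.2 zero_le_one) ht
    rw [← inner_xi, ← inner_xi, ← inner_sub_left] at hmv
    rw [zero_smul, add_zero, ← hd, real_inner_self_eq_norm_sq, sub_zero] at hmv
    have ht1 : ‖t‖ ≤ 1 := by rw [Real.norm_of_nonneg ht.1]; exact ht.2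
    rcases (norm_nonneg d).eq_or_lt with h0 | h0
    · rw [← h0]; positivity
    · have : ‖d‖ ^ 2 ≤ M * M * M * ‖p' - p‖ * m * ‖d‖ := by
        rw [Real.norm_of_nonneg (by positivity)] at hmv
        refine hmv.trans ?_
        calc _ ≤ M * M * M * ‖p' - p‖ * m * ‖d‖ * 1 := by gcongr
          _ = _ := mul_one _
      nlinarith
  have hm2 : m ≤ 2 * ‖xi c U V (a, x, p)‖ := by
    have h1 := key t0 ht0
    have h2 : m ≤ ‖xi c U V (a, x, p)‖ + ‖xi c U V (a, x, p + t0 • (p' - p)) - xi c U V (a, x, p)‖ := by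
      rw [hm]; exact norm_le_norm_add_norm_sub' _ _
    have h3 : M * M * M * ‖p' - p‖ * m ≤ 1 / 4 * m := by gcongr; linarith
    have : 0 ≤ m := norm_nonneg _
    linarith
  have h1 := key 1 (right_mem_Icc.2 zero_le_one)
  rw [one_smul, add_sub_cancel] at h1
  refine h1.trans ?_
  calc _ ≤ M * M * M * ‖p' - p‖ * (2 * ‖xi c U V (a, x, p)‖) := by gcongr
    _ = _ := by ring

/-- small `ξ` means close to the base point -/
theorem xi_near (G : Good c U V) {A P : Set (Euc n)} (hA : IsCompact A) (hP : IsCompact P)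
    (hAP : A ×ˢ P ⊆ DP c U V) {r : ℝ} (hr : 0 < r) (hAU : ∀ a ∈ A, closedBall a r ⊆ U) :
    ∃ η : ℝ, 0 < η ∧ ∀ a ∈ A, ∀ p ∈ P, ∀ x ∈ U, ‖xi c U V (a, x, p)‖ < η → dist x a < r := by
  let K : Set (Euc n × Euc n × Euc n) := (fun t : Euc n × Euc n × Euc n => (t.1, t.1 + t.2.1, t.2.2)) ''
    (A ×ˢ (sphere (0 : Euc n) r) ×ˢ P)
  have hK : IsCompact K := (hA.prod ((isCompact_sphere _ _).prod hP)).image (by fun_prop)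
  have hKs : K ⊆ DF c U V := by
    rintro _ ⟨⟨a, w, p⟩, ⟨ha, hw, hp⟩, rfl⟩
    refine ⟨hAU a ha ?_, hAP (mk_mem_prod ha hp)⟩
    simpa using (mem_sphere_zero_iff_norm.1 hw).le
  have hpos : ∀ z ∈ K, 0 < ‖xi c U V z‖ := by
    rintro _ ⟨⟨a, w, p⟩, ⟨ha, hw, hp⟩, rfl⟩
    have hw' : ‖w‖ = r := mem_sphere_zero_iff_norm.1 hw
    refine norm_pos_iff.2 fun h0 => ?_
    have hDP := hAP (mk_mem_prod ha hp)
    have := G.xi_inj hDP (x0 := a + w) (x1 := a) (hAU a ha (by simpa using hw'.le)) (mem_DP.1 hDP).1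
      (by rw [G.xi_self hDP]; exact h0)
    have hw0 : w = 0 := by simpa using this
    rw [hw0, norm_zero] at hw'
    linarith
  have hex : ∃ η : ℝ, 0 < η ∧ ∀ z ∈ K, η ≤ ‖xi c U V z‖ := by
    rcases K.eq_empty_or_nonempty with h | h
    · exact ⟨1, one_pos, by simp [h]⟩
    · obtain ⟨z, hz, hmin⟩ := hK.exists_isMinOn h (G.xi_cont.mono hKs).norm
      exact ⟨_, hpos z hz, fun z' hz' => hmin hz'⟩
  obtain ⟨η, hη, hηK⟩ := hex
  refine ⟨η, hη, fun a ha p hp x hx hlt => ?_⟩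
  by_contra! hfar
  have hDP : (a, p) ∈ DP c U V := hAP (mk_mem_prod ha hp)
  have haU := (mem_DP.1 hDP).1
  have hy := G.Yv_mem hDP
  have hcX : ContinuousOn (fun s : ℝ => Xs c U V (Yv c U V (a, p)) a x s) (Icc 0 1) := by
    unfold Xs
    exact G.Xinv_smooth.continuousOn.comp (f := fun s : ℝ => (qm c a (Yv c U V (a, p)) + s •
      (qm c x (Yv c U V (a, p)) - qm c a (Yv c U V (a, p))), Yv c U V (a, p))) (by fun_prop)
      (fun s hs => G.DX_seg (PreGood.jm_mem haU hy) (PreGood.jm_mem hx hy) hs)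
  have e0 : Xs c U V (Yv c U V (a, p)) a x 0 = a := by
    unfold Xs; rw [zero_smul, add_zero, G.Xinv_qm haU hy]
  have e1 : Xs c U V (Yv c U V (a, p)) a x 1 = x := by
    unfold Xs; rw [one_smul, add_sub_cancel, G.Xinv_qm hx hy]
  have hivt := intermediate_value_Icc (zero_le_one' ℝ)
    (f := fun s => dist (Xs c U V (Yv c U V (a, p)) a x s) a)
    ((continuous_id.dist continuous_const).comp_continuousOn hcX)
  have hmem : r ∈ Icc (dist (Xs c U V (Yv c U V (a, p)) a x 0) a)
      (dist (Xs c U V (Yv c U V (a, p)) a x 1) a) := by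
    rw [e0, e1, dist_self]; exact ⟨hr.le, hfar⟩
  obtain ⟨s, hs, hsr⟩ := hivt hmem
  dsimp only at hsr
  have hin : (a, Xs c U V (Yv c U V (a, p)) a x s, p) ∈ K := by
    refine ⟨(a, Xs c U V (Yv c U V (a, p)) a x s - a, p), ⟨ha, ?_, hp⟩, by simp⟩
    rw [mem_sphere_zero_iff_norm, ← dist_eq_norm]; exact hsr
  have h2 := hηK _ hin
  rw [G.xi_Xs hDP haU hx hs, G.xi_self hDP, zero_add, sub_zero, norm_smul, Real.norm_of_nonneg hs.1] at h2
  have : s * ‖xi c U V (a, x, p)‖ ≤ 1 * ‖xi c U V (a, x, p)‖ := by gcongr; exact hs.2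
  linarith

end Good
end FKM

end


section
open Set MeasureTheory Metric Bornology Filter Topology
open scoped ENNReal NNReal Pointwise

namespace FKM
variable {n : ℕ}
attribute [local irreducible] qm pm Yv Xinv Phi

/-- uniform local constants near a point -/
structure Loc (c : Euc n → Euc n → ℝ) (U V : Set (Euc n)) (u v : Euc n → ℝ) (O : Set (Euc n))
    (A P X : Set (Euc n)) (κ C η : ℝ) : Prop where
  cP : IsCompact P
  vP : Convex ℝ P
  kpos : 0 < κ
  kle : κ ≤ 1
  Cpos : 0 < C
  epos : 0 < η
  dp : ∀ a ∈ A, ∀ p ∈ P, (a, p) ∈ DP c U V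
  XU : X ⊆ U
  cX : IsCompact X
  k1 : ∀ a ∈ A, ∀ x ∈ X, ∀ p ∈ P, ∀ p' ∈ P,
    min (κ * inner ℝ (Good.xi c U V (a, x, p)) (p' - p))
      (κ⁻¹ * inner ℝ (Good.xi c U V (a, x, p)) (p' - p)) ≤
      Phi c U V (a, x, p') - Phi c U V (a, x, p)
  ct : ∀ a ∈ A, ∀ p ∈ P, ∀ x ∈ closure U, u x + v (Yv c U V (a, p)) + c x (Yv c U V (a, p)) = 0 →
    x ∈ X ∧ ∀ s ∈ Icc (0:ℝ) 1, Xs c U V (Yv c U V (a, p)) a x s ∈ X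
  bd : ∀ a ∈ A, ∀ x ∈ X, ∀ p ∈ P, ‖Good.xi c U V (a, x, p)‖ ≤ C
  lip : ∀ a ∈ A, ∀ x ∈ X, ∀ p ∈ P, ∀ p' ∈ P, C * ‖p' - p‖ ≤ 1 / 2 →
    ‖Good.xi c U V (a, x, p') - Good.xi c U V (a, x, p)‖ ≤ C * ‖p' - p‖ * ‖Good.xi c U V (a, x, p)‖
  volY : ∀ a ∈ A, ∀ s ⊆ P, IsCompact s →
    volume ((fun p => Yv c U V (a, p)) '' s) ≤ ENNReal.ofReal C * volume s
  volP : ∀ a ∈ A, ∀ s ⊆ P, IsCompact s →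
    volume s ≤ ENNReal.ofReal C * volume ((fun p => Yv c U V (a, p)) '' s)
  volX : ∀ a ∈ A, ∀ p ∈ P, ∀ s ⊆ X, IsCompact s →
    volume s ≤ ENNReal.ofReal C * volume ((fun x => Good.xi c U V (a, x, p)) '' s)
  volxi : ∀ a ∈ A, ∀ p ∈ P, ∀ s ⊆ X, IsCompact s →
    volume ((fun x => Good.xi c U V (a, x, p)) '' s) ≤ ENNReal.ofReal C * volume s
  near : ∀ a ∈ A, ∀ p ∈ P, ∀ x ∈ U, ‖Good.xi c U V (a, x, p)‖ < η → x ∈ O ∧ x ∈ X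

theorem Good.xi_contx {c : Euc n → Euc n → ℝ} {U V : Set (Euc n)} (G : Good c U V) {a p : Euc n}
    (h : (a, p) ∈ DP c U V) : ContinuousOn (fun x => Good.xi c U V (a, x, p)) U :=
  G.xi_cont.comp (f := fun x => (a, x, p)) (by fun_prop) (fun _ hx => ⟨hx, h⟩)

theorem Good.Yv_contp {c : Euc n → Euc n → ℝ} {U V : Set (Euc n)} (G : Good c U V) {a : Euc n}
    {P : Set (Euc n)} (h : ∀ p ∈ P, (a, p) ∈ DP c U V) : ContinuousOn (fun p => Yv c U V (a, p)) P :=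
  G.Yv_smooth.continuousOn.comp (f := fun p => (a, p)) (by fun_prop) (fun p hp => h p hp)

theorem exists_loc {c : Euc n → Euc n → ℝ} {U V O : Set (Euc n)} {u v : Euc n → ℝ} {lam Lam : ℝ}
    (S : Setup c U V u v O lam Lam) {xb y0 : Euc n} (hx : xb ∈ O) (hy : y0 ∈ V) :
    ∃ (r1 r2 : ℝ) (X : Set (Euc n)) (κ C η : ℝ), 0 < r1 ∧ 0 < r2 ∧
      Loc c U V u v O (closedBall xb r1) (closedBall (pm c xb y0) r2) X κ C η := by
  have G := S.G
  have hxU := S.sO hx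
  set p0 := pm c xb y0 with hp0
  obtain ⟨r, hr, hball⟩ := Metric.isOpen_iff.1 G.oDP (xb, p0) (Good.pm_mem_DP hxU hy)
  obtain ⟨ρ, hρ, hρO⟩ := Metric.isOpen_iff.1 S.oO xb hx
  set r1 := min (r/2) (ρ/4) with hr1
  set r2 := r/2 with hr2
  have hr1p : 0 < r1 := by positivity
  have hr2p : 0 < r2 := by positivity
  set A := closedBall xb r1 with hA
  set P := closedBall p0 r2 with hP
  have hAc : IsCompact A := isCompact_closedBall _ _
  have hPc : IsCompact P := isCompact_closedBall _ _
  have hPv : Convex ℝ P := convex_closedBall _ _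
  have hdp : A ×ˢ P ⊆ DP c U V := by
    rintro ⟨a, p⟩ ⟨ha, hp⟩
    refine hball ?_
    rw [mem_ball, Prod.dist_eq]
    have h1 : dist a xb ≤ r/2 := (mem_closedBall.1 ha).trans (min_le_left _ _)
    have h2 : dist p p0 ≤ r/2 := mem_closedBall.1 hp
    refine max_lt ?_ ?_
    · dsimp only; linarith
    · dsimp only; linarith
  have hdp' : ∀ a ∈ A, ∀ p ∈ P, (a, p) ∈ DP c U V := fun a ha p hp => hdp (mk_mem_prod ha hp)
  -- contact points
  have hYc : IsCompact (Yv c U V '' (A ×ˢ P)) :=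
    (hAc.prod hPc).image_of_continuousOn (G.Yv_smooth.continuousOn.mono hdp)
  have hYV : Yv c U V '' (A ×ˢ P) ⊆ V := by
    rintro _ ⟨⟨a, p⟩, h, rfl⟩; exact G.Yv_mem (hdp h)
  have hcc := S.contact_compact hYc (hYV.trans subset_closure)
  set X0 : Set (Euc n) := Prod.fst '' {z : Euc n × Euc n | z.1 ∈ closure U ∧
    z.2 ∈ Yv c U V '' (A ×ˢ P) ∧ u z.1 + v z.2 + c z.1 z.2 = 0} with hX0
  have hX0c : IsCompact X0 := hcc.image continuous_fst
  have hX0U : X0 ⊆ U := by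
    rintro _ ⟨⟨x, y⟩, ⟨h1, h2, h3⟩, rfl⟩
    exact S.inU y (hYV h2) x h1 h3
  set T : Set (ℝ × Euc n × Euc n × Euc n) := Icc (0:ℝ) 1 ×ˢ A ×ˢ X0 ×ˢ P with hT
  have hTc : IsCompact T := isCompact_Icc.prod (hAc.prod (hX0c.prod hPc))
  have hTs : T ⊆ Icc (0:ℝ) 1 ×ˢ DF c U V := by
    rintro ⟨s, a, x, p⟩ ⟨hs, ha, hx, hp⟩
    exact ⟨hs, hX0U hx, hdp' a ha p hp⟩
  set X1 : Set (Euc n) := (fun t => Xinv c U V (Good.qs c U V t)) '' T with hX1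
  have hX1c : IsCompact X1 := hTc.image_of_continuousOn
    (G.Xinv_smooth.continuousOn.comp (G.qs_cont.mono hTs) (fun t ht => G.qs_mem (hTs ht)))
  have hX1U : X1 ⊆ U := by
    rintro _ ⟨t, ht, rfl⟩
    exact G.Xinv_mem (G.qs_mem (hTs ht))
  set B := closedBall xb (ρ/2) with hB
  have hBO : B ⊆ O := (closedBall_subset_ball (by linarith)).trans hρO
  have hBc : IsCompact B := isCompact_closedBall _ _
  set X : Set (Euc n) := (X0 ∪ X1) ∪ B with hX
  have hXc : IsCompact X := (hX0c.union hX1c).union hBc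
  have hXU : X ⊆ U := union_subset (union_subset hX0U hX1U) (hBO.trans S.sO)
  have hKc : IsCompact (A ×ˢ X ×ˢ P) := hAc.prod (hXc.prod hPc)
  have hKs : A ×ˢ X ×ˢ P ⊆ DF c U V := by
    rintro ⟨a, x, p⟩ ⟨ha, hx, hp⟩
    exact ⟨hXU hx, hdp' a ha p hp⟩
  have hseg : ∀ a ∈ A, ∀ x ∈ X, ∀ p ∈ P, ∀ p' ∈ P, ∀ t ∈ Icc (0:ℝ) 1,
      (a, x, p + t • (p' - p)) ∈ A ×ˢ X ×ˢ P := by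
    intro a ha x hx p hp p' hp' t ht
    exact ⟨ha, hx, hPv.add_smul_sub_mem hp hp' ht⟩
  obtain ⟨κ, hκ, hκ1, hk1⟩ := G.K1 hKc hKs
  obtain ⟨R, hR, hRb⟩ := G.bounds1 hKc hKs
  obtain ⟨L, hL, hLb⟩ := G.xi_lip hKc hKs
  obtain ⟨Cv, hCv, hvol⟩ := vol_image_le n R
  obtain ⟨η, hη, hηb⟩ := G.xi_near hAc hPc hdp (r := ρ/4) (by positivity) (by
    intro a ha x hx
    refine S.sO (hρO ?_)
    have h1 : dist a xb ≤ ρ/4 := (mem_closedBall.1 ha).trans (min_le_right _ _)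
    have h2 := mem_closedBall.1 hx
    rw [mem_ball]
    linarith [dist_triangle x a xb])
  set C := max R (max L Cv) with hC
  have hCR : R ≤ C := le_max_left _ _
  have hCL : L ≤ C := (le_max_left _ _).trans (le_max_right _ _)
  have hCC : Cv ≤ C := (le_max_right _ _).trans (le_max_right _ _)
  have hup : ∀ s : Set (Euc n), ENNReal.ofReal Cv * volume s ≤ ENNReal.ofReal C * volume s :=
    fun s => by gcongr
  have hxbX : xb ∈ X := Or.inr (mem_closedBall_self (by positivity))
  refine ⟨r1, r2, X, κ, C, η, hr1p, hr2p, ⟨hPc, hPv, hκ, hκ1, hR.trans_le hCR, hη, hdp', hXU, hXc, ?_, ?_, ?_,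
    ?_, ?_, ?_, ?_, ?_, ?_⟩⟩
  · intro a ha x hx p hp p' hp'
    exact hk1 a x p p' (hseg a ha x hx p hp p' hp')
  · intro a ha p hp x hxc hc
    have hx0 : x ∈ X0 := ⟨(x, Yv c U V (a, p)), ⟨hxc, ⟨(a, p), mk_mem_prod ha hp, rfl⟩, hc⟩, rfl⟩
    refine ⟨Or.inl (Or.inl hx0), fun s hs => Or.inl (Or.inr ?_)⟩
    exact ⟨(s, a, x, p), ⟨hs, ha, hx0, hp⟩, rfl⟩
  · intro a ha x hx p hp
    exact (hRb a x p ⟨ha, hx, hp⟩).2.2.2.2.trans hCR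
  · intro a ha x hx p hp p' hp' hsm
    have hn := norm_nonneg (p' - p)
    have := hLb a x p p' (hseg a ha x hx p hp p' hp')
      ((mul_le_mul_of_nonneg_right hCL hn).trans hsm)
    exact this.trans (by gcongr)
  · intro a ha s hs hsc
    refine (hvol _ (fun p => Dy c U V (a, p)) s hsc.measurableSet (fun p hp => ?_) (fun p hp => ?_)).trans
      (hup _)
    · exact (G.Yv_hasFDeriv (hdp' a ha p (hs hp))).hasFDerivWithinAt
    · exact (hRb a xb p ⟨ha, hxbX, hs hp⟩).1
  · intro a ha s hs hsc
    have haU := (Good.mem_DP.1 (hdp' a ha p0 (mem_closedBall_self hr2p.le))).1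
    have hc' : IsCompact ((fun p => Yv c U V (a, p)) '' s) :=
      hsc.image_of_continuousOn (G.Yv_contp fun p hp => hdp' a ha p (hs hp))
    have himg : (fun y => pm c a y) '' ((fun p => Yv c U V (a, p)) '' s) = s := by
      rw [image_image]
      ext p
      constructor
      · rintro ⟨q, hq, rfl⟩
        dsimp only
        rw [G.pm_Yv (hdp' a ha q (hs hq))]; exact hq
      · intro hp
        exact ⟨p, hp, G.pm_Yv (hdp' a ha p (hs hp))⟩
    have := hvol (fun y => pm c a y) (fun y => Dp c (a, y)) ((fun p => Yv c U V (a, p)) '' s)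
      hc'.measurableSet (by
        rintro _ ⟨p, hp, rfl⟩
        exact (G.pm_hasFDeriv haU (G.Yv_mem (hdp' a ha p (hs hp)))).hasFDerivWithinAt) (by
        rintro _ ⟨p, hp, rfl⟩
        exact (hRb a xb p ⟨ha, hxbX, hs hp⟩).2.1)
    rw [himg] at this
    exact this.trans (hup _)
  · intro a ha p hp s hs hsc
    have hDP := hdp' a ha p hp
    have hyV := G.Yv_mem hDP
    set y := Yv c U V (a, p) with hyd
    have hc' : IsCompact ((fun x => Good.xi c U V (a, x, p)) '' s) :=
      hsc.image_of_continuousOn ((G.xi_contx hDP).mono (hs.trans hXU))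
    have hadj : ∀ x ∈ s, ContinuousLinearMap.adjoint (Dp c (a, y)) (Good.xi c U V (a, x, p)) + qm c a y =
        qm c x y := by
      intro x hx
      rw [G.adj_xi (a := a) (p := p) (x := x) ⟨hXU (hs hx), hDP⟩]; simp [hyd]
    set g : Euc n → Euc n := fun ξ => Xinv c U V
      (ContinuousLinearMap.adjoint (Dp c (a, y)) ξ + qm c a y, y) with hg
    have hgx : ∀ x ∈ s, g (Good.xi c U V (a, x, p)) = x := by
      intro x hx
      simp only [hg]
      rw [hadj x hx, G.Xinv_qm (hXU (hs hx)) hyV]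
    have himg : g '' ((fun x => Good.xi c U V (a, x, p)) '' s) = s := by
      rw [image_image]
      ext x
      constructor
      · rintro ⟨q, hq, rfl⟩
        dsimp only
        rw [hgx q hq]; exact hq
      · intro hx
        exact ⟨x, hx, hgx x hx⟩
    have := hvol g (fun ξ => ((fderiv ℝ (Xinv c U V) (qm c (g ξ) y, y)).comp
        (ContinuousLinearMap.inl ℝ (Euc n) (Euc n))).comp
          (ContinuousLinearMap.adjoint (Dp c (a, y)))) ((fun x => Good.xi c U V (a, x, p)) '' s)
      hc'.measurableSet (by
        rintro _ ⟨x, hx, rfl⟩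
        dsimp only
        rw [hgx x hx]
        have h1 := G.Xinv_hasFDeriv (hXU (hs hx)) hyV
        rw [← hadj x hx] at h1
        have h2 : HasFDerivAt (fun ξ => ContinuousLinearMap.adjoint (Dp c (a, y)) ξ + qm c a y)
          (ContinuousLinearMap.adjoint (Dp c (a, y))) (Good.xi c U V (a, x, p)) :=
          (ContinuousLinearMap.hasFDerivAt _).add_const _
        have h3 := (h1.comp (Good.xi c U V (a, x, p)) h2).hasFDerivWithinAt
          (s := (fun x => Good.xi c U V (a, x, p)) '' s)
        rw [hadj x hx] at h3
        exact h3) (by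
        rintro _ ⟨x, hx, rfl⟩
        dsimp only
        rw [hgx x hx]
        exact (hRb a x p ⟨ha, hs hx, hp⟩).2.2.1)
    rw [himg] at this
    exact this.trans (hup _)
  · intro a ha p hp s hs hsc
    have hDP := hdp' a ha p hp
    have hyV := G.Yv_mem hDP
    set y := Yv c U V (a, p) with hyd
    refine (hvol _ (fun x => (ContinuousLinearMap.adjoint (Dy c U V (a, p))).comp
        ((fderiv ℝ (fun z : Euc n × Euc n => qm c z.1 z.2) (x, y)).comp
        (ContinuousLinearMap.inl ℝ (Euc n) (Euc n)))) s hsc.measurableSet (fun x hx => ?_)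
          (fun x hx => ?_)).trans (hup _)
    · have h1 := (G.qm_hasFDeriv (hXU (hs hx)) hyV).sub_const (qm c a y)
      have h2 := (ContinuousLinearMap.hasFDerivAt
        (ContinuousLinearMap.adjoint (Dy c U V (a, p)))).comp x h1
      refine h2.hasFDerivWithinAt.congr (fun x' hx' => ?_) ?_
      · exact G.xi_adj (a := a) (p := p) (x := x') ⟨hXU (hs hx'), hDP⟩
      · exact G.xi_adj (a := a) (p := p) (x := x) ⟨hXU (hs hx), hDP⟩
    · exact (hRb a x p ⟨ha, hs hx, hp⟩).2.2.2.1
  · intro a ha p hp x hx hlt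
    have h1 := hηb a ha p hp x hx hlt
    have h2 : dist a xb ≤ ρ/4 := (mem_closedBall.1 ha).trans (min_le_right _ _)
    have h3 : x ∈ B := by
      rw [hB, mem_closedBall]; linarith [dist_triangle x a xb]
    exact ⟨hBO h3, Or.inr h3⟩

end FKM

end


section
open Set MeasureTheory Metric Bornology Filter Topology
open scoped ENNReal NNReal Pointwise

namespace FKM
variable {n : ℕ}
attribute [local irreducible] qm pm Yv Xinv Phi

noncomputable def om (c : Euc n → Euc n → ℝ) (U V : Set (Euc n)) (v : Euc n → ℝ) (a : Euc n) (k : ℝ)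
    (p : Euc n) : ℝ := v (Yv c U V (a, p)) + c a (Yv c U V (a, p)) - k

/-- data of a section -/
structure Sec (c : Euc n → Euc n → ℝ) (U V : Set (Euc n)) (u v : Euc n → ℝ) (O : Set (Euc n))
    (lam Lam : ℝ) (A P X : Set (Euc n)) (κ C η : ℝ) (a p0 : Euc n) (k H ρ : ℝ) : Prop where
  S : Setup c U V u v O lam Lam
  L : Loc c U V u v O A P X κ C η
  ha : a ∈ A
  p0P : P ∈ 𝓝 p0
  glob : ∀ y ∈ closure V, v y + c a y ≤ k → y ∈ V ∧ pm c a y ∈ P ∧ ‖pm c a y - p0‖ ≤ ρ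
  om0 : om c U V v a k p0 = -H
  Hpos : 0 < H
  low : ∀ y ∈ closure V, k - 2 * H ≤ v y + c a y

def Qs (c : Euc n → Euc n → ℝ) (U V : Set (Euc n)) (v : Euc n → ℝ) (P : Set (Euc n)) (a : Euc n) (k : ℝ) :
    Set (Euc n) := {p | p ∈ P ∧ om c U V v a k p ≤ 0}

namespace Sec
variable {c : Euc n → Euc n → ℝ} {U V O A P X : Set (Euc n)} {u v : Euc n → ℝ} {lam Lam κ C η : ℝ}
  {a p0 : Euc n} {k H ρ : ℝ}

theorem aU (T : Sec c U V u v O lam Lam A P X κ C η a p0 k H ρ) : a ∈ U :=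
  (Good.mem_DP.1 (T.L.dp a T.ha p0 (mem_of_mem_nhds T.p0P))).1

theorem om_cont (T : Sec c U V u v O lam Lam A P X κ C η a p0 k H ρ) :
    ContinuousOn (om c U V v a k) {p | (a, p) ∈ DP c U V} := by
  have hY : ContinuousOn (fun p => Yv c U V (a, p)) {p | (a, p) ∈ DP c U V} :=
    T.S.G.Yv_contp (fun p hp => hp)
  have hm : MapsTo (fun p => Yv c U V (a, p)) {p | (a, p) ∈ DP c U V} (closure V) :=
    fun p hp => subset_closure (T.S.G.Yv_mem hp)
  have h1 := T.S.cv.comp hY hm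
  have h2 := T.S.cont.comp (f := fun p => (a, Yv c U V (a, p))) (continuousOn_const.prodMk hY)
    (fun p hp => mk_mem_prod (subset_closure T.aU) (hm hp))
  exact (h1.add h2).sub continuousOn_const

theorem om_contP (T : Sec c U V u v O lam Lam A P X κ C η a p0 k H ρ) :
    ContinuousOn (om c U V v a k) P := T.om_cont.mono (fun p hp => T.L.dp a T.ha p hp)

theorem memQ (T : Sec c U V u v O lam Lam A P X κ C η a p0 k H ρ) {p : Euc n}
    (hp : (a, p) ∈ DP c U V) (h : om c U V v a k p ≤ 0) : p ∈ Qs c U V v P a k ∧ ‖p - p0‖ ≤ ρ := by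
  have h' := T.glob _ (subset_closure (T.S.G.Yv_mem hp)) (by unfold om at h; linarith)
  rw [T.S.G.pm_Yv hp] at h'
  exact ⟨⟨h'.2.1, h⟩, h'.2.2⟩

theorem Q_rho (T : Sec c U V u v O lam Lam A P X κ C η a p0 k H ρ) {p : Euc n}
    (hp : p ∈ Qs c U V v P a k) : ‖p - p0‖ ≤ ρ := (T.memQ (T.L.dp a T.ha p hp.1) hp.2).2

theorem Q_compact (T : Sec c U V u v O lam Lam A P X κ C η a p0 k H ρ) :
    IsCompact (Qs c U V v P a k) := by
  have h := T.om_contP.preimage_isClosed_of_isClosed T.L.cP.isClosed (isClosed_Iic (a := (0:ℝ)))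
  exact T.L.cP.of_isClosed_subset h inter_subset_left

theorem Q_convex (T : Sec c U V u v O lam Lam A P X κ C η a p0 k H ρ) :
    Convex ℝ (Qs c U V v P a k) := by
  rw [convex_iff_add_mem]
  rintro p ⟨hp, hp'⟩ q ⟨hq, hq'⟩ α β hα hβ hab
  refine ⟨T.L.vP hp hq hα hβ hab, ?_⟩
  have := T.S.sub_conv (T.L.dp a T.ha p hp) (T.L.dp a T.ha q hq) (t := β) ⟨hβ, by linarith⟩
  have e : p + β • (q - p) = α • p + β • q := by
    have : α = 1 - β := by linarith
    subst this; module
  rw [e] at this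
  unfold om at *
  rcases le_max_iff.1 this with h | h <;> linarith

theorem Q_ball (T : Sec c U V u v O lam Lam A P X κ C η a p0 k H ρ) :
    ∃ r, 0 < r ∧ closedBall p0 r ⊆ Qs c U V v P a k := by
  have h1 : ContinuousAt (om c U V v a k) p0 := T.om_contP.continuousAt T.p0P
  have h2 : ∀ᶠ p in 𝓝 p0, om c U V v a k p < 0 :=
    h1.eventually_lt continuousAt_const (by rw [T.om0]; linarith [T.Hpos])
  have h3 : Qs c U V v P a k ∈ 𝓝 p0 := by
    filter_upwards [h2, T.p0P] with p h h'
    exact ⟨h', h.le⟩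
  obtain ⟨r, hr, h⟩ := Metric.nhds_basis_closedBall.mem_iff.1 h3
  exact ⟨r, hr, h⟩

theorem om_low (T : Sec c U V u v O lam Lam A P X κ C η a p0 k H ρ) {p : Euc n}
    (hp : p ∈ P) : -(2*H) ≤ om c U V v a k p := by
  have := T.low _ (subset_closure (T.S.G.Yv_mem (T.L.dp a T.ha p hp)))
  unfold om; linarith

/-- contact inequality -/
theorem om_contact (T : Sec c U V u v O lam Lam A P X κ C η a p0 k H ρ) {p p1 x : Euc n}
    (hp : (a, p) ∈ DP c U V) (hx : x ∈ closure U)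
    (h : u x + v (Yv c U V (a, p1)) + c x (Yv c U V (a, p1)) = 0) :
    Phi c U V (a, x, p) - Phi c U V (a, x, p1) ≤ om c U V v a k p - om c U V v a k p1 := by
  have := T.S.ge x hx _ (subset_closure (T.S.G.Yv_mem hp))
  rw [Good.Phi_apply, Good.Phi_apply]
  unfold om
  linarith

theorem min_bound {κ g B : ℝ} (hk : 0 < κ) (hk1 : κ ≤ 1) (hB : 0 ≤ B)
    (h : min (κ * g) (κ⁻¹ * g) ≤ B) : g ≤ B / κ := by
  rw [le_div_iff₀ hk]
  rcases min_le_iff.1 h with h | h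
  · linarith
  · rw [inv_mul_le_iff₀ hk] at h
    have h1 := mul_le_mul_of_nonneg_right h hk.le
    have h2 : κ * κ ≤ 1 := by nlinarith
    nlinarith

theorem min_lower {κ g B : ℝ} (hk : 0 < κ) (hB : 0 ≤ B) (hg : -B ≤ g) :
    -(max κ κ⁻¹ * B) ≤ min (κ * g) (κ⁻¹ * g) := by
  have h1 : 0 < κ⁻¹ := by positivity
  rw [le_min_iff]
  have h2 := le_max_left κ κ⁻¹
  have h3 := le_max_right κ κ⁻¹
  constructor
  · nlinarith
  · nlinarith

theorem lower_est (T : Sec c U V u v O lam Lam A P X κ C η a p0 k H ρ)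
    (b : OrthonormalBasis (Fin n) ℝ (Euc n)) (w : Fin n → Euc n)
    (hw : ∀ i, p0 + w i ∈ Qs c U V v P a k) (hd : LinearMap.det (wmap b w) ≠ 0) :
    |LinearMap.det (wmap b w)| ^ 2 ≤ Lam * C^2 * (8 * ((n:ℝ)+1)^3 / κ^3) ^ n * H ^ n := by
  have L := T.L
  have hk := L.kpos
  have hH := T.Hpos
  set Q := Qs c U V v P a k with hQ
  have p0Q : p0 ∈ Q := ⟨mem_of_mem_nhds T.p0P, by rw [T.om0]; linarith⟩
  set N : ℝ := (n:ℝ) + 1 with hN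
  have hN0 : 0 < N := by positivity
  -- convex combos
  have hcomb : ∀ s : Fin n → ℝ, (∀ i, 0 ≤ s i) → ∑ i, s i ≤ 1 → p0 + ∑ i, s i • w i ∈ Q := by
    intro s h0 h1
    have := T.Q_convex.sum_mem (t := Finset.univ) (w := fun o : Option (Fin n) => o.elim (1 - ∑ i, s i) s)
      (z := fun o : Option (Fin n) => o.elim p0 (fun i => p0 + w i)) (by
        intro o _; cases o with
        | none => simpa using h1
        | some i => exact h0 i) (by simp [Fintype.sum_option]) (by
        intro o _; cases o with
        | none => exact p0Q
        | some i => exact hw i)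
    simp only [Fintype.sum_option, Option.elim, smul_add, Finset.sum_add_distrib, ← Finset.sum_smul] at this
    convert this using 1
    module
  set z : Euc n := p0 + ∑ i, (1/N) • w i with hz
  set cube : Set (Euc n) := {x : Euc n | ∀ i, inner ℝ (b i) x ∈ Icc (-(1/(2*N^2))) (1/(2*N^2))} with hcube
  set T' : Set (Euc n) := (fun x => z + wmap b w x) '' cube with hT'
  have hwc : Continuous (wmap b w) := LinearMap.continuous_of_finiteDimensional _
  have hT'c : IsCompact T' := (cube_compact b _ _).image (by fun_prop)
  have hn1 : (n:ℝ) = N - 1 := by rw [hN]; ring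
  have hpts : ∀ x ∈ cube, ∀ θ ∈ Icc (0:ℝ) 2, z + θ • wmap b w x ∈ Q := by
    intro x hx θ hθ
    have e : z + θ • wmap b w x = p0 + ∑ i, (1/N + θ * inner ℝ (b i) x) • w i := by
      rw [hz, wmap_apply, Finset.smul_sum, add_assoc, ← Finset.sum_add_distrib]
      congr 1
      refine Finset.sum_congr rfl fun i _ => ?_
      module
    have hb : ∀ i, |θ * inner ℝ (b i) x| ≤ 1/N^2 := by
      intro i
      have h1 : |inner ℝ (b i) x| ≤ 1/(2*N^2) := abs_le.2 ⟨(hx i).1, (hx i).2⟩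
      rw [abs_mul, abs_of_nonneg hθ.1]
      calc θ * |inner ℝ (b i) x| ≤ 2 * (1/(2*N^2)) := mul_le_mul hθ.2 h1 (abs_nonneg _) (by norm_num)
        _ = 1/N^2 := by field_simp
    have hN1 : 1 ≤ N := by rw [hN]; linarith [Nat.cast_nonneg (α := ℝ) n]
    rw [e]
    refine hcomb _ (fun i => ?_) ?_
    · have := (abs_le.1 (hb i)).1
      have h2 : 1/N^2 ≤ 1/N := by
        apply one_div_le_one_div_of_le hN0; nlinarith
      linarith
    · calc ∑ i, (1/N + θ * inner ℝ (b i) x) ≤ ∑ i : Fin n, (1/N + 1/N^2) :=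
            Finset.sum_le_sum fun i _ => by linarith [(abs_le.1 (hb i)).2]
        _ = (N-1) * (1/N + 1/N^2) := by simp [hn1]; ring
        _ ≤ 1 := by
          have : (N-1) * (1/N + 1/N^2) = 1 - 1/N^2 := by field_simp; ring
          rw [this]
          have : 0 ≤ 1/N^2 := by positivity
          linarith
  have hzQ : z ∈ Q := by
    have := hcomb (fun _ => 1/N) (fun i => by positivity) (by
      simp only [Finset.sum_const, Finset.card_univ, Fintype.card_fin, nsmul_eq_mul, hn1]
      rw [mul_one_div, div_le_one hN0]; linarith)
    exact this
  have hT'Q : T' ⊆ Q := by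
    rintro _ ⟨x, hx, rfl⟩
    have := hpts x hx 1 (by norm_num)
    simpa using this
  -- slopes
  set t : ℝ := N * (4 * H / κ^3) with ht
  have ht0 : 0 ≤ t := by positivity
  set Y := (fun p => Yv c U V (a, p)) '' T' with hY
  have hQP : Q ⊆ P := fun p hp => hp.1
  have hYV : Y ⊆ V := by
    rintro _ ⟨p, hp, rfl⟩
    exact T.S.G.Yv_mem (L.dp a T.ha p (hQP (hT'Q hp)))
  have hYc : IsCompact Y := hT'c.image_of_continuousOn
    (T.S.G.Yv_contp fun p hp => L.dp a T.ha p (hQP (hT'Q hp)))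
  set Xc := {x | x ∈ closure U ∧ ∃ y ∈ Y, u x + v y + c x y = 0} with hXc
  have hXcc : IsCompact Xc := by
    have := (T.S.contact_compact hYc (hYV.trans subset_closure)).image continuous_fst
    convert this using 1
    ext x
    constructor
    · rintro ⟨h1, y, h2, h3⟩; exact ⟨(x, y), ⟨h1, h2, h3⟩, rfl⟩
    · rintro ⟨⟨x', y⟩, ⟨h1, h2, h3⟩, rfl⟩; exact ⟨h1, y, h2, h3⟩
  have hXcX : Xc ⊆ X := by
    rintro x ⟨hx, _, ⟨p, hp, rfl⟩, h⟩
    exact (L.ct a T.ha p (hQP (hT'Q hp)) x hx h).1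
  have hslope : (fun x => Good.xi c U V (a, x, z)) '' Xc ⊆ {x : Euc n | ∀ i, |inner ℝ (w i) x| ≤ t} := by
    rintro _ ⟨x, hx, rfl⟩ 
    have hxX := hXcX hx
    obtain ⟨hxU, _, ⟨p1, ⟨s, hs, rfl⟩, rfl⟩, hcx⟩ := hx
    dsimp only at hcx ⊢
    set p1 := z + wmap b w s with hp1
    have hp1Q : p1 ∈ Q := hT'Q ⟨s, hs, rfl⟩
    have hp2Q : z + (2:ℝ) • wmap b w s ∈ Q := hpts s hs 2 (by norm_num)
    have hf : ∀ p ∈ Q, Phi c U V (a, x, p) - Phi c U V (a, x, p1) ≤ 2 * H := by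
      intro p hp
      have h1 := T.om_contact (p := p) (p1 := p1) (x := x) (L.dp a T.ha p hp.1) hxU hcx
      have h2 := T.om_low hp1Q.1
      have h3 : om c U V v a k p ≤ 0 := hp.2
      linarith
    have g1 := L.k1 a T.ha x hxX p1 hp1Q.1 _ hp2Q.1
    have g2 := L.k1 a T.ha x hxX p1 hp1Q.1 z hzQ.1
    have e1 : z + (2:ℝ) • wmap b w s - p1 = wmap b w s := by rw [hp1]; module
    have e2 : z - p1 = - wmap b w s := by rw [hp1]; module
    rw [e1] at g1
    rw [e2, inner_neg_right] at g2
    set g := inner ℝ (Good.xi c U V (a, x, p1)) (wmap b w s) with hg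
    have g3 := min_bound hk L.kle (by positivity) (g1.trans (hf _ hp2Q))
    have hmx : max κ κ⁻¹ = κ⁻¹ := max_eq_right (by
      rw [le_inv_comm₀ hk hk]; exact L.kle.trans (one_le_inv₀ hk |>.2 L.kle))
    have g4 := min_lower (g := -g) (B := 2*H/κ) hk (by positivity) (by linarith)
    rw [hmx] at g4
    have hfz : -(2*H/κ^2) ≤ Phi c U V (a, x, z) - Phi c U V (a, x, p1) := by
      have : κ⁻¹ * (2*H/κ) = 2*H/κ^2 := by field_simp
      rw [this] at g4
      exact g4.trans g2
    have hh : ∀ p ∈ Q, inner ℝ (Good.xi c U V (a, x, z)) (p - z) ≤ 4 * H / κ^3 := by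
      intro p hp
      have h1 := L.k1 a T.ha x hxX z hzQ.1 p hp.1
      have h2 : Phi c U V (a, x, p) - Phi c U V (a, x, z) ≤ 4*H/κ^2 := by
        have h3 := hf p hp
        have h4 : 2 * H ≤ 2 * H/κ^2 := by
          rw [le_div_iff₀ (by positivity)]
          have : κ^2 ≤ 1 := pow_le_one₀ hk.le L.kle
          nlinarith
        have h5 : 4 * H/κ^2 = 2*H/κ^2 + 2*H/κ^2 := by ring
        linarith
      have h3 := min_bound hk L.kle (by positivity) (h1.trans h2)
      have : 4*H/κ^2/κ = 4*H/κ^3 := by field_simp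
      linarith
    set ξ := Good.xi c U V (a, x, z) with hξ
    set B := 4 * H / κ^3 with hB
    have h0 := hh p0 p0Q
    have hi := fun i => hh (p0 + w i) (hw i)
    have hsum : inner ℝ ξ (p0 - z) + ∑ i, inner ℝ ξ (p0 + w i - z) = 0 := by
      rw [← inner_sum, ← inner_add_right]
      have : p0 - z + ∑ i, (p0 + w i - z) = 0 := by
        have e3 : ∀ i, p0 + w i - z = (p0 - z) + w i := fun i => by abel
        simp only [e3, Finset.sum_add_distrib, Finset.sum_const, Finset.card_univ, Fintype.card_fin]
        have e4 : p0 - z = -((1/N) • ∑ i, w i) := by rw [hz, ← Finset.smul_sum]; abel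
        rw [e4, ← Nat.cast_smul_eq_nsmul ℝ, hn1, smul_neg, smul_smul]
        have : (N - 1) * (1/N) = 1 - 1/N := by field_simp
        rw [this]; module
      rw [this, inner_zero_right]
    intro i
    have hBt : t = N * B := rfl
    have hB0 : 0 ≤ B := by positivity
    have hdiff : inner ℝ (w i) ξ = inner ℝ ξ (p0 + w i - z) - inner ℝ ξ (p0 - z) := by
      rw [← inner_sub_right, real_inner_comm]; congr 1; abel
    have hs1 : ∑ j, inner ℝ ξ (p0 + w j - z) ≤ (N-1) * B := by
      calc _ ≤ ∑ j : Fin n, B := Finset.sum_le_sum fun j _ => hi j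
        _ = (N-1) * B := by simp [hn1]
    have hs2 : ∑ j, inner ℝ ξ (p0 + w j - z) ≤ inner ℝ ξ (p0 + w i - z) + (N-1-1) * B := by
      rw [← Finset.add_sum_erase _ _ (Finset.mem_univ i)]
      have : ∑ j ∈ Finset.univ.erase i, inner ℝ ξ (p0 + w j - z) ≤ ∑ j ∈ Finset.univ.erase i, B :=
        Finset.sum_le_sum fun j _ => hi j
      have h7 : ∑ j ∈ Finset.univ.erase i, B = (N-1-1) * B := by
        have := Finset.add_sum_erase Finset.univ (fun _ : Fin n => B) (Finset.mem_univ i)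
        have h8 : ∑ j : Fin n, B = (N-1) * B := by simp [hn1]
        linarith
      linarith
    have := hi i
    rw [hdiff, abs_le, hBt]
    constructor <;> nlinarith
  have v1 : volume T' = ENNReal.ofReal (|LinearMap.det (wmap b w)| * (1/N^2) ^ n) := by
    have : T' = z +ᵥ (wmap b w '' cube) := by
      rw [hT', ← image_vadd, image_image]; rfl
    rw [this, measure_vadd, vol_wmap b w _ _ (by linarith [show (0:ℝ) ≤ 1/(2*N^2) by positivity])]
    congr 3
    field_simp
    ring
  have v2 := L.volP a T.ha T' (hT'Q.trans hQP) hT'c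
  have v3 := T.S.vle Y hYV hYc
  have v4 := L.volX a T.ha z hzQ.1 Xc hXcX hXcc
  have v5 := (measure_mono hslope).trans_eq (vol_dual b w t ht0 hd)
  have v6 : volume T' ≤ ENNReal.ofReal C * (ENNReal.ofReal Lam * (ENNReal.ofReal C *
      ENNReal.ofReal (|LinearMap.det (wmap b w)|⁻¹ * (2 * t) ^ n))) := by
    refine v2.trans (mul_le_mul_right ?_ _)
    refine v3.trans (mul_le_mul_right ?_ _)
    exact v4.trans (mul_le_mul_right v5 _)
  have hC := L.Cpos
  have hLam := T.S.hLam
  rw [v1, ← ENNReal.ofReal_mul hC.le, ← ENNReal.ofReal_mul hLam.le, ← ENNReal.ofReal_mul hC.le,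
    ENNReal.ofReal_le_ofReal_iff (by positivity)] at v6
  set D := |LinearMap.det (wmap b w)| with hD
  have hDp : 0 < D := abs_pos.2 hd
  have e5 : (8 * N^3/κ^3)^n * H^n * (1/N^2)^n = (2*t)^n := by
    rw [← mul_pow, ← mul_pow]; congr 1; rw [ht]; field_simp; ring
  have e6 : 0 < (1/N^2)^n := by positivity
  have v7 : D * (D * (1/N^2)^n) ≤ D * (C * (Lam * (C * (D⁻¹ * (2*t)^n)))) := by gcongr
  have e7 : D * (C * (Lam * (C * (D⁻¹ * (2*t)^n)))) = Lam * C^2 * (2*t)^n := by field_simp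
  rw [e7, ← e5] at v7
  refine le_of_mul_le_mul_right ?_ e6
  calc D^2 * (1/N^2)^n = D * (D * (1/N^2)^n) := by ring
    _ ≤ _ := v7
    _ = _ := by ring
end Sec
end FKM

end


section
open Set MeasureTheory Metric Bornology Filter Topology
open scoped ENNReal NNReal Pointwise

namespace FKM
variable {n : ℕ}
attribute [local irreducible] qm pm Yv Xinv Phi

namespace Sec
variable {c : Euc n → Euc n → ℝ} {U V O A P X : Set (Euc n)} {u v : Euc n → ℝ} {lam Lam κ C η : ℝ}
  {a p0 : Euc n} {k H ρ : ℝ}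

theorem om_pb (T : Sec c U V u v O lam Lam A P X κ C η a p0 k H ρ) {e pb : Euc n} (he : ‖e‖ = 1)
    (hpb : pb ∈ Qs c U V v P a k) (hmax : ∀ p ∈ Qs c U V v P a k, inner ℝ e p ≤ inner ℝ e pb) :
    om c U V v a k pb = 0 := by
  refine le_antisymm hpb.2 ?_
  by_contra! hneg
  have hD := T.L.dp a T.ha pb hpb.1
  have hop : IsOpen {p | (a, p) ∈ DP c U V} := T.S.G.oDP.preimage (by fun_prop : Continuous fun p => (a, p))
  have hc : ContinuousAt (om c U V v a k) pb := T.om_cont.continuousAt (hop.mem_nhds hD)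
  have h2 : ∀ᶠ p in 𝓝 pb, om c U V v a k p < 0 ∧ (a, p) ∈ DP c U V :=
    (hc.eventually_lt continuousAt_const hneg).and (hop.mem_nhds hD)
  have h3 : Tendsto (fun s : ℝ => pb + s • e) (𝓝[>] 0) (𝓝 pb) := by
    have : Continuous (fun s : ℝ => pb + s • e) := by fun_prop
    have := this.tendsto 0
    simp only [zero_smul, add_zero] at this
    exact this.mono_left nhdsWithin_le_nhds
  obtain ⟨s, ⟨h4, h5⟩, h6⟩ := ((h3.eventually h2).and self_mem_nhdsWithin).exists
  have h7 := hmax _ (T.memQ h5 h4.le).1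
  rw [inner_add_right, inner_smul_right, real_inner_self_eq_norm_sq, he] at h7
  have : (0:ℝ) < s := h6
  linarith

theorem normal (T : Sec c U V u v O lam Lam A P X κ C η a p0 k H ρ) {e pb : Euc n} (he : ‖e‖ = 1)
    (hpb : pb ∈ Qs c U V v P a k) (hmax : ∀ p ∈ Qs c U V v P a k, inner ℝ e p ≤ inner ℝ e pb) :
    ∃ x ∈ closure U, u x + v (Yv c U V (a, pb)) + c x (Yv c U V (a, pb)) = 0 ∧
      ∃ t : ℝ, 0 < t ∧ Good.xi c U V (a, x, pb) = t • e := by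
  have om_b := T.om_pb he hpb hmax
  have hD := T.L.dp a T.ha pb hpb.1
  have G := T.S.G
  set yb := Yv c U V (a, pb) with hyb
  have hybV : yb ∈ V := G.Yv_mem hD
  set K : Set (Euc n) := {x | x ∈ closure U ∧ u x + v yb + c x yb = 0} with hK
  have hKU : K ⊆ U := fun x hx => T.S.inU yb hybV x hx.1 hx.2
  have hKc : IsCompact K := by
    have := (T.S.contact_compact (isCompact_singleton (x := yb)) (by
      simpa using subset_closure hybV)).image continuous_fst
    convert this using 1
    ext x
    constructor
    · rintro ⟨h1, h3⟩; exact ⟨(x, yb), ⟨h1, rfl, h3⟩, rfl⟩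
    · rintro ⟨⟨x', y⟩, ⟨h1, h2, h3⟩, rfl⟩
      dsimp only at h1 h2 h3 ⊢
      rw [mem_singleton_iff.1 h2] at h3
      exact ⟨h1, h3⟩
  set N := (fun x => Good.xi c U V (a, x, pb)) '' K with hN
  have hNc : IsCompact N := hKc.image_of_continuousOn ((G.xi_contx hD).mono hKU)
  have hNv : Convex ℝ N := G.xi_convex hD hKU (fun x0 h0 x1 h1 s hs =>
    ⟨subset_closure (G.Xs_mem hybV (hKU h0) (hKU h1) hs),
      T.S.contact_Xs hybV (hKU h0) (hKU h1) h0.2 h1.2 hs⟩)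
  by_contra! hcon
  have hdisj : Disjoint N ((fun t : ℝ => t • e) '' Ici 0) := by
    rw [Set.disjoint_left]
    rintro _ ⟨x, hx, rfl⟩ ⟨t, ht, hte⟩
    dsimp only at hte
    rcases (mem_Ici.1 ht).eq_or_lt with h0 | h0
    · rw [← h0, zero_smul] at hte
      have hxa : x = a := by
        refine G.xi_inj hD (hKU hx) T.aU ?_
        rw [← hte, G.xi_self hD]
      have hp0 := T.L.dp a T.ha p0 (mem_of_mem_nhds T.p0P)
      have := T.om_contact (p := p0) (p1 := pb) (x := x) hp0 hx.1 hx.2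
      rw [hxa, Good.Phi_apply, Good.Phi_apply, T.om0, om_b] at this
      linarith [T.Hpos]
    · exact hcon x hx.1 hx.2 t h0 hte.symm
  have hRv : Convex ℝ ((fun t : ℝ => t • e) '' Ici 0) :=
    (convex_Ici (0:ℝ)).is_linear_image (f := fun t : ℝ => t • e)
      (LinearMap.isLinear (LinearMap.toSpanSingleton ℝ (Euc n) e))
  have hRc : IsClosed ((fun t : ℝ => t • e) '' Ici 0) := by
    have : Isometry (fun t : ℝ => t • e) := by
      refine Isometry.of_dist_eq fun s t => ?_
      rw [dist_eq_norm, ← sub_smul, norm_smul, he, mul_one, dist_eq_norm]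
    exact this.isClosedEmbedding.isClosedMap _ isClosed_Ici
  obtain ⟨f, s, r, hfN, hsr, hfR⟩ := geometric_hahn_banach_compact_closed hNv hNc hRv hRc hdisj
  have hr0 : r < 0 := by
    have := hfR 0 ⟨0, by simp, by simp⟩
    simpa using this
  have hfe : 0 ≤ f e := by
    by_contra! hneg
    have := hfR ((r / f e) • e) ⟨r / f e, (div_pos_of_neg_of_neg hr0 hneg).le, rfl⟩
    rw [map_smul, smul_eq_mul, div_mul_cancel₀ _ hneg.ne] at this
    exact lt_irrefl _ this
  set τ := (InnerProductSpace.toDual ℝ (Euc n)).symm f with hτ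
  have hfτ : ∀ x, f x = inner ℝ τ x := fun x => by rw [hτ, InnerProductSpace.toDual_symm_apply]
  obtain ⟨R, hR⟩ := hNc.isBounded.exists_norm_le
  set ε := (-s) / (2 * (|R| + 1)) with hε
  have hs0 : s < 0 := hsr.trans hr0
  have hεp : 0 < ε := by
    have : 0 < -s := by linarith
    positivity
  set σ := τ + ε • e with hσ
  have hσN : ∀ x ∈ N, inner ℝ σ x < 0 := by
    intro x hx
    rw [hσ, inner_add_left, ← hfτ, inner_smul_left]
    have h1 := hfN x hx
    have h2 : inner ℝ e x ≤ |R| + 1 := by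
      have := real_inner_le_norm e x
      rw [he, one_mul] at this
      linarith [hR x hx, le_abs_self R]
    have h3 : ε * inner ℝ e x ≤ ε * (|R| + 1) := by gcongr
    have h4 : ε * (|R| + 1) = -s/2 := by rw [hε]; field_simp
    simp only [conj_trivial]
    linarith
  have hσe : 0 < inner ℝ σ e := by
    rw [hσ, inner_add_left, ← hfτ, inner_smul_left, real_inner_self_eq_norm_sq, he]
    simp only [conj_trivial]
    linarith
  -- sequence
  have hop : IsOpen {p | (a, p) ∈ DP c U V} := G.oDP.preimage (by fun_prop : Continuous fun p => (a, p))
  have h3 : Tendsto (fun s : ℝ => pb + s • σ) (𝓝[>] 0) (𝓝 pb) := by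
    have : Continuous (fun s : ℝ => pb + s • σ) := by fun_prop
    have := this.tendsto 0
    simp only [zero_smul, add_zero] at this
    exact this.mono_left nhdsWithin_le_nhds
  have hseq : Tendsto (fun k : ℕ => 1 / ((k:ℝ) + 1)) atTop (𝓝[>] 0) :=
    tendsto_nhdsWithin_iff.2 ⟨tendsto_one_div_add_atTop_nhds_zero_nat,
      Eventually.of_forall fun k => by simp only [mem_Ioi]; positivity⟩
  have h4 := h3.comp hseq
  set pk : ℕ → Euc n := fun k => pb + (1 / ((k:ℝ) + 1)) • σ with hpk
  have h4 : Tendsto pk atTop (𝓝 pb) := h4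
  obtain ⟨k0, hk0⟩ := eventually_atTop.1 (h4.eventually (hop.mem_nhds hD))
  have hpD : ∀ j, (a, pk (j + k0)) ∈ DP c U V := fun j => hk0 _ (by omega)
  have h5 : Tendsto (fun j => pk (j + k0)) atTop (𝓝 pb) := h4.comp (tendsto_add_atTop_nat k0)
  have hx : ∀ j, ∃ x ∈ closure U, u x + v (Yv c U V (a, pk (j + k0))) + c x (Yv c U V (a, pk (j+k0))) = 0 :=
    fun j => T.S.eyx _ (subset_closure (G.Yv_mem (hpD j)))
  choose x hxU hxc using hx
  have hxi : ∀ j, 0 < inner ℝ σ (Good.xi c U V (a, x j, pk (j + k0))) := by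
    intro j
    have hpos : 0 < 1 / (((j + k0 : ℕ):ℝ) + 1) := by positivity
    have hom : 0 < om c U V v a k (pk (j + k0)) := by
      by_contra! hle
      have h7 := hmax _ (T.memQ (hpD j) hle).1
      rw [hpk] at h7
      dsimp only at h7
      rw [inner_add_right, inner_smul_right, real_inner_comm σ e] at h7
      have := mul_pos hpos hσe
      linarith
    have h8 := T.om_contact (p := pb) (p1 := pk (j + k0)) (x := x j) hD (hxU j) (hxc j)
    by_contra! hle
    have hxjU := T.S.inU _ (G.Yv_mem (hpD j)) _ (hxU j) (hxc j)
    have h9 := G.slope_nonneg (a := a) (x := x j) (p := pk (j + k0)) (p' := pb) hxjU (hpD j) hD (by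
      have : pb - pk (j + k0) = - ((1 / (((j + k0 : ℕ):ℝ) + 1)) • σ) := by
        rw [hpk]; dsimp only; module
      rw [this, inner_neg_right, inner_smul_right, real_inner_comm]
      nlinarith)
    linarith
  obtain ⟨xi, hxiU, φ, hφ, hlim⟩ := T.S.cU.tendsto_subseq hxU
  have h6 : Tendsto (fun j => pk (φ j + k0)) atTop (𝓝 pb) := h5.comp hφ.tendsto_atTop
  have hYt : Tendsto (fun j => Yv c U V (a, pk (φ j + k0))) atTop (𝓝[closure V] yb) := by
    refine tendsto_nhdsWithin_iff.2 ⟨?_, Eventually.of_forall fun j => subset_closure (G.Yv_mem (hpD _))⟩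
    have : ContinuousAt (fun p => Yv c U V (a, p)) pb :=
      (G.Yv_contp (a := a) (P := {p | (a, p) ∈ DP c U V}) (fun p hp => hp)).continuousAt (hop.mem_nhds hD)
    exact this.tendsto.comp h6
  have hxt : Tendsto (fun j => x (φ j)) atTop (𝓝[closure U] xi) :=
    tendsto_nhdsWithin_iff.2 ⟨hlim, Eventually.of_forall fun j => hxU _⟩
  have hct : u xi + v yb + c xi yb = 0 := by
    have e1 := (T.S.cu xi hxiU).tendsto.comp hxt
    have e2 := (T.S.cv yb (subset_closure hybV)).tendsto.comp hYt
    have e3 : Tendsto (fun j => (x (φ j), Yv c U V (a, pk (φ j + k0)))) atTop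
        (𝓝[closure U ×ˢ closure V] (xi, yb)) := by
      rw [nhdsWithin_prod_eq]
      exact hxt.prodMk hYt
    have e4 := (T.S.cont (xi, yb) ⟨hxiU, subset_closure hybV⟩).tendsto.comp e3
    have e5 := (e1.add e2).add e4
    refine tendsto_nhds_unique e5 ?_
    refine tendsto_const_nhds.congr fun j => ?_
    exact (hxc (φ j)).symm
  have hxiK : xi ∈ K := ⟨hxiU, hct⟩
  have hcx : ContinuousAt (Good.xi c U V) (a, xi, pb) :=
    G.xi_cont.continuousAt (G.oDF.mem_nhds ⟨hKU hxiK, hD⟩)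
  have e6 : Tendsto (fun j => (a, x (φ j), pk (φ j + k0))) atTop (𝓝 (a, xi, pb)) :=
    tendsto_const_nhds.prodMk_nhds (hlim.prodMk_nhds h6)
  have e7 := (hcx.tendsto.comp e6)
  have e8 : Tendsto (fun j => inner ℝ σ (Good.xi c U V (a, x (φ j), pk (φ j + k0)))) atTop
      (𝓝 (inner ℝ σ (Good.xi c U V (a, xi, pb)))) := tendsto_const_nhds.inner e7
  have e9 : 0 ≤ inner ℝ σ (Good.xi c U V (a, xi, pb)) :=
    ge_of_tendsto' e8 (fun j => (hxi _).le)
  have := hσN _ ⟨xi, hxiK, rfl⟩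
  dsimp only at this
  linarith

theorem dualpt (T : Sec c U V u v O lam Lam A P X κ C η a p0 k H ρ) {e : Euc n} (he : ‖e‖ = 1)
    {θ : ℝ} (hθ : 0 < θ) (hθ1 : θ ≤ 1) (hCρ : C * ρ ≤ 1/2) {D : ℝ}
    (hD : ∀ p ∈ Qs c U V v P a k, inner ℝ e (p - p0) ≤ D) :
    ∃ x ∈ X, ∃ t : ℝ, θ * κ * H / D ≤ t ∧ t ≤ θ * C ∧ 
      ‖Good.xi c U V (a, x, p0) - t • e‖ ≤ C * ρ * t ∧
      ∀ p ∈ Qs c U V v P a k, Phi c U V (a, x, p) - Phi c U V (a, x, p0) ≤ θ * H := by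
  have G := T.S.G
  have hk := T.L.kpos
  have hH := T.Hpos
  obtain ⟨r, hr, hball⟩ := T.Q_ball
  have p0Q : p0 ∈ Qs c U V v P a k := hball (mem_closedBall_self hr.le)
  obtain ⟨pb, hpb, hmax⟩ := T.Q_compact.exists_isMaxOn ⟨p0, p0Q⟩
    (f := fun p => inner ℝ e p) (by fun_prop)
  have hmax : ∀ p ∈ Qs c U V v P a k, inner ℝ e p ≤ inner ℝ e pb := fun p hp => hmax hp
  set δ := inner ℝ e (pb - p0) with hδ
  have hδp : 0 < δ := by
    have := hmax (p0 + r • e) (hball (by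
      rw [mem_closedBall, dist_eq_norm, add_sub_cancel_left, norm_smul, he, mul_one, Real.norm_eq_abs,
        abs_of_pos hr]))
    rw [inner_add_right, inner_smul_right, real_inner_self_eq_norm_sq, he] at this
    rw [hδ, inner_sub_right]
    linarith
  have hδD : δ ≤ D := hD pb hpb
  obtain ⟨x, hxU, hxc, t, ht, hxt⟩ := T.normal he hpb hmax
  have om_b := T.om_pb he hpb hmax
  obtain ⟨hxX, hxs⟩ := T.L.ct a T.ha pb hpb.1 x hxU hxc
  have hDb := T.L.dp a T.ha pb hpb.1
  have hD0 := T.L.dp a T.ha p0 p0Q.1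
  have hm1 : ∀ p ∈ Qs c U V v P a k, Phi c U V (a, x, p) - Phi c U V (a, x, pb) ≤ om c U V v a k p := by
    intro p hp
    have := T.om_contact (p := p) (p1 := pb) (x := x) (T.L.dp a T.ha p hp.1) hxU hxc
    rw [om_b] at this; linarith
  have hig : ∀ s : ℝ, inner ℝ (s • e) (p0 - pb) = -(s * δ) := by
    intro s
    rw [hδ, inner_smul_left, ← neg_sub pb p0, inner_neg_right]; simp
  have htδ : κ * H ≤ t * δ := by
    have h1 := T.L.k1 a T.ha x hxX pb hpb.1 p0 p0Q.1
    rw [hxt, hig] at h1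
    have h2 := hm1 p0 p0Q
    rw [T.om0] at h2
    have h3 := h1.trans h2
    by_contra! hlt
    have h4 := min_lower (g := -(t*δ)) (B := t * δ) hk (by positivity) le_rfl
    have hmx : max κ κ⁻¹ = κ⁻¹ := max_eq_right (by
      rw [le_inv_comm₀ hk hk]; exact T.L.kle.trans (one_le_inv₀ hk |>.2 T.L.kle))
    rw [hmx] at h4
    have h5 : κ⁻¹ * (t * δ) < H := by rw [inv_mul_lt_iff₀ hk]; exact hlt
    linarith
  set σ := θ * κ * H / (t * δ) with hσ
  have hσ0 : 0 < σ := by positivity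
  have hσθ : σ ≤ θ := by
    rw [hσ, div_le_iff₀ (by positivity)]; nlinarith
  have hσI : σ ∈ Icc (0:ℝ) 1 := ⟨hσ0.le, hσθ.trans hθ1⟩
  set x' := Xs c U V (Yv c U V (a, pb)) a x σ with hx'
  have hx'X : x' ∈ X := hxs σ hσI
  have hxi : Good.xi c U V (a, x', pb) = (σ * t) • e := by
    rw [hx', G.xi_Xs hDb T.aU (T.L.XU hxX) hσI, G.xi_self hDb, hxt, zero_add, sub_zero, smul_smul]
  have hms : ∀ p ∈ Qs c U V v P a k, Phi c U V (a, x', p) - Phi c U V (a, x', pb) ≤ 0 := by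
    intro p hp
    have h1 := G.dual_quasi (G.Yv_mem hDb) (G.Yv_mem (T.L.dp a T.ha p hp.1)) T.aU (T.L.XU hxX) hσI
    have h2 := (hm1 p hp).trans hp.2
    rw [Good.Phi_apply, Good.Phi_apply] at h2 ⊢
    rw [← hx'] at h1
    rcases le_max_iff.1 h1 with h | h <;> linarith
  have hst : σ * t = θ * κ * H / δ := by rw [hσ]; field_simp
  have htC : t ≤ C := by
    have := T.L.bd a T.ha x hxX pb hpb.1
    rwa [hxt, norm_smul, he, mul_one, Real.norm_eq_abs, abs_of_pos ht] at this
  have hp0b : ‖p0 - pb‖ ≤ ρ := by rw [norm_sub_rev]; exact T.Q_rho hpb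
  have hst0 : 0 < σ * t := by positivity
  refine ⟨x', hx'X, σ * t, ?_, ?_, ?_, ?_⟩
  · rw [hst]; gcongr
  · exact mul_le_mul hσθ htC ht.le hθ.le
  · have h1 := T.L.lip a T.ha x' hx'X pb hpb.1 p0 p0Q.1
      ((mul_le_mul_of_nonneg_left hp0b T.L.Cpos.le).trans hCρ)
    rw [hxi, norm_smul, he, mul_one, Real.norm_eq_abs, abs_of_pos hst0] at h1
    refine h1.trans ?_
    have := T.L.Cpos
    gcongr
  · intro p hp
    have h1 := hms p hp
    have h2 := T.L.k1 a T.ha x' hx'X pb hpb.1 p0 p0Q.1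
    rw [hxi, hig] at h2
    have h4 := min_lower (g := -(σ * t*δ)) (B := σ * t * δ) hk (by positivity) le_rfl
    have hmx : max κ κ⁻¹ = κ⁻¹ := max_eq_right (by
      rw [le_inv_comm₀ hk hk]; exact T.L.kle.trans (one_le_inv₀ hk |>.2 T.L.kle))
    rw [hmx] at h4
    have h5 : κ⁻¹ * (σ * t * δ) = θ * H := by rw [hst]; field_simp
    rw [h5] at h4
    linarith

theorem contact_in_Q (T : Sec c U V u v O lam Lam A P X κ C η a p0 k H ρ) {θ : ℝ} (hθ1 : θ < 1)
    {x : Euc n} (hxO : x ∈ O)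
    (hx : ∀ p ∈ Qs c U V v P a k, Phi c U V (a, x, p) - Phi c U V (a, x, p0) ≤ θ * H)
    {y : Euc n} (hy : y ∈ closure V) (hc : u x + v y + c x y = 0) :
    y ∈ (fun p => Yv c U V (a, p)) '' Qs c U V v P a k := by
  have G := T.S.G
  have hyV := T.S.inV x hxO y hy hc
  have hxU := T.S.sO hxO
  have hH := T.Hpos
  have hD0 := T.L.dp a T.ha p0 (mem_of_mem_nhds T.p0P)
  set y0 := Yv c U V (a, p0) with hy0
  have hy0V : y0 ∈ V := G.Yv_mem hD0
  by_cases hle : om c U V v a k (pm c a y) ≤ 0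
  · exact ⟨pm c a y, (T.memQ (Good.pm_mem_DP T.aU hyV) hle).1, G.Yv_pm T.aU hyV⟩
  push Not at hle
  exfalso
  have d0 := Good.pm_mem_DP (c := c) (U := U) (V := V) hxU hy0V
  have d1 := Good.pm_mem_DP (c := c) (U := U) (V := V) hxU hyV
  set yt : ℝ → Euc n := fun t => Yv c U V (x, pm c x y0 + t • (pm c x y - pm c x y0)) with hyt
  have hytV : ∀ t ∈ Icc (0:ℝ) 1, yt t ∈ V := fun t ht => G.Yv_mem (G.DP_seg d0 d1 ht)
  have hytc : ContinuousOn yt (Icc 0 1) :=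
    G.Yv_smooth.continuousOn.comp (f := fun t : ℝ => (x, pm c x y0 + t • (pm c x y - pm c x y0)))
      (by fun_prop) (fun t ht => G.DP_seg d0 d1 ht)
  have e0 : yt 0 = y0 := by simp only [hyt, zero_smul, add_zero]; exact G.Yv_pm hxU hy0V
  have e1 : yt 1 = y := by
    simp only [hyt, one_smul, add_sub_cancel]; exact G.Yv_pm hxU hyV
  have hh : ContinuousOn (fun t => v (yt t) + c a (yt t) - k) (Icc 0 1) := by
    refine ((T.S.cv.comp hytc (fun t ht => subset_closure (hytV t ht))).add ?_).sub continuousOn_const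
    exact T.S.cont.comp (f := fun t => (a, yt t)) (continuousOn_const.prodMk hytc)
      (fun t ht => mk_mem_prod (subset_closure T.aU) (subset_closure (hytV t ht)))
  have om0 := T.om0
  unfold om at om0 hle
  rw [G.Yv_pm T.aU hyV] at hle
  rw [← hy0] at om0
  obtain ⟨t, ht, h0⟩ := intermediate_value_Icc (zero_le_one) hh (show (0:ℝ) ∈ _ from by
    rw [e0, e1]
    constructor <;> linarith)
  dsimp only at h0
  have hs := T.S.sub_conv d0 d1 ht
  rw [G.Yv_pm hxU hyV, G.Yv_pm hxU hy0V] at hs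
  change v (yt t) + c x (yt t) ≤ _ at hs
  have g0 := T.S.ge x (subset_closure hxU) y0 (subset_closure hy0V)
  have hs' : v (yt t) + c x (yt t) ≤ v y0 + c x y0 := by
    rcases le_max_iff.1 hs with h | h <;> linarith
  have hDt := Good.pm_mem_DP (c := c) (U := U) (V := V) T.aU (hytV t ht)
  have hYt := G.Yv_pm T.aU (hytV t ht)
  have h6 := hx _ (T.memQ hDt (by unfold om; rw [hYt]; linarith)).1
  rw [Good.Phi_apply, Good.Phi_apply, hYt, ← hy0] at h6
  nlinarith

theorem upper_est (T : Sec c U V u v O lam Lam A P X κ C η a p0 k H ρ)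
    (b : OrthonormalBasis (Fin n) ℝ (Euc n)) (hn : 0 < n) {θ ε M : ℝ} (hθ : 0 < θ) (hθ1 : θ < 1)
    (hθη : 2 * θ * C < η) (hCρ : C * ρ ≤ 1/2) (hCε : C * ρ ≤ ε)
    (hdet : ∀ (z : Fin n → Euc n) (t : Fin n → ℝ), (∀ i, 0 < t i) →
      (∀ i, ‖z i - t i • b i‖ ≤ ε * t i) → (1/2) * ∏ i, t i ≤ |LinearMap.det (wmap b z)|)
    (D : Fin n → ℝ) (hD : ∀ i, 0 < D i)
    (hQD : ∀ i, ∀ p ∈ Qs c U V v P a k, inner ℝ (b i) (p - p0) ≤ D i)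
    (hM0 : 0 ≤ M) (hM : volume (Qs c U V v P a k) ≤ ENNReal.ofReal M) :
    lam / 2 * (θ * κ * H / n) ^ n ≤ C^2 * M * ∏ i, D i := by
  have G := T.S.G
  have hk := T.L.kpos
  have hH := T.Hpos
  have hC := T.L.Cpos
  have hlam := T.S.hlam
  have hn' : (0:ℝ) < n := by exact_mod_cast hn
  have hD0 := T.L.dp a T.ha p0 (mem_of_mem_nhds T.p0P)
  have p0P := mem_of_mem_nhds T.p0P
  set Q := Qs c U V v P a k with hQ
  have hb1 : ∀ i, ‖b i‖ = 1 := fun i => b.orthonormal.1 i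
  have hpt := fun i => T.dualpt (hb1 i) hθ hθ1.le hCρ (hQD i)
  choose x hxX t ht1 ht2 hxt hxQ using hpt
  have htp : ∀ i, 0 < t i := fun i => lt_of_lt_of_le (by have := hD i; positivity) (ht1 i)
  set ζ : Fin n → Euc n := fun i => Good.xi c U V (a, x i, p0) with hζ
  have hdz := hdet ζ t htp (fun i => (hxt i).trans (by have := htp i; gcongr))
  have hζn : ∀ i, ‖ζ i‖ ≤ 2 * θ * C := by
    intro i
    have h1 : ‖ζ i‖ ≤ ‖ζ i - t i • b i‖ + ‖t i • b i‖ := by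
      have := norm_add_le (ζ i - t i • b i) (t i • b i)
      rwa [sub_add_cancel] at this
    rw [norm_smul, hb1, mul_one, Real.norm_eq_abs, abs_of_pos (htp i)] at h1
    have h2 : C * ρ * t i ≤ 1/2 * t i := by have := htp i; gcongr
    have h3 := hxt i
    have h4 := ht2 i
    have h5 := htp i
    change ‖ζ i - t i • b i‖ ≤ _ at h3
    linarith
  set P' : Set (Euc n) := {x | x ∈ U ∧ ∀ p ∈ Q, Phi c U V (a, x, p) - Phi c U V (a, x, p0) ≤ θ * H} with hP'
  have hcv : Convex ℝ ((fun x => Good.xi c U V (a, x, p0)) '' P') := by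
    refine G.xi_convex hD0 (fun x hx => hx.1) ?_
    intro x0 h0 x1 h1 s hs
    refine ⟨G.Xs_mem (G.Yv_mem hD0) h0.1 h1.1 hs, fun p hp => ?_⟩
    have h2 := G.dual_quasi (G.Yv_mem hD0) (G.Yv_mem (T.L.dp a T.ha p hp.1)) h0.1 h1.1 hs
    have h3 := h0.2 p hp
    have h4 := h1.2 p hp
    rw [Good.Phi_apply, Good.Phi_apply] at h3 h4 ⊢
    rcases le_max_iff.1 h2 with h | h <;> linarith
  have hz0 : (0 : Euc n) ∈ (fun x => Good.xi c U V (a, x, p0)) '' P' := by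
    refine ⟨a, ⟨T.aU, fun p hp => ?_⟩, G.xi_self hD0⟩
    rw [Good.Phi_apply, Good.Phi_apply]
    have : 0 ≤ θ * H := by positivity
    linarith
  have hzi : ∀ i, ζ i ∈ (fun x => Good.xi c U V (a, x, p0)) '' P' := fun i =>
    ⟨x i, ⟨T.L.XU (hxX i), hxQ i⟩, rfl⟩
  set cube : Set (Euc n) := {x : Euc n | ∀ i, inner ℝ (b i) x ∈ Icc 0 (1/(n:ℝ))} with hcube
  set Zc := wmap b ζ '' cube with hZc
  have hZcc : IsCompact Zc := (cube_compact b _ _).image (LinearMap.continuous_of_finiteDimensional _)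
  have hZsub : Zc ⊆ (fun x => Good.xi c U V (a, x, p0)) '' P' := by
    rintro _ ⟨s, hs, rfl⟩
    rw [wmap_apply]
    have hsum : ∑ i, inner ℝ (b i) s ≤ 1 := by
      calc _ ≤ ∑ i : Fin n, 1/(n:ℝ) := Finset.sum_le_sum fun i _ => (hs i).2
        _ = 1 := by simp [hn'.ne']
    have := hcv.sum_mem (t := Finset.univ) (w := fun o : Option (Fin n) => o.elim (1 - ∑ i, inner ℝ (b i) s) (fun i => inner ℝ (b i) s))
      (z := fun o : Option (Fin n) => o.elim 0 ζ) (by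
        intro o _; cases o with
        | none => simpa using hsum
        | some i => exact (hs i).1) (by simp [Fintype.sum_option]) (by
        intro o _; cases o with
        | none => exact hz0
        | some i => exact hzi i)
    simpa only [Fintype.sum_option, Option.elim, smul_zero, zero_add] using this
  have hZn : ∀ ξ ∈ Zc, ‖ξ‖ < η := by
    rintro _ ⟨s, hs, rfl⟩
    rw [wmap_apply]
    refine lt_of_le_of_lt ?_ hθη
    calc _ ≤ ∑ i, ‖inner ℝ (b i) s • ζ i‖ := norm_sum_le _ _
      _ ≤ ∑ i : Fin n, 1/(n:ℝ) * (2 * θ * C) := by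
        refine Finset.sum_le_sum fun i _ => ?_
        rw [norm_smul, Real.norm_eq_abs, abs_of_nonneg (hs i).1]
        exact mul_le_mul (hs i).2 (hζn i) (norm_nonneg _) (by positivity)
      _ = 2 * θ * C := by simp; field_simp
  set P0 : Set (Euc n) := {x | x ∈ X ∧ Good.xi c U V (a, x, p0) ∈ Zc} with hP0
  have hP0c : IsCompact P0 := by
    have h := ((G.xi_contx hD0).mono T.L.XU).preimage_isClosed_of_isClosed T.L.cX.isClosed hZcc.isClosed
    exact T.L.cX.of_isClosed_subset h inter_subset_left
  have hP0P : P0 ⊆ P' := by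
    intro x hx
    obtain ⟨x', hx', he⟩ := hZsub hx.2
    rwa [G.xi_inj hD0 (T.L.XU hx.1) hx'.1 he.symm]
  have hP0O : P0 ⊆ O := fun x hx => (T.L.near a T.ha p0 p0P x (T.L.XU hx.1) (hZn _ hx.2)).1
  have hP0X : P0 ⊆ X := fun x hx => hx.1
  have hZP0 : Zc ⊆ (fun x => Good.xi c U V (a, x, p0)) '' P0 := by
    intro ξ hξ
    obtain ⟨x, hx, he⟩ := hZsub hξ
    dsimp only at he
    refine ⟨x, ⟨(T.L.near a T.ha p0 p0P x hx.1 ?_).2, ?_⟩, he⟩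
    · rw [he]; exact hZn _ hξ
    · rw [he]; exact hξ
  have v1 : volume Zc = ENNReal.ofReal (|LinearMap.det (wmap b ζ)| * (1/(n:ℝ)) ^ n) := by
    rw [hZc, hcube, vol_wmap b ζ _ _ (by positivity), sub_zero]
  have v2 := (measure_mono hZP0).trans (T.L.volxi a T.ha p0 p0P P0 hP0X hP0c)
  have v3 := T.S.vge P0 hP0O hP0c.isClosed.measurableSet
  have v4 : volume {y | y ∈ closure V ∧ ∃ x ∈ P0, u x + v y + c x y = 0} ≤
      volume ((fun p => Yv c U V (a, p)) '' Q) := by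
    refine measure_mono ?_
    rintro y ⟨hy, x, hx, hc⟩
    exact T.contact_in_Q hθ1 (hP0O hx) (hP0P hx).2 hy hc
  have v5 := T.L.volY a T.ha Q (fun p hp => hp.1) T.Q_compact
  have v6 : ENNReal.ofReal lam * volume Zc ≤ ENNReal.ofReal C * (ENNReal.ofReal C * ENNReal.ofReal M) := by
    calc ENNReal.ofReal lam * volume Zc ≤ ENNReal.ofReal lam * (ENNReal.ofReal C * volume P0) := by gcongr
      _ = ENNReal.ofReal C * (ENNReal.ofReal lam * volume P0) := by ring
      _ ≤ _ := mul_le_mul_right (v3.trans (v4.trans (v5.trans (mul_le_mul_right hM _)))) _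
  rw [v1, ← ENNReal.ofReal_mul hlam.le, ← ENNReal.ofReal_mul hC.le, ← ENNReal.ofReal_mul hC.le,
    ENNReal.ofReal_le_ofReal_iff (by positivity)] at v6
  have hpt : ∏ i, (θ * κ * H / D i) ≤ ∏ i, t i :=
    Finset.prod_le_prod (fun i _ => by have := hD i; positivity) (fun i _ => ht1 i)
  rw [Finset.prod_div_distrib, Finset.prod_const, Finset.card_univ, Fintype.card_fin] at hpt
  have hDp : 0 < ∏ i, D i := Finset.prod_pos fun i _ => hD i
  rw [div_le_iff₀ hDp] at hpt
  have h1 : (θ * κ * H / n)^n = (θ * κ * H)^n * (1/(n:ℝ))^n := by rw [← mul_pow]; congr 1; ring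
  rw [h1]
  calc lam/2 * ((θ * κ * H)^n * (1/(n:ℝ))^n) ≤ lam/2 * (((∏ i, t i) * ∏ i, D i) * (1/(n:ℝ))^n) := by gcongr
    _ = lam * (((1/2) * ∏ i, t i) * (1/(n:ℝ))^n) * ∏ i, D i := by ring
    _ ≤ lam * (|LinearMap.det (wmap b ζ)| * (1/(n:ℝ))^n) * ∏ i, D i := by gcongr
    _ ≤ C * (C * M) * ∏ i, D i := by gcongr
    _ = _ := by ring
end Sec
end FKM

end


section
open Set MeasureTheory Metric Bornology Filter Topology
open scoped ENNReal NNReal Pointwise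

namespace FKM
attribute [local irreducible] qm pm Yv Xinv Phi

theorem Sec.main_est {m : ℕ} {c : Euc (m+1) → Euc (m+1) → ℝ} {U V O A P X : Set (Euc (m+1))}
    {u v : Euc (m+1) → ℝ} {lam Lam κ C η : ℝ} {a p0 : Euc (m+1)} {k H ρ : ℝ}
    (T : Sec c U V u v O lam Lam A P X κ C η a p0 k H ρ) {θ ε τ d : ℝ} (hθ : 0 < θ) (hθ1 : θ < 1)
    (hθη : 2 * θ * C < η) (hCρ : C * ρ ≤ 1/2) (hCε : C * ρ ≤ ε)
    (hdet : ∀ (b : OrthonormalBasis (Fin (m+1)) ℝ (Euc (m+1))) (z : Fin (m+1) → Euc (m+1))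
      (t : Fin (m+1) → ℝ), (∀ i, 0 < t i) →
      (∀ i, ‖z i - t i • b i‖ ≤ ε * t i) → (1/2) * ∏ i, t i ≤ |LinearMap.det (wmap b z)|)
    (w1 : Euc (m+1)) (hw1 : p0 + w1 ∈ Qs c U V v P a k) (hd : 0 < d) (hdw : d ≤ ‖w1‖) (hτ : 0 < τ)
    (hτQ : ∀ p ∈ Qs c U V v P a k, inner ℝ (-(‖w1‖⁻¹ • w1)) (p - p0) ≤ τ) :
    lam / 2 * (θ * κ / (m+1)) ^ (m+1) * d^2 ≤
      C^2 * 2^(m+1) * ρ * (Lam * C^2 * (8 * ((m:ℝ)+1+1)^3 / κ^3) ^ (m+1)) * τ := by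
  have hw0 : 0 < ‖w1‖ := hd.trans_le hdw
  have hH := T.Hpos
  have hC := T.L.Cpos
  obtain ⟨r, hr, hball⟩ := T.Q_ball
  set Q := Qs c U V v P a k with hQ
  have p0Q : p0 ∈ Q := hball (mem_closedBall_self hr.le)
  have hρ : 0 ≤ ρ := (norm_nonneg _).trans (T.Q_rho p0Q)
  set f0 := -(‖w1‖⁻¹ • w1) with hf0
  have hf1 : ‖f0‖ = 1 := by
    rw [hf0, norm_neg, norm_smul, norm_inv, norm_norm, inv_mul_cancel₀ hw0.ne']
  have hwf : w1 = -(‖w1‖ • f0) := by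
    rw [hf0, smul_neg, neg_neg, smul_smul, mul_inv_cancel₀ hw0.ne', one_smul]
  obtain ⟨b, w', hb0, hw'⟩ := greedy m f0 hf1 ((fun p => p - p0) '' Q)
    (T.Q_compact.image (by fun_prop)) hr (by
      intro z hz
      refine ⟨p0 + z, hball ?_, by simp⟩
      simpa [mem_closedBall, dist_eq_norm] using hz)
  have hb1 : ∀ i, ‖b i‖ = 1 := fun i => b.orthonormal.1 i
  set w := Function.update w' 0 w1 with hw
  have w0 : w 0 = w1 := by simp [hw]
  have wi : ∀ i, i ≠ 0 → w i = w' i := fun i hi => by simp [hw, hi]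
  have hwQ : ∀ i, p0 + w i ∈ Q := by
    intro i
    by_cases hi : i = 0
    · rw [hi, w0]; exact hw1
    · rw [wi i hi]
      obtain ⟨p, hp, he⟩ := (hw' i hi).1
      rw [← he]; simpa using hp
  have hin0 : inner ℝ (b 0) (w 0) = -‖w1‖ := by
    rw [w0, hb0]
    conv_lhs => rw [hwf]
    rw [inner_neg_right, inner_smul_right, real_inner_self_eq_norm_sq, hf1]; simp
  have horth : ∀ i j, i < j → inner ℝ (b j) (w i) = 0 := by
    intro i j hij
    by_cases hi : i = 0
    · subst hi
      rw [w0, hwf, ← hb0, inner_neg_right, inner_smul_right, b.orthonormal.2 hij.ne']; simp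
    · rw [wi i hi]; exact (hw' i hi).2.2 j hij
  have hai : ∀ i, i ≠ 0 → (∀ p ∈ Q, |inner ℝ (b i) (p - p0)| ≤ inner ℝ (b i) (w i)) := by
    intro i hi p hp
    rw [wi i hi]
    exact (hw' i hi).2.1 _ ⟨p, hp, rfl⟩
  have hap : ∀ i, i ≠ 0 → 0 < inner ℝ (b i) (w i) := by
    intro i hi
    have := hai i hi (p0 + r • b i) (hball (by
      rw [mem_closedBall, dist_eq_norm, add_sub_cancel_left, norm_smul, hb1, mul_one, Real.norm_eq_abs,
        abs_of_pos hr]))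
    rw [add_sub_cancel_left, inner_smul_right, real_inner_self_eq_norm_sq, hb1] at this
    refine lt_of_lt_of_le ?_ this
    rw [one_pow, mul_one, abs_of_pos hr]; exact hr
  set Pq : ℝ := ∏ i : Fin m, inner ℝ (b i.succ) (w i.succ) with hPq
  have hPqp : 0 < Pq := Finset.prod_pos fun i _ => hap _ (Fin.succ_ne_zero i)
  have hdW : LinearMap.det (wmap b w) = -‖w1‖ * Pq := by
    rw [det_wmap b w horth, Fin.prod_univ_succ, hin0]
  have hlow := T.lower_est b w hwQ (by
    rw [hdW]; exact mul_ne_zero (by simpa using hw0.ne') hPqp.ne')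
  rw [hdW, sq_abs] at hlow
  push_cast at hlow
  set C5 := Lam * C^2 * (8 * ((m:ℝ)+1+1)^3 / κ^3) ^ (m+1) with hC5
  have hvol : volume Q ≤ ENNReal.ofReal (2^(m+1) * ρ * Pq) := by
    set E : Fin (m+1) → ℝ := Fin.cons ρ (fun i => inner ℝ (b i.succ) (w i.succ)) with hE
    have hsub : Q ⊆ p0 +ᵥ {x : Euc (m+1) | ∀ i, inner ℝ (b i) x ∈ Icc (-E i) (E i)} := by
      intro p hp
      rw [mem_vadd_set]
      refine ⟨p - p0, fun i => ?_, by simp⟩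
      rw [mem_Icc, ← abs_le]
      refine Fin.cases ?_ (fun j => ?_) i
      · simp only [hE, Fin.cons_zero]
        refine (abs_real_inner_le_norm _ _).trans ?_
        rw [hb1, one_mul]; exact T.Q_rho hp
      · simp only [hE, Fin.cons_succ]
        exact hai _ (Fin.succ_ne_zero j) p hp
    refine (measure_mono hsub).trans ?_
    rw [measure_vadd, vol_box, ← ENNReal.ofReal_prod_of_nonneg]
    · refine ENNReal.ofReal_le_ofReal (le_of_eq ?_)
      rw [Fin.prod_univ_succ]
      simp only [hE, Fin.cons_zero, Fin.cons_succ, sub_neg_eq_add, ← two_mul, Finset.prod_mul_distrib,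
        Finset.prod_const, Finset.card_univ, Fintype.card_fin]
      rw [← hPq]; ring
    · intro i _
      refine Fin.cases ?_ (fun j => ?_) i
      · simp only [hE, Fin.cons_zero]; linarith
      · simp only [hE, Fin.cons_succ]; linarith [hap _ (Fin.succ_ne_zero j)]
  have hup := T.upper_est b (Nat.succ_pos m) hθ hθ1 hθη hCρ hCε (hdet b)
    (Fin.cons τ (fun i : Fin m => inner ℝ (b i.succ) (w i.succ))) (by
      intro i
      refine Fin.cases ?_ (fun j => ?_) i
      · simpa using hτ
      · simpa using hap _ (Fin.succ_ne_zero j)) (by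
      intro i p hp
      refine Fin.cases ?_ (fun j => ?_) i
      · simp only [Fin.cons_zero]; rw [hb0]; exact hτQ p hp
      · simp only [Fin.cons_succ]
        exact (le_abs_self _).trans (hai _ (Fin.succ_ne_zero j) p hp))
    (by positivity) hvol
  rw [Fin.prod_univ_succ] at hup
  simp only [Fin.cons_zero, Fin.cons_succ] at hup
  rw [← hPq] at hup
  push_cast at hup
  have hHn : 0 < H^(m+1) := by positivity
  have e1 : (θ * κ * H / ((m:ℝ)+1))^(m+1) = (θ * κ / (m+1))^(m+1) * H^(m+1) := by
    rw [← mul_pow]; congr 1; ring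
  rw [e1] at hup
  have hlow' : d^2 * Pq^2 ≤ C5 * H^(m+1) := by
    refine le_trans ?_ hlow
    rw [neg_mul, neg_sq, mul_pow]
    gcongr
  refine le_of_mul_le_mul_right ?_ hHn
  calc lam / 2 * (θ * κ / (m+1)) ^ (m+1) * d^2 * H^(m+1)
      = (lam / 2 * ((θ * κ / (m+1)) ^ (m+1) * H^(m+1))) * d^2 := by ring
    _ ≤ (C^2 * (2^(m+1) * ρ * Pq) * (τ * Pq)) * d^2 := by gcongr
    _ = C^2 * 2^(m+1) * ρ * τ * (d^2 * Pq^2) := by ring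
    _ ≤ C^2 * 2^(m+1) * ρ * τ * (C5 * H^(m+1)) := by gcongr
    _ = _ := by ring
end FKM

end


section
open Set MeasureTheory Metric Bornology Filter Topology
open scoped ENNReal NNReal Pointwise

namespace FKM
variable {n : ℕ}
attribute [local irreducible] qm pm Yv Xinv Phi

theorem Good.dq {c : Euc n → Euc n → ℝ} {U V : Set (Euc n)} (G : Good c U V) {xb y ν : Euc n}
    (hx : xb ∈ U) (hy : y ∈ V) (hν : ‖ν‖ = 1) {δ : ℝ} (hδ : 0 < δ) :
    ∀ᶠ z : ℝ × Euc n in 𝓝 (0, y),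
      |c (xb + z.1 • ν) z.2 - c xb z.2 + z.1 * inner ℝ (pm c xb y) ν| ≤ δ * |z.1| := by
  have hC : ContDiffAt ℝ 4 (Function.uncurry c) (xb, y) :=
    G.smooth.contDiffAt (G.oUV.mem_nhds ⟨hx, hy⟩)
  have hs : HasStrictFDerivAt (Function.uncurry c) (fderiv ℝ (Function.uncurry c) (xb, y)) (xb, y) :=
    hC.hasStrictFDerivAt (by norm_num)
  have ho := hs.isLittleO
  have ht : Tendsto (fun z : ℝ × Euc n => ((xb + z.1 • ν, z.2), (xb, z.2))) (𝓝 (0, y))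
      (𝓝 ((xb, y), (xb, y))) := by
    have : Continuous (fun z : ℝ × Euc n => ((xb + z.1 • ν, z.2), (xb, z.2))) := by fun_prop
    have := this.tendsto (0, y)
    simpa using this
  filter_upwards [ht.eventually (ho.bound hδ)] with z hz
  have e1 : ((xb + z.1 • ν, z.2) - (xb, z.2) : Euc n × Euc n) = z.1 • (ν, 0) := by
    ext <;> simp
  rw [e1, map_smul, norm_smul, Prod.norm_mk, hν, norm_zero, max_eq_left zero_le_one, mul_one,
    Real.norm_eq_abs, Real.norm_eq_abs] at hz
  have e2 := G.inner_pm hx hy ν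
  unfold dd at e2
  rw [e2]
  convert hz using 2
  simp only [Function.uncurry, smul_eq_mul]
  ring

theorem compact_diam {K : Set (Euc n)} (hK : IsCompact K) (hne : K.Nonempty) :
    ∃ p0 ∈ K, ∃ p1 ∈ K, ∀ p ∈ K, ∀ q ∈ K, ‖p - q‖ ≤ ‖p0 - p1‖ := by
  obtain ⟨z, hz, hmax⟩ := (hK.prod hK).exists_isMaxOn (hne.prod hne)
    (f := fun z : Euc n × Euc n => ‖z.1 - z.2‖)
    (continuous_fst.sub continuous_snd).norm.continuousOn
  exact ⟨z.1, hz.1, z.2, hz.2, fun p hp q hq => isMaxOn_iff.1 hmax (p, q) (mk_mem_prod hp hq)⟩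

set_option maxHeartbeats 1000000 in
theorem Setup.singleton {m : ℕ} {c : Euc (m+1) → Euc (m+1) → ℝ} {U V O : Set (Euc (m+1))}
    {u v : Euc (m+1) → ℝ} {lam Lam : ℝ} (S : Setup c U V u v O lam Lam) {xb ya yb : Euc (m+1)}
    (hxO : xb ∈ O) (hya : ya ∈ closure V) (hyb : yb ∈ closure V)
    (hca : u xb + v ya + c xb ya = 0) (hcb : u xb + v yb + c xb yb = 0) : ya = yb := by
  by_contra hne
  have G := S.G
  have hxU := S.sO hxO
  have hxC : xb ∈ closure U := subset_closure hxU
  have hcxb : ContinuousOn (fun y => u xb + v y + c xb y) (closure V) :=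
    (continuousOn_const.add S.cv).add
      (S.cont.comp (f := fun y => (xb, y)) (by fun_prop) (fun y hy => ⟨hxC, hy⟩))
  set S' : Set (Euc (m+1)) := {y | y ∈ closure V ∧ u xb + v y + c xb y = 0} with hS'
  have hS'V : S' ⊆ V := fun y hy => S.inV xb hxO y hy.1 hy.2
  have hS'c : IsCompact S' := by
    have h := hcxb.preimage_isClosed_of_isClosed S.cV.isClosed (isClosed_singleton (x := (0:ℝ)))
    exact S.cV.of_isClosed_subset h inter_subset_left
  have pmc : ContinuousOn (fun y => pm c xb y) V :=
    G.pm_smooth.continuousOn.comp (f := fun y => (xb, y)) (by fun_prop) (fun y hy => ⟨hxU, hy⟩)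
  set K := (fun y => pm c xb y) '' S' with hK
  have hKc : IsCompact K := hS'c.image_of_continuousOn (pmc.mono hS'V)
  have haS : ya ∈ S' := ⟨hya, hca⟩
  have hbS : yb ∈ S' := ⟨hyb, hcb⟩
  obtain ⟨p0, hp0, p1, hp1, hmax⟩ := compact_diam hKc ⟨pm c xb ya, ya, haS, rfl⟩
  set D := ‖p0 - p1‖ with hD
  have hD0 : 0 < D := by
    refine lt_of_lt_of_le ?_ (hmax _ ⟨ya, haS, rfl⟩ _ ⟨yb, hbS, rfl⟩)
    rw [norm_pos_iff, sub_ne_zero]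
    intro h
    exact hne (by rw [← G.Yv_pm hxU (hS'V haS), ← G.Yv_pm hxU (hS'V hbS)]; simp only at h; rw [h])
  set ν := D⁻¹ • (p0 - p1) with hν
  have hν1 : ‖ν‖ = 1 := by rw [hν, norm_smul, norm_inv, norm_norm, inv_mul_cancel₀ hD0.ne']
  have hp01 : p0 - p1 = D • ν := by rw [hν, smul_smul, mul_inv_cancel₀ hD0.ne', one_smul]
  have hdiam : ∀ p ∈ K, ‖p - p0‖^2 ≤ -(2 * D * inner ℝ (p - p0) ν) := by
    intro p hp
    have h1 := hmax p hp p1 hp1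
    have h2 : p - p1 = (p - p0) + D • ν := by rw [← hp01]; abel
    have h3 : ‖p - p1‖^2 ≤ D^2 := by gcongr
    rw [h2, norm_add_sq_real, norm_smul, hν1, mul_one, Real.norm_eq_abs, abs_of_pos hD0,
      inner_smul_right] at h3
    linarith
  obtain ⟨y0, hy0S, hy0⟩ := hp0
  obtain ⟨y2, hy2S, hy2⟩ := hp1
  dsimp only at hy0 hy2
  have hy0V := hS'V hy0S
  have dp0 : (xb, p0) ∈ DP c U V := by rw [← hy0]; exact Good.pm_mem_DP hxU hy0V
  have dp1 : (xb, p1) ∈ DP c U V := by rw [← hy2]; exact Good.pm_mem_DP hxU (hS'V hy2S)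
  have Y0 : Yv c U V (xb, p0) = y0 := by rw [← hy0]; exact G.Yv_pm hxU hy0V
  have Y2 : Yv c U V (xb, p1) = y2 := by rw [← hy2]; exact G.Yv_pm hxU (hS'V hy2S)
  obtain ⟨r1, r2, X, κ, C, η, hr1, hr2, L⟩ := exists_loc S hxO hy0V
  rw [hy0] at L
  obtain ⟨ε0, hε0, hdet⟩ := det_near (m+1)
  have hC := L.Cpos
  have hk := L.kpos
  have hη := L.epos
  have hlam := S.hlam
  have hLam := S.hLam
  obtain ⟨ρ, hρ, hρr, hρC, hρε⟩ : ∃ ρ : ℝ, 0 < ρ ∧ ρ ≤ r2 / 2 ∧ C * ρ ≤ 1/2 ∧ C * ρ ≤ ε0 := by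
    refine ⟨min (r2/2) (min (1/(2*C)) (ε0/C)), by positivity, min_le_left _ _, ?_, ?_⟩
    · calc C * _ ≤ C * (1/(2*C)) := by
            gcongr; exact (min_le_right _ _).trans (min_le_left _ _)
        _ = 1/2 := by field_simp
    · calc C * _ ≤ C * (ε0/C) := by
            gcongr; exact (min_le_right _ _).trans (min_le_right _ _)
        _ = ε0 := by field_simp
  obtain ⟨θ, hθ, hθ1, hθη⟩ : ∃ θ : ℝ, 0 < θ ∧ θ < 1 ∧ 2 * θ * C < η := by
    refine ⟨min (1/2) (η/(4*C)), by positivity, (min_le_left _ _).trans_lt (by norm_num), ?_⟩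
    calc 2 * _ * C ≤ 2 * (η/(4*C)) * C := by gcongr; exact min_le_right _ _
      _ = η/2 := by field_simp; ring
      _ < η := by linarith
  obtain ⟨d, hd, hdD, hdρ⟩ : ∃ d : ℝ, 0 < d ∧ d ≤ 2 * D ∧ 2 * D * d < ρ^2 := by
    refine ⟨min (2*D) (ρ^2/(4*D)), by positivity, min_le_left _ _, ?_⟩
    calc 2 * D * _ ≤ 2 * D * (ρ^2/(4*D)) := by gcongr; exact min_le_right _ _
      _ = ρ^2/2 := by field_simp; ring
      _ < ρ^2 := by linarith [show 0 < ρ^2 by positivity]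
  set K0 := lam / 2 * (θ * κ / (m+1)) ^ (m+1) * (d/4)^2 with hK0
  have hK0p : 0 < K0 := by positivity
  set K1 := C^2 * 2^(m+1) * ρ * (Lam * C^2 * (8 * ((m:ℝ)+1+1)^3 / κ^3) ^ (m+1)) with hK1
  have hK1p : 0 < K1 := by positivity
  set τ := K0 / (2 * K1) with hτ
  have hτp : 0 < τ := by positivity
  -- the second point
  set y1 := Yv c U V (xb, p0 + (d/(2*D)) • (p1 - p0)) with hy1
  have hs1 : d/(2*D) ∈ Icc (0:ℝ) 1 := ⟨by positivity, by rw [div_le_one (by positivity)]; exact hdD⟩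
  have dpy1 := G.DP_seg dp0 dp1 hs1
  have hy1V : y1 ∈ V := G.Yv_mem dpy1
  have pmy1 : pm c xb y1 = p0 - (d/2) • ν := by
    rw [hy1, G.pm_Yv dpy1, ← neg_sub p0 p1, hp01, smul_neg, smul_smul, ← sub_eq_add_neg]
    congr 2; field_simp
  have hy1c : u xb + v y1 + c xb y1 = 0 := by
    refine le_antisymm ?_ (S.ge xb hxC y1 (subset_closure hy1V))
    have h1 := S.sub_conv dp0 dp1 hs1
    rw [← hy1, Y0, Y2] at h1
    have h2 := hy0S.2
    have h3 := hy2S.2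
    rcases le_max_iff.1 h1 with h | h <;> linarith
  set aε : ℝ → Euc (m+1) := fun ε => xb + ε • ν with haε
  have aεc : Continuous aε := by rw [haε]; fun_prop
  have aε0 : aε 0 = xb := by simp [haε]
  have aεt : Tendsto aε (𝓝 0) (𝓝 xb) := by have := aεc.tendsto 0; rwa [aε0] at this
  -- joint continuity of pm
  have pmt : ∀ y ∈ V, Tendsto (fun z : ℝ × Euc (m+1) => pm c (aε z.1) z.2) (𝓝 (0, y)) (𝓝 (pm c xb y)) := by
    intro y hy
    have h1 : ContinuousAt (fun z : Euc (m+1) × Euc (m+1) => pm c z.1 z.2) (xb, y) :=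
      G.pm_smooth.continuousOn.continuousAt (G.oUV.mem_nhds ⟨hxU, hy⟩)
    have h2 : Tendsto (fun z : ℝ × Euc (m+1) => (aε z.1, z.2)) (𝓝 (0, y)) (𝓝 (xb, y)) := by
      have : Continuous (fun z : ℝ × Euc (m+1) => (aε z.1, z.2)) := by fun_prop
      have := this.tendsto (0, y)
      rwa [aε0] at this
    exact h1.tendsto.comp h2
  have pm0t : Tendsto (fun ε => pm c (aε ε) y0) (𝓝 0) (𝓝 p0) := by
    rw [← hy0]
    have h1 : Tendsto (fun ε : ℝ => (ε, y0)) (𝓝 0) (𝓝 (0, y0)) := tendsto_id.prodMk_nhds tendsto_const_nhds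
    exact (pmt y0 hy0V).comp h1
  have pm1t : Tendsto (fun ε => pm c (aε ε) y1) (𝓝 0) (𝓝 (p0 - (d/2) • ν)) := by
    rw [← pmy1]
    have h1 : Tendsto (fun ε : ℝ => (ε, y1)) (𝓝 0) (𝓝 (0, y1)) := tendsto_id.prodMk_nhds tendsto_const_nhds
    exact (pmt y1 hy1V).comp h1
  set w1 : ℝ → Euc (m+1) := fun ε => pm c (aε ε) y1 - pm c (aε ε) y0 with hw1
  have w1t : Tendsto w1 (𝓝 0) (𝓝 (-((d/2) • ν))) := by
    have := pm1t.sub pm0t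
    rwa [show p0 - (d/2) • ν - p0 = -((d/2) • ν) by abel] at this
  have nw : ‖-((d/2) • ν)‖ = d/2 := by
    rw [norm_neg, norm_smul, hν1, mul_one, Real.norm_eq_abs, abs_of_pos (by positivity)]
  have w1n : Tendsto (fun ε => ‖w1 ε‖) (𝓝 0) (𝓝 (d/2)) := by have := w1t.norm; rwa [nw] at this
  set fε : ℝ → Euc (m+1) := fun ε => -(‖w1 ε‖⁻¹ • w1 ε) with hfε
  have fεt : Tendsto fε (𝓝 0) (𝓝 ν) := by
    have := ((w1n.inv₀ (by positivity)).smul w1t).neg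
    have e : -((d/2)⁻¹ • -((d/2) • ν)) = ν := by
      rw [smul_neg, neg_neg, smul_smul, inv_mul_cancel₀ (by positivity), one_smul]
    rwa [e] at this
  have q0 : ∀ δ : ℝ, 0 < δ → ∀ᶠ ε in 𝓝 (0:ℝ),
      |c (aε ε) y0 - c xb y0 + ε * inner ℝ p0 ν| ≤ δ * |ε| := by
    intro δ hδ
    have := G.dq hxU hy0V hν1 hδ
    rw [hy0] at this
    exact (tendsto_id.prodMk_nhds tendsto_const_nhds : Tendsto (fun ε : ℝ => (ε, y0)) (𝓝 0) (𝓝 (0, y0))).eventually this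
  -- compactness
  have key : ∀ᶠ ε in 𝓝 (0:ℝ), ∀ y ∈ closure V, 0 < ε → y ∈ closure V →
      v y + c (aε ε) y ≤ v y0 + c (aε ε) y0 + ε * d →
      y ∈ V ∧ pm c (aε ε) y ∈ closedBall p0 r2 ∧ ‖pm c (aε ε) y - pm c (aε ε) y0‖ ≤ ρ ∧
      inner ℝ (fε ε) (pm c (aε ε) y - pm c (aε ε) y0) ≤ τ ∧
      v y0 + c (aε ε) y0 - ε * d ≤ v y + c (aε ε) y := by
    refine S.cV.eventually_forall_of_forall_eventually fun y hy => ?_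
    by_cases hyS : y ∈ S'
    · have hyV := hS'V hyS
      set p := pm c xb y with hp
      have hpK : p ∈ K := ⟨y, hyS, rfl⟩
      have hpd := hdiam p hpK
      have lift : ∀ {Q : ℝ → Prop}, (∀ᶠ ε in 𝓝 (0:ℝ), Q ε) → ∀ᶠ z : ℝ × Euc (m+1) in 𝓝 (0, y), Q z.1 :=
        fun h => (continuous_fst.tendsto (0, y)).eventually h
      have diff0 : ∀ z : ℝ × Euc (m+1), z.2 ∈ closure V → v y0 + c xb y0 ≤ v z.2 + c xb z.2 := by
        intro z hz
        have := S.ge xb hxC z.2 hz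
        have := hy0S.2
        linarith
      rcases lt_or_ge (inner ℝ (p - p0) ν) (-d) with hlt | hge
      · set δ := (-d - inner ℝ (p - p0) ν) / 4 with hδ
        have hδ0 : 0 < δ := by rw [hδ]; linarith
        filter_upwards [G.dq hxU hyV hν1 hδ0, lift (q0 δ hδ0)] with z h1 h2 hz hzV hsec
        exfalso
        have h3 := diff0 z hzV
        rw [abs_of_pos hz] at h1 h2
        rw [abs_le] at h1 h2
        rw [← hp] at h1
        change (-(δ * z.1) ≤ c (aε z.1) z.2 - _ + _) ∧ _ at h1
        have h4 : inner ℝ (p - p0) ν = -d - 4 * δ := by rw [hδ]; ring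
        rw [inner_sub_left] at h4
        have h5 : z.1 * inner ℝ p ν - z.1 * inner ℝ p0 ν = -(z.1 * d) - 4 * (δ * z.1) := by
          rw [← mul_sub, h4]; ring
        have h6 := mul_pos hδ0 hz
        clear_value δ
        linarith only [h1.1, h2.2, h3, h5, h6, hsec]
      · have hpr : ‖p - p0‖ < ρ := by
          refine lt_of_pow_lt_pow_left₀ 2 hρ.le ?_
          have := mul_le_mul_of_nonneg_left hge (show 0 ≤ 2 * D by positivity)
          linarith only [this, hpd, hdρ]
        have hnu : inner ℝ (p - p0) ν ≤ 0 := by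
          by_contra! hpos
          have h1 := sq_nonneg ‖p - p0‖
          have h2 := mul_pos hD0 hpos
          linarith only [h1, h2, hpd]
        have t1 := pmt y hyV
        rw [← hp] at t1
        have t2 : Tendsto (fun z : ℝ × Euc (m+1) => pm c (aε z.1) y0) (𝓝 (0, y)) (𝓝 p0) :=
          pm0t.comp (continuous_fst.tendsto (0, y))
        have t3 : Tendsto (fun z : ℝ × Euc (m+1) => fε z.1) (𝓝 (0, y)) (𝓝 ν) :=
          fεt.comp (continuous_fst.tendsto (0, y))
        have e1 : ∀ᶠ z : ℝ × Euc (m+1) in 𝓝 (0, y), z.2 ∈ V :=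
          (continuous_snd.tendsto (0, y)).eventually (G.oV.mem_nhds hyV)
        have e2 : ∀ᶠ z : ℝ × Euc (m+1) in 𝓝 (0, y), pm c (aε z.1) z.2 ∈ closedBall p0 r2 :=
          t1.eventually (closedBall_mem_nhds_of_mem (by
            rw [mem_ball, dist_eq_norm]; linarith))
        have e3 : ∀ᶠ z : ℝ × Euc (m+1) in 𝓝 (0, y), ‖pm c (aε z.1) z.2 - pm c (aε z.1) y0‖ < ρ :=
          (t1.sub t2).norm.eventually (gt_mem_nhds hpr)
        have e4 : ∀ᶠ z : ℝ × Euc (m+1) in 𝓝 (0, y),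
            inner ℝ (fε z.1) (pm c (aε z.1) z.2 - pm c (aε z.1) y0) < τ :=
          (t3.inner (t1.sub t2)).eventually (gt_mem_nhds (by rw [real_inner_comm]; linarith))
        filter_upwards [e1, e2, e3, e4, G.dq hxU hyV hν1 (show 0 < d/4 by positivity),
          lift (q0 (d/4) (by positivity))] with z h1 h2 h3 h4 h5 h6 hz hzV hsec
        refine ⟨h1, h2, h3.le, h4.le, ?_⟩
        have h7 := diff0 z hzV
        rw [abs_of_pos hz] at h5 h6
        rw [abs_le] at h5 h6
        rw [← hp] at h5
        change (-(d/4 * z.1) ≤ c (aε z.1) z.2 - _ + _) ∧ _ at h5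
        rw [inner_sub_left] at hnu
        have h8 := mul_pos hd hz
        have h9 := mul_nonneg hz.le (sub_nonneg.2 hnu)
        rw [zero_sub, mul_neg, mul_sub] at h9
        linarith only [h5.1, h6.2, h7, h8, h9]
    · have hpos : 0 < u xb + v y + c xb y :=
        lt_of_le_of_ne (S.ge xb hxC y hy) (fun h => hyS ⟨hy, h.symm⟩)
      have hW : ContinuousOn (fun z : ℝ × Euc (m+1) => v z.2 + c (aε z.1) z.2 -
          (v y0 + c (aε z.1) y0 + z.1 * d)) {z | aε z.1 ∈ closure U ∧ z.2 ∈ closure V} := by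
        have a1 : ContinuousOn (fun z : ℝ × Euc (m+1) => v z.2) {z | aε z.1 ∈ closure U ∧ z.2 ∈ closure V} :=
          S.cv.comp continuousOn_snd (fun z hz => hz.2)
        have a2 : ContinuousOn (fun z : ℝ × Euc (m+1) => c (aε z.1) z.2) {z | aε z.1 ∈ closure U ∧ z.2 ∈ closure V} :=
          S.cont.comp (f := fun z : ℝ × Euc (m+1) => (aε z.1, z.2)) (by fun_prop) (fun z hz => mk_mem_prod hz.1 hz.2)
        have a3 : ContinuousOn (fun z : ℝ × Euc (m+1) => c (aε z.1) y0) {z | aε z.1 ∈ closure U ∧ z.2 ∈ closure V} :=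
          S.cont.comp (f := fun z : ℝ × Euc (m+1) => (aε z.1, y0)) (by fun_prop)
            (fun z hz => mk_mem_prod hz.1 hy0S.1)
        exact (a1.add a2).sub ((continuousOn_const.add a3).add (by fun_prop))
      have hW1 := hW (0, y) ⟨by simpa [aε0] using hxC, hy⟩
      have hW2 := hW1.eventually (lt_mem_nhds (a := 0) (by
        have := hy0S.2
        dsimp only
        rw [aε0]; linarith))
      rw [eventually_nhdsWithin_iff] at hW2
      have hU : ∀ᶠ z : ℝ × Euc (m+1) in 𝓝 (0, y), aε z.1 ∈ U :=
        (aεt.comp (continuous_fst.tendsto (0, y))).eventually (G.oU.mem_nhds hxU)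
      filter_upwards [hW2, hU] with z h1 h2 hz hzV hsec
      have := h1 ⟨subset_closure h2, hzV⟩
      linarith
  -- y1 in the section
  have ev1 : ∀ᶠ ε in 𝓝 (0:ℝ), 0 < ε → v y1 + c (aε ε) y1 ≤ v y0 + c (aε ε) y0 + ε * d := by
    have h1 := (tendsto_id.prodMk_nhds tendsto_const_nhds : Tendsto (fun ε : ℝ => (ε, y1)) (𝓝 0)
      (𝓝 (0, y1))).eventually (G.dq hxU hy1V hν1 (show 0 < d/4 by positivity))
    filter_upwards [h1, q0 (d/4) (by positivity)] with ε h1 h2 hε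
    simp only [id] at h1
    rw [abs_of_pos hε] at h1 h2
    rw [abs_le] at h1 h2
    rw [pmy1, inner_sub_left, inner_smul_left, real_inner_self_eq_norm_sq, hν1] at h1
    simp only [conj_trivial] at h1
    change _ ∧ c (aε ε) y1 - _ + _ ≤ _ at h1
    have h3 := hy0S.2
    have h4 := mul_pos hd hε
    rw [mul_sub] at h1
    linarith only [h1.2, h2.1, h3, h4, hy1c]
  have ev2 : ∀ᶠ ε in 𝓝 (0:ℝ), d/4 < ‖w1 ε‖ := w1n.eventually (lt_mem_nhds (by linarith))
  have ev3 : ∀ᶠ ε in 𝓝 (0:ℝ), aε ε ∈ closedBall xb r1 := aεt.eventually (closedBall_mem_nhds _ hr1)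
  have ev4 : ∀ᶠ ε in 𝓝 (0:ℝ), pm c (aε ε) y0 ∈ ball p0 r2 := pm0t.eventually (ball_mem_nhds _ hr2)
  have hall := (((key.and ev1).and (ev2.and ev3)).and ev4)
  obtain ⟨ε, ⟨⟨⟨hkey, h1⟩, h2, h3⟩, h4⟩, hε⟩ :=
    ((hall.filter_mono nhdsWithin_le_nhds).and (self_mem_nhdsWithin (a := (0:ℝ)) (s := Ioi 0))).exists
  have hε : 0 < ε := hε
  set a := aε ε with ha
  set k := v y0 + c a y0 + ε * d with hkk
  have haU : a ∈ U := (Good.mem_DP.1 (L.dp a h3 _ (ball_subset_closedBall h4))).1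
  have Ya0 := G.Yv_pm haU hy0V
  have Ya1 := G.Yv_pm haU hy1V
  have T : Sec c U V u v O lam Lam (closedBall xb r1) (closedBall p0 r2) X κ C η a (pm c a y0) k (ε * d) ρ := by
    refine ⟨S, L, h3, closedBall_mem_nhds_of_mem h4, ?_, ?_, by positivity, ?_⟩
    · intro y hy hs
      obtain ⟨g1, g2, g3, -⟩ := hkey y hy hε hy hs
      exact ⟨g1, g2, g3⟩
    · unfold om; rw [Ya0, hkk]; ring
    · intro y hy
      rcases le_or_gt (v y + c a y) k with hs | hs
      · have := (hkey y hy hε hy hs).2.2.2.2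
        rw [hkk]; linarith
      · have := mul_pos hε hd
        linarith
  have hmain := T.main_est hθ hθ1 hθη hρC hρε hdet (w1 ε) (by
      have e : pm c a y0 + w1 ε = pm c a y1 := by rw [hw1]; dsimp only; abel
      rw [e]
      exact (T.memQ (Good.pm_mem_DP haU hy1V) (by unfold om; rw [Ya1]; linarith [h1 hε])).1)
    (show 0 < d/4 by positivity) h2.le hτp (by
      intro p hp
      have hpD := L.dp a h3 p hp.1
      have hpV := G.Yv_mem hpD
      have := (hkey _ (subset_closure hpV) hε (subset_closure hpV) (by
        have := hp.2; unfold om at this; linarith)).2.2.2.1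
      rwa [G.pm_Yv hpD] at this)
  have : K0 ≤ K1 * τ := hmain
  have h9 : K1 * τ = K0/2 := by rw [hτ]; field_simp
  linarith

end FKM

end


section
open Set MeasureTheory Metric Bornology Filter Topology
open scoped ENNReal NNReal Pointwise

namespace FKM
variable {n : ℕ}
attribute [local irreducible] qm pm Yv Xinv Phi

theorem Setup.c1 {c : Euc n → Euc n → ℝ} {U V O : Set (Euc n)}
    {u v : Euc n → ℝ} {lam Lam : ℝ} (S : Setup c U V u v O lam Lam)
    (huq : ∀ x ∈ O, ∀ ya ∈ closure V, ∀ yb ∈ closure V, u x + v ya + c x ya = 0 →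
      u x + v yb + c x yb = 0 → ya = yb) : ContDiffOn ℝ 1 u O := by
  classical
  have G := S.G
  have hex : ∀ x, ∃ y, x ∈ O → (y ∈ closure V ∧ u x + v y + c x y = 0) := by
    intro x
    by_cases hx : x ∈ O
    · obtain ⟨y, hy, h⟩ := S.exy x (subset_closure (S.sO hx))
      exact ⟨y, fun _ => ⟨hy, h⟩⟩
    · exact ⟨0, fun h => absurd h hx⟩
  choose yy hyy using hex
  have yV : ∀ x ∈ O, yy x ∈ V := fun x hx => S.inV x hx _ (hyy x hx).1 (hyy x hx).2
  have ycont : ∀ x0 ∈ O, ContinuousAt yy x0 := by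
    intro x0 hx0
    rw [ContinuousAt, _root_.tendsto_nhds]
    intro W hW hxW
    have hKc : IsCompact (closure V \ W) := S.cV.diff hW
    have hev : ∀ᶠ x in 𝓝 x0, ∀ y ∈ closure V \ W, y ∈ closure V → x ∈ U → 0 < u x + v y + c x y := by
      refine hKc.eventually_forall_of_forall_eventually fun y hy => ?_
      have hpos : 0 < u x0 + v y + c x0 y := by
        refine lt_of_le_of_ne (S.ge x0 (subset_closure (S.sO hx0)) y hy.1) fun h => ?_
        have := huq x0 hx0 y hy.1 _ (hyy x0 hx0).1 h.symm (hyy x0 hx0).2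
        exact hy.2 (this ▸ hxW)
      have hcont : ContinuousOn (fun z : Euc n × Euc n => u z.1 + v z.2 + c z.1 z.2)
          (closure U ×ˢ closure V) :=
        ((S.cu.comp continuousOn_fst (fun z hz => hz.1)).add
          (S.cv.comp continuousOn_snd (fun z hz => hz.2))).add S.cont
      have h1 := (hcont (x0, y) (mk_mem_prod (subset_closure (S.sO hx0)) hy.1)).eventually
        (lt_mem_nhds hpos)
      rw [eventually_nhdsWithin_iff] at h1
      filter_upwards [h1] with z hz hzV hzU
      exact hz (mk_mem_prod (subset_closure hzU) hzV)
    filter_upwards [hev, S.oO.mem_nhds hx0] with x hx hxO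
    by_contra hxW'
    have h2 := hyy x hxO
    have := hx (yy x) ⟨h2.1, hxW'⟩ h2.1 (S.sO hxO)
    linarith [h2.2]
  set Lf : Euc n → (Euc n →L[ℝ] ℝ) := fun x =>
    -((fderiv ℝ (Function.uncurry c) (x, yy x)).comp (ContinuousLinearMap.inl ℝ (Euc n) (Euc n))) with hLf
  have hder : ∀ x ∈ O, HasFDerivAt u (Lf x) x := by
    intro x hx
    have hC : ContDiffAt ℝ 4 (Function.uncurry c) (x, yy x) :=
      G.smooth.contDiffAt (G.oUV.mem_nhds ⟨S.sO hx, yV x hx⟩)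
    have hs : HasStrictFDerivAt (Function.uncurry c) (fderiv ℝ (Function.uncurry c) (x, yy x)) (x, yy x) :=
      hC.hasStrictFDerivAt (by norm_num)
    have ho := hs.isLittleO
    have ht : Tendsto (fun z : Euc n × Euc n => ((z.1, z.2), (x, z.2))) (𝓝 (x, yy x))
        (𝓝 ((x, yy x), (x, yy x))) := by
      have : Continuous (fun z : Euc n × Euc n => ((z.1, z.2), (x, z.2))) := by fun_prop
      exact this.tendsto (x, yy x)
    have hy1 : Tendsto (fun x' => (x', yy x')) (𝓝 x) (𝓝 (x, yy x)) :=
      tendsto_id.prodMk_nhds (ycont x hx)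
    have hy2 : Tendsto (fun x' => (x', yy x)) (𝓝 x) (𝓝 (x, yy x)) :=
      tendsto_id.prodMk_nhds tendsto_const_nhds
    rw [hasFDerivAt_iff_isLittleO, Asymptotics.isLittleO_iff]
    intro δ hδ
    have hb := ht.eventually (ho.bound hδ)
    filter_upwards [hy1.eventually hb, hy2.eventually hb, S.oO.mem_nhds hx] with x' h1 h2 h3
    have key : ∀ y : Euc n, ((x', y) - (x, y) : Euc n × Euc n) = (x' - x, 0) := by
      intro y; ext <;> simp
    simp only [key, Prod.norm_mk, norm_zero, max_eq_left (norm_nonneg (x' - x))] at h1 h2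
    have eL : (Lf x) (x' - x) = -(fderiv ℝ (Function.uncurry c) (x, yy x) (x' - x, 0)) := by
      simp [hLf]
    have xC := subset_closure (S.sO hx)
    have xC' := subset_closure (S.sO h3)
    have a1 := (hyy x hx).2
    have a2 := (hyy x' h3).2
    have a3 := S.ge x' xC' _ (hyy x hx).1
    have a4 := S.ge x xC _ (hyy x' h3).1
    rw [Real.norm_eq_abs, abs_le] at h1 h2 ⊢
    simp only [Function.uncurry] at h1 h2
    rw [eL]
    constructor
    · linarith [h2.1, h2.2]
    · linarith [h1.1, h1.2]
  have hcontL : ContinuousOn Lf O := by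
    have h1 : ContinuousOn (fun x => fderiv ℝ (Function.uncurry c) (x, yy x)) O := by
      have h2 : ContinuousOn (fderiv ℝ (Function.uncurry c)) (U ×ˢ V) :=
        G.smooth.continuousOn_fderiv_of_isOpen G.oUV (by norm_num)
      refine h2.comp (f := fun x => (x, yy x)) ?_ (fun x hx => mk_mem_prod (S.sO hx) (yV x hx))
      exact continuousOn_id.prodMk (fun x hx => (ycont x hx).continuousWithinAt)
    exact (h1.clm_comp continuousOn_const).neg
  have e : (1 : WithTop ℕ∞) = 0 + 1 := by norm_num
  rw [e, contDiffOn_succ_iff_fderiv_of_isOpen S.oO]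
  refine ⟨fun x hx => (hder x hx).differentiableAt.differentiableWithinAt, by simp, ?_⟩
  rw [contDiffOn_zero]
  exact hcontL.congr fun x hx => (hder x hx).fderiv

end FKM

end


section
open Set MeasureTheory Metric Bornology Filter Topology
open scoped ENNReal NNReal Pointwise
namespace FKM
variable {n : ℕ}
attribute [local irreducible] qm pm Yv Xinv Phi

/-- a property which holds locally with some bound holds uniformly on a compact set -/
theorem compact_bound {E : Type*} [TopologicalSpace E] {S : Set E} (hS : IsCompact S)
    (P : E → ℝ → Prop) (mono : ∀ z K K', K ≤ K' → P z K → P z K')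
    (h : ∀ z ∈ S, ∃ K : ℝ, ∀ᶠ w in 𝓝[S] z, P w K) : ∃ K : ℝ, 0 ≤ K ∧ ∀ z ∈ S, P z K := by
  refine hS.induction_on (p := fun A => ∃ K : ℝ, 0 ≤ K ∧ ∀ z ∈ A, P z K) ?_ ?_ ?_ ?_
  · exact ⟨0, le_rfl, fun z hz => absurd hz (by simp)⟩
  · rintro s t hst ⟨K, h0, hK⟩
    exact ⟨K, h0, fun z hz => hK z (hst hz)⟩
  · rintro s t ⟨K, h0, hK⟩ ⟨K', h0', hK'⟩
    refine ⟨max K K', le_max_of_le_left h0, ?_⟩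
    rintro z (hz | hz)
    · exact mono _ _ _ (le_max_left _ _) (hK z hz)
    · exact mono _ _ _ (le_max_right _ _) (hK' z hz)
  · intro z hz
    obtain ⟨K, hK⟩ := h z hz
    exact ⟨{w | P w K}, hK, max K 0, le_max_right _ _, fun w hw =>
      mono _ _ _ (le_max_left _ _) hw⟩

theorem c1_bound {E F : Type*} [NormedAddCommGroup E] [NormedSpace ℝ E]
    [NormedAddCommGroup F] [NormedSpace ℝ F] {g : E → F} {W : Set E} (hW : IsCompact W)
    (hg : ContDiffOn ℝ 1 g W) :
    ∃ L : ℝ, 0 ≤ L ∧ ∀ x ∈ W, ∃ f' : E →L[ℝ] F, HasFDerivWithinAt g f' W x ∧ ‖f'‖ ≤ L := by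
  refine compact_bound hW (fun x L => ∃ f' : E →L[ℝ] F, HasFDerivWithinAt g f' W x ∧ ‖f'‖ ≤ L)
    ?_ ?_
  · rintro z K K' h ⟨f', h1, h2⟩
    exact ⟨f', h1, h2.trans h⟩
  · intro z hz
    have h1 := hg z hz
    have h2 : ContDiffWithinAt ℝ (0 + 1) g W z := by simpa using h1
    rw [contDiffWithinAt_succ_iff_hasFDerivWithinAt' (by simp)] at h2
    obtain ⟨u, hu, hsub, -, f', hf', hc⟩ := h2
    rw [insert_eq_of_mem hz] at hu hsub
    refine ⟨‖f' z‖ + 1, ?_⟩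
    have hcz : ContinuousWithinAt f' W z := (hc.continuousWithinAt)
    have h3 : ∀ᶠ w in 𝓝[W] z, ‖f' w‖ < ‖f' z‖ + 1 :=
      hcz.norm.eventually (Iio_mem_nhds (by linarith))
    filter_upwards [h3, hu] with w hw hwu
    exact ⟨f' w, hf' w hwu, hw.le⟩

theorem iter_bound {E F : Type*} [NormedAddCommGroup E] [NormedSpace ℝ E]
    [NormedAddCommGroup F] [NormedSpace ℝ F] {g : E → F} {S O : Set E} (hS : IsCompact S)
    (hO : IsOpen O) (hOS : O ⊆ S) {k : ℕ} (hg : ContDiffOn ℝ k g S) :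
    ∃ K : ℝ, 0 ≤ K ∧ ∀ z ∈ O, ‖iteratedFDeriv ℝ k g z‖ ≤ K := by
  obtain ⟨K, h0, hK⟩ := compact_bound hS (fun x K => x ∈ O → ‖iteratedFDeriv ℝ k g x‖ ≤ K)
    (fun z K K' h h1 h2 => (h1 h2).trans h) (by
    intro z hz
    obtain ⟨u, hu, p, hp⟩ := (hg z hz) k le_rfl
    rw [insert_eq_of_mem hz] at hu
    have hzu : z ∈ u := mem_of_mem_nhdsWithin hz hu
    refine ⟨‖p z k‖ + 1, ?_⟩
    have hc : ContinuousWithinAt (fun x => p x k) u z := (hp.cont k le_rfl) z hzu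
    have hc' : ContinuousWithinAt (fun x => p x k) S z := hc.mono_of_mem_nhdsWithin hu
    have h3 : ∀ᶠ w in 𝓝[S] z, ‖p w k‖ < ‖p z k‖ + 1 :=
      hc'.norm.eventually (Iio_mem_nhds (by linarith))
    have h4 : ∀ᶠ w in 𝓝[S] z, ∀ᶠ w' in 𝓝[S] w, w' ∈ u :=
      eventually_eventually_nhdsWithin.2 hu
    filter_upwards [h3, h4] with w hw hwu hwO
    have hu' : u ∈ 𝓝 w := by
      have : 𝓝[S] w = 𝓝 w := nhdsWithin_eq_nhds.2 (mem_of_superset (hO.mem_nhds hwO) hOS)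
      rw [this] at hwu
      exact hwu
    obtain ⟨t, htu, hto, hwt⟩ := _root_.mem_nhds_iff.1 hu'
    have hpt := hp.mono htu
    have := hpt.eq_iteratedFDerivWithin_of_uniqueDiffOn le_rfl hto.uniqueDiffOn hwt
    rw [iteratedFDerivWithin_of_isOpen k hto hwt] at this
    rw [← this]
    exact hw.le)
  exact ⟨K, h0, fun z hz => hK z (hOS hz) hz⟩

theorem dd_iter_succ {E : Type*} [NormedAddCommGroup E] [NormedSpace ℝ E] {f : E → ℝ} {O : Set E}
    (hO : IsOpen O) {k : ℕ} {r : WithTop ℕ∞} (hf : ContDiffOn ℝ r f O) (hk : (k : WithTop ℕ∞) < r)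
    {h : E → ℝ} {m : Fin k → E}
    (hh : EqOn h (fun z => iteratedFDeriv ℝ k f z m) O) (a : E) :
    EqOn (dd a h) (fun z => iteratedFDeriv ℝ (k + 1) f z (Fin.cons a m)) O := by
  intro z hz
  rw [dd_congr hO hh a hz]
  have hd : DifferentiableAt ℝ (iteratedFDeriv ℝ k f) z :=
    (hf.contDiffAt (hO.mem_nhds hz)).differentiableAt_iteratedFDeriv hk
  have h1 : HasFDerivAt (fun z => iteratedFDeriv ℝ k f z m)
      ((ContinuousMultilinearMap.apply ℝ (fun _ : Fin k => E) ℝ m).comp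
        (fderiv ℝ (iteratedFDeriv ℝ k f) z)) z :=
    (ContinuousMultilinearMap.apply ℝ (fun _ : Fin k => E) ℝ m).hasFDerivAt.comp z hd.hasFDerivAt
  unfold dd
  rw [h1.fderiv]
  simp only [iteratedFDeriv_succ_apply_left]
  simp

theorem dd_bounds {E : Type*} [NormedAddCommGroup E] [NormedSpace ℝ E] {f : E → ℝ} {S O : Set E}
    (hS : IsCompact S) (hO : IsOpen O) (hOS : O ⊆ S) (hf : ContDiffOn ℝ 4 f S) :
    ∃ K : ℝ, 0 ≤ K ∧ ∀ z ∈ O, ∀ a b d e : E,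
      |dd a (dd b f) z| ≤ K * (‖a‖ * ‖b‖) ∧
      |dd a (dd b (dd d f)) z| ≤ K * (‖a‖ * ‖b‖ * ‖d‖) ∧
      |dd a (dd b (dd d (dd e f))) z| ≤ K * (‖a‖ * ‖b‖ * ‖d‖ * ‖e‖) := by
  obtain ⟨K2, h2, hK2⟩ := iter_bound hS hO hOS (k := 2) (hf.of_le (by norm_num))
  obtain ⟨K3, h3, hK3⟩ := iter_bound hS hO hOS (k := 3) (hf.of_le (by norm_num))
  obtain ⟨K4, h4, hK4⟩ := iter_bound hS hO hOS (k := 4) (hf.of_le (by norm_num))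
  have hf' := hf.mono hOS
  refine ⟨K2 + K3 + K4, by positivity, fun z hz a b d e => ?_⟩
  have key : ∀ e : E, EqOn (dd e f) (fun z => iteratedFDeriv ℝ 1 f z (Fin.cons e Fin.elim0)) O := by
    intro e
    exact dd_iter_succ hO (k := 0) hf' (by norm_num) (h := f) (m := Fin.elim0) (fun z _ => by simp) e
  have key2 : ∀ b e : E, EqOn (dd b (dd e f))
      (fun z => iteratedFDeriv ℝ 2 f z (Fin.cons b (Fin.cons e Fin.elim0))) O := fun b e =>
    dd_iter_succ hO (k := 1) hf' (by norm_num) (key e) b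
  have key3 : ∀ a b e : E, EqOn (dd a (dd b (dd e f)))
      (fun z => iteratedFDeriv ℝ 3 f z (Fin.cons a (Fin.cons b (Fin.cons e Fin.elim0)))) O :=
    fun a b e => dd_iter_succ hO (k := 2) hf' (by norm_num) (key2 b e) a
  have key4 : ∀ d a b e : E, EqOn (dd d (dd a (dd b (dd e f))))
      (fun z => iteratedFDeriv ℝ 4 f z
        (Fin.cons d (Fin.cons a (Fin.cons b (Fin.cons e Fin.elim0))))) O :=
    fun d a b e => dd_iter_succ hO (k := 3) hf' (by norm_num) (key3 a b e) d
  refine ⟨?_, ?_, ?_⟩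
  · rw [key2 a b hz]
    refine ((iteratedFDeriv ℝ 2 f z).le_of_opNorm_le (hK2 z hz) _).trans ?_
    simp only [Fin.prod_univ_succ, Fin.cons_zero, Fin.cons_succ, Finset.univ_eq_empty,
      Finset.prod_empty, mul_one]
    exact mul_le_mul_of_nonneg_right (by linarith) (by positivity)
  · rw [key3 a b d hz]
    refine ((iteratedFDeriv ℝ 3 f z).le_of_opNorm_le (hK3 z hz) _).trans ?_
    simp only [Fin.prod_univ_succ, Fin.cons_zero, Fin.cons_succ, Finset.univ_eq_empty,
      Finset.prod_empty, mul_one, ← mul_assoc]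
    gcongr
    linarith
  · rw [key4 a b d e hz]
    refine ((iteratedFDeriv ℝ 4 f z).le_of_opNorm_le (hK4 z hz) _).trans ?_
    simp only [Fin.prod_univ_succ, Fin.cons_zero, Fin.cons_succ, Finset.univ_eq_empty,
      Finset.prod_empty, mul_one, ← mul_assoc]
    gcongr
    linarith

end FKM

end


section
open Set MeasureTheory Metric Bornology Filter Topology
open scoped ENNReal NNReal Pointwise
namespace FKM
variable {n : ℕ}
attribute [local irreducible] qm pm Yv Xinv Phi

theorem diffeo_lip {f : Euc n → Euc n} {S O : Set (Euc n)} (hS : IsCompact S) (hO : IsOpen O)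
    (hOS : O ⊆ S) (h : DiffeoOnto n f S) :
    ∃ L : ℝ, 0 ≤ L ∧ (∀ y ∈ O, ∀ v, ‖v‖ ≤ L * ‖fderiv ℝ f y v‖) ∧
      (∀ p ∈ f '' S, ∃ f' : Euc n →L[ℝ] Euc n, HasFDerivWithinAt (Function.invFunOn f S) f' (f '' S) p ∧ ‖f'‖ ≤ L) := by
  obtain ⟨hinj, hf, hg⟩ := h
  have hW : IsCompact (f '' S) := hS.image_of_continuousOn hf.continuousOn
  obtain ⟨L, hL0, hL⟩ := c1_bound hW hg
  refine ⟨L, hL0, fun y hy v => ?_, hL⟩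
  obtain ⟨g', hg', hg'L⟩ := hL (f y) (mem_image_of_mem f (hOS hy))
  have hfd : HasFDerivAt f (fderiv ℝ f y) y :=
    ((hf.contDiffAt (mem_of_superset (hO.mem_nhds hy) hOS)).differentiableAt (by norm_num)).hasFDerivAt
  have hcomp : HasFDerivAt (Function.invFunOn f S ∘ f) (g'.comp (fderiv ℝ f y)) y :=
    hg'.comp_hasFDerivAt y hfd
      (by filter_upwards [hO.mem_nhds hy] with w hw using mem_image_of_mem f (hOS hw))
  have hid : HasFDerivAt (Function.invFunOn f S ∘ f) (ContinuousLinearMap.id ℝ (Euc n)) y := by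
    refine (hasFDerivAt_id y).congr_of_eventuallyEq ?_
    filter_upwards [hO.mem_nhds hy] with w hw
    exact hinj.leftInvOn_invFunOn (hOS hw)
  have he := hcomp.unique hid
  have : v = g' (fderiv ℝ f y v) := by
    have := congrArg (fun T : Euc n →L[ℝ] Euc n => T v) he
    simpa using this.symm
  calc ‖v‖ = ‖g' (fderiv ℝ f y v)‖ := by rw [← this]
    _ ≤ L * ‖fderiv ℝ f y v‖ := g'.le_of_opNorm_le hg'L _

theorem fderiv_qm {c : Euc n → Euc n → ℝ} {U V : Set (Euc n)} (G : Sm c U V) {x y : Euc n}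
    (hx : x ∈ U) (hy : y ∈ V) (η : Euc n) :
    fderiv ℝ (fun x => qm c x y) x η = dd (η, 0) (fun z : Euc n × Euc n => qm c z.1 z.2) (x, y) := by
  have hd : DifferentiableAt ℝ (fun z : Euc n × Euc n => qm c z.1 z.2) (x, y) :=
    (G.qm_smooth.contDiffAt (G.oUV.mem_nhds ⟨hx, hy⟩)).differentiableAt (by norm_num)
  have h1 : HasFDerivAt (fun x => qm c x y)
      ((fderiv ℝ (fun z : Euc n × Euc n => qm c z.1 z.2) (x, y)).comp
        (ContinuousLinearMap.inl ℝ (Euc n) (Euc n))) x :=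
    HasFDerivAt.comp (g := fun z : Euc n × Euc n => qm c z.1 z.2) (f := fun e => (e, y)) x hd.hasFDerivAt
      (hasFDerivAt_prodMk_left x y)
  rw [h1.fderiv]
  simp [dd]

theorem qm_eq (c : Euc n → Euc n → ℝ) : (fun x y => qm c x y) = fun x y => -gradY n c x y := by
  unfold qm; rfl
theorem pm_eq (c : Euc n → Euc n → ℝ) : (fun x y => pm c x y) = fun x y => -gradX n c x y := by
  unfold pm; rfl
theorem qm_swap (c : Euc n → Euc n → ℝ) (x y : Euc n) : qm (fun y x => c x y) y x = pm c x y := by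
  unfold qm pm gradX gradY; rfl

theorem b1q {c : Euc n → Euc n → ℝ} {U V : Set (Euc n)} (hB1 : B1cond n c U V) {y : Euc n}
    (hy : y ∈ closure V) : DiffeoOnto n (fun x => qm c x y) (closure U) := by
  have := hB1.1 y hy
  unfold qm; exact this

theorem B0_swap {c : Euc n → Euc n → ℝ} {U V : Set (Euc n)} (h : B0cond n c U V) :
    B0cond n (fun y x => c x y) V U := by
  obtain ⟨h1, h2, h3, h4, h5⟩ := h
  refine ⟨h3, h4, h1, h2, ?_⟩
  rw [uncurry_swap]
  exact h5.comp (ContinuousLinearEquiv.prodComm ℝ (Euc n) (Euc n)).contDiff.contDiffOn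
      (fun z hz => ⟨hz.2, hz.1⟩)
theorem B1_swap {c : Euc n → Euc n → ℝ} {U V : Set (Euc n)} (h : B1cond n c U V) :
    B1cond n (fun y x => c x y) V U := ⟨h.2, h.1⟩
theorem B2_swap {c : Euc n → Euc n → ℝ} {U V : Set (Euc n)} (h : B2cond n c U V) :
    B2cond n (fun y x => c x y) V U := ⟨h.2, h.1⟩
theorem B2s_swap {c : Euc n → Euc n → ℝ} {U V : Set (Euc n)} (h : B2scond n c U V) :
    B2scond n (fun y x => c x y) V U := ⟨h.2, h.1⟩

theorem sm_of {c : Euc n → Euc n → ℝ} {U V : Set (Euc n)} (hB0 : B0cond n c U V) : Sm c U V :=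
  ⟨hB0.1, hB0.2.2.1, hB0.2.2.2.2.mono (prod_mono subset_closure subset_closure)⟩

theorem ndq_of {c : Euc n → Euc n → ℝ} {U V : Set (Euc n)} (hB0 : B0cond n c U V)
    (hB1 : B1cond n c U V) : ∀ x ∈ U, ∀ y ∈ V, ∀ η : Euc n,
    (∀ ζ : Euc n, dd (η, 0) (dd (0, ζ) (Function.uncurry c)) (x, y) = 0) → η = 0 := by
  intro x hx y hy η h
  have S := sm_of hB0
  obtain ⟨L, hL0, hL, -⟩ := diffeo_lip hB0.2.1.isCompact_closure S.oU subset_closure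
    (b1q hB1 (subset_closure hy))
  have h1 := hL x hx η
  have h2 : fderiv ℝ (fun x => qm c x y) x η = 0 := by
    rw [fderiv_qm S hx hy]
    refine ext_inner_right ℝ fun ζ => ?_
    rw [S.inner_dd_qm ⟨hx, hy⟩, h ζ]; simp
  rw [h2] at h1
  simpa using h1

theorem preGood_of {c : Euc n → Euc n → ℝ} {U V : Set (Euc n)} (hB0 : B0cond n c U V)
    (hB1 : B1cond n c U V) (hB2 : B2cond n c U V) : PreGood c U V where
  toSm := sm_of hB0
  injq := fun y hy => (b1q hB1 (subset_closure hy)).1.mono subset_closure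
  injp := fun x hx => by
    have := (b1q (B1_swap hB1) (subset_closure hx)).1.mono subset_closure
    simpa only [qm_swap] using this
  ndq := ndq_of hB0 hB1
  ndp := by
    intro x hx y hy ζ h
    refine ndq_of (B0_swap hB0) (B1_swap hB1) y hy x hx ζ ?_
    simp only [uncurry_swap, dd_swap]
    exact h
  cvq := fun y hy => by
    have := hB2.1 y (subset_closure hy)
    unfold Uyset at this
    unfold qm; exact this
  cvp := fun y hy => by
    have := hB2.2 y (subset_closure hy)
    unfold Vxset at this
    unfold pm; exact this

end FKM

end


section
open Set MeasureTheory Metric Bornology Filter Topology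
open scoped ENNReal NNReal Pointwise
namespace FKM
variable {n : ℕ}
attribute [local irreducible] qm pm Yv Xinv Phi

theorem dd_smul_fun {G : Type*} [NormedAddCommGroup G] [NormedSpace ℝ G] (r : ℝ) (e : G)
    (f : G → ℝ) : dd e (fun z => r * f z) = fun z => r * dd e f z := by
  ext z
  unfold dd
  have : (fun z => r * f z) = r • f := by ext; simp
  rw [this, fderiv_const_smul_field]
  simp

theorem dd_smul' {G : Type*} [NormedAddCommGroup G] [NormedSpace ℝ G] (r : ℝ) (e : G)
    (f : G → ℝ) : dd (r • e) f = fun z => r * dd e f z := by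
  ext z
  rw [dd_smul]; simp

theorem qjet {c : Euc n → Euc n → ℝ} {U V : Set (Euc n)} (G : PreGood c U V) {x y η η' : Euc n}
    (hx : x ∈ U) (hy : y ∈ V)
    (hj : ∀ ζ0 : Euc n, dd (η, 0) (dd (η, 0) (dd (0, ζ0) (Function.uncurry c))) (x, y)
      + dd (η', 0) (dd (0, ζ0) (Function.uncurry c)) (x, y) = 0) :
    ∃ r : ℝ, 0 < r ∧ ∃ X X' : ℝ → Euc n, ∃ w : Euc n, (∀ t ∈ Icc (-1 : ℝ) 1, X t ∈ U) ∧ X 0 = x ∧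
      (∀ t ∈ Icc (-1 : ℝ) 1, qm c (X t) y = qm c x y + t • w) ∧
      (∀ t ∈ Icc (-1 : ℝ) 1, HasDerivAt X (X' t) t) ∧ X' 0 = r • η ∧
      HasDerivAt X' (r ^ 2 • η') 0 := by
  have hz : (x, y) ∈ U ×ˢ V := ⟨hx, hy⟩
  set w := dd (η, 0) (fun z : Euc n × Euc n => qm c z.1 z.2) (x, y) with hw
  have hwi : ∀ ζ, inner ℝ w ζ = - dd (η, 0) (dd (0, ζ) (Function.uncurry c)) (x, y) := fun ζ =>
    G.inner_dd_qm hz (η, 0) ζ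
  have hmem : (qm c x y, y) ∈ jm c '' (U ×ˢ V) := PreGood.jm_mem hx hy
  obtain ⟨ε, hε, hball⟩ := Metric.isOpen_iff.1 G.oDX _ hmem
  obtain ⟨r, hr, hrw⟩ : ∃ r : ℝ, 0 < r ∧ r * ‖w‖ < ε := by
    refine ⟨ε / (‖w‖ + 1) , by positivity, ?_⟩
    rw [div_mul_eq_mul_div, div_lt_iff₀ (by positivity)]
    nlinarith [norm_nonneg w]
  have hdom : ∀ t ∈ Icc (-1 : ℝ) 1, (qm c x y + t • (r • w), y) ∈ jm c '' (U ×ˢ V) := by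
    intro t ht
    apply hball
    rw [mem_ball, dist_eq_norm]
    have : (qm c x y + t • (r • w), y) - (qm c x y, y) = (t • (r • w), (0 : Euc n)) := by simp
    rw [this, Prod.norm_def, norm_zero, norm_smul, norm_smul, Real.norm_of_nonneg hr.le,
      max_eq_left (by positivity)]
    have h1 : |t| ≤ 1 := abs_le.2 ht
    have h2 : |t| * (r * ‖w‖) ≤ 1 * (r * ‖w‖) := mul_le_mul_of_nonneg_right h1 (by positivity)
    rw [Real.norm_eq_abs]
    linarith
  have h0 : (0 : ℝ) ∈ Icc (-1 : ℝ) 1 := by constructor <;> norm_num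
  obtain ⟨γ', γ'', -, h2, -, h4, h5, h6⟩ := G.qcurve (hdom 0 h0)
  have hX0 : Xinv c U V (qm c x y + (0 : ℝ) • (r • w), y) = x := by
    rw [zero_smul, add_zero]; exact G.Xinv_qm hx hy
  have e1 : γ' 0 = r • η := by
    rw [← sub_eq_zero]
    refine G.ndq x hx y hy _ fun ζ => ?_
    have h7 := h5 0 (hdom 0 h0) ζ
    rw [hX0, real_inner_smul_left, hwi] at h7
    have h8 : ((γ' 0 - r • η, 0) : Euc n × Euc n) = (γ' 0, 0) + (-r) • (η, 0) := by
      simp [sub_eq_add_neg]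
    rw [h8, dd_add, dd_smul, h7, smul_eq_mul]
    ring
  have e2 : γ'' = r ^ 2 • η' := by
    rw [← sub_eq_zero]
    refine G.ndq x hx y hy _ fun ζ => ?_
    have h7 := h6 ζ
    rw [hX0, e1] at h7
    have h8 : ((γ'' - r ^ 2 • η', 0) : Euc n × Euc n) = (γ'', 0) + (-r ^ 2) • (η', 0) := by
      simp [sub_eq_add_neg]
    have h9 : ((r • η, 0) : Euc n × Euc n) = r • (η, 0) := by simp
    rw [h9, dd_smul', dd_smul', dd_smul_fun] at h7
    have h10 := hj ζ
    rw [h8, dd_add, dd_smul, smul_eq_mul]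
    linear_combination h7 - r ^ 2 * h10
  refine ⟨r, hr, fun t => Xinv c U V (qm c x y + t • (r • w), y), γ', r • w, ?_, hX0, ?_, ?_, e1, ?_⟩
  · intro t ht; exact (G.Xinv_mem (hdom t ht))
  · intro t ht; exact G.qm_Xinv (hdom t ht)
  · intro t ht; exact h4 t (hdom t ht)
  · rw [← e2]; exact h2

theorem good_of {c : Euc n → Euc n → ℝ} {U V : Set (Euc n)} (hB0 : B0cond n c U V)
    (hB1 : B1cond n c U V) (hB2 : B2cond n c U V) (hB3 : B3cond n c U V) : Good c U V where
  toPreGood := preGood_of hB0 hB1 hB2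
  mtw := by
    have G := preGood_of hB0 hB1 hB2
    intro x hx y hy η η' ζ ζ' h1 h2 h3
    have hz : (x, y) ∈ U ×ˢ V := ⟨hx, hy⟩
    obtain ⟨r, hr, X, X', w, hXU, hX0, hXq, hXd, hX'0, hX''⟩ := qjet G hx hy h1
    obtain ⟨ρ, hρ, Y, Y', w', hYV, hY0, hYq, hYd, hY'0, hY''⟩ := qjet G.swap (x := y) (y := x)
      (η := ζ) (η' := ζ') hy hx (by
        intro η0
        simp only [uncurry_swap, dd_swap]
        exact h2 η0)
    have h0 : (0 : ℝ) ∈ Icc (-1 : ℝ) 1 := by constructor <;> norm_num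
    have hnb : Icc (-1 : ℝ) 1 ∈ 𝓝 (0 : ℝ) := Icc_mem_nhds (by norm_num) (by norm_num)
    set C := Function.uncurry c with hC
    have hCs : ∀ z ∈ U ×ˢ V, ContDiffAt ℝ 4 C z := fun z hz => G.smooth.contDiffAt (G.oUV.mem_nhds hz)
    set b : Euc n × Euc n := (0, ρ • ζ) with hb
    set b' : Euc n × Euc n := (0, ρ ^ 2 • ζ') with hb'
    set a : Euc n × Euc n := (r • η, 0) with ha
    set a' : Euc n × Euc n := (r ^ 2 • η', 0) with ha'
    have T1 : ∀ s ∈ Icc (-1 : ℝ) 1, ∀ t ∈ Icc (-1 : ℝ) 1,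
        HasDerivAt (fun t => c (X s) (Y t)) (dd (0, Y' t) C (X s, Y t)) t := by
      intro s hs t ht
      exact dd_hasDerivAt (f := C) (γ := fun t => (X s, Y t)) ((hasDerivAt_const t (X s)).prodMk (hYd t ht))
        ((hCs _ ⟨hXU s hs, hYV t ht⟩).differentiableAt (by norm_num))
    have T2 : ∀ s ∈ Icc (-1 : ℝ) 1, deriv (deriv (fun t => c (X s) (Y t))) 0
        = dd b (dd b C) (X s, y) + dd b' C (X s, y) := by
      intro s hs
      have e : deriv (fun t => c (X s) (Y t)) =ᶠ[𝓝 0] fun t => dd (0, Y' t) C (X s, Y t) := by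
        filter_upwards [hnb] with t ht using (T1 s hs t ht).deriv
      rw [e.deriv_eq]
      have := dd_hasDerivAt2 (f := C) (γ := fun t => (X s, Y t)) (γ' := fun t => (0, Y' t)) (s := 0)
        (γ'' := (0, ρ ^ 2 • ζ')) ((hasDerivAt_const 0 (X s)).prodMk (hYd 0 h0))
        ((hasDerivAt_const 0 (0 : Euc n)).prodMk hY'')
        ((hCs _ ⟨hXU s hs, hYV 0 h0⟩).of_le (by norm_num))
      rw [this.deriv]
      simp only [hY'0, hY0, hb, hb']
    set H : Euc n × Euc n → ℝ := fun z => dd b (dd b C) z + dd b' C z with hH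
    have hHs : ContDiffOn ℝ 2 H (U ×ˢ V) :=
      (G.dd_smooth2 b b).add ((G.dd_smooth3 b').of_le (by norm_num))
    have c4 : crossDiff4 n c X Y = dd a (dd a H) (x, y) + dd a' H (x, y) := by
      unfold crossDiff4
      have e : (fun s => deriv (deriv (fun t => c (X s) (Y t))) 0) =ᶠ[𝓝 0] fun s => H (X s, y) := by
        filter_upwards [hnb] with s hs using T2 s hs
      rw [e.deriv.deriv_eq]
      have e2 : deriv (fun s => H (X s, y)) =ᶠ[𝓝 0] fun s => dd (X' s, 0) H (X s, y) := by
        filter_upwards [hnb] with s hs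
        exact (dd_hasDerivAt (f := H) (γ := fun s => (X s, y))
          ((hXd s hs).prodMk (hasDerivAt_const s y))
          ((hHs.contDiffAt (G.oUV.mem_nhds ⟨hXU s hs, hy⟩)).differentiableAt (by norm_num))).deriv
      rw [e2.deriv_eq]
      have := dd_hasDerivAt2 (f := H) (γ := fun t => (X t, y)) (γ' := fun t => (X' t, 0)) (s := 0)
        (γ'' := (r ^ 2 • η', 0)) ((hXd 0 h0).prodMk (hasDerivAt_const 0 y))
        (hX''.prodMk (hasDerivAt_const 0 (0 : Euc n)))
        (hHs.contDiffAt (G.oUV.mem_nhds ⟨hXU 0 h0, hy⟩))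
      rw [this.deriv]
      simp only [hX'0, hX0, ha, ha']
    have ea : a = r • (η, 0) := by simp [ha]
    have ea' : a' = r ^ 2 • (η', 0) := by simp [ha']
    have eb : b = ρ • (0, ζ) := by simp [hb]
    have eb' : b' = ρ ^ 2 • (0, ζ') := by simp [hb']
    have c2 : crossDiff2 n c X Y = 0 := by
      unfold crossDiff2
      have e : (fun s => deriv (fun t => c (X s) (Y t)) 0) =ᶠ[𝓝 0] fun s => dd b C (X s, y) := by
        filter_upwards [hnb] with s hs
        rw [(T1 s hs 0 h0).deriv, hY'0, hY0]
      rw [e.deriv_eq]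
      have := dd_hasDerivAt (f := dd b C) (γ := fun s => (X s, y))
          ((hXd 0 h0).prodMk (hasDerivAt_const 0 y))
          (((G.dd_smooth3 b).contDiffAt (G.oUV.mem_nhds ⟨hXU 0 h0, hy⟩)).differentiableAt (by norm_num))
      rw [this.deriv, hX'0, hX0, ← ha, ea, eb, dd_smul', dd_smul', dd_smul_fun]
      simp only [h3, mul_zero]
    have hle := hB3 X Y (fun t ht => subset_closure (hXU t ht)) (fun t ht => subset_closure (hYV t ht))
      (by
        refine ⟨(-qm c x y, -pm c x y), (-w, -w'), fun t ht => ?_⟩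
        have e1 := hXq t ht
        have e2 := hYq t ht
        rw [qm_swap, qm_swap] at e2
        have e3 : gradY n c (X t) y = - qm c (X t) y := by unfold qm; simp
        have e4 : gradX n c x (Y t) = - pm c x (Y t) := by unfold pm; simp
        simp only [hX0, hY0]
        rw [e3, e4, e1, e2]
        simp only [Prod.smul_mk, Prod.mk_add_mk, smul_neg, neg_add]) c2
    rw [c4] at hle
    -- expand
    have D1 : ∀ e, EqOn (dd e H) (fun z => dd e (dd b (dd b C)) z + dd e (dd b' C) z) (U ×ˢ V) := by
      intro e z hz
      exact dd_add_fun (((G.dd_smooth2 b b).contDiffAt (G.oUV.mem_nhds hz)).differentiableAt (by norm_num))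
        (((G.dd_smooth3 b').contDiffAt (G.oUV.mem_nhds hz)).differentiableAt (by norm_num)) e
    have D2 : dd a (dd a H) (x, y) = dd a (dd a (dd b (dd b C))) (x, y) + dd a (dd a (dd b' C)) (x, y) := by
      rw [dd_congr G.oUV (D1 a) a hz]
      refine dd_add_fun ?_ ?_ a
      · exact ((dd_contDiffOn G.oUV (m := 1) (by norm_num) (G.dd_smooth2 b b) a).contDiffAt
          (G.oUV.mem_nhds hz)).differentiableAt (by norm_num)
      · exact ((G.dd_smooth2 a b').contDiffAt (G.oUV.mem_nhds hz)).differentiableAt (by norm_num)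
    rw [D2, D1 a' hz] at hle
    have E2 := h1 (ρ ^ 2 • ζ')
    have E3 := h2 (r ^ 2 • η')
    rw [← hb'] at E2
    rw [← ha'] at E3
    rw [G.comm3 _ _ hz] at E3
    have E4 := G.comm2 (η', 0) (0, ζ') hz
    simp only [ea, ea', eb, eb', dd_smul', dd_smul_fun] at hle E2 E3
    have hpos : 0 < r ^ 2 * ρ ^ 2 := by positivity
    have hfin : (r ^ 2 * ρ ^ 2) * (dd (η, 0) (dd (η, 0) (dd (0, ζ) (dd (0, ζ) C))) (x, y)
        - dd (η', 0) (dd (0, ζ') C) (x, y)) ≤ 0 := by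
      linear_combination hle - r ^ 2 * E2 - ρ ^ 2 * E3 - r ^ 2 * ρ ^ 2 * E4
    have := nonpos_of_mul_nonpos_right hfin hpos
    linarith

end FKM

end


section
open Set MeasureTheory Metric Bornology Filter Topology
open scoped ENNReal NNReal Pointwise
namespace FKM
variable {n : ℕ}
attribute [local irreducible] qm pm Yv Xinv Phi

theorem qpath {c : Euc n → Euc n → ℝ} {U V : Set (Euc n)} (G : PreGood c U V) {y x0 x1 : Euc n}
    (hy : y ∈ V) {L : ℝ} (hL : ∀ x ∈ U, ∀ v, ‖v‖ ≤ L * ‖fderiv ℝ (fun x => qm c x y) x v‖)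
    (h0 : x0 ∈ U) (h1 : x1 ∈ U) :
    ∃ γ γ' : ℝ → Euc n, γ 0 = x0 ∧ γ 1 = x1 ∧ ∀ t ∈ Icc (0 : ℝ) 1, γ t ∈ U ∧
      HasDerivAt γ (γ' t) t ∧ ‖γ' t‖ ≤ L * ‖qm c x1 y - qm c x0 y‖ := by
  set q0 := qm c x0 y with hq0
  set w := qm c x1 y - q0 with hw
  have hdom : ∀ t ∈ Icc (0 : ℝ) 1, (q0 + t • w, y) ∈ jm c '' (U ×ˢ V) := fun t ht =>
    G.DX_seg (PreGood.jm_mem h0 hy) (PreGood.jm_mem h1 hy) ht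
  obtain ⟨γ', -, -, -, -, h4, h5, -⟩ := G.qcurve (hdom 0 ⟨le_rfl, zero_le_one⟩)
  refine ⟨fun r => Xinv c U V (q0 + r • w, y), γ', ?_, ?_, fun t ht => ⟨G.Xinv_mem (hdom t ht),
    h4 t (hdom t ht), ?_⟩⟩
  · simp only [zero_smul, add_zero]; exact G.Xinv_qm h0 hy
  · simp only [one_smul, hw, add_sub_cancel]; exact G.Xinv_qm h1 hy
  · have hm := G.Xinv_mem (hdom t ht)
    have e : fderiv ℝ (fun x => qm c x y) (Xinv c U V (q0 + t • w, y)) (γ' t) = w := by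
      rw [fderiv_qm G.toSm hm hy]
      refine ext_inner_right ℝ fun ζ => ?_
      rw [G.inner_dd_qm ⟨hm, hy⟩, h5 t (hdom t ht), neg_neg]
    have := hL _ hm (γ' t)
    rwa [e] at this

theorem mvt01 {f f' : ℝ → ℝ} {B : ℝ} (h : ∀ t ∈ Icc (0 : ℝ) 1, HasDerivAt f (f' t) t)
    (hB : ∀ t ∈ Icc (0 : ℝ) 1, |f' t| ≤ B) {t : ℝ} (ht : t ∈ Icc (0 : ℝ) 1) :
    |f t - f 0| ≤ B := by
  have h1 := (convex_Icc (0 : ℝ) 1).norm_image_sub_le_of_norm_hasDerivWithin_le (f := f) (f' := f')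
    (C := B) (fun t ht => (h t ht).hasDerivWithinAt) (fun t ht => by
      rw [Real.norm_eq_abs]; exact hB t ht) (⟨le_rfl, zero_le_one⟩ : (0 : ℝ) ∈ Icc (0 : ℝ) 1) ht
  rw [Real.norm_eq_abs, sub_zero, Real.norm_eq_abs] at h1
  have hB0 : 0 ≤ B := (abs_nonneg _).trans (hB t ht)
  have : |t| ≤ 1 := by rw [abs_of_nonneg ht.1]; exact ht.2
  have h2 := mul_le_mul_of_nonneg_left this hB0
  linarith

theorem quad_est {ψ : Euc n → ℝ} {V : Set (Euc n)} (hV : IsOpen V) (hψ : ContDiffOn ℝ 2 ψ V)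
    {κ ℓ : ℝ} (hκ0 : 0 ≤ κ) (hκ : ∀ y ∈ V, ∀ a e, |dd a (dd e ψ) y| ≤ κ * (‖a‖ * ‖e‖))
    {γ γ' : ℝ → Euc n}
    (hγ : ∀ t ∈ Icc (0 : ℝ) 1, γ t ∈ V ∧ HasDerivAt γ (γ' t) t ∧ ‖γ' t‖ ≤ ℓ)
    (h0 : ∀ e, dd e ψ (γ 0) = 0) : |ψ (γ 1) - ψ (γ 0)| ≤ κ * ℓ ^ 2 := by
  have hℓ : 0 ≤ ℓ := (norm_nonneg _).trans (hγ 0 ⟨le_rfl, zero_le_one⟩).2.2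
  have s1 : ∀ e, ∀ t ∈ Icc (0 : ℝ) 1, |dd e ψ (γ t)| ≤ κ * (ℓ * ‖e‖) := by
    intro e t ht
    have := mvt01 (f := fun t => dd e ψ (γ t)) (f' := fun t => dd (γ' t) (dd e ψ) (γ t))
      (B := κ * (ℓ * ‖e‖)) (fun t ht => by
        obtain ⟨h1, h2, h3⟩ := hγ t ht
        exact dd_hasDerivAt (f := dd e ψ) h2
          (((dd_contDiffOn hV (m := 1) (by norm_num) hψ e).contDiffAt (hV.mem_nhds h1)).differentiableAt
            (by norm_num))) (fun t ht => by
        obtain ⟨h1, h2, h3⟩ := hγ t ht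
        refine (hκ _ h1 _ _).trans ?_
        gcongr) ht
    simpa [h0] using this
  refine mvt01 (f := fun t => ψ (γ t)) (f' := fun t => dd (γ' t) ψ (γ t)) (B := κ * ℓ ^ 2)
    (fun t ht => ?_) (fun t ht => ?_) ⟨zero_le_one, le_rfl⟩
  · obtain ⟨h1, h2, h3⟩ := hγ t ht
    exact dd_hasDerivAt (f := ψ) h2 ((hψ.contDiffAt (hV.mem_nhds h1)).differentiableAt (by norm_num))
  · obtain ⟨h1, h2, h3⟩ := hγ t ht
    refine (s1 _ t ht).trans ?_
    rw [pow_two]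
    gcongr

theorem lip_seg {E : Type*} [NormedAddCommGroup E] [NormedSpace ℝ E] {f : E → ℝ} {O : Set E}
    (hO : IsOpen O) (hf : ContDiffOn ℝ 1 f O) {z w : E} {B : ℝ}
    (hseg : ∀ t ∈ Icc (0 : ℝ) 1, z + t • w ∈ O)
    (hB : ∀ t ∈ Icc (0 : ℝ) 1, |dd w f (z + t • w)| ≤ B) {t : ℝ} (ht : t ∈ Icc (0 : ℝ) 1) :
    |f (z + t • w) - f z| ≤ B := by
  have hl : ∀ t : ℝ, HasDerivAt (fun t : ℝ => z + t • w) w t := fun t => by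
    simpa using ((hasDerivAt_id t).smul_const w).const_add z
  have := mvt01 (f := fun t => f (z + t • w)) (f' := fun t => dd w f (z + t • w)) (B := B)
    (fun t ht => dd_hasDerivAt (f := f) (hl t)
      ((hf.contDiffAt (hO.mem_nhds (hseg t ht))).differentiableAt (by norm_num))) hB ht
  simpa using this

theorem taylor2 {E : Type*} [NormedAddCommGroup E] [NormedSpace ℝ E] {f : E → ℝ} {O : Set E}
    (hO : IsOpen O) (hf : ContDiffOn ℝ 2 f O) {z w : E} {B : ℝ}
    (hseg : ∀ t ∈ Icc (0 : ℝ) 1, z + t • w ∈ O)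
    (hB : ∀ t ∈ Icc (0 : ℝ) 1, |dd w (dd w f) (z + t • w)| ≤ B) :
    |f (z + w) - f z - dd w f z| ≤ B := by
  have hl : ∀ t : ℝ, HasDerivAt (fun t : ℝ => z + t • w) w t := fun t => by
    simpa using ((hasDerivAt_id t).smul_const w).const_add z
  have s1 : ∀ t ∈ Icc (0 : ℝ) 1, |dd w f (z + t • w) - dd w f z| ≤ B := fun t ht =>
    lip_seg hO (dd_contDiffOn hO (m := 1) (by norm_num) hf w) hseg hB ht
  have := mvt01 (f := fun t => f (z + t • w) - t * dd w f z)
    (f' := fun t => dd w f (z + t • w) - dd w f z) (B := B)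
    (fun t ht => by
      have h1 := dd_hasDerivAt (f := f) (hl t)
        ((hf.contDiffAt (hO.mem_nhds (hseg t ht))).differentiableAt (by norm_num))
      have h2 : HasDerivAt (fun t : ℝ => t * dd w f z) (dd w f z) t := by
        simpa using (hasDerivAt_id t).mul_const (dd w f z)
      exact h1.sub h2) s1 (t := 1) ⟨zero_le_one, le_rfl⟩
  have e : f (z + (1 : ℝ) • w) - 1 * dd w f z - (f (z + (0 : ℝ) • w) - 0 * dd w f z)
    = f (z + w) - f z - dd w f z := by
    rw [one_smul, zero_smul, add_zero]; ring
  rw [e] at this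
  exact this

end FKM

end


section
open Set MeasureTheory Metric Bornology Filter Topology
open scoped ENNReal NNReal Pointwise
namespace FKM
variable {n : ℕ}
attribute [local irreducible] qm pm Yv Xinv Phi

/-- interior data with uniform bounds at a fixed `xb` -/
structure Bd (c : Euc n → Euc n → ℝ) (U V : Set (Euc n)) (xb : Euc n) (ρ K L : ℝ) : Prop where
  G : PreGood c U V
  hρ : 0 < ρ
  hball : closedBall xb ρ ⊆ U
  hK : 1 ≤ K
  hL : 1 ≤ L
  bd : ∀ z ∈ U ×ˢ V, ∀ a b d e : Euc n × Euc n,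
      |dd a (dd b (Function.uncurry c)) z| ≤ K * (‖a‖ * ‖b‖) ∧
      |dd a (dd b (dd d (Function.uncurry c))) z| ≤ K * (‖a‖ * ‖b‖ * ‖d‖) ∧
      |dd a (dd b (dd d (dd e (Function.uncurry c)))) z| ≤ K * (‖a‖ * ‖b‖ * ‖d‖ * ‖e‖)
  lip : ∀ y ∈ V, ∀ v, ‖v‖ ≤ L * ‖fderiv ℝ (fun y => qm (fun y x => c x y) y xb) y v‖

theorem norm_le_of_inner {v : Euc n} {B : ℝ} (hB : 0 ≤ B)
    (h : ∀ ζ : Euc n, |inner ℝ v ζ| ≤ B * ‖ζ‖) : ‖v‖ ≤ B := by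
  have h1 := h v
  rw [real_inner_self_eq_norm_sq, abs_of_nonneg (sq_nonneg _)] at h1
  by_cases h0 : ‖v‖ = 0
  · rw [h0]; exact hB
  · have h3 : 0 < ‖v‖ := lt_of_le_of_ne (norm_nonneg _) (Ne.symm h0)
    nlinarith

theorem nl (a : Euc n) : ‖((a, 0) : Euc n × Euc n)‖ = ‖a‖ := by
  rw [Prod.norm_def]; simp
theorem nr (a : Euc n) : ‖((0, a) : Euc n × Euc n)‖ = ‖a‖ := by
  rw [Prod.norm_def]; simp

namespace Bd
variable {c : Euc n → Euc n → ℝ} {U V : Set (Euc n)} {xb : Euc n} {ρ K L : ℝ}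

theorem mem (B : Bd c U V xb ρ K L) : xb ∈ U := B.hball (mem_closedBall_self B.hρ.le)

theorem inner_A (B : Bd c U V xb ρ K L) {x y : Euc n} (hx : x ∈ U) (hy : y ∈ V) (η ζ : Euc n) :
    inner ℝ (fderiv ℝ (fun x => qm c x y) x η) ζ
      = - dd (η, 0) (dd (0, ζ) (Function.uncurry c)) (x, y) := by
  rw [fderiv_qm B.G.toSm hx hy, B.G.inner_dd_qm ⟨hx, hy⟩]

theorem transpose (B : Bd c U V xb ρ K L) {y : Euc n} (hy : y ∈ V) (η : Euc n) :
    ‖η‖ ≤ L * ‖fderiv ℝ (fun x => qm c x y) xb η‖ := by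
  set P := fderiv ℝ (fun y => qm (fun y x => c x y) y xb) y with hP
  have hinj : Function.Injective (P : Euc n →ₗ[ℝ] Euc n) := by
    rw [injective_iff_map_eq_zero]
    intro v hv
    have := B.lip y hy v
    rw [← hP] at this
    have hv' : P v = 0 := hv
    rw [hv', norm_zero, mul_zero] at this
    exact norm_le_zero_iff.1 this
  obtain ⟨ζ, hζ⟩ := LinearMap.injective_iff_surjective.1 hinj η
  have hζ' : P ζ = η := hζ
  have h1 : ‖ζ‖ ≤ L * ‖η‖ := by rw [← hζ']; exact B.lip y hy ζ
  have h2 : inner ℝ (P ζ) η = inner ℝ (fderiv ℝ (fun x => qm c x y) xb η) ζ := by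
    rw [B.inner_A B.mem hy, hP, fderiv_qm B.G.toSm.swap hy B.mem,
      B.G.toSm.swap.inner_dd_qm ⟨hy, B.mem⟩]
    simp only [uncurry_swap, dd_swap, Prod.swap_prod_mk]
    rw [B.G.comm2 _ _ ⟨B.mem, hy⟩]
  rw [hζ', real_inner_self_eq_norm_sq] at h2
  have h3 := real_inner_le_norm (fderiv ℝ (fun x => qm c x y) xb η) ζ
  have h4 : ‖fderiv ℝ (fun x => qm c x y) xb η‖ * ‖ζ‖
      ≤ ‖fderiv ℝ (fun x => qm c x y) xb η‖ * (L * ‖η‖) :=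
    mul_le_mul_of_nonneg_left h1 (norm_nonneg _)
  by_cases h0 : ‖η‖ = 0
  · rw [h0]; have := B.hL; positivity
  · have h5 : 0 < ‖η‖ := lt_of_le_of_ne (norm_nonneg _) (Ne.symm h0)
    have h6 : ‖η‖ * ‖η‖ ≤ (L * ‖fderiv ℝ (fun x => qm c x y) xb η‖) * ‖η‖ := by
      linarith only [h2, h3, h4, pow_two ‖η‖]
    exact le_of_mul_le_mul_right h6 h5

theorem A_norm (B : Bd c U V xb ρ K L) {y : Euc n} (hy : y ∈ V) (η : Euc n) :
    ‖fderiv ℝ (fun x => qm c x y) xb η‖ ≤ K * ‖η‖ := by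
  have := B.hK
  refine norm_le_of_inner (by positivity) fun ζ => ?_
  rw [B.inner_A B.mem hy, abs_neg]
  refine (B.bd (xb, y) ⟨B.mem, hy⟩ (η, 0) (0, ζ) 0 0).1.trans (le_of_eq ?_)
  rw [nl, nr]; ring

theorem seg_mem (B : Bd c U V xb ρ K L) {x x' y : Euc n} (hx : x ∈ closedBall xb ρ)
    (hx' : x' ∈ closedBall xb ρ) (hy : y ∈ V) {t : ℝ} (ht : t ∈ Icc (0 : ℝ) 1) :
    ((x, y) : Euc n × Euc n) + t • ((x' - x, 0) : Euc n × Euc n) ∈ U ×ˢ V := by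
  have : ((x, y) : Euc n × Euc n) + t • ((x' - x, 0) : Euc n × Euc n) = (x + t • (x' - x), y) := by
    simp
  rw [this]
  exact ⟨B.hball ((convex_closedBall xb ρ).add_smul_sub_mem hx hx' ht), hy⟩

theorem DA (B : Bd c U V xb ρ K L) {x y : Euc n} (hx : x ∈ closedBall xb ρ) (hy : y ∈ V) :
    ‖fderiv ℝ (fun x => qm c x y) x - fderiv ℝ (fun x => qm c x y) xb‖ ≤ K * ‖x - xb‖ := by
  have hK := B.hK
  refine ContinuousLinearMap.opNorm_le_bound _ (by positivity) fun η => ?_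
  refine norm_le_of_inner (by positivity) fun ζ => ?_
  rw [sub_apply, inner_sub_left, B.inner_A (B.hball hx) hy, B.inner_A B.mem hy]
  have h := lip_seg (f := dd (η, 0) (dd (0, ζ) (Function.uncurry c))) B.G.oUV
    ((B.G.dd_smooth2 _ _).of_le (by norm_num)) (z := (xb, y)) (w := (x - xb, 0))
    (B := K * (‖x - xb‖ * ‖η‖ * ‖ζ‖))
    (fun t ht => B.seg_mem (mem_closedBall_self B.hρ.le) hx hy ht) (fun t ht => by
      refine (B.bd _ (B.seg_mem (mem_closedBall_self B.hρ.le) hx hy ht)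
        (x - xb, 0) (η, 0) (0, ζ) 0).2.1.trans (le_of_eq ?_)
      rw [nl, nl, nr]) (t := 1) ⟨zero_le_one, le_rfl⟩
  have e : ((xb, y) : Euc n × Euc n) + (1 : ℝ) • ((x - xb, 0) : Euc n × Euc n) = (x, y) := by simp
  rw [e] at h
  rw [abs_sub_comm] at h
  have e2 : ∀ a b : ℝ, - a - - b = b - a := fun a b => by ring
  rw [e2]
  refine h.trans (le_of_eq (by ring))

theorem solve (B : Bd c U V xb ρ K L) {s : ℝ} (hs : 0 < s) (hs1 : 2 * L * K * s ≤ ρ)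
    (hs2 : K * (2 * L * K * s) ≤ 1 / (2 * L)) {y ν : Euc n} (hy : y ∈ V) (hν : ‖ν‖ = 1) :
    ∃ x1 ∈ closedBall xb (2 * L * K * s),
      qm c x1 y = qm c xb y + s • fderiv ℝ (fun x => qm c x y) xb ν := by
  have hK := B.hK
  have hL := B.hL
  set A := fderiv ℝ (fun x => qm c x y) xb with hA
  have hsub : closedBall xb (2 * L * K * s) ⊆ closedBall xb ρ := closedBall_subset_closedBall hs1
  have hinj : Function.Injective (A : Euc n →ₗ[ℝ] Euc n) := by
    rw [injective_iff_map_eq_zero]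
    intro v hv
    have := B.transpose hy v
    rw [← hA] at this
    have hv' : A v = 0 := hv
    rw [hv', norm_zero, mul_zero] at this
    exact norm_le_zero_iff.1 this
  have hsurj : Function.Surjective A := LinearMap.injective_iff_surjective.1 hinj
  choose R hR using hsurj
  have hL0 : (0 : ℝ) ≤ L := by linarith
  let N : A.NonlinearRightInverse :=
    { toFun := R
      nnnorm := ⟨L, hL0⟩
      bound' := fun v => by
        have := B.transpose hy (R v)
        rw [← hA, hR v] at this
        exact this
      right_inv' := hR }
  have hkey : ∀ x ∈ closedBall xb (2 * L * K * s), ∀ x' ∈ closedBall xb (2 * L * K * s),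
      ‖qm c x y - qm c x' y - A (x - x')‖ ≤ (K * (2 * L * K * s)) * ‖x - x'‖ := by
    intro x hx x' hx'
    refine Convex.norm_image_sub_le_of_norm_hasFDerivWithin_le' (𝕜 := ℝ) (f := fun x => qm c x y)
      (φ := A) (C := K * (2 * L * K * s)) (s := closedBall xb (2 * L * K * s)) (f' := fun x => fderiv ℝ (fun x => qm c x y) x) (fun z hz => ?_) (fun z hz => ?_)
      (convex_closedBall _ _) hx' hx
    · have hzU := B.hball (hsub hz)
      have : DifferentiableAt ℝ (fun x => qm c x y) z :=
        DifferentiableAt.comp (g := fun z : Euc n × Euc n => qm c z.1 z.2) (f := fun x => (x, y)) z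
          ((B.G.qm_smooth.contDiffAt (B.G.oUV.mem_nhds ⟨hzU, hy⟩)).differentiableAt (by norm_num))
          (by fun_prop)
      exact this.hasFDerivAt.hasFDerivWithinAt
    · refine (B.DA (hsub hz) hy).trans ?_
      have : ‖z - xb‖ ≤ 2 * L * K * s := by rw [← dist_eq_norm]; exact hz
      exact mul_le_mul_of_nonneg_left this (by linarith)
  have happ : ApproximatesLinearOn (fun x => qm c x y) A (closedBall xb (2 * L * K * s))
      ⟨K * (2 * L * K * s), by positivity⟩ := hkey
  have hS := happ.surjOn_closedBall_of_nonlinearRightInverse N (ε := 2 * L * K * s) (b := xb)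
    (by positivity) (Subset.refl _)
  have hmem : qm c xb y + s • A ν ∈ closedBall (qm c xb y)
      ((L⁻¹ - K * (2 * L * K * s)) * (2 * L * K * s)) := by
    rw [mem_closedBall, dist_eq_norm, add_sub_cancel_left, norm_smul, Real.norm_of_nonneg hs.le]
    have h1 := B.A_norm hy ν
    rw [← hA, hν, mul_one] at h1
    have h2 : s * ‖A ν‖ ≤ s * K := mul_le_mul_of_nonneg_left h1 hs.le
    refine h2.trans ?_
    have h3 : 1 / (2 * L) ≤ L⁻¹ - K * (2 * L * K * s) := by
      have : 1 / (2 * L) = L⁻¹ - 1 / (2 * L) := by field_simp; norm_num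
      linarith
    have h4 : 1 / (2 * L) * (2 * L * K * s) ≤ (L⁻¹ - K * (2 * L * K * s)) * (2 * L * K * s) :=
      mul_le_mul_of_nonneg_right h3 (by positivity)
    have h5 : 1 / (2 * L) * (2 * L * K * s) = s * K := by field_simp
    rw [h5] at h4
    exact h4
  obtain ⟨x1, hx1, he⟩ := hS hmem
  exact ⟨x1, hx1, he⟩

end Bd
end FKM

end


section
open Set MeasureTheory Metric Bornology Filter Topology
open scoped ENNReal NNReal Pointwise
namespace FKM
variable {n : ℕ}
attribute [local irreducible] qm pm Yv Xinv Phi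

theorem dd_slice {f : Euc n × Euc n → ℝ} {x y : Euc n} (hf : DifferentiableAt ℝ f (x, y)) (e : Euc n) :
    dd e (fun y => f (x, y)) y = dd (0, e) f (x, y) := by
  have h1 : HasFDerivAt (fun y' => f (x, y'))
      ((fderiv ℝ f (x, y)).comp (ContinuousLinearMap.inr ℝ (Euc n) (Euc n))) y :=
    HasFDerivAt.comp (g := f) (f := fun y' => (x, y')) y hf.hasFDerivAt (hasFDerivAt_prodMk_right x y)
  unfold dd
  rw [h1.fderiv]; simp

theorem slice_smooth {f : Euc n × Euc n → ℝ} {U V : Set (Euc n)} {k : WithTop ℕ∞}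
    (hf : ContDiffOn ℝ k f (U ×ˢ V)) {x : Euc n} (hx : x ∈ U) :
    ContDiffOn ℝ k (fun y => f (x, y)) V :=
  hf.comp (g := f) (f := fun y => (x, y)) (contDiffOn_const.prodMk contDiffOn_id) (fun y hy => ⟨hx, hy⟩)

theorem dd_sub3 {f g h : Euc n → ℝ} {y : Euc n} (hf : DifferentiableAt ℝ f y)
    (hg : DifferentiableAt ℝ g y) (hh : DifferentiableAt ℝ h y) (e : Euc n) :
    dd e (fun y => f y - g y - h y) y = dd e f y - dd e g y - dd e h y := by
  unfold dd
  have h1 : HasFDerivAt (fun y => f y - g y - h y) (fderiv ℝ f y - fderiv ℝ g y - fderiv ℝ h y) y :=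
    (hf.hasFDerivAt.sub hg.hasFDerivAt).sub hh.hasFDerivAt
  rw [h1.fderiv]; simp

/-- slicewise derivative of `f₁(x₁,·) - f₂(x,·) - f₃(x,·)` -/
theorem dd_slice3 {f g h : Euc n × Euc n → ℝ} {U V : Set (Euc n)} (hO : IsOpen (U ×ˢ V))
    (hf : ContDiffOn ℝ 1 f (U ×ˢ V)) (hg : ContDiffOn ℝ 1 g (U ×ˢ V)) (hh : ContDiffOn ℝ 1 h (U ×ˢ V))
    {x x1 : Euc n} (hx : x ∈ U) (hx1 : x1 ∈ U) (e : Euc n) :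
    ∀ y ∈ V, dd e (fun y => f (x1, y) - g (x, y) - h (x, y)) y
      = dd (0, e) f (x1, y) - dd (0, e) g (x, y) - dd (0, e) h (x, y) := by
  intro y hy
  have d : ∀ {f : Euc n × Euc n → ℝ} {x : Euc n}, ContDiffOn ℝ 1 f (U ×ˢ V) → x ∈ U →
      DifferentiableAt ℝ f (x, y) := fun hf hx =>
    (hf.contDiffAt (hO.mem_nhds ⟨hx, hy⟩)).differentiableAt (by norm_num)
  have d' : ∀ {f : Euc n × Euc n → ℝ} {x : Euc n}, ContDiffOn ℝ 1 f (U ×ˢ V) → x ∈ U →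
      DifferentiableAt ℝ (fun y => f (x, y)) y := fun {f x} hf hx =>
    DifferentiableAt.comp (g := f) (f := fun y => (x, y)) y (d hf hx) (by fun_prop)
  rw [dd_sub3 (d' hf hx1) (d' hg hx) (d' hh hx), dd_slice (d hf hx1), dd_slice (d hg hx),
    dd_slice (d hh hx)]

namespace Bd
variable {c : Euc n → Euc n → ℝ} {U V : Set (Euc n)} {xb : Euc n} {ρ K L : ℝ}

theorem touch (B : Bd c U V xb ρ K L) {s : ℝ} (hs : 0 < s) (hs1 : 2 * L * K * s ≤ ρ)
    (hs2 : K * (2 * L * K * s) ≤ 1 / (2 * L)) {y0 ν : Euc n} (hy0 : y0 ∈ V) (hν : ‖ν‖ = 1) :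
    ∃ x1 ∈ closedBall xb (2 * L * K * s), ∀ y ∈ V,
      -(c x1 y - c x1 y0 - c xb y + c xb y0) ≤
        s * inner ℝ (qm (fun y x => c x y) y xb - qm (fun y x => c x y) y0 xb) ν +
        (K * ((2 * L * K) ^ 2 * (1 + L * K)) * L ^ 2) * s ^ 2 *
          ‖qm (fun y x => c x y) y xb - qm (fun y x => c x y) y0 xb‖ ^ 2 := by
  have hK := B.hK
  have hL := B.hL
  have hO := B.G.oUV
  obtain ⟨x1, hx1, hq⟩ := B.solve hs hs1 hs2 hy0 hν
  refine ⟨x1, hx1, fun y hy => ?_⟩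
  set C := Function.uncurry c with hC
  set w := x1 - xb with hw
  have hx1' : x1 ∈ closedBall xb ρ := closedBall_subset_closedBall hs1 hx1
  have hx1U := B.hball hx1'
  have hxb' := mem_closedBall_self (x := xb) B.hρ.le
  have hwn : ‖w‖ ≤ 2 * L * K * s := by rw [hw, ← dist_eq_norm]; exact hx1
  have ew : ∀ y : Euc n, ((xb, y) : Euc n × Euc n) + ((w, 0) : Euc n × Euc n) = (x1, y) := by
    intro y; simp [hw]
  -- (i)
  have hi : ‖w - s • ν‖ ≤ L * (K * ‖w‖ ^ 2) := by
    refine (B.transpose hy0 _).trans ?_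
    refine mul_le_mul_of_nonneg_left ?_ (by linarith)
    refine norm_le_of_inner (by positivity) fun ζ => ?_
    have e1 : inner ℝ (fderiv ℝ (fun x => qm c x y0) xb (w - s • ν)) ζ
        = dd (0, ζ) C (x1, y0) - dd (0, ζ) C (xb, y0) - dd (w, 0) (dd (0, ζ) C) (xb, y0) := by
      rw [map_sub, map_smul]
      have e2 : s • fderiv ℝ (fun x => qm c x y0) xb ν = qm c x1 y0 - qm c xb y0 := by
        rw [hq]; abel
      rw [e2, inner_sub_left, inner_sub_left, B.inner_A B.mem hy0, B.G.inner_qm hx1U hy0,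
        B.G.inner_qm B.mem hy0]
      ring
    rw [e1]
    have := taylor2 (f := dd (0, ζ) C) hO ((B.G.dd_smooth3 _).of_le (by norm_num)) (z := (xb, y0))
      (w := (w, 0)) (B := K * (‖w‖ * ‖w‖ * ‖ζ‖)) (fun t ht => B.seg_mem hxb' hx1' hy0 ht)
      (fun t ht => by
        refine (B.bd _ (B.seg_mem hxb' hx1' hy0 ht) (w, 0) (w, 0) (0, ζ) 0).2.1.trans (le_of_eq ?_)
        rw [nl, nr])
    rw [ew] at this
    refine this.trans (le_of_eq (by ring))
  -- the function psi
  set ψ : Euc n → ℝ := fun y => C (x1, y) - C (xb, y) - dd (s • ν, 0) C (xb, y) with hψ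
  have hψs : ContDiffOn ℝ 2 ψ V :=
    ((slice_smooth (B.G.smooth.of_le (by norm_num)) hx1U).sub
      (slice_smooth (B.G.smooth.of_le (by norm_num)) B.mem)).sub
      (slice_smooth ((B.G.dd_smooth3 _).of_le (by norm_num)) B.mem)
  have D1 : ∀ e, EqOn (dd e ψ) (fun y => dd (0, e) C (x1, y) - dd (0, e) C (xb, y)
      - dd (0, e) (dd (s • ν, 0) C) (xb, y)) V := fun e =>
    dd_slice3 hO (B.G.smooth.of_le (by norm_num)) (B.G.smooth.of_le (by norm_num))
      ((B.G.dd_smooth3 _).of_le (by norm_num)) B.mem hx1U e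
  have D2 : ∀ a e, ∀ y ∈ V, dd a (dd e ψ) y = dd (0, a) (dd (0, e) C) (x1, y)
      - dd (0, a) (dd (0, e) C) (xb, y) - dd (0, a) (dd (0, e) (dd (s • ν, 0) C)) (xb, y) := by
    intro a e y hy
    rw [dd_congr B.G.oV (D1 e) a hy]
    exact dd_slice3 hO ((B.G.dd_smooth3 _).of_le (by norm_num)) ((B.G.dd_smooth3 _).of_le (by norm_num))
      ((B.G.dd_smooth2 _ _).of_le (by norm_num)) B.mem hx1U a y hy
  set κ := K * ((2 * L * K) ^ 2 * (1 + L * K)) * s ^ 2 with hκ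
  have hκ0 : 0 ≤ κ := by positivity
  have hκw : K * (‖w‖ ^ 2 + ‖w - s • ν‖) ≤ κ := by
    have h1 : ‖w‖ ^ 2 ≤ (2 * L * K * s) ^ 2 := pow_le_pow_left₀ (norm_nonneg _) hwn 2
    have h2 : L * (K * ‖w‖ ^ 2) ≤ L * (K * (2 * L * K * s) ^ 2) := by gcongr
    have h3 : K * (‖w‖ ^ 2 + ‖w - s • ν‖) ≤ K * ((2 * L * K * s) ^ 2 + L * (K * (2 * L * K * s) ^ 2)) :=
      mul_le_mul_of_nonneg_left (by linarith) (by linarith)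
    refine h3.trans (le_of_eq ?_)
    rw [hκ]; ring
  have hbd : ∀ y ∈ V, ∀ a e, |dd a (dd e ψ) y| ≤ κ * (‖a‖ * ‖e‖) := by
    intro y hy a e
    rw [D2 a e y hy]
    have hz : (xb, y) ∈ U ×ˢ V := ⟨B.mem, hy⟩
    have e1 : dd (0, a) (dd (0, e) (dd (s • ν, 0) C)) (xb, y)
        = dd (s • ν, 0) (dd (0, a) (dd (0, e) C)) (xb, y) := by
      have c1 : EqOn (dd (0, e) (dd (s • ν, 0) C)) (dd (s • ν, 0) (dd (0, e) C)) (U ×ˢ V) :=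
        fun z hz => B.G.comm2 _ _ hz
      rw [dd_congr hO c1 _ hz]
      exact dd_comm hO (by norm_num) (B.G.dd_smooth3 (0, e)) _ _ hz
    have e2 : dd (s • ν, 0) (dd (0, a) (dd (0, e) C)) (xb, y)
        = dd (w, 0) (dd (0, a) (dd (0, e) C)) (xb, y)
          - dd (w - s • ν, 0) (dd (0, a) (dd (0, e) C)) (xb, y) := by
      have : ((w, 0) : Euc n × Euc n) = (w - s • ν, 0) + (s • ν, 0) := by simp
      rw [this, dd_add]; ring
    have h1 := taylor2 (f := dd (0, a) (dd (0, e) C)) hO (B.G.dd_smooth2 _ _) (z := (xb, y))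
      (w := (w, 0)) (B := K * (‖w‖ * ‖w‖ * ‖a‖ * ‖e‖)) (fun t ht => B.seg_mem hxb' hx1' hy ht)
      (fun t ht => by
        refine (B.bd _ (B.seg_mem hxb' hx1' hy ht) (w, 0) (w, 0) (0, a) (0, e)).2.2.trans (le_of_eq ?_)
        rw [nl, nr, nr])
    rw [ew] at h1
    have h2 := (B.bd _ hz (w - s • ν, 0) (0, a) (0, e) 0).2.1
    rw [nl, nr, nr] at h2
    rw [e1, e2]
    have e3 : ∀ p q r t : ℝ, p - q - (r - t) = (p - q - r) + t := fun p q r t => by ring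
    rw [e3]
    refine (abs_add_le _ _).trans ((add_le_add h1 h2).trans ?_)
    have h4 := mul_le_mul_of_nonneg_right hκw (mul_nonneg (norm_nonneg a) (norm_nonneg e))
    refine le_trans (le_of_eq ?_) h4
    ring
  -- path
  obtain ⟨γ, γ', g0, g1, hγ⟩ := qpath B.G.swap B.mem B.lip hy0 hy
  have hq0 := quad_est B.G.oV hψs hκ0 hbd hγ (by
    intro e
    rw [g0, D1 e hy0]
    have e1 : inner ℝ (qm c x1 y0) e = inner ℝ (qm c xb y0) e
        + s * inner ℝ (fderiv ℝ (fun x => qm c x y0) xb ν) e := by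
      rw [hq, inner_add_left, real_inner_smul_left]
    rw [B.G.inner_qm hx1U hy0, B.G.inner_qm B.mem hy0, B.inner_A B.mem hy0] at e1
    have e2 : dd (0, e) (dd (s • ν, 0) C) (xb, y0) = s * dd (ν, 0) (dd (0, e) C) (xb, y0) := by
      rw [B.G.comm2 _ _ ⟨B.mem, hy0⟩]
      have : ((s • ν, 0) : Euc n × Euc n) = s • (ν, 0) := by simp
      rw [this, dd_smul, smul_eq_mul]
    simp only [e2]
    linarith only [e1])
  rw [g0, g1] at hq0
  have hin : ∀ y ∈ V, s * inner ℝ (qm (fun y x => c x y) y xb) ν = - dd (s • ν, 0) C (xb, y) := by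
    intro y hy
    rw [B.G.toSm.swap.inner_qm hy B.mem]
    simp only [uncurry_swap, dd_swap, Prod.swap_prod_mk]
    have : ((s • ν, 0) : Euc n × Euc n) = s • (ν, 0) := by simp
    rw [this, dd_smul, smul_eq_mul]; ring
  have hlow := (abs_le.1 hq0).1
  rw [inner_sub_left, mul_sub, hin y hy, hin y0 hy0]
  have ex : ∀ x y, C (x, y) = c x y := fun x y => rfl
  simp only [hψ, ex] at hlow
  have e5 : κ * (L * ‖qm (fun y x => c x y) y xb - qm (fun y x => c x y) y0 xb‖) ^ 2 =
    K * ((2 * L * K) ^ 2 * (1 + L * K)) * L ^ 2 * s ^ 2 *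
          ‖qm (fun y x => c x y) y xb - qm (fun y x => c x y) y0 xb‖ ^ 2 := by
    rw [hκ]; ring
  rw [e5] at hlow
  linarith only [hlow]

theorem lipM (B : Bd c U V xb ρ K L) {x x' y y0 : Euc n} (hx : x ∈ closedBall xb ρ)
    (hx' : x' ∈ closedBall xb ρ) (hy : y ∈ V) (hy0 : y0 ∈ V) :
    |(c x' y - c x y) - (c x' y0 - c x y0)| ≤
      K * L * ‖x' - x‖ * ‖qm (fun y x => c x y) y xb - qm (fun y x => c x y) y0 xb‖ := by
  have hK := B.hK
  have hL := B.hL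
  have hO := B.G.oUV
  set C := Function.uncurry c with hC
  obtain ⟨γ, γ', g0, g1, hγ⟩ := qpath B.G.swap B.mem B.lip hy0 hy
  have h := mvt01 (f := fun t => c x' (γ t) - c x (γ t))
    (f' := fun t => dd (0, γ' t) C (x', γ t) - dd (0, γ' t) C (x, γ t))
    (B := K * L * ‖x' - x‖ * ‖qm (fun y x => c x y) y xb - qm (fun y x => c x y) y0 xb‖)
    (fun t ht => by
      obtain ⟨h1, h2, h3⟩ := hγ t ht
      have k : ∀ x ∈ U, HasDerivAt (fun t => c x (γ t)) (dd (0, γ' t) C (x, γ t)) t := fun x hx =>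
        dd_hasDerivAt (f := C) (γ := fun t => (x, γ t)) ((hasDerivAt_const t x).prodMk h2)
          ((B.G.smooth.contDiffAt (hO.mem_nhds ⟨hx, h1⟩)).differentiableAt (by norm_num))
      exact (k x' (B.hball hx')).sub (k x (B.hball hx)))
    (fun t ht => by
      obtain ⟨h1, h2, h3⟩ := hγ t ht
      have := lip_seg (f := dd (0, γ' t) C) hO ((B.G.dd_smooth3 _).of_le (by norm_num)) (z := (x, γ t))
        (w := (x' - x, 0)) (B := K * (‖x' - x‖ * ‖γ' t‖)) (fun r hr => B.seg_mem hx hx' h1 hr)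
        (fun r hr => by
          refine (B.bd _ (B.seg_mem hx hx' h1 hr) (x' - x, 0) (0, γ' t) 0 0).1.trans (le_of_eq ?_)
          rw [nl, nr]) (t := 1) ⟨zero_le_one, le_rfl⟩
      have e : ((x, γ t) : Euc n × Euc n) + (1 : ℝ) • ((x' - x, 0) : Euc n × Euc n) = (x', γ t) := by
        simp
      rw [e] at this
      refine this.trans ?_
      have h4 : K * (‖x' - x‖ * ‖γ' t‖) ≤ K * (‖x' - x‖ *
        (L * ‖qm (fun y x => c x y) y xb - qm (fun y x => c x y) y0 xb‖)) := by gcongr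
      refine h4.trans (le_of_eq (by ring))) (t := 1) ⟨zero_le_one, le_rfl⟩
  simpa only [g0, g1] using h

end Bd
end FKM

end


section
open Set MeasureTheory Metric Bornology Filter Topology
open scoped ENNReal NNReal Pointwise
namespace FKM
variable {n : ℕ}
attribute [local irreducible] qm pm Yv Xinv Phi

/-- outward normal at a boundary point -/
theorem bdry_normal {W : Set (Euc n)} (hW : StronglyConvexSet n W) {pb : Euc n}
    (h1 : pb ∈ closure W) (h2 : pb ∉ W) :
    ∃ R : ℝ, 0 < R ∧ ∃ ν : Euc n, ‖ν‖ = 1 ∧ ∀ p ∈ closure W,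
      inner ℝ (p - pb) ν ≤ - ‖p - pb‖ ^ 2 / (2 * R) := by
  obtain ⟨-, R, hR, h⟩ := hW
  obtain ⟨z, hz, hb⟩ := h pb ⟨h1, fun h => h2 (interior_subset h)⟩
  have hb' : closure W ⊆ closedBall z R := closure_minimal hb isClosed_closedBall
  rw [dist_eq_norm] at hz
  refine ⟨R, hR, R⁻¹ • (pb - z), ?_, fun p hp => ?_⟩
  · rw [norm_smul, hz, norm_inv, Real.norm_of_nonneg hR.le, inv_mul_cancel₀ hR.ne']
  have h3 := hb' hp
  rw [mem_closedBall, dist_eq_norm] at h3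
  have h4 : ‖p - z‖ ^ 2 ≤ R ^ 2 := by gcongr
  have h5 : p - z = (p - pb) + (pb - z) := by abel
  rw [h5, norm_add_sq_real, hz] at h4
  rw [inner_smul_right, inv_mul_le_iff₀ hR]
  have : R * (-‖p - pb‖ ^ 2 / (2 * R)) = -‖p - pb‖ ^ 2 / 2 := by field_simp
  rw [this]
  linarith only [h4]

namespace Bd
variable {c : Euc n → Euc n → ℝ} {U V : Set (Euc n)} {xb : Euc n} {ρ K L : ℝ}

theorem touch_cl (B : Bd c U V xb ρ K L)
    (hc : ContinuousOn (Function.uncurry c) (closure U ×ˢ closure V)) {P : Euc n → Euc n}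
    (hPd : ∀ y, P y = qm (fun y x => c x y) y xb) (hP : ContinuousOn P (closure V))
    {s : ℝ} (hs : 0 < s) (hs1 : 2 * L * K * s ≤ ρ)
    (hs2 : K * (2 * L * K * s) ≤ 1 / (2 * L)) {yb ν : Euc n} (hyb : yb ∈ closure V) (hν : ‖ν‖ = 1) :
    ∃ x1 ∈ closedBall xb (2 * L * K * s), ∀ y ∈ closure V,
      -(c x1 y - c x1 yb - c xb y + c xb yb) ≤
        s * inner ℝ (P y - P yb) ν +
        (K * ((2 * L * K) ^ 2 * (1 + L * K)) * L ^ 2) * s ^ 2 * ‖P y - P yb‖ ^ 2 := by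
  obtain ⟨yk, hyk, hlim⟩ := mem_closure_iff_seq_limit.1 hyb
  have ht := fun k => B.touch hs hs1 hs2 (hyk k) hν
  choose xk hxk hx using ht
  obtain ⟨x1, hx1, φ, hφ, hxl⟩ := (isCompact_closedBall xb (2 * L * K * s)).tendsto_subseq hxk
  have hbU : closedBall xb (2 * L * K * s) ⊆ closure U :=
    (closedBall_subset_closedBall hs1).trans (B.hball.trans subset_closure)
  have hbc : xb ∈ closure U := subset_closure B.mem
  have hyl : Tendsto (yk ∘ φ) atTop (𝓝 yb) := hlim.comp hφ.tendsto_atTop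
  have cl : ∀ {x : Euc n} {y : Euc n} {a b : ℕ → Euc n}, x ∈ closure U → y ∈ closure V →
      (∀ k, a k ∈ closure U) → (∀ k, b k ∈ closure V) → Tendsto a atTop (𝓝 x) →
      Tendsto b atTop (𝓝 y) → Tendsto (fun k => c (a k) (b k)) atTop (𝓝 (c x y)) := by
    intro x y a b hx hy ha hb hal hbl
    have h1 := hc (x, y) ⟨hx, hy⟩
    have h2 : Tendsto (fun k => (a k, b k)) atTop (𝓝[closure U ×ˢ closure V] (x, y)) :=
      tendsto_nhdsWithin_iff.2 ⟨hal.prodMk_nhds hbl, Eventually.of_forall fun k => ⟨ha k, hb k⟩⟩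
    exact Tendsto.comp (g := Function.uncurry c) h1 h2
  have hpl : Tendsto (fun k => P (yk (φ k))) atTop (𝓝 (P yb)) := by
    have h1 := hP yb hyb
    exact Tendsto.comp (g := P) h1 (tendsto_nhdsWithin_iff.2
      ⟨hyl, Eventually.of_forall fun k => subset_closure (hyk (φ k))⟩)
  refine ⟨x1, hx1, ?_⟩
  have hV : ∀ y ∈ V, -(c x1 y - c x1 yb - c xb y + c xb yb) ≤
        s * inner ℝ (P y - P yb) ν +
        (K * ((2 * L * K) ^ 2 * (1 + L * K)) * L ^ 2) * s ^ 2 * ‖P y - P yb‖ ^ 2 := by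
    intro y hy
    have hyc := subset_closure hy
    have l1 := cl (hbU hx1) hyc (fun k => hbU (hxk (φ k))) (fun _ => hyc) hxl tendsto_const_nhds
    have l2 := cl (hbU hx1) hyb (fun k => hbU (hxk (φ k))) (fun k => subset_closure (hyk (φ k))) hxl hyl
    have l4 := cl hbc hyb (fun _ => hbc) (fun k => subset_closure (hyk (φ k))) tendsto_const_nhds hyl
    have l3 : Tendsto (fun _ : ℕ => c xb y) atTop (𝓝 (c xb y)) := tendsto_const_nhds
    have L1 := (((l1.sub l2).sub l3).add l4).neg
    have hd : Tendsto (fun k => P y - P (yk (φ k))) atTop (𝓝 (P y - P yb)) :=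
      tendsto_const_nhds.sub hpl
    have L2 : Tendsto (fun k => s * inner ℝ (P y - P (yk (φ k))) ν +
        (K * ((2 * L * K) ^ 2 * (1 + L * K)) * L ^ 2) * s ^ 2 * ‖P y - P (yk (φ k))‖ ^ 2) atTop
        (𝓝 (s * inner ℝ (P y - P yb) ν +
        (K * ((2 * L * K) ^ 2 * (1 + L * K)) * L ^ 2) * s ^ 2 * ‖P y - P yb‖ ^ 2)) :=
      ((hd.inner tendsto_const_nhds).const_mul s).add ((hd.norm.pow 2).const_mul _)
    refine le_of_tendsto_of_tendsto' L1 L2 fun k => ?_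
    have := hx (φ k) y hy
    rw [← hPd, ← hPd] at this
    exact this
  intro y hy
  have cc : ∀ x ∈ closure U, ContinuousWithinAt (fun y => c x y) V y := fun x hx =>
    (ContinuousOn.comp (g := Function.uncurry c) (f := fun y => (x, y)) (t := closure U ×ˢ closure V) hc
      (by fun_prop) (fun y hy => ⟨hx, hy⟩) y hy).mono subset_closure
  have cP : ContinuousWithinAt (fun y => P y - P yb) V y :=
    ((hP y hy).mono subset_closure).sub continuousWithinAt_const
  refine ContinuousWithinAt.closure_le (s := V) hy
    (f := fun y => -(c x1 y - c x1 yb - c xb y + c xb yb)) ?_ ?_ hV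
  · exact ((((cc x1 (hbU hx1)).sub continuousWithinAt_const).sub (cc xb hbc)).add
      continuousWithinAt_const).neg
  · exact ((cP.inner continuousWithinAt_const).const_smul s).add
      ((cP.norm.pow 2).const_smul ((K * ((2 * L * K) ^ 2 * (1 + L * K)) * L ^ 2) * s ^ 2))

theorem lipM_cl (B : Bd c U V xb ρ K L)
    (hc : ContinuousOn (Function.uncurry c) (closure U ×ˢ closure V)) {P : Euc n → Euc n}
    (hPd : ∀ y, P y = qm (fun y x => c x y) y xb) (hP : ContinuousOn P (closure V))
    {x x' y yb : Euc n} (hx : x ∈ closedBall xb ρ) (hx' : x' ∈ closedBall xb ρ)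
    (hy : y ∈ closure V) (hyb : yb ∈ closure V) :
    |(c x' y - c x y) - (c x' yb - c x yb)| ≤ K * L * ‖x' - x‖ * ‖P y - P yb‖ := by
  have hb : closedBall xb ρ ⊆ closure U := B.hball.trans subset_closure
  have cc : ∀ x ∈ closure U, ∀ y ∈ closure V, ContinuousWithinAt (fun y => c x y) V y := fun x hx y hy =>
    (ContinuousOn.comp (g := Function.uncurry c) (f := fun y => (x, y)) (t := closure U ×ˢ closure V) hc
      (by fun_prop) (fun y hy => ⟨hx, hy⟩) y hy).mono subset_closure
  have cP : ∀ y ∈ closure V, ContinuousWithinAt P V y := fun y hy => (hP y hy).mono subset_closure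
  have h1 : ∀ y0 ∈ V, |(c x' y - c x y) - (c x' y0 - c x y0)| ≤ K * L * ‖x' - x‖ * ‖P y - P y0‖ := by
    intro y0 hy0
    refine ContinuousWithinAt.closure_le (s := V) hy
      (f := fun y => |(c x' y - c x y) - (c x' y0 - c x y0)|)
      (g := fun y => K * L * ‖x' - x‖ * ‖P y - P y0‖) ?_ ?_ ?_
    · exact (((cc x' (hb hx') y hy).sub (cc x (hb hx) y hy)).sub continuousWithinAt_const).abs
    · exact (((cP y hy).sub continuousWithinAt_const).norm).const_smul (K * L * ‖x' - x‖)
    · intro y hy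
      have := B.lipM hx hx' hy hy0
      rw [← hPd, ← hPd] at this
      exact this
  refine ContinuousWithinAt.closure_le (s := V) hyb
      (f := fun yb => |(c x' y - c x y) - (c x' yb - c x yb)|)
      (g := fun yb => K * L * ‖x' - x‖ * ‖P y - P yb‖) ?_ ?_ h1
  · exact ((continuousWithinAt_const).sub ((cc x' (hb hx') yb hyb).sub (cc x (hb hx) yb hyb))).abs
  · exact ((continuousWithinAt_const.sub (cP yb hyb)).norm).const_smul (K * L * ‖x' - x‖)

end Bd

theorem exists_bd {c : Euc n → Euc n → ℝ} {U V : Set (Euc n)} (hB0 : B0cond n c U V)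
    (hB1 : B1cond n c U V) (hB2 : B2cond n c U V) {xb : Euc n} {ρ : ℝ} (hρ : 0 < ρ)
    (hball : closedBall xb ρ ⊆ U) :
    ∃ K L, Bd c U V xb ρ K L ∧ ∀ p ∈ (fun y => qm (fun y x => c x y) y xb) '' closure V,
      ∃ f' : Euc n →L[ℝ] Euc n, HasFDerivWithinAt
        (Function.invFunOn (fun y => qm (fun y x => c x y) y xb) (closure V)) f'
        ((fun y => qm (fun y x => c x y) y xb) '' closure V) p ∧ ‖f'‖ ≤ L := by
  have hxb : xb ∈ closure U := subset_closure (hball (mem_closedBall_self hρ.le))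
  have cU : IsCompact (closure U) := hB0.2.1.isCompact_closure
  have cV : IsCompact (closure V) := hB0.2.2.2.1.isCompact_closure
  obtain ⟨K, hK0, hK⟩ := dd_bounds (cU.prod cV) (sm_of hB0).oUV
    (prod_mono subset_closure subset_closure) hB0.2.2.2.2
  obtain ⟨L, hL0, hL1, hL2⟩ := diffeo_lip cV hB0.2.2.1 subset_closure (b1q (B1_swap hB1) hxb)
  refine ⟨K + 1, L + 1, ⟨preGood_of hB0 hB1 hB2, hρ, hball, by linarith, by linarith, ?_, ?_⟩, ?_⟩
  · intro z hz a b d e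
    obtain ⟨h1, h2, h3⟩ := hK z hz a b d e
    refine ⟨h1.trans ?_, h2.trans ?_, h3.trans ?_⟩ <;> gcongr <;> linarith
  · intro y hy v
    refine (hL1 y hy v).trans ?_
    gcongr; linarith
  · intro p hp
    obtain ⟨f', h1, h2⟩ := hL2 p hp
    exact ⟨f', h1, h2.trans (by linarith)⟩

end FKM

end


section
open Set MeasureTheory Metric Bornology Filter Topology
open scoped ENNReal NNReal Pointwise
namespace FKM
variable {n : ℕ}
attribute [local irreducible] qm pm Yv Xinv Phi

theorem slab_vol {m : ℕ} (pb ν : Euc (m+1)) (hν : ‖ν‖ = 1) {a b : ℝ} (ha : 0 ≤ a) (hb : 0 ≤ b) :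
    volume {p : Euc (m+1) | ‖p - pb‖ ≤ a ∧ -b ≤ inner ℝ (p - pb) ν ∧ inner ℝ (p - pb) ν ≤ 0} ≤
      ENNReal.ofReal (b * (2 * a) ^ m) := by
  have ho : Orthonormal ℝ (({0} : Set (Fin (m+1))).domRestrict (fun _ => ν)) := by
    refine ⟨fun i => hν, fun i j hij => absurd (Subsingleton.elim i j) hij⟩
  obtain ⟨e, he⟩ := Orthonormal.exists_orthonormalBasis_extension_of_card_eq
    (𝕜 := ℝ) (E := Euc (m+1)) (by simp) ho
  have he0 : e 0 = ν := he 0 rfl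
  have hv := vol_box e (fun i => inner ℝ (e i) pb + if i = 0 then -b else -a)
    (fun i => inner ℝ (e i) pb + if i = 0 then 0 else a)
  refine (measure_mono (t := {x : Euc (m+1) | ∀ i, inner ℝ (e i) x ∈
    Icc (inner ℝ (e i) pb + if i = 0 then -b else -a) (inner ℝ (e i) pb + if i = 0 then 0 else a)}) ?_).trans ?_
  · rintro p ⟨h1, h2, h3⟩ i
    have h4 : inner ℝ (e i) p = inner ℝ (e i) pb + inner ℝ (p - pb) (e i) := by
      rw [real_inner_comm (e i) (p - pb), ← inner_add_right]; congr 1; abel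
    have h5 : |inner ℝ (p - pb) (e i)| ≤ a := by
      have := abs_real_inner_le_norm (p - pb) (e i)
      rw [e.norm_eq_one, mul_one] at this
      exact this.trans h1
    obtain ⟨h6, h7⟩ := abs_le.1 h5
    rw [mem_Icc, h4]
    by_cases hi : i = 0
    · subst hi
      rw [he0] at *
      simp only [if_true]
      constructor <;> linarith
    · simp only [hi, if_false]
      constructor <;> linarith
  · rw [hv, Fin.prod_univ_succ, ENNReal.ofReal_mul hb, ENNReal.ofReal_pow (by positivity)]
    apply le_of_eq
    congr 1
    · simp
    · rw [Finset.prod_congr rfl (g := fun _ => ENNReal.ofReal (2 * a))]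
      · simp
      · intro i _
        congr 1
        simp [Fin.succ_ne_zero]; ring

/-- scalar computation in the boundary lemma -/
theorem bdry_scalar {s R κ δ t d M M1 : ℝ} (hs : 0 < s) (hR : 0 < R) (hκ : 0 ≤ κ) (hδ : 0 ≤ δ)
    (hd : 0 ≤ d) (ht : t ≤ -d ^ 2 / (2 * R)) (hM : 0 ≤ M) (hM1 : M1 ≤ s * t + s / (4 * R) * d ^ 2)
    (hMM : M - M1 ≤ κ * δ * d) :
    d ≤ 4 * R * κ / s * δ ∧ -(8 * R * κ ^ 2 / s ^ 2 * δ ^ 2) ≤ t ∧ t ≤ 0 := by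
  have e1 : s / (4 * R) * d ^ 2 = s * (d ^ 2 / (2 * R)) / 2 := by field_simp; ring
  have e2 : -d ^ 2 / (2 * R) = -(d ^ 2 / (2 * R)) := by ring
  set D := d ^ 2 / (2 * R) with hD
  have hD0 : 0 ≤ D := by positivity
  have h1 : s * t ≤ s * (-D) := mul_le_mul_of_nonneg_left (by linarith) hs.le
  have h2 : s * D / 2 ≤ κ * δ * d := by linarith
  have h3 : d ≤ 4 * R * κ / s * δ := by
    rcases hd.eq_or_lt with h | h
    · rw [← h]; positivity
    · have h4 : s * d / (4 * R) * d ≤ κ * δ * d := by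
        calc s * d / (4 * R) * d = s * D / 2 := by rw [hD]; field_simp; ring
          _ ≤ _ := h2
      have h5 := le_of_mul_le_mul_right h4 h
      rw [div_le_iff₀ (by positivity)] at h5
      rw [div_mul_eq_mul_div, le_div_iff₀ hs]
      linarith
  refine ⟨h3, ?_, by linarith⟩
  have h6 : -(s * t) / 2 ≤ κ * δ * d := by linarith
  have h7 : κ * δ * d ≤ κ * δ * (4 * R * κ / s * δ) := by gcongr
  have h8 : κ * δ * (4 * R * κ / s * δ) = s * (8 * R * κ ^ 2 / s ^ 2 * δ ^ 2) / 2 := by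
    field_simp; ring
  have h9 : s * (-t) ≤ s * (8 * R * κ ^ 2 / s ^ 2 * δ ^ 2) := by linarith
  have := le_of_mul_le_mul_left h9 hs
  linarith

theorem boundary {m : ℕ} {c : Euc (m+1) → Euc (m+1) → ℝ} {U V O : Set (Euc (m+1))}
    {u v : Euc (m+1) → ℝ} {Λ : ℝ}
    (hB0 : B0cond (m+1) c U V) (hB1 : B1cond (m+1) c U V) (hB2 : B2cond (m+1) c U V)
    (hB2s : B2scond (m+1) c U V)
    (ge : ∀ x ∈ closure U, ∀ y ∈ closure V, 0 ≤ u x + v y + c x y)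
    (hO : IsOpen O) (hOU : O ⊆ U)
    (hvol : ∀ Y ⊆ O, IsCompact Y → volume Y ≤
      ENNReal.ofReal Λ * volume {y | y ∈ closure V ∧ ∃ x ∈ Y, u x + v y + c x y = 0})
    {xb yb : Euc (m+1)} (hxb : xb ∈ O) (hyb : yb ∈ closure V) (hcon : u xb + v yb + c xb yb = 0) :
    yb ∈ V := by
  by_contra hybV
  obtain ⟨ρ, hρ, hρO⟩ := nhds_basis_closedBall.mem_iff.1 (hO.mem_nhds hxb)
  obtain ⟨K, L, B, hg⟩ := exists_bd hB0 hB1 hB2 hρ (hρO.trans hOU)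
  set P : Euc (m+1) → Euc (m+1) := fun y => qm (fun y x => c x y) y xb with hPdef
  have hxbc : xb ∈ closure U := subset_closure (hOU hxb)
  have hdiff : DiffeoOnto (m+1) P (closure V) := b1q (B1_swap hB1) hxbc
  have hP : ContinuousOn P (closure V) := hdiff.2.1.continuousOn
  have cV : IsCompact (closure V) := hB0.2.2.2.1.isCompact_closure
  have hcc := hB0.2.2.2.2.continuousOn
  have hPd : ∀ y, P y = qm (fun y x => c x y) y xb := fun y => rfl
  have hsub : P '' closure V ⊆ closure (P '' V) := hP.image_closure
  have hsc : StronglyConvexSet (m+1) (P '' V) := by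
    have := hB2s.2 xb hxbc
    have e : P '' V = Vxset (m+1) c V xb := by
      rw [hPdef]; simp only [qm_swap]; unfold pm Vxset; rfl
    rw [e]; exact this
  obtain ⟨R, hR, ν, hν, hin⟩ := bdry_normal hsc (hsub (mem_image_of_mem P hyb)) (by
    rintro ⟨y, hy, he⟩
    exact hybV (hdiff.1 (subset_closure hy) hyb he ▸ hy))
  have hK := B.hK
  have hL := B.hL
  set C := K * ((2 * L * K) ^ 2 * (1 + L * K)) * L ^ 2 with hC
  have hC0 : 0 < C := by positivity
  obtain ⟨s, hs, hs1, hs2, hs3⟩ : ∃ s : ℝ, 0 < s ∧ 2 * L * K * s ≤ ρ / 2 ∧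
      K * (2 * L * K * s) ≤ 1 / (2 * L) ∧ C * s ≤ 1 / (4 * R) := by
    refine ⟨min (ρ / 2 / (2 * L * K)) (min (1 / (2 * L) / (K * (2 * L * K))) (1 / (4 * R) / C)),
      by positivity, ?_, ?_, ?_⟩
    · rw [mul_comm, ← le_div_iff₀ (by positivity)]; exact min_le_left _ _
    · rw [← mul_assoc, mul_comm, ← le_div_iff₀ (by positivity)]
      exact (min_le_right _ _).trans (min_le_left _ _)
    · rw [mul_comm, ← le_div_iff₀ (by positivity)]
      exact (min_le_right _ _).trans (min_le_right _ _)
  obtain ⟨x1, hx1, ht⟩ := B.touch_cl hcc hPd hP hs (hs1.trans (by linarith)) hs2 hyb hν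
  have hx1' : x1 ∈ closedBall xb (ρ / 2) := closedBall_subset_closedBall hs1 hx1
  have hx1ρ : x1 ∈ closedBall xb ρ := closedBall_subset_closedBall (by linarith) hx1'
  set κ := K * L with hκ
  have hκ0 : 0 ≤ κ := by positivity
  set C2 := 4 * R * κ / s with hC2
  set C3 := 8 * R * κ ^ 2 / s ^ 2 with hC3
  have hC20 : 0 ≤ C2 := by positivity
  have hC30 : 0 ≤ C3 := by positivity
  obtain ⟨D, hD0, hD⟩ := vol_image_le (m+1) L
  -- main volume estimate
  have main : ∀ δ : ℝ, 0 < δ → δ ≤ ρ / 2 → ENNReal.ofReal (δ ^ (m+1)) * volume (ball (0 : Euc (m+1)) 1) ≤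
      ENNReal.ofReal Λ * (ENNReal.ofReal D * ENNReal.ofReal (C3 * δ ^ 2 * (2 * (C2 * δ)) ^ m)) := by
    intro δ hδ hδρ
    have hbsub : closedBall x1 δ ⊆ closedBall xb ρ := by
      apply closedBall_subset_closedBall'
      rw [mem_closedBall] at hx1'
      linarith
    have h1 := hvol (closedBall x1 δ) (hbsub.trans hρO) (isCompact_closedBall _ _)
    rw [Measure.addHaar_closedBall _ _ hδ.le] at h1
    simp only [finrank_euclideanSpace, Fintype.card_fin] at h1
    refine h1.trans ?_
    gcongr
    set Q := {p : Euc (m+1) | ‖p - P yb‖ ≤ C2 * δ ∧ -(C3 * δ ^ 2) ≤ inner ℝ (p - P yb) ν ∧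
      inner ℝ (p - P yb) ν ≤ 0} with hQ
    have hQc : IsClosed Q := by
      have f1 : Continuous fun p : Euc (m+1) => ‖p - P yb‖ := by fun_prop
      have f2 : Continuous fun p : Euc (m+1) => inner ℝ (p - P yb) ν := by fun_prop
      exact IsClosed.inter (isClosed_le f1 continuous_const)
        (IsClosed.inter (isClosed_le continuous_const f2) (isClosed_le f2 continuous_const))
    have hW : IsCompact (P '' closure V) := cV.image_of_continuousOn hP
    set g := Function.invFunOn P (closure V) with hgdef
    choose! g' hg' using hg
    have h2 := hD g g' (P '' closure V ∩ Q) (hW.isClosed.inter hQc).measurableSet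
      (fun p hp => (hg' p hp.1).1.mono inter_subset_left) (fun p hp => (hg' p hp.1).2)
    have h3 : volume (P '' closure V ∩ Q) ≤ ENNReal.ofReal (C3 * δ ^ 2 * (2 * (C2 * δ)) ^ m) :=
      (measure_mono inter_subset_right).trans (slab_vol (P yb) ν hν (by positivity) (by positivity))
    refine (measure_mono ?_).trans (h2.trans (by gcongr))
    rintro y ⟨hy, x', hx', hc'⟩
    refine ⟨P y, ⟨mem_image_of_mem P hy, ?_⟩, hdiff.1.leftInvOn_invFunOn hy⟩
    have hx'ρ := hbsub hx'
    have hl := B.lipM_cl hcc hPd hP hx1ρ hx'ρ hy hyb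
    have h4 := ht y hy
    have h5 := hin (P y) (hsub (mem_image_of_mem P hy))
    have h6 : ‖x' - x1‖ ≤ δ := by rwa [mem_closedBall, dist_eq_norm] at hx'
    have hx'c : x' ∈ closure U := subset_closure (hOU (hρO hx'ρ))
    have h7 := ge x' hx'c yb hyb
    have h8 := ge xb hxbc y hy
    refine bdry_scalar (M := -(c x' y - c x' yb - c xb y + c xb yb))
      (M1 := -(c x1 y - c x1 yb - c xb y + c xb yb)) hs hR hκ0 hδ.le (norm_nonneg _) h5 ?_ ?_ ?_
    · linarith only [h7, h8, hc', hcon]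
    · refine h4.trans ?_
      have : C * s ^ 2 ≤ s / (4 * R) := by
        calc C * s ^ 2 = s * (C * s) := by ring
          _ ≤ s * (1 / (4 * R)) := by gcongr
          _ = _ := by ring
      gcongr
    · have h9 : K * L * ‖x' - x1‖ * ‖P y - P yb‖ ≤ κ * δ * ‖P y - P yb‖ := by
        rw [hκ]; gcongr
      have := (abs_le.1 (hl.trans h9)).1
      linarith only [this]
  -- contradiction
  set E := max Λ 0 * (D * (C3 * (2 * C2) ^ m)) with hE
  have hE0 : 0 ≤ E := by positivity
  set b := (volume (ball (0 : Euc (m+1)) 1)).toReal with hb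
  have hbfin : volume (ball (0 : Euc (m+1)) 1) ≠ ∞ := measure_ball_lt_top.ne
  have hb0 : 0 < b := ENNReal.toReal_pos (measure_ball_pos _ _ one_pos).ne' hbfin
  have hmax : ENNReal.ofReal Λ = ENNReal.ofReal (max Λ 0) := by
    rcases le_total 0 Λ with h | h
    · rw [max_eq_left h]
    · rw [max_eq_right h, ENNReal.ofReal_of_nonpos h, ENNReal.ofReal_zero]
  have real : ∀ δ : ℝ, 0 < δ → δ ≤ ρ / 2 → b ≤ E * δ := by
    intro δ hδ hδρ
    have h := main δ hδ hδρ
    rw [← ENNReal.ofReal_toReal hbfin, ← ENNReal.ofReal_mul (by positivity),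
      ← ENNReal.ofReal_mul hD0.le, hmax,
      ← ENNReal.ofReal_mul (le_max_right _ _), ENNReal.ofReal_le_ofReal_iff (by positivity)] at h
    have h2 : max Λ 0 * (D * (C3 * δ ^ 2 * (2 * (C2 * δ)) ^ m)) = δ ^ (m+1) * (E * δ) := by
      rw [hE]; ring
    rw [h2] at h
    exact le_of_mul_le_mul_left h (by positivity)
  have h := real (min (ρ / 2) (b / (2 * (E + 1)))) (by positivity) (min_le_left _ _)
  have h2 : E * min (ρ / 2) (b / (2 * (E + 1))) ≤ E * (b / (2 * (E + 1))) := by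
    gcongr; exact min_le_right _ _
  have h3 : E * (b / (2 * (E + 1))) ≤ b / 2 := by
    rw [mul_div_assoc', div_le_div_iff₀ (by positivity) (by positivity)]
    nlinarith only [hE0, hb0]
  linarith only [h, h2, h3, hb0]

end FKM

end


section
open Set MeasureTheory Metric Bornology Filter Topology
open scoped ENNReal NNReal Pointwise
namespace FKM
variable {n : ℕ}
attribute [local irreducible] qm pm Yv Xinv Phi

theorem sup_cont {c : Euc n → Euc n → ℝ} {A B : Set (Euc n)} (cA : IsCompact A) (cB : IsCompact B)
    (hc : ContinuousOn (Function.uncurry c) (A ×ˢ B)) {f w : Euc n → ℝ}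
    (h1 : ∀ x ∈ A, ∀ y ∈ B, -c x y - w x ≤ f y)
    (h2 : ∀ y ∈ B, ∀ t, (∀ x ∈ A, -c x y - w x ≤ t) → f y ≤ t) : ContinuousOn f B := by
  have hu := (cA.prod cB).uniformContinuousOn_of_continuous hc
  rw [Metric.uniformContinuousOn_iff] at hu
  rw [Metric.continuousOn_iff]
  intro b hb ε hε
  obtain ⟨δ, hδ, h⟩ := hu (ε / 2) (by positivity)
  have key : ∀ y ∈ B, ∀ y' ∈ B, dist y y' < δ → f y ≤ f y' + ε / 2 := by
    intro y hy y' hy' hd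
    refine h2 y hy _ fun x hx => ?_
    have := h (x, y) ⟨hx, hy⟩ (x, y') ⟨hx, hy'⟩ (by rw [Prod.dist_eq]; simpa using hd)
    rw [Real.dist_eq] at this
    have h3 := abs_lt.1 this
    have h4 := h1 x hx y' hy'
    simp only [Function.uncurry] at h3
    linarith [h3.1, h3.2]
  refine ⟨δ, hδ, fun a ha hd => ?_⟩
  have k1 := key a ha b hb hd
  have k2 := key b hb a ha (by rwa [dist_comm])
  rw [Real.dist_eq, abs_lt]
  constructor <;> linarith

/-- basic facts on the pair `u`, `v = u^{c*}` -/
theorem pair_facts {c : Euc n → Euc n → ℝ} {A B : Set (Euc n)} (cA : IsCompact A) (cB : IsCompact B)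
    (nA : A.Nonempty) (nB : B.Nonempty)
    (hc : ContinuousOn (Function.uncurry c) (A ×ˢ B)) {u : Euc n → ℝ} (hu : CConvexOn n c A B u) :
    ContinuousOn u A ∧ ContinuousOn (cStarT n c A u) B ∧
    (∀ x ∈ A, ∀ y ∈ B, 0 ≤ u x + cStarT n c A u y + c x y) ∧
    (∀ x ∈ A, ∃ y ∈ B, u x + cStarT n c A u y + c x y = 0) ∧
    (∀ y ∈ B, ∃ x ∈ A, u x + cStarT n c A u y + c x y = 0) := by
  set v := cStarT n c A u with hv
  obtain ⟨M, hM⟩ := (cA.prod cB).exists_bound_of_continuousOn hc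
  have hM' : ∀ x ∈ A, ∀ y ∈ B, |c x y| ≤ M := fun x hx y hy => hM (x, y) ⟨hx, hy⟩
  -- u is bounded below
  have hbd : ∃ m : ℝ, ∀ x ∈ A, m ≤ u x := by
    by_contra hno
    push Not at hno
    have hv0 : ∀ y ∈ B, v y = 0 := by
      intro y hy
      rw [hv]; unfold cStarT
      apply Real.sSup_of_not_bddAbove
      rintro ⟨t, ht⟩
      obtain ⟨x, hx, hxt⟩ := hno (-t - M)
      have h1 := ht (mem_image_of_mem _ hx)
      have h2 := (abs_le.1 (hM' x hx y hy)).2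
      linarith
    obtain ⟨x, hx, hxM⟩ := hno (-M)
    have h1 := hu x hx
    obtain ⟨y, hy⟩ := nB
    have h2 : -c x y - v y ≤ u x := by
      rw [h1]
      refine le_csSup ⟨M, ?_⟩ (mem_image_of_mem _ hy)
      rintro _ ⟨y', hy', rfl⟩
      have h2 := (abs_le.1 (hM' x hx y' hy')).1
      have h3 := hv0 y' hy'
      rw [hv] at h3
      simp only [h3]
      linarith
    rw [hv0 y hy] at h2
    have h3 := (abs_le.1 (hM' x hx y hy)).2
    linarith
  obtain ⟨m, hm⟩ := hbd
  have v1 : ∀ x ∈ A, ∀ y ∈ B, -c x y - u x ≤ v y := by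
    intro x hx y hy
    rw [hv]; unfold cStarT
    refine le_csSup ⟨M - m, ?_⟩ (mem_image_of_mem _ hx)
    rintro _ ⟨x', hx', rfl⟩
    have h2 := (abs_le.1 (hM' x' hx' y hy)).1
    have h3 := hm x' hx'
    simp only
    linarith
  have v2 : ∀ y ∈ B, ∀ t, (∀ x ∈ A, -c x y - u x ≤ t) → v y ≤ t := by
    intro y hy t ht
    rw [hv]; unfold cStarT
    refine csSup_le (nA.image _) ?_
    rintro _ ⟨x', hx', rfl⟩
    exact ht x' hx'
  have ge : ∀ x ∈ A, ∀ y ∈ B, 0 ≤ u x + v y + c x y := fun x hx y hy => by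
    linarith [v1 x hx y hy]
  have u2 : ∀ x ∈ A, ∀ t, (∀ y ∈ B, -c x y - v y ≤ t) → u x ≤ t := by
    intro x hx t ht
    rw [hu x hx]
    refine csSup_le (nB.image _) ?_
    rintro _ ⟨y', hy', rfl⟩
    exact ht y' hy'
  have hcs : ContinuousOn (Function.uncurry fun y x => c x y) (B ×ˢ A) :=
    hc.comp (f := Prod.swap) continuous_swap.continuousOn (fun z hz => ⟨hz.2, hz.1⟩)
  have cv : ContinuousOn v B := sup_cont cA cB hc v1 v2
  have cu : ContinuousOn u A := sup_cont (c := fun y x => c x y) cB cA hcs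
    (fun y hy x hx => by linarith [ge x hx y hy]) u2
  refine ⟨cu, cv, ge, fun x hx => ?_, fun y hy => ?_⟩
  · have hcx : ContinuousOn (fun y => -c x y - v y) B :=
      (ContinuousOn.comp (g := Function.uncurry c) (f := fun y => (x, y)) (t := A ×ˢ B) hc
        (by fun_prop) (fun y hy => ⟨hx, hy⟩)).neg.sub cv
    obtain ⟨y, hy, hmax⟩ := cB.exists_isMaxOn nB hcx
    refine ⟨y, hy, ?_⟩
    have h1 := u2 x hx _ (fun y' hy' => isMaxOn_iff.1 hmax y' hy')
    linarith [ge x hx y hy]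
  · have hcx : ContinuousOn (fun x => -c x y - u x) A :=
      (ContinuousOn.comp (g := Function.uncurry c) (f := fun x => (x, y)) (t := A ×ˢ B) hc
        (by fun_prop) (fun x hx => ⟨hx, hy⟩)).neg.sub cu
    obtain ⟨x, hx, hmax⟩ := cA.exists_isMaxOn nA hcx
    refine ⟨x, hx, ?_⟩
    have h1 := v2 y hy _ (fun y' hy' => isMaxOn_iff.1 hmax y' hy')
    linarith [ge x hx y hy]

theorem contact_compact {c : Euc n → Euc n → ℝ} {A B Y : Set (Euc n)} (cA : IsCompact A)
    (hc : ContinuousOn (Function.uncurry c) (A ×ˢ B)) {u v : Euc n → ℝ} (cu : ContinuousOn u A)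
    (cv : ContinuousOn v B) (hY : IsCompact Y) (hYB : Y ⊆ B) :
    IsCompact {x | x ∈ A ∧ ∃ y ∈ Y, u x + v y + c x y = 0} := by
  have hF : ContinuousOn (fun z : Euc n × Euc n => u z.1 + v z.2 + c z.1 z.2) (A ×ˢ Y) := by
    refine ContinuousOn.add (ContinuousOn.add ?_ ?_) ?_
    · exact cu.comp continuous_fst.continuousOn (fun z hz => hz.1)
    · exact cv.comp continuous_snd.continuousOn (fun z hz => hYB hz.2)
    · exact hc.mono (prod_mono subset_rfl hYB)
  have h1 : IsCompact ((A ×ˢ Y) ∩ (fun z : Euc n × Euc n => u z.1 + v z.2 + c z.1 z.2) ⁻¹' {0}) :=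
    (cA.prod hY).of_isClosed_subset
      (hF.preimage_isClosed_of_isClosed (cA.prod hY).isClosed isClosed_singleton) inter_subset_left
  convert h1.image continuous_fst using 1
  ext x
  constructor
  · rintro ⟨hx, y, hy, h⟩
    exact ⟨(x, y), ⟨⟨hx, hy⟩, h⟩, rfl⟩
  · rintro ⟨⟨x, y⟩, ⟨⟨hx, hy⟩, h⟩, rfl⟩
    exact ⟨hx, y, hy, h⟩

theorem img_eq {c : Euc n → Euc n → ℝ} {A B X : Set (Euc n)} (u : Euc n → ℝ) (hX : X ⊆ A) :
    cSubdiffImg n c A B u X = {y | y ∈ B ∧ ∃ x ∈ X, u x + cStarT n c A u y + c x y = 0} := by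
  ext y
  simp only [cSubdiffImg, cSubdiffAt, cSubdiff, mem_iUnion, mem_setOf_eq]
  constructor
  · rintro ⟨x, hx, -, hy, h⟩; exact ⟨hy, x, hx, h⟩
  · rintro ⟨hy, x, hx, h⟩; exact ⟨x, hx, hX hx, hy, h⟩

theorem inV_aux {c : Euc n → Euc n → ℝ} {U V O : Set (Euc n)} {u v : Euc n → ℝ} {Λ : ℝ}
    (hB0 : B0cond n c U V) (hB1 : B1cond n c U V) (hB2 : B2cond n c U V)
    (hB2s : B2scond n c U V)
    (ge : ∀ x ∈ closure U, ∀ y ∈ closure V, 0 ≤ u x + v y + c x y)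
    (hO : IsOpen O) (hOU : O ⊆ U)
    (hvol : ∀ Y ⊆ O, IsCompact Y → volume Y ≤
      ENNReal.ofReal Λ * volume {y | y ∈ closure V ∧ ∃ x ∈ Y, u x + v y + c x y = 0}) :
    ∀ xb ∈ O, ∀ yb ∈ closure V, u xb + v yb + c xb yb = 0 → yb ∈ V := by
  intro xb hxb yb hyb h
  rcases n with _ | m
  · obtain ⟨y, hy⟩ := closure_nonempty_iff.1 ⟨yb, hyb⟩
    rwa [Subsingleton.elim yb y]
  · exact boundary hB0 hB1 hB2 hB2s ge hO hOU hvol hxb hyb h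

theorem final (c : Euc n → Euc n → ℝ) (U V Ulam : Set (Euc n)) (u : Euc n → ℝ) (lam Lam : ℝ)
    (hB0 : B0cond n c U V) (hB1 : B1cond n c U V) (hB2 : B2cond n c U V) (hB3 : B3cond n c U V)
    (hB2s : B2scond n c U V) (hO : IsOpen Ulam) (hUlam : Ulam ⊆ U)
    (hu : CConvexOn n c (closure U) (closure V) u) (hlam : 0 < lam) (hLam : 0 < Lam)
    (hge : MAge n c (closure U) (closure V) u lam Ulam)
    (hleU : MAle n c (closure U) (closure V) u Lam (closure U)) :
    ContDiffOn ℝ 1 u Ulam ∧ ∀ x ∈ Ulam, ∃ y, cSubdiffAt n c (closure U) (closure V) u x = {y} := by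
  rcases Ulam.eq_empty_or_nonempty with he | hne
  · subst he; exact ⟨contDiffOn_empty, fun x hx => absurd hx (notMem_empty x)⟩
  have hUc : Ulam ⊆ closure U := hUlam.trans subset_closure
  have nU : (closure U).Nonempty := hne.mono hUc
  have nV : (closure V).Nonempty := by
    have h1 := hge Ulam subset_rfl hO.measurableSet
    rw [img_eq u hUc] at h1
    have h2 : 0 < ENNReal.ofReal lam * volume Ulam :=
      ENNReal.mul_pos (ENNReal.ofReal_pos.2 hlam).ne' (hO.measure_pos volume hne).ne'
    obtain ⟨y, hy, -⟩ := nonempty_of_measure_ne_zero (h2.trans_le h1).ne'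
    exact ⟨y, hy⟩
  have cU : IsCompact (closure U) := hB0.2.1.isCompact_closure
  have cV : IsCompact (closure V) := hB0.2.2.2.1.isCompact_closure
  have hcc := hB0.2.2.2.2.continuousOn
  obtain ⟨cu, cv, ge, exy, eyx⟩ := pair_facts cU cV nU nV hcc hu
  set v := cStarT n c (closure U) u with hv
  have vge : ∀ X ⊆ Ulam, MeasurableSet X → ENNReal.ofReal lam * volume X ≤
      volume {y | y ∈ closure V ∧ ∃ x ∈ X, u x + v y + c x y = 0} := by
    intro X hX hm
    have := hge X hX hm
    rwa [img_eq u (hX.trans hUc)] at this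
  have vle : ∀ Y ⊆ V, IsCompact Y → volume Y ≤
      ENNReal.ofReal Lam * volume {x | x ∈ closure U ∧ ∃ y ∈ Y, u x + v y + c x y = 0} := by
    intro Y hY hYc
    have hX := contact_compact cU hcc cu cv hYc (hY.trans subset_closure)
    have h1 := hleU _ (fun x hx => hx.1) hX.measurableSet
    rw [img_eq u (fun x hx => hx.1)] at h1
    refine (measure_mono ?_).trans h1
    intro y hy
    obtain ⟨x, hx, h⟩ := eyx y (subset_closure (hY hy))
    exact ⟨subset_closure (hY hy), x, ⟨hx, y, hy, h⟩, h⟩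
  have hinV : ∀ x ∈ Ulam, ∀ y ∈ closure V, u x + v y + c x y = 0 → y ∈ V := by
    refine inV_aux (Λ := 1 / lam) hB0 hB1 hB2 hB2s ge hO hUlam fun Y hY hYc => ?_
    have h1 := vge Y hY hYc.measurableSet
    have h2 := mul_le_mul_right h1 (ENNReal.ofReal (1 / lam))
    rw [← mul_assoc, ← ENNReal.ofReal_mul (by positivity), one_div_mul_cancel hlam.ne',
      ENNReal.ofReal_one, one_mul] at h2
    exact h2
  have hinU : ∀ y ∈ V, ∀ x ∈ closure U, u x + v y + c x y = 0 → x ∈ U := by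
    have h := inV_aux (c := fun y x => c x y) (u := v) (v := u) (O := V) (Λ := Lam) (B0_swap hB0)
      (B1_swap hB1) (B2_swap hB2) (B2s_swap hB2s)
      (fun y hy x hx => by rw [add_comm (v y) (u x)]; exact ge x hx y hy) hB0.2.2.1 subset_rfl
      (fun Y hY hYc => by simp only [add_comm (v _) (u _)]; exact vle Y hY hYc)
    intro y hy x hx hh
    exact h y hy x hx (by rw [add_comm (v y) (u x)]; exact hh)
  have S : Setup c U V u v Ulam lam Lam :=
    ⟨good_of hB0 hB1 hB2 hB3, hB0.2.1, hB0.2.2.2.1, hcc, cu, cv, ge, exy, eyx, hO, hUlam, hinV, hinU,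
      hlam, hLam, vge, vle⟩
  have huq : ∀ x ∈ Ulam, ∀ ya ∈ closure V, ∀ yb ∈ closure V, u x + v ya + c x ya = 0 →
      u x + v yb + c x yb = 0 → ya = yb := by
    intro x hx ya hya yb hyb h1 h2
    rcases n with _ | m
    · exact Subsingleton.elim _ _
    · exact S.singleton hx hya hyb h1 h2
  refine ⟨S.c1 huq, fun x hx => ?_⟩
  obtain ⟨y, hy, h⟩ := exy x (hUc hx)
  refine ⟨y, ?_⟩
  ext y'
  simp only [cSubdiffAt, cSubdiff, mem_setOf_eq, mem_singleton_iff]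
  constructor
  · rintro ⟨-, hy', h'⟩; exact huq x hx y' hy' y hy h' h
  · rintro rfl; exact ⟨hUc hx, hy, h⟩

end FKM

end

/-- Theorem 8.2: continuity of optimal maps to strongly `c`-convex
targets; the potential is continuously differentiable and its `c`-subdifferential
is single-valued inside `U^λ`. -/
theorem continuity_of_potential (n : ℕ) (c : Euc n → Euc n → ℝ)
    (U V Ulam : Set (Euc n)) (u : Euc n → ℝ) (lam Lam : ℝ)
    (hB0 : B0cond n c U V) (hB1 : B1cond n c U V) (hB2 : B2cond n c U V)
    (hB3 : B3cond n c U V) (hB2s : B2scond n c U V)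
    (hUlamOpen : IsOpen Ulam) (hUlam : Ulam ⊆ U)
    (hu : CConvexOn n c (closure U) (closure V) u)
    (hlam : 0 < lam) (hLam : 0 < Lam)
    (hge : MAge n c (closure U) (closure V) u lam Ulam)
    (hle : MAle n c (closure U) (closure V) u (1 / lam) Ulam)
    (hleU : MAle n c (closure U) (closure V) u Lam (closure U)) :
    ContDiffOn ℝ 1 u Ulam ∧
    ∀ x ∈ Ulam, ∃ y : Euc n, cSubdiffAt n c (closure U) (closure V) u x = {y} := by
  exact FKM.final c U V Ulam u lam Lam hB0 hB1 hB2 hB3 hB2s hUlamOpen hUlam hu hlam hLam hge hleU
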